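/- Let Ω ⊂ ℝ² be a simply connected open set and let B : Ω → ℝ² be a bounded vector field with bounded support which has bounded variation, in the sense that there exist finite signed Radon measures (DB)_{ij} on Ω (i,j ∈ {1,2}) with ∫_Ω B_i ∂_j φ dx = −∫_Ω φ d(DB)_{ij} for every φ ∈ C_c^∞(Ω). Suppose B is steady nearly incompressible: there exist ρ ∈ L^∞(Ω) and constants C₂ > C₁ > 0 with C₁ ≤ ρ ≤ C₂ a.e. in Ω and ∫_Ω ρ B·∇ψ dx = 0 for every ψ ∈ C_c^∞(Ω). Then B has the renormalization property: for every T > 0, every bounded u : (0,T) × Ω → ℝ satisfying ∫∫_{(0,T)×Ω} ( ρ(x) u(t,x) ∂_t φ(t,x) + ρ(x) u(t,x) B(x)·∇_x φ(t,x) ) dt dx = 0 for every φ ∈ C_c^∞((0,T) × Ω), and every smooth β : ℝ → ℝ, the function β(u) satisfies ∫∫_{(0,T)×Ω} ( ρ(x) β(u(t,x)) ∂_t φ(t,x) + ρ(x) β(u(t,x)) B(x)·∇_x φ(t,x) ) dt dx = 0 for every φ ∈ C_c^∞((0,T) × Ω). -/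

import Mathlib

open MeasureTheory Set Filter
open scoped Topology ENNReal NNReal RealInnerProductSpace

noncomputable section

set_option linter.unusedSectionVars false
set_option linter.unusedSimpArgs false
set_option linter.unusedVariables false

namespace Renorm

/-! ### Mollification -/
section Moll
variable {E : Type*} [NormedAddCommGroup E] [NormedSpace ℝ E] [FiniteDimensional ℝ E]
  [MeasureSpace E] [BorelSpace E] [(volume : Measure E).IsAddHaarMeasure]
  {F : Type*} [NormedAddCommGroup F] [NormedSpace ℝ F] [CompleteSpace F]

/-- standard sequence of bumps -/
def bmp (E : Type*) [NormedAddCommGroup E] [NormedSpace ℝ E] (n : ℕ) : ContDiffBump (0 : E) where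
  rIn := 1 / (2 * ((n : ℝ) + 1))
  rOut := 1 / ((n : ℝ) + 1)
  rIn_pos := by positivity
  rIn_lt_rOut := by
    have : (0:ℝ) ≤ n := by positivity
    apply one_div_lt_one_div_of_lt
    · positivity
    · linarith

/-- mollifier kernel -/
def ker (E : Type*) [NormedAddCommGroup E] [NormedSpace ℝ E] [FiniteDimensional ℝ E]
  [MeasureSpace E] [BorelSpace E] [(volume : Measure E).IsAddHaarMeasure] (n : ℕ) (t : E) : ℝ :=
  (bmp E n).normed volume t

/-- mollification -/
def mol (n : ℕ) (g : E → F) (x : E) : F := ∫ t, ker E n t • g (x - t)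

lemma bmp_rOut (n : ℕ) : (bmp E n).rOut = 1 / ((n : ℝ) + 1) := rfl

lemma ker_nonneg (n : ℕ) (t : E) : 0 ≤ ker E n t := (bmp E n).nonneg_normed t
lemma ker_contDiff (n : ℕ) : ContDiff ℝ (⊤ : ℕ∞) (ker E n) := (bmp E n).contDiff_normed
lemma ker_cont (n : ℕ) : Continuous (ker E n) := (ker_contDiff n).continuous
lemma ker_int (n : ℕ) : ∫ t, ker E n t = 1 := (bmp E n).integral_normed
lemma ker_cpt (n : ℕ) : HasCompactSupport (ker E n) := (bmp E n).hasCompactSupport_normed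
lemma ker_integrable (n : ℕ) : Integrable (ker E n) :=
  (ker_cont n).integrable_of_hasCompactSupport (ker_cpt n)
lemma ker_zero (n : ℕ) (t : E) (ht : 1 / ((n : ℝ) + 1) ≤ ‖t‖) : ker E n t = 0 := by
  have h := (bmp E n).support_normed_eq (μ := volume)
  by_contra hne
  have : t ∈ Function.support ((bmp E n).normed volume) := hne
  rw [h, bmp_rOut] at this
  simp at this
  simp at ht
  linarith

lemma ker_neg (n : ℕ) (t : E) : ker E n (-t) = ker E n t := (bmp E n).normed_neg t

lemma mol_eq_conv (n : ℕ) (g : E → F) :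
    mol n g = convolution ((bmp E n).normed volume) g (ContinuousLinearMap.lsmul ℝ ℝ) volume := rfl

lemma mol_contDiff (n : ℕ) {g : E → F} (hg : LocallyIntegrable g) :
    ContDiff ℝ (⊤ : ℕ∞) (mol n g) :=
  (ker_cpt n).contDiff_convolution_left (ContinuousLinearMap.lsmul ℝ ℝ) (ker_contDiff n) hg

lemma mol_integrable (n : ℕ) {g : E → F} (hg : AEStronglyMeasurable g) {C : ℝ}
    (hb : ∀ x, ‖g x‖ ≤ C) (x : E) : Integrable (fun t => ker E n t • g (x - t)) := by
  refine ((ker_integrable (E := E) n).norm.mul_const C).mono' ?_ ?_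
  · refine (ker_cont n).aestronglyMeasurable.smul ?_
    exact hg.comp_quasiMeasurePreserving (quasiMeasurePreserving_sub_left volume x)
  · refine Eventually.of_forall fun t => ?_
    rw [norm_smul]
    exact mul_le_mul_of_nonneg_left (hb _) (norm_nonneg _)

lemma mol_bound (n : ℕ) {g : E → F} {C : ℝ}
    (hb : ∀ x, ‖g x‖ ≤ C) (x : E) : ‖mol n g x‖ ≤ C := by
  have h1 : ‖mol n g x‖ ≤ ∫ t, ker E n t * C := by
    refine norm_integral_le_of_norm_le ((ker_integrable n).mul_const C) ?_
    refine Eventually.of_forall fun t => ?_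
    rw [norm_smul, Real.norm_of_nonneg (ker_nonneg n t)]
    exact mul_le_mul_of_nonneg_left (hb _) (ker_nonneg n t)
  rwa [integral_mul_const, ker_int, one_mul] at h1

lemma locInt {g : E → F} (hg : AEStronglyMeasurable g) {C : ℝ}
    (hb : ∀ x, ‖g x‖ ≤ C) : LocallyIntegrable g := by
  intro x
  refine ⟨Metric.closedBall x 1, Metric.closedBall_mem_nhds x one_pos, ?_⟩
  exact Measure.integrableOn_of_bounded (M := C)
    (isCompact_closedBall x 1).measure_lt_top.ne hg (Eventually.of_forall hb)

lemma mol_tendsto {g : E → F} (hg : LocallyIntegrable g) :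
    ∀ᵐ x, Tendsto (fun n => mol n g x) atTop (𝓝 (g x)) := by
  refine ContDiffBump.ae_convolution_tendsto_right_of_locallyIntegrable (φ := fun n => bmp E n)
    (K := 2) ?_ ?_ hg
  · exact tendsto_one_div_add_atTop_nhds_zero_nat
  · refine Eventually.of_forall fun n => ?_
    simp only [bmp]
    field_simp
    norm_num

lemma mol_zero (n : ℕ) {g : E → F} {K : Set E} (hK : ∀ x, x ∉ K → g x = 0) {x : E}
    (hx : x ∉ Metric.cthickening (1 / ((n : ℝ) + 1)) K) : mol n g x = 0 := by
  unfold mol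
  rw [integral_eq_zero_of_ae]
  refine Eventually.of_forall fun t => ?_
  by_cases ht : 1 / ((n : ℝ) + 1) ≤ ‖t‖
  · simp [ker_zero n t ht]
  · have : x - t ∉ K := by
      intro h
      apply hx
      apply Metric.mem_cthickening_of_dist_le x (x - t) _ _ h
      simp [dist_eq_norm] at ht ⊢
      exact ht.le
    simp [hK _ this]

lemma mol_fderiv (n : ℕ) {g : E → ℝ} {C : ℝ≥0} (hg : LipschitzWith C g) {D : ℝ}
    (hD : ∀ x, ‖g x‖ ≤ D) (x : E) :
    HasFDerivAt (mol n g) (mol n (fderiv ℝ g) x) x := by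
  refine (hasFDerivAt_integral_of_dominated_loc_of_lip (𝕜 := ℝ) (s := univ)
    (F := fun x t => ker E n t • g (x - t)) (F' := fun t => ker E n t • fderiv ℝ g (x - t))
    (bound := fun t => ker E n t * C) univ_mem ?_ ?_ ?_ ?_ ?_ ?_).2
  · refine Eventually.of_forall fun y => ?_
    exact (mol_integrable n hg.continuous.aestronglyMeasurable hD y).1
  · exact mol_integrable n hg.continuous.aestronglyMeasurable hD x
  · refine (mol_integrable n (g := fderiv ℝ g) (C := C) ?_ ?_ x).1
    · exact (measurable_fderiv ℝ g).aestronglyMeasurable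
    · exact fun x => norm_fderiv_le_of_lipschitz ℝ hg
  · refine Eventually.of_forall fun t => LipschitzWith.lipschitzOnWith ?_
    refine LipschitzWith.of_dist_le_mul fun y z => ?_
    have := hg.dist_le_mul (y - t) (z - t)
    rw [dist_sub_right] at this
    simp only [smul_eq_mul, Real.dist_eq] at *
    rw [← mul_sub, abs_mul, abs_of_nonneg (ker_nonneg n t)]
    have h3 : |ker E n t * (C:ℝ)| = ker E n t * C :=
      abs_of_nonneg (mul_nonneg (ker_nonneg n t) C.2)
    rw [Real.coe_nnabs, h3, mul_assoc]
    exact mul_le_mul_of_nonneg_left this (ker_nonneg n t)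
  · exact (ker_integrable n).mul_const _
  · have h1 : ∀ᵐ t : E, DifferentiableAt ℝ g (x - t) :=
      (quasiMeasurePreserving_sub_left volume x).ae hg.ae_differentiableAt
    filter_upwards [h1] with t ht
    have h2 : HasFDerivAt (fun y => g (y - t)) (fderiv ℝ g (x - t)) x := by
      have := ht.hasFDerivAt.comp x ((hasFDerivAt_id x).sub_const t)
      rwa [ContinuousLinearMap.comp_id] at this
    exact h2.const_smul (ker E n t)

/-- bounded, vanishing off a compact set: integrable -/
lemma int_bdd {g : E → F} (hg : AEStronglyMeasurable g) {C : ℝ} (hb : ∀ x, ‖g x‖ ≤ C)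
    {K : Set E} (hK : IsCompact K) (h0 : ∀ x, x ∉ K → g x = 0) : Integrable g := by
  have h1 : IntegrableOn g K := Measure.integrableOn_of_bounded (M := C)
    hK.measure_lt_top.ne hg (Eventually.of_forall hb)
  exact (integrableOn_iff_integrable_of_support_subset
    (fun x hx => by_contra fun h => hx (h0 x h))).1 h1

lemma tendsto_int {G : ℕ → E → F} {g : E → F} (hm : ∀ n, AEStronglyMeasurable (G n)) {C : ℝ}
    (hb : ∀ n x, ‖G n x‖ ≤ C) {K : Set E} (hK : IsCompact K) (h0 : ∀ n x, x ∉ K → G n x = 0)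
    (hl : ∀ᵐ x, Tendsto (fun n => G n x) atTop (𝓝 (g x))) :
    Tendsto (fun n => ∫ x, G n x) atTop (𝓝 (∫ x, g x)) := by
  refine tendsto_integral_of_dominated_convergence (K.indicator fun _ => C) hm ?_ ?_ hl
  · exact (integrable_indicator_iff hK.measurableSet).2
      (integrableOn_const hK.measure_lt_top.ne)
  · intro n
    refine Eventually.of_forall fun x => ?_
    by_cases hx : x ∈ K
    · simpa [hx] using hb n x
    · simp [hx, h0 n x hx]

/-- Lipschitz compactly supported functions are approximated by smooth ones. -/
lemma smooth_approx {U : Set E} (hU : IsOpen U) {g : E → ℝ} {C : ℝ≥0} (hg : LipschitzWith C g)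
    (hc : HasCompactSupport g) (hs : tsupport g ⊆ U) :
    ∃ (G : ℕ → E → ℝ) (K : Set E) (D : ℝ), IsCompact K ∧ K ⊆ U ∧
      (∀ n, ContDiff ℝ (⊤ : ℕ∞) (G n)) ∧ (∀ n, tsupport (G n) ⊆ K) ∧
      (∀ n x, |G n x| ≤ D) ∧ (∀ n x, ‖fderiv ℝ (G n) x‖ ≤ D) ∧
      (∀ᵐ x, Tendsto (fun n => G n x) atTop (𝓝 (g x))) ∧
      (∀ᵐ x, Tendsto (fun n => fderiv ℝ (G n) x) atTop (𝓝 (fderiv ℝ g x))) := by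
  obtain ⟨δ, hδ, hδU⟩ := hc.isCompact.exists_cthickening_subset_open hU hs
  obtain ⟨D, hD⟩ := hc.exists_bound_of_continuous hg.continuous
  obtain ⟨N, hN⟩ := exists_nat_one_div_lt hδ
  have hli : LocallyIntegrable g := locInt hg.continuous.aestronglyMeasurable hD
  have hfb : ∀ x, ‖fderiv ℝ g x‖ ≤ C := fun x => norm_fderiv_le_of_lipschitz ℝ hg
  have hlf : LocallyIntegrable (fderiv ℝ g) :=
    locInt (measurable_fderiv ℝ g).aestronglyMeasurable hfb
  refine ⟨fun n => mol (n + N) g, Metric.cthickening δ (tsupport g), max D C,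
    hc.isCompact.cthickening, hδU, fun n => mol_contDiff _ hli, fun n => ?_, fun n x => ?_,
    fun n x => ?_, ?_, ?_⟩
  · refine closure_minimal ?_ Metric.isClosed_cthickening
    intro x hx
    by_contra h
    apply hx
    refine mol_zero (n + N) (K := tsupport g) (fun y hy => image_eq_zero_of_notMem_tsupport hy) ?_
    intro h2
    apply h
    refine Metric.cthickening_mono ?_ _ h2
    refine le_trans ?_ hN.le
    apply one_div_le_one_div_of_le (by positivity)
    push_cast; linarith [(Nat.cast_nonneg n : (0:ℝ) ≤ n)]
  · exact (mol_bound _ hD x).trans (le_max_left _ _)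
  · rw [(mol_fderiv (n + N) hg hD x).fderiv]
    exact (mol_bound _ hfb x).trans (le_max_right _ _)
  · filter_upwards [mol_tendsto hli] with x hx
    exact hx.comp (tendsto_add_atTop_nat N)
  · filter_upwards [mol_tendsto hlf] with x hx
    simp_rw [fun n => (mol_fderiv (n + N) hg hD x).fderiv]
    exact hx.comp (tendsto_add_atTop_nat N)

end Moll

/-! ### Basic notions on the plane -/

/-- first partial derivative -/
def d1 (H : ℝ × ℝ → ℝ) (p : ℝ × ℝ) : ℝ := fderiv ℝ H p (1, 0)
/-- second partial derivative -/
def d2 (H : ℝ × ℝ → ℝ) (p : ℝ × ℝ) : ℝ := fderiv ℝ H p (0, 1)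
/-- bracket -/
def br (H E : ℝ × ℝ → ℝ) (p : ℝ × ℝ) : ℝ := d2 H p * d1 E p - d1 H p * d2 E p
/-- Lipschitz -/
def Lip (H : ℝ × ℝ → ℝ) : Prop := ∃ C : ℝ≥0, LipschitzWith C H

/-- Lipschitz test functions -/
structure Tst (U : Set (ℝ × ℝ)) (φ : ℝ × ℝ → ℝ) : Prop where
  lip : Lip φ
  cpt : HasCompactSupport φ
  sub : tsupport φ ⊆ U

/-- bounded measurable -/
structure BM (f : ℝ × ℝ → ℝ) : Prop where
  meas : Measurable f
  bdd : ∃ M : ℝ, ∀ p, |f p| ≤ M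

/-- weak divergence -/
def Div (U : Set (ℝ × ℝ)) (b1 b2 G : ℝ × ℝ → ℝ) : Prop :=
  ∀ φ, Tst U φ → ∫ p, (b1 p * d1 φ p + b2 p * d2 φ p) = -∫ p, G p * φ p

/-- weak equation -/
def Weak (U : Set (ℝ × ℝ)) (H f G : ℝ × ℝ → ℝ) : Prop :=
  ∀ φ, Tst U φ → ∫ p, f p * br H φ p = -∫ p, G p * φ p

@[fun_prop] lemma measurable_d1 (H : ℝ × ℝ → ℝ) : Measurable (d1 H) :=
  measurable_fderiv_apply_const ℝ H _
@[fun_prop] lemma measurable_d2 (H : ℝ × ℝ → ℝ) : Measurable (d2 H) :=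
  measurable_fderiv_apply_const ℝ H _
@[fun_prop] lemma measurable_br (H E : ℝ × ℝ → ℝ) : Measurable (br H E) := by
  unfold br; fun_prop

lemma d1_le' (H : ℝ × ℝ → ℝ) (p : ℝ × ℝ) : |d1 H p| ≤ ‖fderiv ℝ H p‖ := by
  have := (fderiv ℝ H p).le_opNorm (1, 0)
  simpa [d1, Prod.norm_def] using this
lemma d2_le' (H : ℝ × ℝ → ℝ) (p : ℝ × ℝ) : |d2 H p| ≤ ‖fderiv ℝ H p‖ := by
  have := (fderiv ℝ H p).le_opNorm (0, 1)
  simpa [d2, Prod.norm_def] using this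
lemma d1_le {H : ℝ × ℝ → ℝ} {C : ℝ≥0} (h : LipschitzWith C H) (p : ℝ × ℝ) : |d1 H p| ≤ C :=
  (d1_le' H p).trans (norm_fderiv_le_of_lipschitz ℝ h)
lemma d2_le {H : ℝ × ℝ → ℝ} {C : ℝ≥0} (h : LipschitzWith C H) (p : ℝ × ℝ) : |d2 H p| ≤ C :=
  (d2_le' H p).trans (norm_fderiv_le_of_lipschitz ℝ h)

lemma fderiv_eq (H : ℝ × ℝ → ℝ) (p v : ℝ × ℝ) :
    fderiv ℝ H p v = v.1 * d1 H p + v.2 * d2 H p := by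
  have : v = v.1 • ((1 : ℝ), (0 : ℝ)) + v.2 • ((0 : ℝ), (1 : ℝ)) := by ext <;> simp
  conv_lhs => rw [this]
  rw [map_add, map_smul, map_smul]
  rfl

namespace Lip
variable {H F φ : ℝ × ℝ → ℝ}
lemma cont (h : Lip H) : Continuous H := h.choose_spec.continuous
lemma meas (h : Lip H) : Measurable H := h.cont.measurable
lemma ae_diff (h : Lip H) : ∀ᵐ p, DifferentiableAt ℝ H p := h.choose_spec.ae_differentiableAt
lemma bm_d1 (h : Lip H) : BM (d1 H) := ⟨measurable_d1 H, _, d1_le h.choose_spec⟩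
lemma bm_d2 (h : Lip H) : BM (d2 H) := ⟨measurable_d2 H, _, d2_le h.choose_spec⟩
lemma const (c : ℝ) : Lip (fun _ => c) := ⟨0, LipschitzWith.const c⟩
lemma fst : Lip (fun p => p.1) := ⟨1, LipschitzWith.prod_fst⟩
lemma snd : Lip (fun p => p.2) := ⟨1, LipschitzWith.prod_snd⟩
lemma add (h : Lip H) (h' : Lip F) : Lip (fun p => H p + F p) := by
  obtain ⟨C, h⟩ := h; obtain ⟨D, h'⟩ := h'; exact ⟨_, h.add h'⟩
lemma sub (h : Lip H) (h' : Lip F) : Lip (fun p => H p - F p) := by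
  obtain ⟨C, h⟩ := h; obtain ⟨D, h'⟩ := h'; exact ⟨_, h.sub h'⟩
lemma neg (h : Lip H) : Lip (fun p => - H p) := by
  obtain ⟨C, h⟩ := h; exact ⟨_, h.neg⟩
lemma comp1 {g : ℝ → ℝ} {D : ℝ≥0} (hg : LipschitzWith D g) (h : Lip H) : Lip (fun p => g (H p)) := by
  obtain ⟨C, h⟩ := h; exact ⟨_, hg.comp h⟩
lemma comp {g : ℝ × ℝ → ℝ × ℝ} {D : ℝ≥0} (h : Lip H) (hg : LipschitzWith D g) :
    Lip (fun p => H (g p)) := by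
  obtain ⟨C, h⟩ := h; exact ⟨_, h.comp hg⟩
lemma comp2 {g : ℝ × ℝ → ℝ} (hg : Lip g) (h : Lip H) (h' : Lip F) :
    Lip (fun p => g (H p, F p)) := by
  obtain ⟨D, hg⟩ := hg; obtain ⟨C, h⟩ := h; obtain ⟨C', h'⟩ := h'
  exact ⟨_, hg.comp (h.prodMk h')⟩
lemma of_bd {C : ℝ} (h : ∀ p q, |H p - H q| ≤ C * dist p q) : Lip H :=
  ⟨C.toNNReal, LipschitzWith.of_dist_le_mul fun p q => by
    rw [Real.dist_eq]
    exact (h p q).trans (mul_le_mul_of_nonneg_right (Real.le_coe_toNNReal C) dist_nonneg)⟩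
lemma bd (h : Lip H) : ∃ C : ℝ, 0 ≤ C ∧ ∀ p q, |H p - H q| ≤ C * dist p q := by
  obtain ⟨C, h⟩ := h
  exact ⟨C, C.2, fun p q => by simpa [Real.dist_eq] using h.dist_le_mul p q⟩
lemma mul (h : Lip H) (h' : Lip F) {M : ℝ} (hM : ∀ p, |H p| ≤ M) {N : ℝ} (hN : ∀ p, |F p| ≤ N) :
    Lip (fun p => H p * F p) := by
  obtain ⟨C, hC, h⟩ := h.bd; obtain ⟨D, hD, h'⟩ := h'.bd
  refine of_bd (C := C * N + M * D) fun p q => ?_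
  have e : H p * F p - H q * F q = (H p - H q) * F p + H q * (F p - F q) := by ring
  rw [e]
  refine (abs_add_le _ _).trans ?_
  rw [abs_mul, abs_mul, add_mul]
  have := dist_nonneg (x := p) (y := q)
  refine add_le_add ?_ ?_
  · calc |H p - H q| * |F p| ≤ (C * dist p q) * N := by
          gcongr
          · exact h p q
          · exact hN p
      _ = _ := by ring
  · calc |H q| * |F p - F q| ≤ M * (D * dist p q) := by
          gcongr
          · exact (abs_nonneg _).trans (hM q)
          · exact hM q
          · exact h' p q
      _ = _ := by ring
lemma mul_cpt (h : Lip H) (h' : Lip φ) (hc : HasCompactSupport φ) :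
    Lip (fun p => H p * φ p) := by
  obtain ⟨N, hN⟩ := hc.exists_bound_of_continuous h'.cont
  obtain ⟨M, hM⟩ := hc.isCompact.exists_bound_of_continuousOn h.cont.continuousOn
  have hM0 : ∀ p, p ∈ tsupport φ → |H p| ≤ max M 0 := fun p hp => (hM p hp).trans (le_max_left _ _)
  obtain ⟨C, hC, h⟩ := h.bd; obtain ⟨D, hD, h'⟩ := h'.bd
  have key : ∀ p q, p ∈ tsupport φ → |H p * φ p - H q * φ q| ≤ (C * N + max M 0 * D) * dist p q := by
    intro p q hp
    have e : H p * φ p - H q * φ q = (H p - H q) * φ q + H p * (φ p - φ q) := by ring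
    rw [e]
    refine (abs_add_le _ _).trans ?_
    rw [abs_mul, abs_mul, add_mul]
    have := dist_nonneg (x := p) (y := q)
    refine add_le_add ?_ ?_
    · calc |H p - H q| * |φ q| ≤ (C * dist p q) * N := by
            gcongr
            · exact h p q
            · exact hN q
        _ = _ := by ring
    · calc |H p| * |φ p - φ q| ≤ max M 0 * (D * dist p q) := by
            gcongr
            · exact hM0 p hp
            · exact h' p q
        _ = _ := by ring
  refine of_bd (C := C * N + max M 0 * D) fun p q => ?_
  by_cases hp : p ∈ tsupport φ
  · exact key p q hp
  by_cases hq : q ∈ tsupport φ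
  · rw [abs_sub_comm, dist_comm]; exact key q p hq
  · have hN0 := (norm_nonneg _).trans (hN p)
    rw [image_eq_zero_of_notMem_tsupport hp, image_eq_zero_of_notMem_tsupport hq]
    simp; positivity
end Lip

namespace BM
variable {f g : ℝ × ℝ → ℝ}
lemma add (hf : BM f) (hg : BM g) : BM (fun p => f p + g p) := by
  obtain ⟨hf, M, hM⟩ := hf; obtain ⟨hg, N, hN⟩ := hg
  exact ⟨by fun_prop, M + N, fun p => (abs_add_le _ _).trans (add_le_add (hM p) (hN p))⟩
lemma neg (hf : BM f) : BM (fun p => - f p) := by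
  obtain ⟨hf, M, hM⟩ := hf
  exact ⟨by fun_prop, M, fun p => by rw [abs_neg]; exact hM p⟩
lemma sub (hf : BM f) (hg : BM g) : BM (fun p => f p - g p) := by
  simpa [sub_eq_add_neg] using hf.add hg.neg
lemma mul (hf : BM f) (hg : BM g) : BM (fun p => f p * g p) := by
  obtain ⟨hf, M, hM⟩ := hf; obtain ⟨hg, N, hN⟩ := hg
  refine ⟨by fun_prop, M * N, fun p => ?_⟩
  rw [abs_mul]
  exact mul_le_mul (hM p) (hN p) (abs_nonneg _) ((abs_nonneg _).trans (hM p))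
lemma const (c : ℝ) : BM (fun _ => c) := ⟨measurable_const, |c|, fun _ => le_rfl⟩
lemma abs (hf : BM f) : BM (fun p => |f p|) := by
  obtain ⟨hf, M, hM⟩ := hf
  exact ⟨by fun_prop, M, fun p => by rw [abs_abs]; exact hM p⟩
lemma sq (hf : BM f) : BM (fun p => f p ^ 2) := by simpa [pow_two] using hf.mul hf
lemma comp (hf : BM f) {T : ℝ × ℝ → ℝ × ℝ} (hT : Measurable T) : BM (fun p => f (T p)) :=
  ⟨hf.meas.comp hT, hf.bdd.imp fun _ h p => h _⟩
lemma ind (hf : BM f) {S : Set (ℝ × ℝ)} (hS : MeasurableSet S) : BM (S.indicator f) := by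
  obtain ⟨hf, M, hM⟩ := hf
  refine ⟨hf.indicator hS, M, fun p => ?_⟩
  by_cases h : p ∈ S
  · simpa [h] using hM p
  · simpa [h] using (abs_nonneg _).trans (hM p)
lemma int (hf : BM f) {K : Set (ℝ × ℝ)} (hK : IsCompact K) (h0 : ∀ x, x ∉ K → f x = 0) :
    Integrable f := by
  obtain ⟨hf, M, hM⟩ := hf
  exact int_bdd hf.aestronglyMeasurable hM hK h0
lemma intOn (hf : BM f) {K : Set (ℝ × ℝ)} (hK : Bornology.IsBounded K) :
    IntegrableOn f K := by
  obtain ⟨hf, M, hM⟩ := hf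
  exact Measure.integrableOn_of_bounded (M := M)
    (hK.measure_lt_top.ne) hf.aestronglyMeasurable (Eventually.of_forall hM)
lemma br {H E : ℝ × ℝ → ℝ} (hH : Lip H) (hE : Lip E) : BM (br H E) :=
  (hH.bm_d2.mul hE.bm_d1).sub (hH.bm_d1.mul hE.bm_d2)
end BM

lemma d1_zero {φ : ℝ × ℝ → ℝ} {p : ℝ × ℝ} (h : p ∉ tsupport φ) : d1 φ p = 0 := by
  simp [d1, fderiv_of_notMem_tsupport ℝ h]
lemma d2_zero {φ : ℝ × ℝ → ℝ} {p : ℝ × ℝ} (h : p ∉ tsupport φ) : d2 φ p = 0 := by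
  simp [d2, fderiv_of_notMem_tsupport ℝ h]
lemma br_zero {H φ : ℝ × ℝ → ℝ} {p : ℝ × ℝ} (h : p ∉ tsupport φ) : br H φ p = 0 := by
  simp [br, d1_zero h, d2_zero h]

namespace Tst
variable {U V : Set (ℝ × ℝ)} {φ ψ f H b1 b2 : ℝ × ℝ → ℝ}
lemma mono (h : Tst U φ) (hUV : U ⊆ V) : Tst V φ := ⟨h.lip, h.cpt, h.sub.trans hUV⟩
lemma bm (h : Tst U φ) : BM φ :=
  ⟨h.lip.meas, h.cpt.exists_bound_of_continuous h.lip.cont⟩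
lemma zero (h : Tst U φ) {p : ℝ × ℝ} (hp : p ∉ U) : φ p = 0 :=
  image_eq_zero_of_notMem_tsupport fun h' => hp (h.sub h')
lemma int (h : Tst U φ) (hf : BM f) : Integrable (fun p => f p * φ p) :=
  (hf.mul h.bm).int h.cpt.isCompact fun p hp => by simp [image_eq_zero_of_notMem_tsupport hp]
lemma int1 (h : Tst U φ) (hf : BM f) : Integrable (fun p => f p * d1 φ p) :=
  (hf.mul h.lip.bm_d1).int h.cpt.isCompact fun p hp => by simp [d1_zero hp]
lemma int2 (h : Tst U φ) (hf : BM f) : Integrable (fun p => f p * d2 φ p) :=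
  (hf.mul h.lip.bm_d2).int h.cpt.isCompact fun p hp => by simp [d2_zero hp]
lemma int_br (h : Tst U φ) (hH : Lip H) (hf : BM f) : Integrable (fun p => f p * br H φ p) :=
  (hf.mul (BM.br hH h.lip)).int h.cpt.isCompact fun p hp => by simp [br_zero hp]
lemma mul (h : Tst U φ) (hH : Lip H) : Tst U (fun p => H p * φ p) :=
  ⟨hH.mul_cpt h.lip h.cpt, h.cpt.mul_left, (closure_mono (Function.support_mul_subset_right _ _)).trans h.sub⟩
lemma add (h : Tst U φ) (h' : Tst U ψ) : Tst U (fun p => φ p + ψ p) :=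
  ⟨h.lip.add h'.lip, h.cpt.add h'.cpt,
    (closure_minimal ((Function.support_add φ ψ).trans
      (union_subset_union subset_closure subset_closure))
      ((isClosed_tsupport φ).union (isClosed_tsupport ψ))).trans (union_subset h.sub h'.sub)⟩
lemma of_smooth (h : ContDiff ℝ (⊤ : ℕ∞) φ) (hc : HasCompactSupport φ) (hs : tsupport φ ⊆ U) :
    Tst U φ :=
  ⟨ContDiff.lipschitzWith_of_hasCompactSupport hc h (by simp), hc, hs⟩
lemma of_closed {K : Set (ℝ × ℝ)} (h : Lip φ) (hK : IsCompact K) (h0 : ∀ p, p ∉ K → φ p = 0) (hKU : K ⊆ U) :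
    Tst U φ := by
  have : tsupport φ ⊆ K := closure_minimal (fun p hp => by_contra fun h => hp (h0 p h)) hK.isClosed
  exact ⟨h, hK.of_isClosed_subset (isClosed_tsupport φ) this, this.trans hKU⟩
end Tst

lemma d1_mul {f g : ℝ × ℝ → ℝ} {p : ℝ × ℝ} (hf : DifferentiableAt ℝ f p) (hg : DifferentiableAt ℝ g p) :
    d1 (fun q => f q * g q) p = f p * d1 g p + g p * d1 f p := by
  simp only [d1]; rw [fderiv_fun_mul hf hg]; simp
lemma d2_mul {f g : ℝ × ℝ → ℝ} {p : ℝ × ℝ} (hf : DifferentiableAt ℝ f p) (hg : DifferentiableAt ℝ g p) :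
    d2 (fun q => f q * g q) p = f p * d2 g p + g p * d2 f p := by
  simp only [d2]; rw [fderiv_fun_mul hf hg]; simp
lemma br_mul {H f g : ℝ × ℝ → ℝ} {p : ℝ × ℝ} (hf : DifferentiableAt ℝ f p) (hg : DifferentiableAt ℝ g p) :
    br H (fun q => f q * g q) p = f p * br H g p + g p * br H f p := by
  simp only [br, d1_mul hf hg, d2_mul hf hg]; ring
lemma d1_add {f g : ℝ × ℝ → ℝ} {p : ℝ × ℝ} (hf : DifferentiableAt ℝ f p) (hg : DifferentiableAt ℝ g p) :
    d1 (fun q => f q + g q) p = d1 f p + d1 g p := by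
  simp only [d1]; rw [fderiv_fun_add hf hg]; simp
lemma d2_add {f g : ℝ × ℝ → ℝ} {p : ℝ × ℝ} (hf : DifferentiableAt ℝ f p) (hg : DifferentiableAt ℝ g p) :
    d2 (fun q => f q + g q) p = d2 f p + d2 g p := by
  simp only [d2]; rw [fderiv_fun_add hf hg]; simp
lemma d1_const_mul {f : ℝ × ℝ → ℝ} {p : ℝ × ℝ} (c : ℝ) :
    d1 (fun q => c * f q) p = c * d1 f p := by
  simp only [d1]; rw [show (fun q => c * f q) = c • f from rfl, fderiv_const_smul_field]; simp
lemma d2_const_mul {f : ℝ × ℝ → ℝ} {p : ℝ × ℝ} (c : ℝ) :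
    d2 (fun q => c * f q) p = c * d2 f p := by
  simp only [d2]; rw [show (fun q => c * f q) = c • f from rfl, fderiv_const_smul_field]; simp

/-- A weak divergence identity for smooth tests extends to Lipschitz tests. -/
lemma Div.of_smooth {U : Set (ℝ × ℝ)} (hU : IsOpen U) {b1 b2 G : ℝ × ℝ → ℝ} (h1 : BM b1) (h2 : BM b2)
    (hG : BM G) (h : ∀ φ, ContDiff ℝ (⊤ : ℕ∞) φ → HasCompactSupport φ → tsupport φ ⊆ U →
      ∫ p, (b1 p * d1 φ p + b2 p * d2 φ p) = -∫ p, G p * φ p) : Div U b1 b2 G := by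
  intro φ hφ
  obtain ⟨C, hC⟩ := hφ.lip
  obtain ⟨g, K, D, hK, hKU, hsm, hts, hb, hbf, hl, hlf⟩ := smooth_approx hU hC hφ.cpt hφ.sub
  have hcpt : ∀ n, HasCompactSupport (g n) := fun n => hK.of_isClosed_subset (isClosed_tsupport _) (hts n)
  obtain ⟨M1, hM1⟩ := h1.bdd
  obtain ⟨M2, hM2⟩ := h2.bdd
  obtain ⟨MG, hMG⟩ := hG.bdd
  have m1 := h1.meas
  have m2 := h2.meas
  have mG := hG.meas
  have L1 : Tendsto (fun n => ∫ p, (b1 p * d1 (g n) p + b2 p * d2 (g n) p)) atTop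
      (𝓝 (∫ p, (b1 p * d1 φ p + b2 p * d2 φ p))) := by
    refine tendsto_int (C := M1 * D + M2 * D) (K := K) (fun n => ?_) ?_ hK ?_ ?_
    · exact Measurable.aestronglyMeasurable (by fun_prop)
    · intro n x
      have e1 := (d1_le' (g n) x).trans (hbf n x)
      have e2 := (d2_le' (g n) x).trans (hbf n x)
      refine (abs_add_le _ _).trans ?_
      rw [abs_mul, abs_mul]
      have := (abs_nonneg _).trans (hM1 x)
      have := (abs_nonneg _).trans (hM2 x)
      gcongr
      · exact hM1 x
      · exact hM2 x
    · intro n x hx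
      rw [d1_zero (fun h => hx (hts n h)), d2_zero (fun h => hx (hts n h))]; simp
    · filter_upwards [hlf] with x hx
      have a1 : Tendsto (fun n => d1 (g n) x) atTop (𝓝 (d1 φ x)) :=
        ((ContinuousLinearMap.apply ℝ ℝ ((1:ℝ),(0:ℝ))).continuous.tendsto _).comp hx
      have a2 : Tendsto (fun n => d2 (g n) x) atTop (𝓝 (d2 φ x)) :=
        ((ContinuousLinearMap.apply ℝ ℝ ((0:ℝ),(1:ℝ))).continuous.tendsto _).comp hx
      exact (a1.const_mul _).add (a2.const_mul _)
  have L2 : Tendsto (fun n => -∫ p, G p * g n p) atTop (𝓝 (-∫ p, G p * φ p)) := by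
    refine (tendsto_int (C := MG * D) (K := K) (fun n => ?_) ?_ hK ?_ ?_).neg
    · exact (mG.mul (hsm n).continuous.measurable).aestronglyMeasurable
    · intro n x
      rw [norm_mul]
      have := (abs_nonneg _).trans (hMG x)
      gcongr
      · exact hMG x
      · exact hb n x
    · intro n x hx
      rw [image_eq_zero_of_notMem_tsupport (fun h => hx (hts n h))]; simp
    · filter_upwards [hl] with x hx
      exact hx.const_mul _
  refine tendsto_nhds_unique L1 (L2.congr fun n => ?_)
  exact (h _ (hsm n) (hcpt n) ((hts n).trans hKU)).symm

lemma weak_iff_div {U : Set (ℝ × ℝ)} {H f G : ℝ × ℝ → ℝ} :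
    Weak U H f G ↔ Div U (fun p => f p * d2 H p) (fun p => - (f p * d1 H p)) G := by
  unfold Weak Div br
  have : ∀ φ : ℝ × ℝ → ℝ, (fun p => f p * (d2 H p * d1 φ p - d1 H p * d2 φ p)) =
    (fun p => f p * d2 H p * d1 φ p + -(f p * d1 H p) * d2 φ p) := fun φ => by ext p; ring
  simp_rw [this]

lemma smooth_d1 {φ : ℝ × ℝ → ℝ} (h : ContDiff ℝ (⊤ : ℕ∞) φ) : ContDiff ℝ (⊤ : ℕ∞) (d1 φ) :=
  (h.fderiv_right (m := (⊤ : ℕ∞)) (by simp)).clm_apply contDiff_const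
lemma smooth_d2 {φ : ℝ × ℝ → ℝ} (h : ContDiff ℝ (⊤ : ℕ∞) φ) : ContDiff ℝ (⊤ : ℕ∞) (d2 φ) :=
  (h.fderiv_right (m := (⊤ : ℕ∞)) (by simp)).clm_apply contDiff_const
lemma tsupport_d1 {φ : ℝ × ℝ → ℝ} : tsupport (d1 φ) ⊆ tsupport φ :=
  closure_minimal (fun p hp => by_contra fun h => hp (d1_zero h)) (isClosed_tsupport _)
lemma tsupport_d2 {φ : ℝ × ℝ → ℝ} : tsupport (d2 φ) ⊆ tsupport φ :=
  closure_minimal (fun p hp => by_contra fun h => hp (d2_zero h)) (isClosed_tsupport _)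
lemma cpt_d1 {φ : ℝ × ℝ → ℝ} (h : HasCompactSupport φ) : HasCompactSupport (d1 φ) :=
  h.isCompact.of_isClosed_subset (isClosed_tsupport _) tsupport_d1
lemma cpt_d2 {φ : ℝ × ℝ → ℝ} (h : HasCompactSupport φ) : HasCompactSupport (d2 φ) :=
  h.isCompact.of_isClosed_subset (isClosed_tsupport _) tsupport_d2

lemma d12_symm {φ : ℝ × ℝ → ℝ} (h : ContDiff ℝ (⊤ : ℕ∞) φ) : d1 (d2 φ) = d2 (d1 φ) := by
  ext p
  have hd : Differentiable ℝ (fderiv ℝ φ) :=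
    (h.fderiv_right (m := (⊤ : ℕ∞)) (by simp)).differentiable (by simp)
  have e := second_derivative_symmetric (f := φ) (f' := fderiv ℝ φ) (x := p)
    (fun y => (h.differentiable (by simp) y).hasFDerivAt) (hd p).hasFDerivAt (1, 0) (0, 1)
  have a1 : d1 (d2 φ) p = fderiv ℝ (fderiv ℝ φ) p (1, 0) (0, 1) := by
    unfold d1 d2
    rw [fderiv_clm_apply (hd p) (by fun_prop)]; simp
  have a2 : d2 (d1 φ) p = fderiv ℝ (fderiv ℝ φ) p (0, 1) (1, 0) := by
    unfold d1 d2
    rw [fderiv_clm_apply (hd p) (by fun_prop)]; simp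
  rw [a1, a2, e]

/-- integration by parts -/
lemma parts1 {H g : ℝ × ℝ → ℝ} (hH : Lip H) (hg : Lip g) (hc : HasCompactSupport g) :
    ∫ p, d1 H p * g p = - ∫ p, H p * d1 g p := by
  obtain ⟨C, hC⟩ := id hH; obtain ⟨D, hD⟩ := id hg
  have := hC.integral_lineDeriv_mul_eq (μ := volume) hD hc (1, 0)
  have e1 : ∫ p, d1 H p * g p = ∫ p, lineDeriv ℝ H p (1, 0) * g p := by
    refine integral_congr_ae ?_
    filter_upwards [hH.ae_diff] with p hp
    rw [hp.lineDeriv_eq_fderiv]; rfl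
  rw [e1, this, ← integral_neg]
  refine integral_congr_ae ?_
  filter_upwards [hg.ae_diff] with p hp
  rw [hp.lineDeriv_eq_fderiv]; simp only [map_neg, d1]; ring
lemma parts2 {H g : ℝ × ℝ → ℝ} (hH : Lip H) (hg : Lip g) (hc : HasCompactSupport g) :
    ∫ p, d2 H p * g p = - ∫ p, H p * d2 g p := by
  obtain ⟨C, hC⟩ := id hH; obtain ⟨D, hD⟩ := id hg
  have := hC.integral_lineDeriv_mul_eq (μ := volume) hD hc (0, 1)
  have e1 : ∫ p, d2 H p * g p = ∫ p, lineDeriv ℝ H p (0, 1) * g p := by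
    refine integral_congr_ae ?_
    filter_upwards [hH.ae_diff] with p hp
    rw [hp.lineDeriv_eq_fderiv]; rfl
  rw [e1, this, ← integral_neg]
  refine integral_congr_ae ?_
  filter_upwards [hg.ae_diff] with p hp
  rw [hp.lineDeriv_eq_fderiv]; simp only [map_neg, d2]; ring

/-- null Lagrangian -/
lemma NL {H : ℝ × ℝ → ℝ} (hH : Lip H) : Weak univ H (fun _ => 1) (fun _ => 0) := by
  rw [weak_iff_div]
  refine Div.of_smooth isOpen_univ ((BM.const 1).mul hH.bm_d2) ((BM.const 1).mul hH.bm_d1).neg (BM.const 0) ?_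
  intro φ hφ hc _
  have t1 : Tst univ (d1 φ) := Tst.of_smooth (smooth_d1 hφ) (cpt_d1 hc) (subset_univ _)
  have t2 : Tst univ (d2 φ) := Tst.of_smooth (smooth_d2 hφ) (cpt_d2 hc) (subset_univ _)
  have p1 := parts2 hH t1.lip t1.cpt
  have p2 := parts1 hH t2.lip t2.cpt
  rw [d12_symm hφ] at p2
  have i1 := t1.int hH.bm_d2
  have i2 := t2.int hH.bm_d1
  simp only [one_mul, neg_mul, zero_mul, integral_zero, neg_zero]
  simp_rw [← sub_eq_add_neg]
  rw [integral_sub i1 i2, p1, p2]; ring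

lemma NL' {H E : ℝ × ℝ → ℝ} (hH : Lip H) (hE : Lip E) (hc : HasCompactSupport E) :
    ∫ p, br H E p = 0 := by
  simpa using NL hH E ⟨hE, hc, subset_univ _⟩

lemma Weak.mono {U V : Set (ℝ × ℝ)} {H f G : ℝ × ℝ → ℝ} (h : Weak V H f G) (hUV : U ⊆ V) :
    Weak U H f G := fun φ hφ => h φ (hφ.mono hUV)

section
variable {E : Type*} [NormedAddCommGroup E] [NormedSpace ℝ E] [FiniteDimensional ℝ E]
  [MeasureSpace E] [BorelSpace E] [(volume : Measure E).IsAddHaarMeasure]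

lemma ker_fderiv_bd (n : ℕ) : ∃ C : ℝ, ∀ t : E, ‖fderiv ℝ (ker E n) t‖ ≤ C := by
  obtain ⟨C, hC⟩ := ContDiff.lipschitzWith_of_hasCompactSupport (ker_cpt (E := E) n) (ker_contDiff n) (by simp)
  exact ⟨C, fun t => norm_fderiv_le_of_lipschitz ℝ hC⟩

lemma mol_swap (n : ℕ) (g : E → ℝ) (x : E) : mol n g x = ∫ t, ker E n (x - t) * g t := by
  rw [mol_eq_conv, convolution_lsmul_swap]; rfl

lemma mol_fderiv_apply (n : ℕ) {g : E → ℝ} (hg : AEStronglyMeasurable g) {C : ℝ}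
    (hb : ∀ x, ‖g x‖ ≤ C) (x v : E) :
    fderiv ℝ (mol n g) x v = ∫ t, fderiv ℝ (ker E n) (x - t) v * g t := by
  have h := (ker_cpt (E := E) n).hasFDerivAt_convolution_left (ContinuousLinearMap.lsmul ℝ ℝ)
    ((ker_contDiff n).of_le (by simp)) (locInt hg hb) x
  have e : mol n g = convolution (ker E n) g (ContinuousLinearMap.lsmul ℝ ℝ) volume := rfl
  rw [e, h.fderiv, convolution_eq_swap]
  obtain ⟨D, hD⟩ := ker_fderiv_bd (E := E) n
  have hcont : Continuous (fderiv ℝ (ker E n)) := (ker_contDiff n).continuous_fderiv (by simp)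
  rw [ContinuousLinearMap.integral_apply]
  · rfl
  · have hcp : IsCompact ((fun t => x - t) ⁻¹' (tsupport (ker E n))) :=
      (Homeomorph.subLeft x).isCompact_preimage.2 (ker_cpt n)
    refine int_bdd (C := D * C) ?_ ?_ hcp ?_
    · exact ((ContinuousLinearMap.precompL E (ContinuousLinearMap.lsmul ℝ ℝ : ℝ →L[ℝ] ℝ →L[ℝ] ℝ))).aestronglyMeasurable_comp₂ (hcont.comp (by fun_prop)).aestronglyMeasurable hg
    · intro t
      have h1 := hD (x - t)
      have h2 := hb t
      have h3 := (norm_nonneg _).trans h1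
      have h4 := (norm_nonneg _).trans h2
      refine ContinuousLinearMap.opNorm_le_bound _ (by positivity) fun w => ?_
      have : ‖fderiv ℝ (ker E n) (x - t) w * g t‖ ≤ D * C * ‖w‖ := by
        rw [norm_mul]
        have := (fderiv ℝ (ker E n) (x - t)).le_opNorm w
        calc _ ≤ (‖fderiv ℝ (ker E n) (x - t)‖ * ‖w‖) * C := by gcongr
          _ ≤ (D * ‖w‖) * C := by gcongr
          _ = _ := by ring
      exact this
    · intro t ht
      rw [fderiv_of_notMem_tsupport ℝ ht]; simp
end

/-- mollified divergence-free fields are divergence free -/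
lemma mol_div {c : ℝ × ℝ} {r r' : ℝ} {b1 b2 : ℝ × ℝ → ℝ} (h1 : BM b1) (h2 : BM b2)
    (hD : Div (Metric.ball c r) b1 b2 (fun _ => 0)) (n : ℕ) (hn : 1 / ((n : ℝ) + 1) < r - r')
    {x : ℝ × ℝ} (hx : x ∈ Metric.ball c r') : d1 (mol n b1) x + d2 (mol n b2) x = 0 := by
  obtain ⟨M1, hM1⟩ := h1.bdd
  obtain ⟨M2, hM2⟩ := h2.bdd
  unfold d1 d2
  rw [mol_fderiv_apply n h1.meas.aestronglyMeasurable hM1,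
    mol_fderiv_apply n h2.meas.aestronglyMeasurable hM2]
  set k := ker (ℝ × ℝ) n
  have hsm : ContDiff ℝ (⊤ : ℕ∞) (fun t => k (x - t)) := (ker_contDiff n).comp (by fun_prop)
  have hT : Tst (Metric.ball c r) (fun t => k (x - t)) := by
    have hl := ContDiff.lipschitzWith_of_hasCompactSupport (ker_cpt (E := ℝ × ℝ) n) (ker_contDiff n) (by simp)
    refine Tst.of_closed (K := Metric.closedBall x (1 / ((n : ℝ) + 1))) ?_ (isCompact_closedBall _ _) ?_ ?_
    · have : LipschitzWith 1 (fun t : ℝ × ℝ => x - t) :=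
        LipschitzWith.of_dist_le_mul fun p q => by rw [dist_sub_left]; simp
      exact Lip.comp (H := k) hl this
    · intro t ht
      apply ker_zero
      rw [Metric.mem_closedBall, not_le, dist_comm, dist_eq_norm] at ht
      exact ht.le
    · intro t ht
      simp only [Metric.mem_closedBall, Metric.mem_ball] at *
      linarith [dist_triangle t x c]
  have e := hD _ hT
  have f1 : ∀ t v, fderiv ℝ (fun t => k (x - t)) t v = - fderiv ℝ k (x - t) v := by
    intro t v
    have hk : DifferentiableAt ℝ k (x - t) := (ker_contDiff n).differentiable (by simp) _
    have h0 : HasFDerivAt (fun t => x - t) (-(ContinuousLinearMap.id ℝ (ℝ × ℝ))) t :=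
      (hasFDerivAt_id t).const_sub x
    have := HasFDerivAt.comp (g := k) t hk.hasFDerivAt h0
    rw [HasFDerivAt.fderiv (f := fun t => k (x - t)) this]
    simp
  have i1 := hT.int1 h1
  have i2 := hT.int2 h2
  rw [integral_add i1 i2] at e
  simp only [zero_mul, integral_zero, neg_zero, d1, d2, f1, mul_neg, integral_neg] at e
  simp_rw [mul_comm _ (b1 _), mul_comm _ (b2 _)]
  linarith

/-- a sequence of equi-Lipschitz functions has a pointwise convergent subsequence -/
lemma lip_subseq {C : ℝ≥0} (H : ℕ → ℝ × ℝ → ℝ) (hL : ∀ n, LipschitzWith C (H n)) (c : ℝ × ℝ)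
    (h0 : ∀ n, H n c = 0) : ∃ (θ : ℕ → ℕ) (L : ℝ × ℝ → ℝ), StrictMono θ ∧ LipschitzWith C L ∧
      ∀ p, Tendsto (fun n => H (θ n) p) atTop (𝓝 (L p)) := by
  let q := TopologicalSpace.denseSeq (ℝ × ℝ)
  have hq : DenseRange q := TopologicalSpace.denseRange_denseSeq _
  have hcomp : IsCompact (Set.pi univ fun k => Metric.closedBall (0:ℝ) (C * dist (q k) c)) :=
    isCompact_univ_pi fun k => isCompact_closedBall _ _
  obtain ⟨a, -, θ, hθ, hlim⟩ := hcomp.isSeqCompact (x := fun n k => H n (q k)) (fun n k _ => by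
    have := (hL n).dist_le_mul (q k) c
    rw [h0] at this
    simpa using this)
  rw [tendsto_pi_nhds] at hlim
  have hC : ∀ p, CauchySeq (fun n => H (θ n) p) := by
    intro p
    rw [Metric.cauchySeq_iff]
    intro ε hε
    obtain ⟨k, hk⟩ := hq.exists_dist_lt p (ε := ε / (4 * (C + 1))) (by positivity)
    have h1 := (hlim k).cauchySeq
    rw [Metric.cauchySeq_iff] at h1
    obtain ⟨N, hN⟩ := h1 (ε / 4) (by positivity)
    refine ⟨N, fun m hm n hn => ?_⟩
    have a1 := (hL (θ m)).dist_le_mul p (q k)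
    have a2 := (hL (θ n)).dist_le_mul (q k) p
    have a3 := hN m hm n hn
    have a4 : (C:ℝ) * dist p (q k) ≤ ε / 4 := by
      have : (C:ℝ) * dist p (q k) ≤ (C + 1) * (ε / (4 * (C + 1))) := by
        gcongr
        · simp
      refine this.trans (le_of_eq ?_)
      field_simp
    rw [dist_comm] at a2
    simp only [Function.comp] at a3
    have t1 := dist_triangle (H (θ m) p) (H (θ m) (q k)) (H (θ n) p)
    have t2 := dist_triangle (H (θ m) (q k)) (H (θ n) (q k)) (H (θ n) p)
    rw [dist_comm (q k) p] at a2
    rw [dist_comm (H (θ n) p)] at a2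
    linarith
  choose L hLim using fun p => cauchySeq_tendsto_of_complete (hC p)
  refine ⟨θ, L, hθ, ?_, hLim⟩
  refine LipschitzWith.of_dist_le_mul fun p p' => ?_
  refine le_of_tendsto ((hLim p).dist (hLim p')) (Eventually.of_forall fun n => ?_)
  exact (hL (θ n)).dist_le_mul p p'

lemma poincare {c : ℝ × ℝ} {r r' : ℝ} (hr : 0 < r') (hrr : r' < r) {b1 b2 : ℝ × ℝ → ℝ}
    (h1 : BM b1) (h2 : BM b2) (hD : Div (Metric.ball c r) b1 b2 (fun _ => 0)) :
    ∃ H, Lip H ∧ ∀ᵐ p, p ∈ Metric.ball c r' → d2 H p = b1 p ∧ d1 H p = - b2 p := by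
  obtain ⟨M1, hM1⟩ := h1.bdd
  obtain ⟨M2, hM2⟩ := h2.bdd
  have m1 := h1.meas
  have m2 := h2.meas
  have hM1' := (abs_nonneg _).trans (hM1 0)
  have hM2' := (abs_nonneg _).trans (hM2 0)
  have li1 := locInt h1.meas.aestronglyMeasurable hM1
  have li2 := locInt h2.meas.aestronglyMeasurable hM2
  obtain ⟨N, hN⟩ := exists_nat_one_div_lt (sub_pos.2 hrr)
  have hN' : ∀ n : ℕ, 1 / (((n + N : ℕ) : ℝ) + 1) < r - r' := fun n => by
    refine lt_of_le_of_lt ?_ hN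
    apply one_div_le_one_div_of_le (by positivity)
    push_cast; linarith [(Nat.cast_nonneg n : (0:ℝ) ≤ n)]
  set K : ℝ≥0 := ⟨M1 + M2, by positivity⟩
  -- potentials
  have key : ∀ n : ℕ, ∃ P : ℝ × ℝ → ℝ, LipschitzWith K P ∧ P c = 0 ∧ ∀ p ∈ Metric.ball c r',
      d2 P p = mol (n + N) b1 p ∧ d1 P p = - mol (n + N) b2 p := by
    intro n
    set β1 := mol (n + N) b1
    set β2 := mol (n + N) b2
    have s1 : ContDiff ℝ (⊤ : ℕ∞) β1 := mol_contDiff _ li1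
    have s2 : ContDiff ℝ (⊤ : ℕ∞) β2 := mol_contDiff _ li2
    let ω : ℝ × ℝ → ℝ × ℝ →L[ℝ] ℝ := fun p =>
      (-β2 p) • ContinuousLinearMap.fst ℝ ℝ ℝ + β1 p • ContinuousLinearMap.snd ℝ ℝ ℝ
    have hω : Differentiable ℝ ω := by
      have := s1.differentiable (by simp)
      have := s2.differentiable (by simp)
      fun_prop
    have hωv : ∀ p v, ω p v = -β2 p * v.1 + β1 p * v.2 := fun p v => by simp [ω]
    have hωd : ∀ p x y, fderiv ℝ ω p x y = - fderiv ℝ β2 p x * y.1 + fderiv ℝ β1 p x * y.2 := by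
      intro p x y
      have e1 : fderiv ℝ ω p x y = fderiv ℝ (fun q => ω q y) p x := by
        rw [fderiv_clm_apply (hω p) (by fun_prop)]; simp
      have d1' := (s1.differentiable (by simp) p).hasFDerivAt.mul_const y.2
      have d2' := (s2.differentiable (by simp) p).hasFDerivAt.neg.mul_const y.1
      have := d2'.add d1'
      rw [e1]
      simp_rw [hωv]
      rw [HasFDerivAt.fderiv (f := fun q => -β2 q * y.1 + β1 q * y.2) this]
      simp; ring
    obtain ⟨P, hP⟩ := (convex_ball c r').exists_forall_hasFDerivAt_of_fderiv_symmetric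
      Metric.isOpen_ball hω.differentiableOn (by
        intro a ha x y
        have := mol_div h1 h2 hD (n + N) (hN' n) ha
        rw [hωd, hωd, fderiv_eq, fderiv_eq, fderiv_eq, fderiv_eq]
        have e : d1 β1 a = - d2 β2 a := by linarith
        rw [e]; ring)
    have hlip : LipschitzOnWith K P (Metric.ball c r') := by
      refine Convex.lipschitzOnWith_of_nnnorm_hasFDerivWithin_le (𝕜 := ℝ)
        (fun x hx => (hP x hx).hasFDerivWithinAt) ?_ (convex_ball c r')
      intro x _
      rw [← NNReal.coe_le_coe]
      change ‖ω x‖ ≤ M1 + M2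
      refine ContinuousLinearMap.opNorm_le_bound _ (by positivity) fun v => ?_
      rw [hωv]
      have a1 : |β1 x| ≤ M1 := by
        have := mol_bound (n + N) (g := b1) hM1 x
        exact this
      have a2 : |β2 x| ≤ M2 := by
        have := mol_bound (n + N) (g := b2) hM2 x
        exact this
      have n1 : |v.1| ≤ ‖v‖ := norm_fst_le v
      have n2 : |v.2| ≤ ‖v‖ := norm_snd_le v
      refine (abs_add_le _ _).trans ?_
      rw [abs_mul, abs_mul, abs_neg, add_mul, add_comm]
      gcongr
    obtain ⟨Q, hQ, hPQ⟩ := hlip.extend_real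
    refine ⟨fun p => Q p - Q c, ?_, by simp, ?_⟩
    · simpa using hQ.sub (LipschitzWith.const (Q c))
    · intro p hp
      have hev : P =ᶠ[𝓝 p] Q := by
        filter_upwards [Metric.isOpen_ball.mem_nhds hp] with q hq using hPQ hq
      have hd : HasFDerivAt (fun p => Q p - Q c) (ω p) p :=
        ((hP p hp).congr_of_eventuallyEq hev.symm).sub_const _
      simp [d1, d2, hd.fderiv, hωv]
  choose P hPl hPc hPd using key
  obtain ⟨θ, H, hθ, hHl, hlim⟩ := lip_subseq P hPl c hPc
  have hH : Lip H := ⟨_, hHl⟩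
  -- common convergence argument
  have conv : ∀ g : ℝ × ℝ → ℝ, Continuous g →
      HasCompactSupport g →
      Tendsto (fun n => ∫ p, P (θ n) p * g p) atTop (𝓝 (∫ p, H p * g p)) := by
    intro g hg hc
    obtain ⟨D, hDb⟩ := hc.exists_bound_of_continuous hg
    obtain ⟨R0, hR0⟩ := hc.isCompact.isBounded.subset_closedBall c
    obtain ⟨R, hRp, hR⟩ : ∃ R, 0 ≤ R ∧ tsupport g ⊆ Metric.closedBall c R :=
      ⟨max R0 0, le_max_right _ _, hR0.trans (Metric.closedBall_subset_closedBall (le_max_left _ _))⟩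
    refine tendsto_int (C := (K * R) * D) (K := tsupport g) (fun n => ?_) ?_ hc.isCompact ?_ ?_
    · exact ((hPl _).continuous.mul hg).aestronglyMeasurable
    · intro n x
      by_cases hx : x ∈ tsupport g
      · have a1 := (hPl (θ n)).dist_le_mul x c
        rw [hPc, Real.dist_eq, sub_zero] at a1
        have a2 := hR hx
        rw [Metric.mem_closedBall] at a2
        have a3 : |P (θ n) x| ≤ K * R := a1.trans (by gcongr)
        rw [norm_mul]
        exact mul_le_mul a3 (hDb x) (norm_nonneg _) ((abs_nonneg _).trans a3)
      · rw [image_eq_zero_of_notMem_tsupport hx]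
        simp only [mul_zero, norm_zero]
        have := (norm_nonneg _).trans (hDb x); positivity
    · intro n x hx
      rw [image_eq_zero_of_notMem_tsupport hx]; simp
    · exact Eventually.of_forall fun x => (hlim x).mul_const _
  have molc : ∀ (b : ℝ × ℝ → ℝ), BM b → ∀ g : ℝ × ℝ → ℝ, Continuous g → HasCompactSupport g →
      Tendsto (fun n => ∫ p, mol (θ n + N) b p * g p) atTop (𝓝 (∫ p, b p * g p)) := by
    intro b hb g hg hc
    obtain ⟨M, hM⟩ := hb.bdd
    obtain ⟨D, hDb⟩ := hc.exists_bound_of_continuous hg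
    have hM' := (abs_nonneg _).trans (hM 0)
    have li := locInt hb.meas.aestronglyMeasurable hM
    refine tendsto_int (C := M * D) (K := tsupport g) (fun n => ?_) ?_ hc.isCompact ?_ ?_
    · exact ((mol_contDiff _ li).continuous.mul hg).aestronglyMeasurable
    · intro n x
      rw [norm_mul]
      exact mul_le_mul (mol_bound _ hM x) (hDb x) (norm_nonneg _) hM'
    · intro n x hx
      rw [image_eq_zero_of_notMem_tsupport hx]; simp
    · have ht : Tendsto (fun n => θ n + N) atTop atTop := (tendsto_add_atTop_nat N).comp hθ.tendsto_atTop
      filter_upwards [mol_tendsto li] with x hx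
      exact (hx.comp ht).mul_const _
  have fin : ∀ (d : (ℝ × ℝ → ℝ) → ℝ × ℝ → ℝ) (b : ℝ × ℝ → ℝ) , BM b → BM (d H) →
      (∀ φ, ContDiff ℝ (⊤ : ℕ∞) φ → ContDiff ℝ (⊤ : ℕ∞) (d φ)) →
      (∀ φ, HasCompactSupport φ → HasCompactSupport (d φ)) →
      (∀ Q g : ℝ × ℝ → ℝ, Lip Q → Lip g → HasCompactSupport g → ∫ p, d Q p * g p = - ∫ p, Q p * d g p) →
      (∀ n, ∀ p ∈ Metric.ball c r', d (P n) p = mol (n + N) b p) →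
      ∀ᵐ p, p ∈ Metric.ball c r' → d H p - b p = 0 := by
    intro d b hb hbd hs hcc hp hm
    have hbb := hbd.sub hb
    refine IsOpen.ae_eq_zero_of_integral_contDiff_smul_eq_zero Metric.isOpen_ball ?_ ?_
    · obtain ⟨M, hM⟩ := hbb.bdd
      exact (locInt hbb.meas.aestronglyMeasurable hM).locallyIntegrableOn _
    · intro φ h1 h2 h3
      have hT : Tst (Metric.ball c r') φ := Tst.of_smooth h1 h2 h3
      have hs' := hs φ h1
      have e1 := conv (d φ) hs'.continuous (hcc _ h2)
      have e2 := molc b hb φ h1.continuous h2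
      have e3 : ∀ n, ∫ p, mol (θ n + N) b p * φ p = - ∫ p, P (θ n) p * d φ p := by
        intro n
        rw [← hp _ _ ⟨_, hPl _⟩ hT.lip h2]
        congr 1; ext p
        by_cases hpp : p ∈ Metric.ball c r'
        · rw [hm _ p hpp]
        · rw [hT.zero hpp]; simp
      simp_rw [e3] at e2
      have e4 := tendsto_nhds_unique e2 e1.neg
      have e5 := hp H φ hH hT.lip h2
      have i1 := hT.int hb
      have i2 := hT.int hbd
      simp only [smul_eq_mul]
      simp_rw [mul_comm (φ _), sub_mul]
      rw [integral_sub i2 i1]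
      linarith
  refine ⟨H, hH, ?_⟩
  have f2 := fin d2 b1 h1 hH.bm_d2 (fun φ h => smooth_d2 h) (fun φ h => cpt_d2 h)
    (fun Q g hQ hg hc => parts2 hQ hg hc) (fun n p hp => (hPd n p hp).1)
  have mneg : ∀ n p, mol n (fun p => - b2 p) p = - mol n b2 p := by
    intro n p
    simp [mol, integral_neg]
  have f1 := fin d1 (fun p => - b2 p) h2.neg hH.bm_d1 (fun φ h => smooth_d1 h) (fun φ h => cpt_d1 h)
    (fun Q g hQ hg hc => parts1 hQ hg hc) (fun n p hp => by rw [mneg]; exact (hPd n p hp).2)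
  filter_upwards [f1, f2] with p a1 a2 hp
  constructor
  · linarith [a2 hp]
  · linarith [a1 hp]

/-! ### one dimensional tools -/

/-- antiderivative of a smooth compactly supported mean-zero function -/
lemma antideriv {a b : ℝ} {k : ℝ → ℝ} (hk : ContDiff ℝ (⊤ : ℕ∞) k) {a' b' : ℝ} (h1 : a < a')
    (h2 : b' < b) (h3 : a' ≤ b')
    (h0 : ∀ x, x ∉ Icc a' b' → k x = 0) (hi : ∫ x, k x = 0) :
    ∃ χ : ℝ → ℝ, ContDiff ℝ (⊤ : ℕ∞) χ ∧ HasCompactSupport χ ∧ tsupport χ ⊆ Ioo a b ∧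
      ∀ x, deriv χ x = k x := by
  let e := (a + a') / 2
  have he : e < a' := by simp only [e]; linarith
  have hd : ∀ x, HasDerivAt (fun x => ∫ t in e..x, k t) (k x) x := fun x =>
    intervalIntegral.integral_hasDerivAt_right (hk.continuous.intervalIntegrable _ _)
      hk.continuous.stronglyMeasurable.stronglyMeasurableAtFilter hk.continuous.continuousAt
  have hz : ∀ x, x ∉ Icc a' b' → ∫ t in e..x, k t = 0 := by
    intro x hx
    by_cases hxa : x < a'
    · apply intervalIntegral.integral_zero_ae
      refine Eventually.of_forall fun t ht => h0 t ?_
      rintro ⟨h, -⟩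
      have := ht.2
      simp only [le_sup_iff] at this
      rcases this with h' | h' <;> linarith
    · have hxb : b' < x := by
        by_contra h
        exact hx ⟨not_lt.1 hxa, not_lt.1 h⟩
      rw [intervalIntegral.integral_eq_integral_of_support_subset, hi]
      intro t ht
      by_contra hh
      apply ht
      apply h0
      intro h
      exact hh ⟨he.trans_le h.1, h.2.trans hxb.le⟩
  have hts : tsupport (fun x => ∫ t in e..x, k t) ⊆ Icc a' b' := by
    refine closure_minimal ?_ isClosed_Icc
    intro x hx
    by_contra h
    exact hx (hz x h)
  refine ⟨_, ?_, HasCompactSupport.of_support_subset_isCompact isCompact_Icc ((subset_tsupport _).trans hts), hts.trans ?_, fun x => (hd x).deriv⟩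
  · rw [contDiff_infty_iff_deriv]
    refine ⟨fun x => (hd x).differentiableAt, ?_⟩
    rwa [show deriv (fun x => ∫ t in e..x, k t) = k from funext fun x => (hd x).deriv]
  · exact fun x hx => ⟨h1.trans_le hx.1, hx.2.trans_lt h2⟩

lemma dbr {a b : ℝ} {w : ℝ → ℝ} (hw : LocallyIntegrable w)
    (h : ∀ χ : ℝ → ℝ, ContDiff ℝ (⊤ : ℕ∞) χ → HasCompactSupport χ → tsupport χ ⊆ Ioo a b →
      ∫ x, deriv χ x * w x = 0) : ∃ c, ∀ᵐ x, x ∈ Ioo a b → w x = c := by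
  by_cases hab : a < b
  swap
  · exact ⟨0, Eventually.of_forall fun x hx => absurd (hx.1.trans hx.2) hab⟩
  let B : ContDiffBump ((a + b) / 2) := ⟨(b - a) / 8, (b - a) / 4, by linarith, by linarith⟩
  let η : ℝ → ℝ := B.normed volume
  have hη : ContDiff ℝ (⊤ : ℕ∞) η := B.contDiff_normed
  have hηc : HasCompactSupport η := B.hasCompactSupport_normed
  have hη1 : ∫ x, η x = 1 := B.integral_normed
  have hηs : ∀ x, x ∉ Icc (a + (b - a) / 4) (b - (b - a) / 4) → η x = 0 := by
    intro x hx
    have hs : Function.support η = Metric.ball ((a + b) / 2) ((b - a) / 4) := B.support_normed_eq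
    by_contra hne
    have : x ∈ Function.support η := hne
    rw [hs, Real.ball_eq_Ioo] at this
    exact hx ⟨by linarith [this.1], by linarith [this.2]⟩
  have iη : Integrable η := hη.continuous.integrable_of_hasCompactSupport hηc
  have iw : ∀ g : ℝ → ℝ, Continuous g → HasCompactSupport g → Integrable (fun x => g x * w x) :=
    fun g hg hc => hw.integrable_smul_left_of_hasCompactSupport hg hc
  refine ⟨∫ x, η x * w x, ?_⟩
  set c := ∫ x, η x * w x
  suffices ∀ᵐ x, x ∈ Ioo a b → w x - c = 0 by
    filter_upwards [this] with x hx hm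
    linarith [hx hm]
  refine IsOpen.ae_eq_zero_of_integral_contDiff_smul_eq_zero isOpen_Ioo ?_ ?_
  · exact (hw.sub (locallyIntegrable_const c)).locallyIntegrableOn _
  · intro g h1 h2 h3
    have ig : Integrable g := h1.continuous.integrable_of_hasCompactSupport h2
    have hpad : ∃ a' b', a < a' ∧ b' < b ∧ a' ≤ b' ∧ a' ≤ a + (b - a) / 4 ∧ b - (b - a) / 4 ≤ b' ∧
        tsupport g ⊆ Icc a' b' := by
      by_cases hne : (tsupport g).Nonempty
      · obtain ⟨p, hp, hp'⟩ := h2.isCompact.exists_isLeast hne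
        obtain ⟨q, hq, hq'⟩ := h2.isCompact.exists_isGreatest hne
        refine ⟨min p (a + (b - a) / 4), max q (b - (b - a) / 4), ?_, ?_, ?_, min_le_right _ _, le_max_right _ _, ?_⟩
        · exact lt_min (h3 hp).1 (by linarith)
        · exact max_lt (h3 hq).2 (by linarith)
        · exact (min_le_right _ _).trans (le_trans (by linarith) (le_max_right _ _))
        · exact fun x hx => ⟨(min_le_left _ _).trans (hp' hx), (hq' hx).trans (le_max_left _ _)⟩
      · refine ⟨a + (b - a) / 4, b - (b - a) / 4, by linarith, by linarith, by linarith, le_rfl, le_rfl, ?_⟩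
        rw [not_nonempty_iff_eq_empty.1 hne]; simp
    obtain ⟨a', b', q1, q2, q3, q4, q5, q6⟩ := hpad
    obtain ⟨χ, c1, c2, c3, c4⟩ := antideriv (k := fun x => g x - (∫ t, g t) * η x) (a := a) (b := b)
      (h1.sub (contDiff_const.mul hη)) q1 q2 q3 (by
        intro x hx
        rw [image_eq_zero_of_notMem_tsupport (fun hh => hx (q6 hh)), hηs x (fun hh => hx ⟨q4.trans hh.1, hh.2.trans q5⟩)]
        simp) (by
        rw [integral_sub ig (iη.const_mul _), integral_const_mul, hη1]; ring)
    have e := h χ c1 c2 c3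
    simp_rw [c4] at e
    have e2 : ∀ x, (g x - (∫ t, g t) * η x) * w x = g x * w x - (∫ t, g t) * (η x * w x) := fun x => by ring
    simp_rw [e2] at e
    rw [integral_sub (iw g h1.continuous h2) ((iw η hη.continuous hηc).const_mul _), integral_const_mul] at e
    simp only [smul_eq_mul, mul_sub]
    rw [integral_sub (iw g h1.continuous h2) (ig.mul_const _), integral_mul_const]
    linarith

/-- Lipschitz functions on lines -/
lemma Lip.line2 {F : ℝ × ℝ → ℝ} (hF : Lip F) :
    ∀ᵐ x : ℝ, ∀ᵐ y : ℝ, DifferentiableAt ℝ F (x, y) := by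
  have := hF.ae_diff
  rw [Measure.volume_eq_prod] at this
  exact Measure.ae_ae_of_ae_prod this

lemma hasDerivAt_line2 {F : ℝ × ℝ → ℝ} {x y : ℝ} (h : DifferentiableAt ℝ F (x, y)) :
    HasDerivAt (fun y => F (x, y)) (d2 F (x, y)) y :=
  h.hasFDerivAt.comp_hasDerivAt y ((hasDerivAt_const y x).prodMk (hasDerivAt_id y))

lemma hasDerivAt_line1 {F : ℝ × ℝ → ℝ} {x y : ℝ} (h : DifferentiableAt ℝ F (x, y)) :
    HasDerivAt (fun x => F (x, y)) (d1 F (x, y)) x :=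
  h.hasFDerivAt.comp_hasDerivAt x ((hasDerivAt_id x).prodMk (hasDerivAt_const x y))

lemma Lip.slice2 {F : ℝ × ℝ → ℝ} (hF : Lip F) (x : ℝ) : ∃ C : ℝ≥0, LipschitzWith C (fun y => F (x, y)) := by
  obtain ⟨C, hC⟩ := hF
  exact ⟨C, LipschitzWith.of_dist_le_mul fun p q => by simpa [Prod.dist_eq] using hC.dist_le_mul (x, p) (x, q)⟩

lemma lip_ftc {g : ℝ → ℝ} {C : ℝ≥0} (hg : LipschitzWith C g) {g' : ℝ → ℝ} (h : ∀ᵐ y, HasDerivAt g (g' y) y)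
    (y0 y1 : ℝ) : ∫ y in y0..y1, g' y = g y1 - g y0 := by
  rw [← (hg.lipschitzOnWith.absolutelyContinuousOnInterval (a := y0) (b := y1)).integral_deriv_eq_sub]
  apply intervalIntegral.integral_congr_ae
  filter_upwards [h] with y hy _ using hy.deriv.symm

lemma lip_ftc_int {g : ℝ → ℝ} {C : ℝ≥0} (hg : LipschitzWith C g) {g' : ℝ → ℝ} (h : ∀ᵐ y, HasDerivAt g (g' y) y)
    (y0 y1 : ℝ) : IntervalIntegrable g' volume y0 y1 := by
  refine ((hg.lipschitzOnWith.absolutelyContinuousOnInterval (a := y0) (b := y1)).intervalIntegrable_deriv).congr_ae ?_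
  apply ae_restrict_of_ae
  filter_upwards [h] with y hy using hy.deriv

/-- gradient vanishes on preimages of null sets: compact case -/
lemma null_compact {H : ℝ × ℝ → ℝ} (hH : Lip H) {K : Set ℝ} (hK : IsCompact K) (h0 : volume K = 0) :
    ∀ᵐ p, H p ∈ K → d1 H p = 0 ∧ d2 H p = 0 := by
  by_cases hne : K.Nonempty
  swap
  · rw [not_nonempty_iff_eq_empty.1 hne]; simp
  let ω : ℕ → ℝ → ℝ := fun k s => max 0 (1 - k * Metric.infDist s K)
  have ωc : ∀ k, Continuous (ω k) := fun k => by
    have := Metric.continuous_infDist_pt K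
    fun_prop
  have ω0 : ∀ k s, 0 ≤ ω k s := fun k s => le_max_left _ _
  have ω1 : ∀ k s, ω k s ≤ 1 := fun k s => max_le zero_le_one (by
    have : 0 ≤ (k:ℝ) * Metric.infDist s K := mul_nonneg (by positivity) Metric.infDist_nonneg
    linarith)
  have ωl : ∀ s, Tendsto (fun k => ω k s) atTop (𝓝 (K.indicator (fun _ => 1) s)) := by
    intro s
    by_cases hs : s ∈ K
    · simp [ω, hs, Metric.infDist_zero_of_mem hs]
    · have hpos : 0 < Metric.infDist s K := (hK.isClosed.notMem_iff_infDist_pos hne).1 hs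
      rw [indicator_of_notMem hs]
      refine tendsto_const_nhds.congr' ?_
      obtain ⟨N, hN⟩ := exists_nat_gt (1 / Metric.infDist s K)
      filter_upwards [eventually_ge_atTop N] with k hk
      symm
      apply max_eq_left
      rw [div_lt_iff₀ hpos] at hN
      have : (N:ℝ) * Metric.infDist s K ≤ k * Metric.infDist s K := by gcongr
      linarith
  let ψ : ℕ → ℝ → ℝ := fun k s => ∫ t in (0:ℝ)..s, ω k t
  have ψd : ∀ k s, HasDerivAt (ψ k) (ω k s) s := fun k s =>
    intervalIntegral.integral_hasDerivAt_right ((ωc k).intervalIntegrable _ _)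
      (ωc k).stronglyMeasurable.stronglyMeasurableAtFilter (ωc k).continuousAt
  have ψl : ∀ k, LipschitzWith 1 (ψ k) := fun k => by
    refine lipschitzWith_of_nnnorm_deriv_le (fun s => (ψd k s).differentiableAt) fun s => ?_
    rw [(ψd k s).deriv, ← NNReal.coe_le_coe, coe_nnnorm, Real.norm_of_nonneg (ω0 k s)]
    exact ω1 k s
  have ψ0 : ∀ s, Tendsto (fun k => ψ k s) atTop (𝓝 0) := by
    intro s
    have e : (0:ℝ) = ∫ t in (0:ℝ)..s, K.indicator (fun _ => (1:ℝ)) t := by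
      symm
      apply intervalIntegral.integral_zero_ae
      have : ∀ᵐ t, t ∉ K := by rw [ae_iff]; simpa using h0
      filter_upwards [this] with t ht _
      simp [ht]
    rw [e]
    refine intervalIntegral.tendsto_integral_filter_of_dominated_convergence (fun _ => 1) ?_ ?_ ?_ ?_
    · exact Eventually.of_forall fun k => (ωc k).aestronglyMeasurable
    · refine Eventually.of_forall fun k => Eventually.of_forall fun t _ => ?_
      rw [Real.norm_of_nonneg (ω0 k t)]; exact ω1 k t
    · simp
    · exact Eventually.of_forall fun t _ => ωl t
  have hψ0 : ∀ k, ψ k 0 = 0 := fun k => by simp [ψ]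
  have gen : ∀ (d : (ℝ × ℝ → ℝ) → ℝ × ℝ → ℝ), BM (d H) →
      (∀ φ, ContDiff ℝ (⊤ : ℕ∞) φ → ContDiff ℝ (⊤ : ℕ∞) (d φ)) →
      (∀ φ, HasCompactSupport φ → HasCompactSupport (d φ)) →
      (∀ Q g : ℝ × ℝ → ℝ, Lip Q → Lip g → HasCompactSupport g → ∫ p, d Q p * g p = - ∫ p, Q p * d g p) →
      (∀ k, ∀ᵐ p, d (fun p => ψ k (H p)) p = ω k (H p) * d H p) →
      ∀ᵐ p, (K.indicator (fun _ => 1) (H p)) * d H p = 0 := by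
    intro d hb hs hcc hp hch
    have mI : BM (fun p => K.indicator (fun _ => 1) (H p)) :=
      ⟨(measurable_const.indicator hK.measurableSet).comp hH.meas, 1, fun p => by
        by_cases h : H p ∈ K <;> simp [h]⟩
    have hbb := mI.mul hb
    refine ae_eq_zero_of_integral_contDiff_smul_eq_zero ?_ ?_
    · obtain ⟨M, hM⟩ := hbb.bdd
      exact (locInt hbb.meas.aestronglyMeasurable hM)
    · intro φ h1 h2
      have hT : Tst univ φ := Tst.of_smooth h1 h2 (subset_univ _)
      obtain ⟨M, hM⟩ := hb.bdd
      obtain ⟨D, hD⟩ := h2.exists_bound_of_continuous h1.continuous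
      have hM0 := (abs_nonneg _).trans (hM 0)
      have e1 : Tendsto (fun k => ∫ p, (ω k (H p) * d H p) * φ p) atTop
          (𝓝 (∫ p, (K.indicator (fun _ => 1) (H p) * d H p) * φ p)) := by
        refine tendsto_int (C := (1 * M) * D) (K := tsupport φ) (fun n => ?_) ?_ h2.isCompact ?_ ?_
        · exact ((((ωc n).measurable.comp hH.meas).mul hb.meas).mul h1.continuous.measurable).aestronglyMeasurable
        · intro n x
          rw [norm_mul, norm_mul, Real.norm_of_nonneg (ω0 _ _)]
          have := hM x
          have := hD x
          have := ω1 n (H x)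
          have := ω0 n (H x)
          gcongr
          exact hM x
        · intro n x hx
          rw [image_eq_zero_of_notMem_tsupport hx]; simp
        · exact Eventually.of_forall fun x => ((ωl _).mul_const _).mul_const _
      have e2 : ∀ k, ∫ p, (ω k (H p) * d H p) * φ p = - ∫ p, ψ k (H p) * d φ p := by
        intro k
        rw [← hp _ φ (hH.comp1 (ψl k)) hT.lip h2]
        apply integral_congr_ae
        filter_upwards [hch k] with p hp
        rw [hp]
      simp_rw [e2] at e1
      have hdc := hs φ h1
      have hdk := hcc φ h2
      obtain ⟨D', hD'⟩ := hdk.exists_bound_of_continuous hdc.continuous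
      obtain ⟨A, hA⟩ := hdk.isCompact.exists_bound_of_continuousOn hH.cont.continuousOn
      have e3 : Tendsto (fun k => ∫ p, ψ k (H p) * d φ p) atTop (𝓝 (∫ p : ℝ × ℝ, 0)) := by
        refine tendsto_int (C := |A| * D') (K := tsupport (d φ)) (fun n => ?_) ?_ hdk.isCompact ?_ ?_
        · exact (((ψl n).continuous.comp hH.cont).mul hdc.continuous).aestronglyMeasurable
        · intro n x
          have b2 := hD' x
          by_cases hx : x ∈ tsupport (d φ)
          · have b1 : |ψ n (H x)| ≤ |A| := by
              have := (ψl n).dist_le_mul (H x) 0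
              simp [hψ0] at this
              exact this.trans ((hA x hx).trans (le_abs_self A))
            rw [norm_mul]
            exact mul_le_mul b1 b2 (norm_nonneg _) (abs_nonneg _)
          · rw [image_eq_zero_of_notMem_tsupport hx]
            have := (norm_nonneg _).trans b2
            simp only [mul_zero, norm_zero]
            positivity
        · intro n x hx
          rw [image_eq_zero_of_notMem_tsupport hx]; simp
        · refine Eventually.of_forall fun x => ?_
          simpa using (ψ0 (H x)).mul_const (d φ x)
      have := tendsto_nhds_unique e1 e3.neg
      simp only [integral_zero, neg_zero] at this
      simp only [smul_eq_mul]
      simp_rw [mul_comm (φ _)]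
      exact this
  have chain : ∀ k p v, DifferentiableAt ℝ H p → fderiv ℝ (fun p => ψ k (H p)) p v = ω k (H p) * fderiv ℝ H p v := by
    intro k p v hp
    have := (ψd k (H p)).comp_hasFDerivAt p hp.hasFDerivAt
    rw [HasFDerivAt.fderiv (f := fun p => ψ k (H p)) this]
    simp
  have f1 := gen d1 hH.bm_d1 (fun φ h => smooth_d1 h) (fun φ h => cpt_d1 h)
    (fun Q g hQ hg hc => parts1 hQ hg hc) (fun k => by
      filter_upwards [hH.ae_diff] with p hp using chain k p _ hp)
  have f2 := gen d2 hH.bm_d2 (fun φ h => smooth_d2 h) (fun φ h => cpt_d2 h)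
    (fun Q g hQ hg hc => parts2 hQ hg hc) (fun k => by
      filter_upwards [hH.ae_diff] with p hp using chain k p _ hp)
  filter_upwards [f1, f2] with p a1 a2 hp
  simp [hp] at a1 a2
  exact ⟨a1, a2⟩

lemma ae_of_balls {P : ℝ × ℝ → Prop} (h : ∀ n : ℕ, ∀ᵐ p, p ∈ Metric.ball (0 : ℝ × ℝ) n → P p) :
    ∀ᵐ p, P p := by
  filter_upwards [ae_all_iff.2 h] with p hp
  obtain ⟨n, hn⟩ := exists_nat_gt (dist p 0)
  exact hp n hn

/-- gradient vanishes on preimages of null sets -/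
lemma null_set {H : ℝ × ℝ → ℝ} (hH : Lip H) {N : Set ℝ} (hN : MeasurableSet N) (h0 : volume N = 0) :
    ∀ᵐ p, H p ∈ N → d1 H p = 0 ∧ d2 H p = 0 := by
  apply ae_of_balls
  intro n
  let S : Set (ℝ × ℝ) := Metric.ball 0 n ∩ {p | ¬ (d1 H p = 0 ∧ d2 H p = 0)}
  have hS : MeasurableSet S := measurableSet_ball.inter (by
    apply MeasurableSet.compl
    exact (measurableSet_eq_fun (measurable_d1 H) measurable_const).inter
      (measurableSet_eq_fun (measurable_d2 H) measurable_const))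
  have hfin : volume S < ∞ := (measure_mono inter_subset_left).trans_lt Metric.isBounded_ball.measure_lt_top
  have : IsFiniteMeasure (volume.restrict S) := ⟨by simpa using hfin⟩
  let ν := (volume.restrict S).map H
  have : IsFiniteMeasure ν := Measure.isFiniteMeasure_map _ _
  have hν : ν N = 0 := by
    rw [hN.measure_eq_iSup_isCompact]
    simp only [ENNReal.iSup_eq_zero]
    intro K hKN hK
    have := null_compact hH hK (measure_mono_null hKN h0)
    rw [Measure.map_apply hH.meas hK.measurableSet, Measure.restrict_apply' hS]
    refine measure_mono_null ?_ (ae_iff.1 this)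
    rintro p ⟨h1, h2⟩
    simp only [mem_ofPred_eq, Classical.not_imp]
    exact ⟨h1, h2.2⟩
  rw [Measure.map_apply hH.meas hN, Measure.restrict_apply' hS] at hν
  rw [ae_iff]
  refine measure_mono_null ?_ hν
  intro p hp
  simp only [mem_ofPred_eq, Classical.not_imp] at hp
  exact ⟨hp.2.1, hp.1, hp.2.2⟩

lemma comp_fderiv {ψ : ℝ → ℝ} (hψ : Differentiable ℝ ψ) {H : ℝ × ℝ → ℝ} {p : ℝ × ℝ} (hp : DifferentiableAt ℝ H p)
    (v : ℝ × ℝ) : fderiv ℝ (fun p => ψ (H p)) p v = deriv ψ (H p) * fderiv ℝ H p v := by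
  have := (hψ (H p)).hasDerivAt.comp_hasFDerivAt p hp.hasFDerivAt
  rw [HasFDerivAt.fderiv (f := fun p => ψ (H p)) this]
  simp

/-- the trapezoid cut-off -/
def trap (y0 y1 η y : ℝ) : ℝ := min 1 (max 0 (min ((y - y0) / η) ((y1 - y) / η)))

lemma trap_lip (y0 y1 : ℝ) {η : ℝ} (hη : 0 < η) : ∃ C : ℝ≥0, LipschitzWith C (trap y0 y1 η) := by
  have a1 : LipschitzWith (Real.toNNReal (1 / η)) (fun y => (y - y0) / η) :=
    LipschitzWith.of_dist_le_mul fun p q => by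
      rw [Real.dist_eq, Real.dist_eq, ← sub_div, abs_div, abs_of_pos hη]
      rw [Real.coe_toNNReal _ (by positivity)]
      rw [show p - y0 - (q - y0) = p - q by ring]
      apply le_of_eq; ring
  have a2 : LipschitzWith (Real.toNNReal (1 / η)) (fun y => (y1 - y) / η) :=
    LipschitzWith.of_dist_le_mul fun p q => by
      rw [Real.dist_eq, Real.dist_eq, ← sub_div, abs_div, abs_of_pos hη]
      rw [Real.coe_toNNReal _ (by positivity)]
      rw [show y1 - p - (y1 - q) = -(p - q) by ring, abs_neg]
      apply le_of_eq; ring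
  exact ⟨_, ((a1.min a2).const_max 0).const_min 1⟩

lemma trap_zero {y0 y1 η y : ℝ} (hη : 0 < η) (hy : y ∉ Icc y0 y1) : trap y0 y1 η y = 0 := by
  unfold trap
  have : min ((y - y0) / η) ((y1 - y) / η) ≤ 0 := by
    by_cases h : y0 ≤ y
    · refine (min_le_right _ _).trans (div_nonpos_of_nonpos_of_nonneg ?_ hη.le)
      have : ¬ y ≤ y1 := fun h' => hy ⟨h, h'⟩
      linarith
    · refine (min_le_left _ _).trans (div_nonpos_of_nonpos_of_nonneg ?_ hη.le)
      linarith
  rw [max_eq_left this]; simp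

lemma trap_one {y0 y1 η y : ℝ} (hη : 0 < η) (h1 : y0 + η ≤ y) (h2 : y ≤ y1 - η) : trap y0 y1 η y = 1 := by
  unfold trap
  have : 1 ≤ min ((y - y0) / η) ((y1 - y) / η) := by
    apply le_min
    · rw [le_div_iff₀ hη]; linarith
    · rw [le_div_iff₀ hη]; linarith
  rw [max_eq_right (by linarith), min_eq_left this]

lemma lip_of_smooth_cpt {χ : ℝ → ℝ} (h : ContDiff ℝ (⊤ : ℕ∞) χ) (hc : HasCompactSupport χ) :
    ∃ C : ℝ≥0, LipschitzWith C χ :=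
  ContDiff.lipschitzWith_of_hasCompactSupport hc h (by simp)

/-- product test functions -/
lemma tst_prod {χ ω : ℝ → ℝ} {C D : ℝ≥0} (hχ : LipschitzWith C χ) (hω : LipschitzWith D ω)
    {K K' : Set ℝ} (hK : IsCompact K) (hK' : IsCompact K') (h0 : ∀ x, x ∉ K → χ x = 0)
    (h0' : ∀ x, x ∉ K' → ω x = 0) {U : Set (ℝ × ℝ)} (hU : K ×ˢ K' ⊆ U) :
    Tst U (fun p => χ p.1 * ω p.2) := by
  have b1 : ∃ M, ∀ p : ℝ × ℝ, |χ p.1| ≤ M := by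
    obtain ⟨M, hM⟩ := hK.exists_bound_of_continuousOn hχ.continuous.continuousOn
    refine ⟨|M|, fun p => ?_⟩
    by_cases h : p.1 ∈ K
    · exact (hM _ h).trans (le_abs_self _)
    · simp [h0 _ h]
  have b2 : ∃ M, ∀ p : ℝ × ℝ, |ω p.2| ≤ M := by
    obtain ⟨M, hM⟩ := hK'.exists_bound_of_continuousOn hω.continuous.continuousOn
    refine ⟨|M|, fun p => ?_⟩
    by_cases h : p.2 ∈ K'
    · exact (hM _ h).trans (le_abs_self _)
    · simp [h0' _ h]
  obtain ⟨M, hM⟩ := b1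
  obtain ⟨M', hM'⟩ := b2
  refine Tst.of_closed (K := K ×ˢ K') ?_ (hK.prod hK') ?_ hU
  · exact (Lip.comp1 hχ Lip.fst).mul (Lip.comp1 hω Lip.snd) hM hM'
  · intro p hp
    by_cases h : p.1 ∈ K
    · have : p.2 ∉ K' := fun h' => hp ⟨h, h'⟩
      rw [h0' _ this, mul_zero]
    · rw [h0 _ h, zero_mul]

lemma const_line {H F f : ℝ × ℝ → ℝ} (hH : Lip H) (hF : Lip F) {U : Set (ℝ × ℝ)}
    (hf : ∀ᵐ p, p ∈ U → d1 F p = f p * d1 H p ∧ d2 F p = f p * d2 H p)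
    {a b y0 y1 α β α' β' : ℝ} (hy : y0 ≤ y1) (hU : Ioo a b ×ˢ Icc y0 y1 ⊆ U)
    (hαβ : ∀ x ∈ Ioo a b, H (x, y0) ≤ α ∧ β ≤ H (x, y1)) (hα : α < α') (hβ : β' < β)
    {ψ : ℝ → ℝ} (hψ : ContDiff ℝ 1 ψ) {D : ℝ≥0} (hψl : LipschitzWith D ψ)
    (hψ0 : ∀ s, s ∉ Icc α' β' → deriv ψ s = 0) :
    ∃ c, ∀ᵐ x, x ∈ Ioo a b → ∫ y in y0..y1, F (x, y) * (deriv ψ (H (x, y)) * d2 H (x, y)) = c := by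
  have hψd : Differentiable ℝ ψ := hψ.differentiable (by simp)
  have hψc : Continuous (deriv ψ) := hψ.continuous_deriv (by simp)
  let g : ℝ × ℝ → ℝ := fun p => F p * (deriv ψ (H p) * d2 H p)
  have gm : Measurable g := hF.meas.mul ((hψc.measurable.comp hH.meas).mul (measurable_d2 H))
  let S : Set (ℝ × ℝ) := Icc a b ×ˢ Ioc y0 y1
  have hS : MeasurableSet S := measurableSet_Icc.prod measurableSet_Ioc
  let Φ := S.indicator g
  have hΦi : Integrable Φ := by
    obtain ⟨A, hA⟩ := (isCompact_Icc.prod isCompact_Icc : IsCompact (Icc a b ×ˢ Icc y0 y1)).exists_bound_of_continuousOn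
      (f := fun p => F p) hF.cont.continuousOn
    obtain ⟨A', hA'⟩ := hH.bm_d2.bdd
    refine int_bdd (C := |A| * (D * |A'|)) (gm.indicator hS).aestronglyMeasurable ?_ (isCompact_Icc.prod isCompact_Icc : IsCompact (Icc a b ×ˢ Icc y0 y1)) ?_
    · intro p
      by_cases hp : p ∈ S
      · rw [show Φ p = g p from indicator_of_mem hp _, norm_mul, norm_mul]
        have h1 := (hA p ⟨hp.1, Ioc_subset_Icc_self hp.2⟩).trans (le_abs_self A)
        have h2 : ‖d2 H p‖ ≤ |A'| := (hA' p).trans (le_abs_self A')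
        have h3 : ‖deriv ψ (H p)‖ ≤ D := norm_deriv_le_of_lipschitz hψl
        gcongr
      · rw [show Φ p = 0 from indicator_of_notMem hp _, norm_zero]; positivity
    · intro p hp
      apply indicator_of_notMem
      exact fun h => hp ⟨h.1, Ioc_subset_Icc_self h.2⟩
  have hwe : ∀ x ∈ Ioo a b, ∫ y, Φ (x, y) = ∫ y in y0..y1, F (x, y) * (deriv ψ (H (x, y)) * d2 H (x, y)) := by
    intro x hx
    rw [intervalIntegral.integral_of_le hy, ← integral_indicator measurableSet_Ioc]
    congr 1; ext y
    by_cases h : y ∈ Ioc y0 y1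
    · have : (x, y) ∈ S := ⟨Ioo_subset_Icc_self hx, h⟩
      simp only [Φ]
      rw [indicator_of_mem h, indicator_of_mem this]
    · have : (x, y) ∉ S := fun h' => h h'.2
      simp only [Φ]
      rw [indicator_of_notMem h, indicator_of_notMem this]
  have hΦi' : Integrable Φ ((volume : Measure ℝ).prod volume) := by rwa [← Measure.volume_eq_prod]
  have hwi : Integrable (fun x => ∫ y, Φ (x, y)) := hΦi'.integral_prod_left
  obtain ⟨c, hc⟩ := dbr (a := a) (b := b) hwi.locallyIntegrable (by
    intro χ c1 c2 c3
    obtain ⟨Cχ, hCχ⟩ := lip_of_smooth_cpt c1 c2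
    have e1 : ∫ x, deriv χ x * ∫ y, Φ (x, y) = ∫ p : ℝ × ℝ, deriv χ p.1 * Φ p := by
      rw [Measure.volume_eq_prod, integral_prod]
      · simp_rw [integral_const_mul]
      · have : Continuous (fun p : ℝ × ℝ => deriv χ p.1) := by
          have := c1.continuous_deriv (by simp)
          fun_prop
        refine hΦi'.bdd_mul (c := Cχ) this.aestronglyMeasurable ?_
        exact Eventually.of_forall fun p => norm_deriv_le_of_lipschitz hCχ
    rw [e1]
    obtain ⟨C, hC⟩ := hH
    have hH : Lip H := ⟨C, hC⟩
    set m := min (α' - α) (β - β') with hm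
    have hm0 : 0 < m := lt_min (by linarith) (by linarith)
    set η := m / (C + 1) with hη
    have hη0 : 0 < η := by positivity
    obtain ⟨Ct, hCt⟩ := trap_lip y0 y1 hη0
    have hT : Tst U (fun p => χ p.1 * trap y0 y1 η p.2) :=
      tst_prod hCχ hCt c2.isCompact isCompact_Icc (fun x hx => image_eq_zero_of_notMem_tsupport hx)
        (fun x hx => trap_zero hη0 hx) ((prod_mono c3 le_rfl).trans hU)
    set φ : ℝ × ℝ → ℝ := fun p => χ p.1 * trap y0 y1 η p.2 with hφ
    have hg : Lip (fun p => ψ (H p)) := hH.comp1 hψl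
    have hE : Tst U (fun p => F p * φ p) := hT.mul hF
    have e2 := NL' hg hE.lip hE.cpt
    rw [← e2]
    apply integral_congr_ae
    filter_upwards [hf, hH.ae_diff, hF.ae_diff, hT.lip.ae_diff] with p p1 p2 p3 p4
    rw [br_mul p3 p4]
    have q0 : br (fun p => ψ (H p)) F p * φ p = 0 := by
      by_cases hp : p ∈ U
      · have := p1 hp
        unfold br
        rw [this.1, this.2]
        unfold d1 d2
        rw [comp_fderiv hψd p2, comp_fderiv hψd p2]
        ring
      · rw [hT.zero hp, mul_zero]
    have q1 : deriv χ p.1 * Φ p = F p * br (fun p => ψ (H p)) φ p := by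
      unfold br
      rw [show d1 (fun p => ψ (H p)) p = deriv ψ (H p) * d1 H p from comp_fderiv hψd p2 _,
        show d2 (fun p => ψ (H p)) p = deriv ψ (H p) * d2 H p from comp_fderiv hψd p2 _]
      by_cases hz : deriv ψ (H p) = 0
      · have : Φ p = 0 := by
          by_cases hpS : p ∈ S
          · simp only [Φ]; rw [indicator_of_mem hpS]; simp [g, hz]
          · exact indicator_of_notMem hpS _
        rw [this, hz]; ring
      have hmem : H p ∈ Icc α' β' := by
        by_contra h; exact hz (hψ0 _ h)
      by_cases hx : p.1 ∈ tsupport χ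
      swap
      · have hnt : p ∉ tsupport φ := by
          have : tsupport φ ⊆ Prod.fst ⁻¹' (tsupport χ) := by
            refine closure_minimal ?_ ((isClosed_tsupport χ).preimage continuous_fst)
            intro q hq
            apply subset_tsupport
            intro h0
            exact hq (by simp [φ, h0])
          exact fun h => hx (this h)
        rw [d1_zero hnt, d2_zero hnt]
        have : deriv χ p.1 = 0 := by
          have := image_eq_zero_of_notMem_tsupport (f := deriv χ) (fun h => hx (tsupport_deriv_subset h))
          exact this
        rw [this]; ring
      by_cases hyy : p.2 ∈ Icc y0 y1
      swap
      · have hnt : p ∉ tsupport φ := by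
          have : tsupport φ ⊆ Prod.snd ⁻¹' (Icc y0 y1) := by
            refine closure_minimal ?_ (isClosed_Icc.preimage continuous_snd)
            intro q hq
            by_contra h0
            exact hq (by simp [φ, trap_zero hη0 h0])
          exact fun h => hyy (this h)
        rw [d1_zero hnt, d2_zero hnt]
        have : Φ p = 0 := indicator_of_notMem (fun h => hyy (Ioc_subset_Icc_self h.2)) _
        rw [this]; ring
      have hxI := c3 hx
      have hab := hαβ _ hxI
      have l1 : |H p - H (p.1, y0)| ≤ C * (p.2 - y0) := by
        have := hC.dist_le_mul p (p.1, y0)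
        rw [Prod.dist_eq, dist_self, Real.dist_eq, Real.dist_eq, max_eq_right (abs_nonneg _),
          abs_of_nonneg (sub_nonneg.2 hyy.1)] at this
        exact this
      have l2 : |H p - H (p.1, y1)| ≤ C * (y1 - p.2) := by
        have := hC.dist_le_mul p (p.1, y1)
        rw [Prod.dist_eq, dist_self, Real.dist_eq, Real.dist_eq, max_eq_right (abs_nonneg _),
          abs_sub_comm p.2, abs_of_nonneg (sub_nonneg.2 hyy.2)] at this
        exact this
      rw [abs_le] at l1 l2
      have hC0 : (0:ℝ) ≤ C := C.2
      have hηm : (C + 1) * η = m := by rw [hη]; field_simp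
      have m1 : m ≤ α' - α := min_le_left _ _
      have m2 : m ≤ β - β' := min_le_right _ _
      have k1 : y0 + η < p.2 := by
        have h1 := l1.2
        have : m ≤ C * (p.2 - y0) := by linarith [hmem.1, hab.1]
        by_contra hcon
        have h2 : p.2 - y0 ≤ η := by linarith
        have h3 : (C:ℝ) * (p.2 - y0) ≤ C * η := by gcongr
        nlinarith
      have k2 : p.2 < y1 - η := by
        have h1 := l2.1
        have : m ≤ C * (y1 - p.2) := by linarith [hmem.2, hab.2]
        by_contra hcon
        have h2 : y1 - p.2 ≤ η := by linarith
        have h3 : (C:ℝ) * (y1 - p.2) ≤ C * η := by gcongr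
        nlinarith
      have hev : φ =ᶠ[𝓝 p] fun q => χ q.1 := by
        have o1 : {q : ℝ × ℝ | y0 + η < q.2} ∈ 𝓝 p := (isOpen_lt (by fun_prop) (by fun_prop)).mem_nhds k1
        have o2 : {q : ℝ × ℝ | q.2 < y1 - η} ∈ 𝓝 p := (isOpen_lt (by fun_prop) (by fun_prop)).mem_nhds k2
        filter_upwards [o1, o2] with q h1 h2
        simp only [φ]
        rw [trap_one hη0 (le_of_lt h1) (le_of_lt h2), mul_one]
      have hχd : Differentiable ℝ χ := c1.differentiable (by simp)
      have hd : ∀ v, fderiv ℝ φ p v = deriv χ p.1 * v.1 := by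
        intro v
        rw [hev.fderiv_eq, comp_fderiv (H := fun q => q.1) hχd differentiableAt_fst, fderiv_fst]
        simp
      have : Φ p = F p * (deriv ψ (H p) * d2 H p) := by
        simp only [Φ]
        rw [indicator_of_mem]
        exact ⟨Ioo_subset_Icc_self hxI, by linarith, by linarith⟩
      rw [this]
      simp only [d1, d2, hd]
      ring
    rw [q1]
    linarith)
  refine ⟨c, ?_⟩
  filter_upwards [hc] with x hx hxI
  rw [← hwe x hxI, hx hxI]

def qq (H F : ℝ × ℝ → ℝ) (y0 y1 h x : ℝ) : ℝ :=
  F (x, y1) - ∫ y in y0..y1, (if h < H (x, y) then d2 F (x, y) else 0)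

/-- smooth steps -/
def stp (h δ s : ℝ) : ℝ := Real.smoothTransition ((s - h) / δ)

lemma stp_contDiff (h δ : ℝ) : ContDiff ℝ (⊤ : ℕ∞) (stp h δ) :=
  Real.smoothTransition.contDiff.comp ((contDiff_id.sub contDiff_const).div_const _)

lemma stp_zero {h δ s : ℝ} (hδ : 0 < δ) (hs : s ≤ h) : stp h δ s = 0 :=
  Real.smoothTransition.zero_of_nonpos (div_nonpos_of_nonpos_of_nonneg (by linarith) hδ.le)

lemma stp_one {h δ s : ℝ} (hδ : 0 < δ) (hs : h + δ ≤ s) : stp h δ s = 1 :=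
  Real.smoothTransition.one_of_one_le (by rw [le_div_iff₀ hδ]; linarith)

lemma stp_nonneg (h δ s : ℝ) : 0 ≤ stp h δ s := Real.smoothTransition.nonneg _
lemma stp_le_one (h δ s : ℝ) : stp h δ s ≤ 1 := Real.smoothTransition.le_one _

lemma stp_deriv {h δ s : ℝ} (hδ : 0 < δ) (hs : s ∉ Icc h (h + δ)) : deriv (stp h δ) s = 0 := by
  by_cases h1 : s < h
  · have : stp h δ =ᶠ[𝓝 s] fun _ => 0 := by
      filter_upwards [Iio_mem_nhds h1] with t ht using stp_zero hδ (le_of_lt ht)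
    rw [this.deriv_eq]; simp
  · have h2 : h + δ < s := by
      by_contra h2; exact hs ⟨not_lt.1 h1, not_lt.1 h2⟩
    have : stp h δ =ᶠ[𝓝 s] fun _ => 1 := by
      filter_upwards [Ioi_mem_nhds h2] with t ht using stp_one hδ (le_of_lt ht)
    rw [this.deriv_eq]; simp

lemma stp_lip {h δ : ℝ} (hδ : 0 < δ) : ∃ D : ℝ≥0, LipschitzWith D (stp h δ) := by
  have hc : Continuous (deriv (stp h δ)) := (stp_contDiff h δ).continuous_deriv (by simp)
  obtain ⟨M, hM⟩ := (isCompact_Icc : IsCompact (Icc h (h + δ))).exists_bound_of_continuousOn hc.continuousOn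
  refine ⟨Real.toNNReal |M|, lipschitzWith_of_nnnorm_deriv_le ((stp_contDiff h δ).differentiable (by simp)) fun s => ?_⟩
  rw [← NNReal.coe_le_coe, coe_nnnorm, Real.coe_toNNReal _ (abs_nonneg _)]
  by_cases hs : s ∈ Icc h (h + δ)
  · exact (hM s hs).trans (le_abs_self _)
  · rw [stp_deriv hδ hs]; simp

lemma stp_tendsto (h s : ℝ) : Tendsto (fun n : ℕ => stp h (1 / ((n:ℝ) + 1)) s) atTop (𝓝 (if h < s then 1 else 0)) := by
  by_cases hs : h < s
  · simp only [hs, if_true]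
    refine tendsto_const_nhds.congr' ?_
    have := tendsto_one_div_add_atTop_nhds_zero_nat (𝕜 := ℝ)
    filter_upwards [this.eventually (Iio_mem_nhds (sub_pos.2 hs))] with n hn
    rw [stp_one (by positivity)]
    have hn : 1 / ((n:ℝ) + 1) < _ := hn
    linarith
  · simp only [hs, if_false]
    refine tendsto_const_nhds.congr fun n => ?_
    rw [stp_zero (by positivity) (not_lt.1 hs)]

section
variable {H F : ℝ × ℝ → ℝ} {y0 y1 x : ℝ}

lemma meas_line_if (hH : Lip H) (hF : Lip F) (h : ℝ) : Measurable (fun y => if h < H (x, y) then d2 F (x, y) else 0) := by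
  have : Measurable (fun y : ℝ => (x, y)) := by fun_prop
  refine Measurable.ite ?_ ((measurable_d2 F).comp this) measurable_const
  exact measurableSet_lt measurable_const (hH.meas.comp this)

lemma qq_step (hH : Lip H) (hF : Lip F) (hx : ∀ᵐ y, DifferentiableAt ℝ H (x, y)) (hx' : ∀ᵐ y, DifferentiableAt ℝ F (x, y))
    {h δ : ℝ} (hδ : 0 < δ) (h0 : H (x, y0) ≤ h) (h1 : h + δ ≤ H (x, y1)) :
    ∫ y in y0..y1, F (x, y) * (deriv (stp h δ) (H (x, y)) * d2 H (x, y)) =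
      F (x, y1) - ∫ y in y0..y1, stp h δ (H (x, y)) * d2 F (x, y) := by
  obtain ⟨C, hC⟩ := hH.slice2 x
  obtain ⟨C', hC'⟩ := hF.slice2 x
  obtain ⟨D, hD⟩ := stp_lip (h := h) hδ
  have a1 := (hC'.lipschitzOnWith (s := uIcc y0 y1)).absolutelyContinuousOnInterval
  have a2 := ((hD.comp hC).lipschitzOnWith (s := uIcc y0 y1)).absolutelyContinuousOnInterval
  have e := a1.integral_deriv_mul_eq_sub a2
  have e0 : stp h δ (H (x, y0)) = 0 := stp_zero hδ h0
  have e1 : stp h δ (H (x, y1)) = 1 := stp_one hδ h1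
  simp only [Function.comp, e0, e1, mul_zero, mul_one, sub_zero] at e
  have hm : Measurable (fun y : ℝ => (x, y)) := by fun_prop
  have dH : ∀ᵐ y, HasDerivAt (fun y => stp h δ (H (x, y))) (deriv (stp h δ) (H (x, y)) * d2 H (x, y)) y := by
    filter_upwards [hx] with y hy
    exact HasDerivAt.comp (h₂ := stp h δ) (h := fun y => H (x, y)) y (((stp_contDiff h δ).differentiable (by simp)) (H (x, y))).hasDerivAt (hasDerivAt_line2 hy)
  have i1 : IntervalIntegrable (fun y => F (x, y) * (deriv (stp h δ) (H (x, y)) * d2 H (x, y))) volume y0 y1 :=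
    (lip_ftc_int (hD.comp hC) dH y0 y1).continuousOn_mul hC'.continuous.continuousOn
  have i2 : IntervalIntegrable (fun y => stp h δ (H (x, y)) * d2 F (x, y)) volume y0 y1 :=
    (lip_ftc_int hC' (hx'.mono fun y hy => hasDerivAt_line2 hy) y0 y1).continuousOn_mul
      (hD.comp hC).continuous.continuousOn
  rw [eq_sub_iff_add_eq, ← e, ← intervalIntegral.integral_add i1 i2]
  apply intervalIntegral.integral_congr_ae
  filter_upwards [dH, hx'] with y h1 h2 _
  rw [HasDerivAt.deriv (f := stp h δ ∘ fun y => H (x, y)) h1, (hasDerivAt_line2 h2).deriv]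
  ring

lemma qq_lim (hH : Lip H) (hF : Lip F) (h : ℝ) : Tendsto (fun n : ℕ => F (x, y1) - ∫ y in y0..y1, stp h (1 / ((n:ℝ) + 1)) (H (x, y)) * d2 F (x, y))
    atTop (𝓝 (qq H F y0 y1 h x)) := by
  obtain ⟨M, hM⟩ := hF.bm_d2.bdd
  have hm : Measurable (fun y : ℝ => (x, y)) := by fun_prop
  refine Tendsto.const_sub _ ?_
  refine intervalIntegral.tendsto_integral_filter_of_dominated_convergence (fun _ => M) ?_ ?_ ?_ ?_
  · refine Eventually.of_forall fun n => ?_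
    exact (((stp_contDiff _ _).continuous.measurable.comp (hH.meas.comp hm)).mul ((measurable_d2 F).comp hm)).aestronglyMeasurable
  · refine Eventually.of_forall fun n => Eventually.of_forall fun y _ => ?_
    rw [norm_mul, Real.norm_of_nonneg (stp_nonneg _ _ _)]
    calc _ ≤ 1 * ‖d2 F (x, y)‖ := by gcongr; exact stp_le_one _ _ _
      _ ≤ M := by rw [one_mul]; exact hM _
  · simp
  · refine Eventually.of_forall fun y _ => ?_
    have := (stp_tendsto h (H (x, y))).mul_const (d2 F (x, y))
    convert this using 2
    split_ifs <;> simp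

lemma qq_right (hH : Lip H) (hF : Lip F) (h : ℝ) : Tendsto (fun h' => qq H F y0 y1 h' x) (𝓝[>] h) (𝓝 (qq H F y0 y1 h x)) := by
  obtain ⟨M, hM⟩ := hF.bm_d2.bdd
  refine Tendsto.const_sub _ ?_
  refine intervalIntegral.tendsto_integral_filter_of_dominated_convergence (fun _ => M) ?_ ?_ ?_ ?_
  · exact Eventually.of_forall fun n => (meas_line_if hH hF _).aestronglyMeasurable
  · refine Eventually.of_forall fun n => Eventually.of_forall fun y _ => ?_
    have := (abs_nonneg _).trans (hM 0)
    split_ifs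
    · exact hM _
    · simpa
  · simp
  · refine Eventually.of_forall fun y _ => ?_
    refine tendsto_const_nhds.congr' ?_
    by_cases hy : h < H (x, y)
    · filter_upwards [Ioo_mem_nhdsGT hy] with t ht
      simp [hy, ht.2]
    · filter_upwards [self_mem_nhdsWithin] with t ht
      have : ¬ t < H (x, y) := by
        have : h < t := ht
        linarith
      simp [hy, this]

lemma qq_reg (hH : Lip H) (hF : Lip F) (hy : y0 ≤ y1) : Measurable (fun h => qq H F y0 y1 h x) ∧ ∀ᵐ h, DifferentiableAt ℝ (fun h => qq H F y0 y1 h x) h := by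
  obtain ⟨M, hM⟩ := hF.bm_d2.bdd
  have hm : Measurable (fun y : ℝ => (x, y)) := by fun_prop
  let m : (ℝ → ℝ) → ℝ → ℝ := fun g h => ∫ y in y0..y1, (if h < H (x, y) then g y else 0)
  have hi : ∀ g : ℝ → ℝ, Measurable g → (∀ y, |g y| ≤ M) → ∀ h, IntervalIntegrable (fun y => if h < H (x, y) then g y else 0) volume y0 y1 := by
    intro g hg hb h
    have : Measurable (fun y => if h < H (x, y) then g y else 0) :=
      Measurable.ite (measurableSet_lt measurable_const (hH.meas.comp hm)) hg measurable_const
    refine (intervalIntegrable_const (c := M)).mono_fun this.aestronglyMeasurable ?_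
    refine Eventually.of_forall fun y => ?_
    have h0 := (abs_nonneg _).trans (hb y)
    dsimp only
    rw [Real.norm_of_nonneg h0]
    split_ifs
    · exact hb y
    · simpa
  have hmono : ∀ g : ℝ → ℝ, Measurable g → (∀ y, |g y| ≤ M) → (∀ y, 0 ≤ g y) → Monotone (fun h => - m g h) := by
    intro g hg hb h0 s t hst
    apply neg_le_neg
    refine intervalIntegral.integral_mono_on hy (hi g hg hb t) (hi g hg hb s) ?_
    intro y _
    have := h0 y
    split_ifs with a1 a2
    · exact le_rfl
    · exact absurd (hst.trans_lt a1) a2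
    · exact this
    · exact le_rfl
  let gp : ℝ → ℝ := fun y => max (d2 F (x, y)) 0
  let gn : ℝ → ℝ := fun y => max (- d2 F (x, y)) 0
  have md : Measurable (fun y => d2 F (x, y)) := (measurable_d2 F).comp hm
  have mgp : Measurable gp := md.max measurable_const
  have mgn : Measurable gn := md.neg.max measurable_const
  have hM0 := (abs_nonneg _).trans (hM 0)
  have bgp : ∀ y, |gp y| ≤ M := fun y => by
    rw [abs_of_nonneg (le_max_right _ _)]
    exact max_le ((le_abs_self _).trans (hM _)) hM0
  have bgn : ∀ y, |gn y| ≤ M := fun y => by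
    rw [abs_of_nonneg (le_max_right _ _)]
    exact max_le ((neg_le_abs _).trans (hM _)) hM0
  have Mp := hmono gp mgp bgp (fun y => le_max_right _ _)
  have Mn := hmono gn mgn bgn (fun y => le_max_right _ _)
  have e : (fun h => qq H F y0 y1 h x) = fun h => F (x, y1) + (- m gp h) - (- m gn h) := by
    ext h
    have : m gp h - m gn h = ∫ y in y0..y1, (if h < H (x, y) then d2 F (x, y) else 0) := by
      simp only [m]
      rw [← intervalIntegral.integral_sub (hi gp mgp bgp h) (hi gn mgn bgn h)]
      congr 1; ext y
      split_ifs
      · simp only [gp, gn]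
        rcases le_total 0 (d2 F (x, y)) with h | h
        · rw [max_eq_left h, max_eq_right (by linarith)]; ring
        · rw [max_eq_right h, max_eq_left (by linarith)]; ring
      · simp
    unfold qq
    rw [← this]; ring
  rw [e]
  constructor
  · exact (measurable_const.add Mp.measurable).sub Mn.measurable
  · filter_upwards [Mp.ae_differentiableAt, Mn.ae_differentiableAt] with h h1 h2
    exact (h1.const_add _).sub h2

end

lemma kappa {H F f : ℝ × ℝ → ℝ} (hH : Lip H) (hF : Lip F) {U : Set (ℝ × ℝ)}
    (hf : ∀ᵐ p, p ∈ U → d1 F p = f p * d1 H p ∧ d2 F p = f p * d2 H p)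
    {a b y0 y1 α β : ℝ} (hy : y0 ≤ y1) (hU : Ioo a b ×ˢ Icc y0 y1 ⊆ U)
    (hαβ : ∀ x ∈ Ioo a b, H (x, y0) ≤ α ∧ β ≤ H (x, y1)) :
    ∃ κ : ℝ → ℝ, Measurable κ ∧ (∀ᵐ h, DifferentiableAt ℝ κ h) ∧
      ∀ᵐ x, x ∈ Ioo a b → ∀ h ∈ Ioo α β, qq H F y0 y1 h x = κ h := by
  have h1 : ∀ (h : ℚ) (n : ℕ), ∃ c, α < h → (h:ℝ) + 1 / ((n:ℝ) + 1) < β →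
      ∀ᵐ x, x ∈ Ioo a b → ∫ y in y0..y1, F (x, y) * (deriv (stp h (1 / ((n:ℝ) + 1))) (H (x, y)) * d2 H (x, y)) = c := by
    intro h n
    by_cases hh : α < h ∧ (h:ℝ) + 1 / ((n:ℝ) + 1) < β
    · have hδ : (0:ℝ) < 1 / ((n:ℝ) + 1) := by positivity
      obtain ⟨D, hD⟩ := stp_lip (h := (h:ℝ)) hδ
      obtain ⟨c, hc⟩ := const_line hH hF hf hy hU hαβ hh.1 hh.2 ((stp_contDiff _ _).of_le (by simp)) hD
        (fun s hs => stp_deriv hδ hs)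
      exact ⟨c, fun _ _ => hc⟩
    · exact ⟨0, fun a b => absurd ⟨a, b⟩ hh⟩
  choose c hc using h1
  have h2 : ∀ᵐ x, (∀ (h : ℚ) (n : ℕ), α < h → (h:ℝ) + 1 / ((n:ℝ) + 1) < β → x ∈ Ioo a b →
      ∫ y in y0..y1, F (x, y) * (deriv (stp h (1 / ((n:ℝ) + 1))) (H (x, y)) * d2 H (x, y)) = c h n) := by
    rw [ae_all_iff]; intro h
    rw [ae_all_iff]; intro n
    by_cases hh : α < h ∧ (h:ℝ) + 1 / ((n:ℝ) + 1) < β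
    · filter_upwards [hc h n hh.1 hh.2] with x hx _ _ using hx
    · exact Eventually.of_forall fun x a b => absurd ⟨a, b⟩ hh
  -- good set
  let Good : ℝ → Prop := fun x => (∀ (h : ℚ) (n : ℕ), α < h → (h:ℝ) + 1 / ((n:ℝ) + 1) < β → x ∈ Ioo a b →
      ∫ y in y0..y1, F (x, y) * (deriv (stp h (1 / ((n:ℝ) + 1))) (H (x, y)) * d2 H (x, y)) = c h n) ∧
      (∀ᵐ y, DifferentiableAt ℝ H (x, y)) ∧ (∀ᵐ y, DifferentiableAt ℝ F (x, y))
  have hGood : ∀ᵐ x, Good x := by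
    filter_upwards [h2, hH.line2, hF.line2] with x a1 a2 a3 using ⟨a1, a2, a3⟩
  have hq : ∀ x, Good x → x ∈ Ioo a b → ∀ h : ℚ, α < h → (h:ℝ) < β →
      Tendsto (fun n => c h n) atTop (𝓝 (qq H F y0 y1 h x)) := by
    intro x hx hxI h hα hβ
    refine (qq_lim hH hF (h:ℝ)).congr' ?_
    have := tendsto_one_div_add_atTop_nhds_zero_nat (𝕜 := ℝ)
    filter_upwards [this.eventually (Iio_mem_nhds (sub_pos.2 hβ))] with n hn
    have hn : 1 / ((n:ℝ) + 1) < _ := hn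
    rw [← hx.1 h n hα (by linarith) hxI, qq_step hH hF hx.2.1 hx.2.2 (by positivity)]
    · exact (hαβ x hxI).1.trans hα.le
    · linarith [(hαβ x hxI).2]
  by_cases hex : ∃ x, Good x ∧ x ∈ Ioo a b
  swap
  · refine ⟨fun _ => 0, measurable_const, Eventually.of_forall fun h => differentiableAt_const _, ?_⟩
    filter_upwards [hGood] with x hx hxI
    exact absurd ⟨x, hx, hxI⟩ hex
  obtain ⟨x₀, hx₀, hxI₀⟩ := hex
  refine ⟨fun h => qq H F y0 y1 h x₀, (qq_reg hH hF hy).1, (qq_reg hH hF hy).2, ?_⟩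
  filter_upwards [hGood] with x hx hxI h hh
  refine tendsto_nhds_unique_of_frequently_eq (qq_right hH hF h) (qq_right hH hF h) ?_
  rw [(nhdsGT_basis h).frequently_iff]
  intro t ht
  obtain ⟨r, hr1, hr2⟩ := exists_rat_btwn (lt_min ht hh.2)
  refine ⟨r, ⟨hr1, hr2.trans_le (min_le_left _ _)⟩, ?_⟩
  have l1 : α < r := hh.1.trans hr1
  have l2 : (r:ℝ) < β := hr2.trans_le (min_le_right _ _)
  exact tendsto_nhds_unique (hq x hx hxI r l1 l2) (hq x₀ hx₀ hxI₀ r l1 l2)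

/-- strict crossing -/
lemma crossing {g : ℝ → ℝ} {d y : ℝ} (h : HasDerivAt g d y) (hd : 0 < d) :
    ∃ ε > 0, (∀ s, y - ε < s → s < y → g s < g y) ∧ (∀ s, y < s → s < y + ε → g y < g s) := by
  have h1 : deriv (fun s => g s - g y) y > 0 := by
    rw [(h.sub_const (g y)).deriv]; exact hd
  have h2 := eventually_nhdsWithin_sign_eq_of_deriv_pos h1 (by simp)
  obtain ⟨ε, hε, h3⟩ := Metric.eventually_nhds_iff.1 h2
  refine ⟨ε, hε, fun s hs1 hs2 => ?_, fun s hs1 hs2 => ?_⟩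
  · have := h3 (y := s) (by rw [Real.dist_eq, abs_lt]; constructor <;> linarith)
    rw [sign_neg (a := s - y) (by linarith), sign_eq_neg_one_iff] at this
    linarith
  · have := h3 (y := s) (by rw [Real.dist_eq, abs_lt]; constructor <;> linarith)
    rw [sign_pos (a := s - y) (by linarith), sign_eq_one_iff] at this
    linarith

def Pset (H : ℝ × ℝ → ℝ) (x y0 y1 α β : ℝ) : Set ℝ :=
  {y | y ∈ Ioo y0 y1 ∧ α < H (x, y) ∧ H (x, y) < β ∧ (∀ s ∈ Icc y0 y1, s < y → H (x, s) < H (x, y)) ∧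
    (∀ s ∈ Icc y0 y1, y < s → H (x, y) < H (x, s))}

lemma qq_pset {H F : ℝ × ℝ → ℝ} (hH : Lip H) (hF : Lip F) {x y0 y1 α β y : ℝ}
    (hx' : ∀ᵐ y, DifferentiableAt ℝ F (x, y)) (hy : y ∈ Pset H x y0 y1 α β) :
    qq H F y0 y1 (H (x, y)) x = F (x, y) := by
  obtain ⟨hI, -, -, h1, h2⟩ := hy
  obtain ⟨C', hC'⟩ := hF.slice2 x
  have hd : ∀ᵐ y, HasDerivAt (fun y => F (x, y)) (d2 F (x, y)) y := hx'.mono fun y hy => hasDerivAt_line2 hy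
  have e1 : ∫ s in y0..y, (if H (x, y) < H (x, s) then d2 F (x, s) else 0) = 0 := by
    rw [intervalIntegral.integral_congr (g := fun _ => 0)]
    · simp
    intro s hs
    rw [uIcc_of_le hI.1.le] at hs
    have : ¬ H (x, y) < H (x, s) := by
      rcases eq_or_lt_of_le hs.2 with h | h
      · simp [h]
      · exact (h1 s ⟨hs.1, hs.2.trans hI.2.le⟩ h).not_gt
    simp [this]
  have e2 : ∫ s in y..y1, (if H (x, y) < H (x, s) then d2 F (x, s) else 0) = F (x, y1) - F (x, y) := by
    rw [← lip_ftc hC' hd y y1]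
    apply intervalIntegral.integral_congr_ae
    refine Eventually.of_forall fun s hs => ?_
    rw [uIoc_of_le hI.2.le] at hs
    simp [h2 s ⟨hI.1.le.trans hs.1.le, hs.2⟩ hs.1]
  have ii : ∀ a b, IntervalIntegrable (fun s => if H (x, y) < H (x, s) then d2 F (x, s) else 0) volume a b := by
    intro a b
    refine (lip_ftc_int hC' hd a b).mono_fun (meas_line_if hH hF _).aestronglyMeasurable ?_
    refine Eventually.of_forall fun s => ?_
    dsimp only
    split_ifs <;> simp
  unfold qq
  rw [← intervalIntegral.integral_add_adjacent_intervals (ii y0 y) (ii y y1), e1, e2]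
  ring

/-- representation of `F`, `f` through a function of `H` -/
def Rep (H F f : ℝ × ℝ → ℝ) (κ : ℝ → ℝ) (p : ℝ × ℝ) : Prop :=
  F p = κ (H p) ∧ DifferentiableAt ℝ κ (H p) ∧ f p = deriv κ (H p)

lemma rep_pos {H F f : ℝ × ℝ → ℝ} (hH : Lip H) (hF : Lip F) {U : Set (ℝ × ℝ)} (hU : IsOpen U)
    (hf : ∀ᵐ p, p ∈ U → d1 F p = f p * d1 H p ∧ d2 F p = f p * d2 H p) :
    ∃ κ : ℕ → ℝ → ℝ, (∀ j, Measurable (κ j)) ∧ ∀ᵐ p, p ∈ U → 0 < d2 H p → ∃ j, Rep H F f (κ j) p := by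
  let J := ℚ × ℚ × ℚ × ℚ × ℚ × ℚ
  let Adm : J → Prop := fun ⟨a, b, y0, y1, α, β⟩ => (y0:ℝ) ≤ y1 ∧ Ioo (a:ℝ) b ×ˢ Icc (y0:ℝ) y1 ⊆ U ∧
    ∀ x ∈ Ioo (a:ℝ) b, H (x, y0) ≤ α ∧ (β:ℝ) ≤ H (x, y1)
  have h0 : ∀ R : J, ∃ κ : ℝ → ℝ, Measurable κ ∧ (∀ᵐ h, DifferentiableAt ℝ κ h) ∧
      (Adm R → ∀ᵐ x, x ∈ Ioo (R.1:ℝ) R.2.1 → ∀ h ∈ Ioo (R.2.2.2.2.1:ℝ) R.2.2.2.2.2, qq H F R.2.2.1 R.2.2.2.1 h x = κ h) := by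
    rintro ⟨a, b, y0, y1, α, β⟩
    by_cases hA : Adm ⟨a, b, y0, y1, α, β⟩
    · obtain ⟨κ, h1, h2, h3⟩ := kappa hH hF hf hA.1 hA.2.1 hA.2.2
      exact ⟨κ, h1, h2, fun _ => h3⟩
    · exact ⟨fun _ => 0, measurable_const, Eventually.of_forall fun h => differentiableAt_const _, fun h => absurd h hA⟩
  choose κ hκm hκd hκ using h0
  suffices hs : ∀ᵐ p, p ∈ U → 0 < d2 H p → ∃ R, F p = κ R (H p) ∧ DifferentiableAt ℝ (κ R) (H p) ∧
      d2 F p = deriv (κ R) (H p) * d2 H p by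
    refine ⟨fun n => κ ((Denumerable.eqv J).symm n), fun j => hκm _, ?_⟩
    filter_upwards [hs, hf] with p h1 h2 hp hd
    obtain ⟨R, hR1, hR2, hR3⟩ := h1 hp hd
    refine ⟨Denumerable.eqv J R, ?_⟩
    simp only [Equiv.symm_apply_apply]
    refine ⟨hR1, hR2, ?_⟩
    have := (h2 hp).2
    rw [hR3] at this
    exact (mul_right_cancel₀ hd.ne' this).symm
  have hms : MeasurableSet {p : ℝ × ℝ | p ∈ U → 0 < d2 H p → ∃ R, F p = κ R (H p) ∧ DifferentiableAt ℝ (κ R) (H p) ∧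
      d2 F p = deriv (κ R) (H p) * d2 H p} := by
    have e : {p : ℝ × ℝ | p ∈ U → 0 < d2 H p → ∃ R, F p = κ R (H p) ∧ DifferentiableAt ℝ (κ R) (H p) ∧
        d2 F p = deriv (κ R) (H p) * d2 H p} = Uᶜ ∪ {p | 0 < d2 H p}ᶜ ∪ ⋃ R, ({p | F p = κ R (H p)} ∩
          (H ⁻¹' {h | DifferentiableAt ℝ (κ R) h} ∩ {p | d2 F p = deriv (κ R) (H p) * d2 H p})) := by
      ext p
      simp only [mem_ofPred_eq, mem_union, mem_compl_iff, mem_iUnion, mem_inter_iff, mem_preimage]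
      tauto
    rw [e]
    refine (hU.measurableSet.compl.union (measurableSet_lt measurable_const (measurable_d2 H)).compl).union ?_
    refine MeasurableSet.iUnion fun R => ?_
    refine (measurableSet_eq_fun hF.meas ((hκm R).comp hH.meas)).inter (((measurableSet_of_differentiableAt ℝ (κ R)).preimage hH.meas).inter ?_)
    exact measurableSet_eq_fun (measurable_d2 F) (((measurable_deriv (κ R)).comp hH.meas).mul (measurable_d2 H))
  rw [Measure.volume_eq_prod, Measure.ae_prod_iff_ae_ae hms]
  -- exceptional values
  let N : Set ℝ := ⋃ R, {h | DifferentiableAt ℝ (κ R) h}ᶜ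
  have hNm : MeasurableSet N := MeasurableSet.iUnion fun R => (measurableSet_of_differentiableAt ℝ (κ R)).compl
  have hN0 : volume N = 0 := measure_iUnion_null fun R => hκd R
  have hN := null_set hH hNm hN0
  rw [Measure.volume_eq_prod] at hN
  have hN := Measure.ae_ae_of_ae_prod hN
  have hqq : ∀ᵐ x, ∀ R : J, Adm R → x ∈ Ioo (R.1:ℝ) R.2.1 → ∀ h ∈ Ioo (R.2.2.2.2.1:ℝ) R.2.2.2.2.2,
      qq H F R.2.2.1 R.2.2.2.1 h x = κ R h := by
    rw [ae_all_iff]; intro R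
    by_cases hA : Adm R
    · filter_upwards [hκ R hA] with x hx _ using hx
    · exact Eventually.of_forall fun x h => absurd h hA
  filter_upwards [hN, hqq, hH.line2, hF.line2] with x hNx hqx hHx hFx
  have hiso : ∀ᵐ y : ℝ, ∀ R : J, ¬ (y ∈ Pset H x R.2.2.1 R.2.2.2.1 R.2.2.2.2.1 R.2.2.2.2.2 ∧
      𝓝[Pset H x R.2.2.1 R.2.2.2.1 R.2.2.2.2.1 R.2.2.2.2.2 ∩ Ioi y] y = ⊥) := by
    rw [ae_all_iff]; intro R
    exact (countable_setOfPred_isolated_right_within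
      (s := Pset H x R.2.2.1 R.2.2.2.1 R.2.2.2.2.1 R.2.2.2.2.2)).ae_notMem volume
  filter_upwards [hNx, hHx, hFx, hiso] with y hNy hHy hFy hisoy hyU hpos
  have dH := hasDerivAt_line2 hHy
  have dF := hasDerivAt_line2 hFy
  obtain ⟨ε, hε, hl, hr⟩ := crossing dH hpos
  obtain ⟨r, hr0, hrU⟩ := Metric.isOpen_iff.1 hU _ hyU
  have hm : 0 < min ε r := lt_min hε hr0
  obtain ⟨y0, hy0, hy0'⟩ := exists_rat_btwn (show y - min ε r < y by linarith)
  obtain ⟨y1, hy1, hy1'⟩ := exists_rat_btwn (show y < y + min ε r by linarith)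
  have me := min_le_left ε r
  have mr := min_le_right ε r
  obtain ⟨α, hα, hα'⟩ := exists_rat_btwn (hl y0 (by linarith) hy0')
  obtain ⟨β, hβ, hβ'⟩ := exists_rat_btwn (hr y1 hy1 (by linarith))
  have c0 : ∀ᶠ x' in 𝓝 x, H (x', y0) < α := by
    have : Continuous fun x' => H (x', (y0:ℝ)) := hH.cont.comp (by fun_prop)
    exact this.continuousAt.eventually (Iio_mem_nhds hα)
  have c1 : ∀ᶠ x' in 𝓝 x, (β:ℝ) < H (x', y1) := by
    have : Continuous fun x' => H (x', (y1:ℝ)) := hH.cont.comp (by fun_prop)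
    exact this.continuousAt.eventually (Ioi_mem_nhds hβ')
  obtain ⟨δ, hδ, hc⟩ := Metric.eventually_nhds_iff.1 (c0.and c1)
  have hm' : 0 < min δ r := lt_min hδ hr0
  obtain ⟨a, ha, ha'⟩ := exists_rat_btwn (show x - min δ r < x by linarith)
  obtain ⟨b, hb, hb'⟩ := exists_rat_btwn (show x < x + min δ r by linarith)
  have md := min_le_left δ r
  have mr' := min_le_right δ r
  let R : J := ⟨a, b, y0, y1, α, β⟩
  have hA : Adm R := by
    refine ⟨(hy0'.trans hy1).le, ?_, ?_⟩
    · rintro ⟨s, t⟩ ⟨⟨hs1, hs2⟩, ⟨ht1, ht2⟩⟩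
      dsimp only at hs1 hs2 ht1 ht2
      apply hrU
      rw [Metric.mem_ball, Prod.dist_eq, max_lt_iff, Real.dist_eq, Real.dist_eq, abs_lt, abs_lt]
      dsimp only
      refine ⟨⟨?_, ?_⟩, ⟨?_, ?_⟩⟩ <;> linarith
    · intro x' hx'
      have := hc (y := x') (by
        rw [Real.dist_eq, abs_lt]
        have := hx'.1
        have := hx'.2
        constructor <;> linarith)
      exact ⟨this.1.le, this.2.le⟩
  have hyP : y ∈ Pset H x y0 y1 α β := by
    refine ⟨⟨hy0', hy1⟩, hα', hβ, fun s hs h => hl s (by linarith [hs.1]) h, fun s hs h => hr s h (by linarith [hs.2])⟩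
  have hval : ∀ s ∈ Pset H x y0 y1 α β, F (x, s) = κ R (H (x, s)) := by
    intro s hs
    rw [← qq_pset hH hF hFx hs]
    exact hqx R hA ⟨ha', hb⟩ _ ⟨hs.2.1, hs.2.2.1⟩
  have hdk : DifferentiableAt ℝ (κ R) (H (x, y)) := by
    by_contra hcon
    have := (hNy (mem_iUnion.2 ⟨R, hcon⟩)).2
    linarith
  refine ⟨R, hval y hyP, hdk, ?_⟩
  have hacc : UniqueDiffWithinAt ℝ (Pset H x y0 y1 α β) y := by
    rw [uniqueDiffWithinAt_iff_accPt, accPt_principal_iff_nhdsWithin]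
    have h1 : NeBot (𝓝[Pset H x y0 y1 α β ∩ Ioi y] y) := ⟨fun h => hisoy R ⟨hyP, h⟩⟩
    refine h1.mono (nhdsWithin_mono _ ?_)
    rintro s ⟨hs1, hs2⟩
    exact ⟨hs1, ne_of_gt hs2⟩
  have k1 : HasDerivAt (fun s => κ R (H (x, s))) (deriv (κ R) (H (x, y)) * d2 H (x, y)) y :=
    HasDerivAt.comp (h₂ := κ R) (h := fun s => H (x, s)) y hdk.hasDerivAt dH
  have k2 := dF.hasDerivWithinAt (s := Pset H x y0 y1 α β)
  have k3 := (k1.hasDerivWithinAt (s := Pset H x y0 y1 α β)).congr hval (hval y hyP)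
  exact hacc.eq_deriv _ k2 k3

lemma fderiv_swap (H : ℝ × ℝ → ℝ) (p v : ℝ × ℝ) :
    fderiv ℝ (fun q : ℝ × ℝ => H q.swap) p v = fderiv ℝ H p.swap v.swap := by
  have := (ContinuousLinearEquiv.prodComm ℝ ℝ ℝ).comp_right_fderiv (f := H) (x := p)
  have e : (H ∘ ⇑(ContinuousLinearEquiv.prodComm ℝ ℝ ℝ)) = fun q : ℝ × ℝ => H q.swap := rfl
  rw [e] at this
  rw [this]
  rfl

lemma d1_swap (H : ℝ × ℝ → ℝ) (p : ℝ × ℝ) : d1 (fun q : ℝ × ℝ => H q.swap) p = d2 H p.swap :=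
  fderiv_swap H p _
lemma d2_swap (H : ℝ × ℝ → ℝ) (p : ℝ × ℝ) : d2 (fun q : ℝ × ℝ => H q.swap) p = d1 H p.swap :=
  fderiv_swap H p _
lemma br_swap (H E : ℝ × ℝ → ℝ) (p : ℝ × ℝ) :
    br (fun q : ℝ × ℝ => H q.swap) (fun q : ℝ × ℝ => E q.swap) p = - br H E p.swap := by
  simp only [br, d1_swap, d2_swap]; ring

lemma d1_neg (H : ℝ × ℝ → ℝ) (p : ℝ × ℝ) : d1 (fun q => - H q) p = - d1 H p := by
  simp only [d1]; rw [fderiv_fun_neg]; simp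
lemma d2_neg (H : ℝ × ℝ → ℝ) (p : ℝ × ℝ) : d2 (fun q => - H q) p = - d2 H p := by
  simp only [d2]; rw [fderiv_fun_neg]; simp

lemma lipschitz_swap : LipschitzWith 1 (Prod.swap : ℝ × ℝ → ℝ × ℝ) :=
  LipschitzWith.of_dist_le_mul fun p q => by simp [Prod.dist_eq, max_comm]

lemma mp_swap : MeasurePreserving (Prod.swap : ℝ × ℝ → ℝ × ℝ) volume volume :=
  Measure.measurePreserving_swap

lemma ae_swap {P : ℝ × ℝ → Prop} (h : ∀ᵐ p, P p) : ∀ᵐ p : ℝ × ℝ, P p.swap :=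
  mp_swap.quasiMeasurePreserving.ae h

def RepS (H F f : ℝ × ℝ → ℝ) (U : Set (ℝ × ℝ)) (Q : ℝ × ℝ → Prop) : Prop :=
  ∃ S : Set (ℝ → ℝ), S.Countable ∧ (∀ κ ∈ S, Measurable κ) ∧ ∀ᵐ p, p ∈ U → Q p → ∃ κ ∈ S, Rep H F f κ p

lemma reps_pos {H F f : ℝ × ℝ → ℝ} (hH : Lip H) (hF : Lip F) {U : Set (ℝ × ℝ)} (hU : IsOpen U)
    (hf : ∀ᵐ p, p ∈ U → d1 F p = f p * d1 H p ∧ d2 F p = f p * d2 H p) :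
    RepS H F f U (fun p => 0 < d2 H p) := by
  obtain ⟨κ, h1, h2⟩ := rep_pos hH hF hU hf
  refine ⟨range κ, countable_range κ, ?_, ?_⟩
  · rintro _ ⟨j, rfl⟩; exact h1 j
  · filter_upwards [h2] with p hp h3 h4
    obtain ⟨j, hj⟩ := hp h3 h4
    exact ⟨_, ⟨j, rfl⟩, hj⟩

lemma reps_ne {H F f : ℝ × ℝ → ℝ} (hH : Lip H) (hF : Lip F) {U : Set (ℝ × ℝ)} (hU : IsOpen U)
    (hf : ∀ᵐ p, p ∈ U → d1 F p = f p * d1 H p ∧ d2 F p = f p * d2 H p) :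
    RepS H F f U (fun p => d2 H p ≠ 0) := by
  obtain ⟨S, s1, s2, s3⟩ := reps_pos hH hF hU hf
  obtain ⟨S', s1', s2', s3'⟩ := reps_pos hH.neg hF.neg hU (f := f) (by
    filter_upwards [hf] with p hp hpU
    rw [d1_neg, d1_neg, d2_neg, d2_neg, (hp hpU).1, (hp hpU).2]
    constructor <;> ring)
  refine ⟨S ∪ (fun κ : ℝ → ℝ => fun h => - κ (-h)) '' S', s1.union (s1'.image _), ?_, ?_⟩
  · rintro κ (h | ⟨κ', h, rfl⟩)
    · exact s2 κ h
    · have := s2' κ' h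
      dsimp only
      fun_prop
  · filter_upwards [s3, s3'] with p h1 h2 hpU hne
    rcases lt_or_gt_of_ne hne with h | h
    · obtain ⟨κ, hκ, a1, a2, a3⟩ := h2 hpU (by rw [d2_neg]; linarith)
      refine ⟨_, Or.inr ⟨κ, hκ, rfl⟩, ?_⟩
      have e : HasDerivAt (fun h => - κ (-h)) (deriv κ (- H p)) (H p) := by
        have := ((HasDerivAt.comp (h₂ := κ) (h := fun s => - s) (H p) a2.hasDerivAt (hasDerivAt_neg _))).neg
        refine HasDerivAt.congr_deriv (f := fun h => - κ (-h)) this ?_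
        simp
      refine ⟨?_, e.differentiableAt, ?_⟩
      · dsimp only; rw [← a1]; ring
      · rw [e.deriv, a3]
    · obtain ⟨κ, hκ, a⟩ := h1 hpU h
      exact ⟨κ, Or.inl hκ, a⟩

lemma reps_all {H F f : ℝ × ℝ → ℝ} (hH : Lip H) (hF : Lip F) {U : Set (ℝ × ℝ)} (hU : IsOpen U)
    (hf : ∀ᵐ p, p ∈ U → d1 F p = f p * d1 H p ∧ d2 F p = f p * d2 H p) :
    RepS H F f U (fun p => ¬ (d1 H p = 0 ∧ d2 H p = 0)) := by
  obtain ⟨S, s1, s2, s3⟩ := reps_ne hH hF hU hf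
  obtain ⟨S', s1', s2', s3'⟩ := reps_ne (hH.comp lipschitz_swap) (hF.comp lipschitz_swap)
    (hU.preimage (continuous_swap : Continuous (Prod.swap : ℝ × ℝ → ℝ × ℝ))) (f := fun p => f p.swap) (by
    filter_upwards [ae_swap hf] with p hp hpU
    rw [d1_swap, d1_swap, d2_swap, d2_swap, (hp hpU).1, (hp hpU).2]
    constructor <;> ring)
  refine ⟨S ∪ S', s1.union s1', ?_, ?_⟩
  · rintro κ (h | h)
    · exact s2 κ h
    · exact s2' κ h
  · filter_upwards [s3, ae_swap s3'] with p h1 h2 hpU hne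
    by_cases h : d2 H p = 0
    · obtain ⟨κ, hκ, a⟩ := h2 (by simpa using hpU) (by rw [d2_swap]; simpa using fun h' => hne ⟨h', h⟩)
      exact ⟨κ, Or.inr hκ, by simpa [Rep] using a⟩
    · obtain ⟨κ, hκ, a⟩ := h1 hpU h
      exact ⟨κ, Or.inl hκ, a⟩

lemma coincide (κ κ' : ℝ → ℝ) : {h | κ h = κ' h ∧ DifferentiableAt ℝ κ h ∧ DifferentiableAt ℝ κ' h ∧
    deriv κ h ≠ deriv κ' h}.Countable := by
  refine (countable_setOfPred_isolated_right_within (s := {h | κ h = κ' h})).mono ?_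
  rintro h ⟨h1, h2, h3, h4⟩
  refine ⟨h1, ?_⟩
  by_contra hne
  apply h4
  have h5 : UniqueDiffWithinAt ℝ {h | κ h = κ' h} h := by
    rw [uniqueDiffWithinAt_iff_accPt, accPt_principal_iff_nhdsWithin]
    have h1 : NeBot (𝓝[{h | κ h = κ' h} ∩ Ioi h] h) := ⟨hne⟩
    refine h1.mono (nhdsWithin_mono _ ?_)
    rintro s ⟨hs1, hs2⟩
    exact ⟨hs1, ne_of_gt hs2⟩
  have k2 := h2.hasDerivAt.hasDerivWithinAt (s := {h | κ h = κ' h})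
  have k3 := (h3.hasDerivAt.hasDerivWithinAt (s := {h | κ h = κ' h})).congr (f₁ := κ) (fun x hx => hx) h1
  exact h5.eq_deriv _ k2 k3

lemma fhat {H F f : ℝ × ℝ → ℝ} (hH : Lip H) (hF : Lip F) {U : Set (ℝ × ℝ)} (hU : IsOpen U)
    (hf : ∀ᵐ p, p ∈ U → d1 F p = f p * d1 H p ∧ d2 F p = f p * d2 H p) {M : ℝ} (hM : ∀ p, |f p| ≤ M) :
    ∃ g : ℝ × ℝ → ℝ, Measurable g ∧ (∀ q, |g q| ≤ M) ∧
      ∀ᵐ p, p ∈ U → ¬ (d1 H p = 0 ∧ d2 H p = 0) → f p = g (H p, F p) := by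
  classical
  obtain ⟨S, s1, s2, s3⟩ := reps_all hH hF hU hf
  have hM0 := (abs_nonneg _).trans (hM 0)
  obtain ⟨κ, hκ⟩ : ∃ κ : ℕ → ℝ → ℝ, insert (fun _ => 0) S = range κ := (s1.insert _).exists_eq_range ⟨_, mem_insert _ _⟩
  have hκm : ∀ n, Measurable (κ n) := by
    intro n
    have : κ n ∈ insert (fun _ => 0) S := by rw [hκ]; exact ⟨n, rfl⟩
    rcases this with h | h
    · rw [h]; exact measurable_const
    · exact s2 _ h
  let A : ℕ → Set (ℝ × ℝ) := fun n => {q | κ n q.1 = q.2 ∧ DifferentiableAt ℝ (κ n) q.1}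
  have hA : ∀ n, MeasurableSet (A n) := fun n =>
    (measurableSet_eq_fun ((hκm n).comp measurable_fst) measurable_snd).inter
      ((measurableSet_of_differentiableAt ℝ (κ n)).preimage measurable_fst)
  let P : ℕ → ℝ × ℝ → Prop := fun n q => q ∈ A n ∪ (⋃ k, A k)ᶜ
  have hex : ∀ q, ∃ n, P n q := by
    intro q
    by_cases h : q ∈ ⋃ k, A k
    · obtain ⟨k, hk⟩ := mem_iUnion.1 h
      exact ⟨k, Or.inl hk⟩
    · exact ⟨0, Or.inr h⟩
  let v : ℕ → ℝ × ℝ → ℝ := fun n q => max (-M) (min M (deriv (κ n) q.1))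
  have hv : ∀ n, Measurable (v n) := fun n =>
    measurable_const.max (measurable_const.min ((measurable_deriv (κ n)).comp measurable_fst))
  refine ⟨fun q => v (Nat.find (hex q)) q, Measurable.find (f := v) (p := P) hv (fun n => (hA n).union (MeasurableSet.iUnion hA).compl) hex, ?_, ?_⟩
  · intro q
    rw [abs_le]
    exact ⟨le_max_left _ _, max_le (by linarith) (min_le_left _ _)⟩
  · have hE : ∀ᵐ p, ∀ n m, H p ∈ {h | κ n h = κ m h ∧ DifferentiableAt ℝ (κ n) h ∧ DifferentiableAt ℝ (κ m) h ∧
        deriv (κ n) h ≠ deriv (κ m) h} → d1 H p = 0 ∧ d2 H p = 0 := by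
      rw [ae_all_iff]; intro n
      rw [ae_all_iff]; intro m
      exact null_set hH (coincide _ _).measurableSet ((coincide _ _).measure_zero volume)
    filter_upwards [s3, hE] with p h1 h2 hpU hne
    obtain ⟨k, hk, a1, a2, a3⟩ := h1 hpU hne
    obtain ⟨j, rfl⟩ : k ∈ range κ := hκ ▸ Or.inr hk
    have hj : (H p, F p) ∈ A j := ⟨a1.symm, a2⟩
    have hn := Nat.find_spec (hex (H p, F p))
    set n := Nat.find (hex (H p, F p)) with hnn
    have hn : (H p, F p) ∈ A n := by
      rcases hn with h | h
      · exact h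
      · exact absurd (mem_iUnion.2 ⟨j, hj⟩) h
    have e : deriv (κ n) (H p) = deriv (κ j) (H p) := by
      by_contra hcon
      exact hne (h2 n j ⟨hn.1.trans a1, hn.2, a2, hcon⟩)
    have := abs_le.1 (hM p)
    simp only [v]
    rw [e, ← a3, min_eq_right this.2, max_eq_right this.1]

lemma comp2_fderiv {Ψ H F : ℝ × ℝ → ℝ} {p : ℝ × ℝ} (hΨ : DifferentiableAt ℝ Ψ (H p, F p))
    (hH : DifferentiableAt ℝ H p) (hF : DifferentiableAt ℝ F p) (v : ℝ × ℝ) :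
    fderiv ℝ (fun p => Ψ (H p, F p)) p v = fderiv ℝ H p v * d1 Ψ (H p, F p) + fderiv ℝ F p v * d2 Ψ (H p, F p) := by
  have := hΨ.hasFDerivAt.comp p (hH.hasFDerivAt.prodMk hF.hasFDerivAt)
  rw [HasFDerivAt.fderiv (f := fun p => Ψ (H p, F p)) this]
  simp [fderiv_eq Ψ]

lemma T0_core {H F f : ℝ × ℝ → ℝ} (hH : Lip H) (hF : Lip F) (hfb : BM f) {U : Set (ℝ × ℝ)} (hU : IsOpen U)
    (hf : ∀ᵐ p, p ∈ U → d1 F p = f p * d1 H p ∧ d2 F p = f p * d2 H p)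
    (hw : Weak U H f (fun _ => 0)) : Weak U H (fun p => f p ^ 2) (fun _ => 0) := by
  intro φ hφ
  simp only [zero_mul, integral_zero, neg_zero]
  obtain ⟨M, hM⟩ := id hfb.bdd
  obtain ⟨g, gm, gb, hg⟩ := fhat hH hF hU hf hM
  have hM0 := (abs_nonneg _).trans (hM 0)
  obtain ⟨D, hD⟩ := (BM.br hH hφ.lip).bdd
  have hD0 := (abs_nonneg _).trans (hD 0)
  let K := tsupport φ
  have hK : IsCompact K := hφ.cpt.isCompact
  let Θ : ℝ × ℝ → ℝ × ℝ := fun p => (H p, F p)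
  have hΘ : Measurable Θ := hH.meas.prodMk hF.meas
  let ν : Measure (ℝ × ℝ) := Measure.map Θ (volume.restrict K)
  have : IsFiniteMeasure (volume.restrict K) := ⟨by simpa using hK.measure_lt_top⟩
  have : IsFiniteMeasure ν := Measure.isFiniteMeasure_map _ _
  have hgL : MemLp g 1 ν := MemLp.of_bound gm.aestronglyMeasurable M (Eventually.of_forall fun q => gb q)
  -- integral of f * g(H,F) * br
  have e1 : ∫ p, f p ^ 2 * br H φ p = ∫ p, f p * g (H p, F p) * br H φ p := by
    apply integral_congr_ae
    filter_upwards [hg] with p hp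
    by_cases hpU : p ∈ U
    · by_cases h0 : d1 H p = 0 ∧ d2 H p = 0
      · simp [br, h0.1, h0.2]
      · rw [← hp hpU h0]; ring
    · rw [br_zero (fun h => hpU (hφ.sub h))]; simp
  rw [e1]
  -- smooth test
  have e2 : ∀ Ψ : ℝ × ℝ → ℝ, ContDiff ℝ (⊤ : ℕ∞) Ψ → HasCompactSupport Ψ → ∫ p, f p * Ψ (H p, F p) * br H φ p = 0 := by
    intro Ψ hΨ hc
    have hL : Lip Ψ := ContDiff.lipschitzWith_of_hasCompactSupport hc hΨ (by simp)
    have hT := hφ.mul (hL.comp2 hH hF)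
    have := hw _ hT
    simp only [zero_mul, integral_zero, neg_zero] at this
    rw [← this]
    apply integral_congr_ae
    filter_upwards [hH.ae_diff, hF.ae_diff, hφ.lip.ae_diff, hf] with p h1 h2 h3 h4
    have hΨd : DifferentiableAt ℝ Ψ (H p, F p) := hΨ.differentiable (by simp) _
    have hd : DifferentiableAt ℝ (fun p => Ψ (H p, F p)) p :=
      DifferentiableAt.comp (f := fun p => (H p, F p)) p hΨd (h1.prodMk h2)
    rw [br_mul hd h3]
    by_cases hpU : p ∈ U
    · have : br H (fun p => Ψ (H p, F p)) p = 0 := by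
        have q1 := comp2_fderiv hΨd h1 h2 (1, 0)
        have q2 := comp2_fderiv hΨd h1 h2 (0, 1)
        change d1 _ p = d1 H p * _ + d1 F p * _ at q1
        change d2 _ p = d2 H p * _ + d2 F p * _ at q2
        simp only [br]
        rw [q1, q2, (h4 hpU).1, (h4 hpU).2]; ring
      rw [this]; ring
    · rw [br_zero (fun h => hpU (hφ.sub h)), hφ.zero hpU]; simp
  -- approximation
  have e3 : ∀ ε : ℝ, 0 < ε → |∫ p, f p * g (H p, F p) * br H φ p| ≤ (M * D) * ε := by
    intro ε hε
    obtain ⟨Ψ, hc, hΨ, hle⟩ := MemLp.exist_eLpNorm_sub_le (by simp) le_rfl hgL hε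
    have hL : Lip Ψ := ContDiff.lipschitzWith_of_hasCompactSupport hc hΨ (by simp)
    have hΨb : BM Ψ := ⟨hL.meas, hc.exists_bound_of_continuous hL.cont⟩
    have hgb : BM g := ⟨gm, M, gb⟩
    have i1 : Integrable (fun p => f p * g (H p, F p) * br H φ p) :=
      hφ.int_br hH (hfb.mul (hgb.comp hΘ))
    have i2 : Integrable (fun p => f p * Ψ (H p, F p) * br H φ p) :=
      hφ.int_br hH (hfb.mul (hΨb.comp hΘ))
    have hi : Integrable (fun q => g q - Ψ q) ν :=
      hgL.integrable le_rfl |>.sub ((MemLp.of_bound (p := 1) hΨb.meas.aestronglyMeasurable hΨb.bdd.choose (Eventually.of_forall fun q => hΨb.bdd.choose_spec q)).integrable le_rfl)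
    have hn : ∫ q, |g q - Ψ q| ∂ν ≤ ε := by
      rw [eLpNorm_one_eq_lintegral_enorm] at hle
      have : ∫ q, ‖g q - Ψ q‖ ∂ν = (∫⁻ q, ‖g q - Ψ q‖ₑ ∂ν).toReal :=
        integral_norm_eq_lintegral_enorm hi.aestronglyMeasurable
      simp only [Real.norm_eq_abs] at this
      rw [this]
      refine ENNReal.toReal_le_of_le_ofReal hε.le hle
    have hn' : ∫ p in K, |g (H p, F p) - Ψ (H p, F p)| ≤ ε := by
      rw [integral_map hΘ.aemeasurable] at hn
      · exact hn
      · exact hi.aestronglyMeasurable.norm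
    have iK : IntegrableOn (fun p => (M * D) * |g (H p, F p) - Ψ (H p, F p)|) K :=
      ((((hgb.sub hΨb).abs.comp hΘ).intOn hK.isBounded).const_mul _)
    rw [← sub_zero (∫ p, f p * g (H p, F p) * br H φ p), ← e2 Ψ hΨ hc, ← integral_sub i1 i2]
    have e4 : ∫ p, (f p * g (H p, F p) * br H φ p - f p * Ψ (H p, F p) * br H φ p) =
        ∫ p in K, (f p * g (H p, F p) * br H φ p - f p * Ψ (H p, F p) * br H φ p) := by
      rw [setIntegral_eq_integral_of_forall_compl_eq_zero]
      intro p hp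
      rw [br_zero hp]; simp
    rw [e4]
    calc _ ≤ ∫ p in K, (M * D) * |g (H p, F p) - Ψ (H p, F p)| := by
          rw [← Real.norm_eq_abs]
          refine norm_integral_le_of_norm_le (μ := volume.restrict K) iK (Eventually.of_forall fun p => ?_)
          rw [show f p * g (H p, F p) * br H φ p - f p * Ψ (H p, F p) * br H φ p =
            (f p * br H φ p) * (g (H p, F p) - Ψ (H p, F p)) by ring, norm_mul, Real.norm_eq_abs, Real.norm_eq_abs, abs_mul]
          exact mul_le_mul_of_nonneg_right (mul_le_mul (hM p) (hD p) (abs_nonneg _) hM0) (abs_nonneg _)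
      _ ≤ _ := by
        rw [integral_const_mul]
        exact mul_le_mul_of_nonneg_left hn' (mul_nonneg hM0 hD0)
  by_contra hne
  have hpos : 0 < |∫ p, f p * g (H p, F p) * br H φ p| := abs_pos.2 hne
  have hMD : 0 ≤ M * D := mul_nonneg hM0 hD0
  have := e3 (|∫ p, f p * g (H p, F p) * br H φ p| / (2 * (M * D + 1))) (by positivity)
  have h2 : M * D * (|∫ p, f p * g (H p, F p) * br H φ p| / (2 * (M * D + 1))) < |∫ p, f p * g (H p, F p) * br H φ p| := by
    rw [← mul_div_assoc, div_lt_iff₀ (by positivity)]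
    nlinarith
  linarith

/-- Theorem `T0`: without source, squares are again solutions. -/
theorem T0 {H f : ℝ × ℝ → ℝ} {c : ℝ × ℝ} {L : ℝ} (hH : Lip H) (hf : BM f)
    (hw : Weak (Metric.ball c L) H f (fun _ => 0)) : Weak (Metric.ball c L) H (fun p => f p ^ 2) (fun _ => 0) := by
  intro φ hφ
  rcases le_or_gt L 0 with hL | hL
  · have : ∀ p, p ∉ tsupport φ := fun p hp => by
      have := hφ.sub hp
      rw [Metric.ball_eq_empty.2 hL] at this
      exact this
    simp [br_zero (this _)]
  obtain ⟨L', ⟨h0, h1⟩, h2⟩ := exists_pos_lt_subset_ball hL (isClosed_tsupport φ) hφ.sub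
  obtain ⟨F, hF, h3⟩ := poincare h0 h1 (hf.mul hH.bm_d2) (hf.mul hH.bm_d1).neg (weak_iff_div.1 hw)
  refine T0_core hH hF hf Metric.isOpen_ball (U := Metric.ball c L') ?_ (hw.mono (Metric.ball_subset_ball h1.le)) φ ⟨hφ.lip, hφ.cpt, h2⟩
  filter_upwards [h3] with p hp hpU
  rw [(hp hpU).1, (hp hpU).2]
  simp

/-- `x` is a (vector-valued) Lebesgue point of `g` in the first variable. -/
def GoodX (g : ℝ × ℝ → ℝ) (R x : ℝ) : Prop :=
  Tendsto (fun k : ℕ => ∫ y in Icc (-R) R, ∫ σ in Icc (-1:ℝ) 1, |g (x + σ / ((k:ℝ) + 1), y) - g (x, y)|) atTop (𝓝 0)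

lemma leb1 {h : ℝ → ℝ} (hm : Measurable h) {M : ℝ} (hM : ∀ x, |h x| ≤ M) :
    ∀ᵐ x, Tendsto (fun k : ℕ => ∫ σ in Icc (-1:ℝ) 1, |h (x + σ / ((k:ℝ) + 1)) - h x|) atTop (𝓝 0) := by
  have hl : LocallyIntegrable h := locInt hm.aestronglyMeasurable (C := M) (fun x => hM x)
  filter_upwards [IsUnifLocDoublingMeasure.ae_tendsto_average_norm_sub volume hl 1] with x hx
  have h1 : Tendsto (fun k : ℕ => 1 / ((k:ℝ) + 1)) atTop (𝓝[>] 0) :=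
    tendsto_nhdsWithin_iff.2 ⟨tendsto_one_div_add_atTop_nhds_zero_nat,
      Eventually.of_forall fun k => by simp only [mem_Ioi]; positivity⟩
  have h2 := (hx (fun _ => x) (fun k : ℕ => 1 / ((k:ℝ) + 1)) h1 (Eventually.of_forall fun k => by
    simp only [Metric.mem_closedBall, dist_self]; positivity)).const_mul 2
  rw [mul_zero] at h2
  refine h2.congr fun k => ?_
  have hk : (0:ℝ) < (k:ℝ) + 1 := by positivity
  rw [setAverage_eq, Real.closedBall_eq_Icc]
  have e1 : ∫ σ in Icc (-1:ℝ) 1, |h (x + σ / ((k:ℝ) + 1)) - h x| = ∫ σ in (-1:ℝ)..1, |h (x + σ / ((k:ℝ) + 1)) - h x| := by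
    rw [intervalIntegral.integral_of_le (by norm_num), integral_Icc_eq_integral_Ioc]
  have e2 : ∫ y in Icc (x - 1 / ((k:ℝ) + 1)) (x + 1 / ((k:ℝ) + 1)), ‖h y - h x‖ =
      ∫ y in (x - 1 / ((k:ℝ) + 1))..(x + 1 / ((k:ℝ) + 1)), |h y - h x| := by
    rw [intervalIntegral.integral_of_le (by
      have : 0 < 1 / ((k:ℝ) + 1) := by positivity
      linarith), integral_Icc_eq_integral_Ioc]
    rfl
  rw [e1, e2]
  have := intervalIntegral.integral_comp_add_div (a := -1) (b := 1) (fun y => |h y - h x|) hk.ne' x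
  rw [this]
  simp only [Measure.real, Real.volume_Icc, smul_eq_mul]
  rw [ENNReal.toReal_ofReal (by ring_nf; positivity)]
  rw [show x + -1 / ((k:ℝ) + 1) = x - 1 / ((k:ℝ) + 1) by ring,
    show x + 1 / ((k:ℝ) + 1) - (x - 1 / ((k:ℝ) + 1)) = 2 / ((k:ℝ) + 1) by ring]
  field_simp

lemma goodX_ae {g : ℝ × ℝ → ℝ} (hg : BM g) (R : ℝ) : ∀ᵐ x, GoodX g R x := by
  obtain ⟨gm, M, hM⟩ := hg
  have hM0 := (abs_nonneg _).trans (hM 0)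
  let I : ℕ → ℝ × ℝ → ℝ := fun k p => ∫ σ in Icc (-1:ℝ) 1, |g (p.1 + σ / ((k:ℝ) + 1), p.2) - g p|
  have hI : ∀ k, Measurable (I k) := by
    intro k
    have : Measurable (fun q : (ℝ × ℝ) × ℝ => |g (q.1.1 + q.2 / ((k:ℝ) + 1), q.1.2) - g q.1|) := by
      have h1 : Measurable (fun q : (ℝ × ℝ) × ℝ => (q.1.1 + q.2 / ((k:ℝ) + 1), q.1.2)) := by fun_prop
      exact ((gm.comp h1).sub (gm.comp measurable_fst)).abs
    exact (this.stronglyMeasurable.integral_prod_right' (ν := volume.restrict (Icc (-1:ℝ) 1))).measurable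
  have hIb : ∀ k p, |I k p| ≤ 2 * M * 2 := by
    intro k p
    have := norm_setIntegral_le_of_norm_le_const (μ := volume) (s := Icc (-1:ℝ) 1) (C := 2 * M)
      (f := fun σ => |g (p.1 + σ / ((k:ℝ) + 1), p.2) - g p|) (by simp)
      (fun σ _ => by
        rw [norm_abs_eq_norm, Real.norm_eq_abs]
        calc _ ≤ |g _| + |g _| := abs_sub _ _
          _ ≤ 2 * M := by linarith [hM (p.1 + σ / ((k:ℝ) + 1), p.2), hM p])
    refine this.trans (le_of_eq ?_)
    simp [Measure.real]; norm_num
  have h1 : ∀ y, ∀ᵐ x, Tendsto (fun k => I k (x, y)) atTop (𝓝 0) := fun y =>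
    leb1 (h := fun x => g (x, y)) (gm.comp (by fun_prop)) (fun x => hM _)
  have h2 : ∀ᵐ x, ∀ᵐ y, Tendsto (fun k => I k (x, y)) atTop (𝓝 0) := by
    rw [Measure.ae_ae_comm]
    · exact Eventually.of_forall h1
    · exact measurableSet_tendsto (f := fun k p => I k p) _ hI
  filter_upwards [h2] with x hx
  have := tendsto_integral_of_dominated_convergence (μ := volume.restrict (Icc (-R) R)) (F := fun k y => I k (x, y)) (f := fun _ => 0)
    (fun _ => 2 * M * 2) (fun k => ((hI k).comp (by fun_prop : Measurable fun y : ℝ => (x, y))).aestronglyMeasurable)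
    (integrable_const _) (fun k => Eventually.of_forall fun y => hIb k _) (ae_restrict_of_ae hx)
  simpa [GoodX] using this

/-- cutoff -/
def chi (t : ℝ) (k : ℕ) (x : ℝ) : ℝ := max 0 (min 1 ((t - |x|) * ((k:ℝ) + 1)))
/-- its derivative -/
def cch (t : ℝ) (k : ℕ) (x : ℝ) : ℝ :=
  (Ioo (-t) (-t + 1 / ((k:ℝ) + 1))).indicator (fun _ => (k:ℝ) + 1) x -
  (Ioo (t - 1 / ((k:ℝ) + 1)) t).indicator (fun _ => (k:ℝ) + 1) x

lemma chi_nonneg (t k x) : 0 ≤ chi t k x := le_max_left _ _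
lemma chi_le (t k x) : chi t k x ≤ 1 := max_le (by norm_num) (min_le_left _ _)
lemma chi_abs (t k x) : |chi t k x| ≤ 1 := by rw [abs_of_nonneg (chi_nonneg _ _ _)]; exact chi_le _ _ _
lemma chi_zero {t : ℝ} {k : ℕ} {x : ℝ} (h : t ≤ |x|) : chi t k x = 0 := by
  refine max_eq_left ((min_le_right _ _).trans ?_)
  exact mul_nonpos_of_nonpos_of_nonneg (by linarith) (by positivity)

lemma chi_lip (t : ℝ) (k : ℕ) : ∃ C : ℝ≥0, LipschitzWith C (chi t k) := by
  have a : LipschitzWith (Real.toNNReal ((k:ℝ) + 1)) (fun x : ℝ => (t - |x|) * ((k:ℝ) + 1)) :=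
    LipschitzWith.of_dist_le_mul fun p q => by
      rw [Real.dist_eq, Real.dist_eq, ← sub_mul, abs_mul, Real.coe_toNNReal _ (by positivity), mul_comm,
        abs_of_pos (show (0:ℝ) < (k:ℝ) + 1 by positivity)]
      refine mul_le_mul_of_nonneg_left ?_ (by positivity)
      rw [show t - |p| - (t - |q|) = -(|p| - |q|) by ring, abs_neg]
      exact abs_abs_sub_abs_le _ _
  exact ⟨_, (a.const_min 1).const_max 0⟩

lemma chi_tendsto {t x : ℝ} (h : |x| < t) : Tendsto (fun k => chi t k x) atTop (𝓝 1) := by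
  have h0 : 0 < t - |x| := by linarith
  apply tendsto_const_nhds.congr'
  obtain ⟨n, hn⟩ := exists_nat_gt (1 / (t - |x|))
  filter_upwards [eventually_ge_atTop n] with k hk
  have : (n:ℝ) ≤ k := by exact_mod_cast hk
  rw [div_lt_iff₀ h0] at hn
  unfold chi
  rw [min_eq_left, max_eq_right (by norm_num)]
  nlinarith

lemma chi_deriv {t : ℝ} {k : ℕ} (ht : 1 / ((k:ℝ) + 1) ≤ t) {x : ℝ}
    (h1 : x ≠ t) (h2 : x ≠ -t) (h3 : x ≠ t - 1 / ((k:ℝ) + 1)) (h4 : x ≠ -t + 1 / ((k:ℝ) + 1)) :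
    HasDerivAt (chi t k) (cch t k x) x := by
  have hk : (0:ℝ) < (k:ℝ) + 1 := by positivity
  have hδ : 0 < 1 / ((k:ℝ) + 1) := by positivity
  have hδk : 1 / ((k:ℝ) + 1) * ((k:ℝ) + 1) = 1 := by field_simp
  set δ := 1 / ((k:ℝ) + 1) with hδd
  rcases lt_or_gt_of_ne h2 with a | a
  · have e : chi t k =ᶠ[𝓝 x] fun _ => 0 := by
      filter_upwards [Iio_mem_nhds a] with y hy
      simp only [mem_Iio] at hy
      exact chi_zero (by rw [abs_of_neg (by linarith)]; linarith)
    have : cch t k x = 0 := by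
      unfold cch
      rw [indicator_of_notMem (by simp only [mem_Ioo]; rintro ⟨_, _⟩; linarith),
        indicator_of_notMem (by simp only [mem_Ioo]; rintro ⟨_, _⟩; linarith)]; simp
    rw [this]; exact (hasDerivAt_const x (0:ℝ)).congr_of_eventuallyEq e
  rcases lt_or_gt_of_ne h4 with b | b
  · have e : chi t k =ᶠ[𝓝 x] fun y => (t + y) * ((k:ℝ) + 1) := by
      filter_upwards [Ioo_mem_nhds a b] with y hy
      unfold chi
      rw [abs_of_nonpos (by linarith [hy.2]), sub_neg_eq_add, min_eq_right, max_eq_right]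
      · nlinarith [hy.1]
      · nlinarith [hy.2]
    have : cch t k x = (k:ℝ) + 1 := by
      unfold cch
      rw [indicator_of_mem (by exact ⟨a, b⟩),
        indicator_of_notMem (by simp only [mem_Ioo]; rintro ⟨_, _⟩; linarith)]; simp
    rw [this]
    refine HasDerivAt.congr_of_eventuallyEq ?_ e
    simpa using ((hasDerivAt_id x).const_add t).mul_const ((k:ℝ) + 1)
  rcases lt_or_gt_of_ne h3 with c | c
  · have e : chi t k =ᶠ[𝓝 x] fun y => 1 := by
      filter_upwards [Ioo_mem_nhds b c] with y hy
      unfold chi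
      rw [min_eq_left, max_eq_right (by norm_num)]
      have : |y| ≤ t - δ := abs_le.2 ⟨by linarith [hy.1], by linarith [hy.2]⟩
      nlinarith
    have : cch t k x = 0 := by
      unfold cch
      rw [indicator_of_notMem (by simp only [mem_Ioo]; rintro ⟨_, _⟩; linarith),
        indicator_of_notMem (by simp only [mem_Ioo]; rintro ⟨_, _⟩; linarith)]; simp
    rw [this]; exact (hasDerivAt_const x (1:ℝ)).congr_of_eventuallyEq e
  rcases lt_or_gt_of_ne h1 with d | d
  · have e : chi t k =ᶠ[𝓝 x] fun y => (t - y) * ((k:ℝ) + 1) := by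
      filter_upwards [Ioo_mem_nhds c d] with y hy
      unfold chi
      rw [abs_of_nonneg (by linarith [hy.1]), min_eq_right, max_eq_right]
      · nlinarith [hy.2]
      · nlinarith [hy.1]
    have : cch t k x = -((k:ℝ) + 1) := by
      unfold cch
      rw [indicator_of_notMem (by simp only [mem_Ioo]; rintro ⟨_, _⟩; linarith),
        indicator_of_mem (by exact ⟨c, d⟩)]; simp
    rw [this]
    refine HasDerivAt.congr_of_eventuallyEq ?_ e
    simpa using ((hasDerivAt_id x).const_sub t).mul_const ((k:ℝ) + 1)
  · have e : chi t k =ᶠ[𝓝 x] fun _ => 0 := by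
      filter_upwards [Ioi_mem_nhds d] with y hy
      simp only [mem_Ioi] at hy
      exact chi_zero (by rw [abs_of_pos (by linarith)]; linarith)
    have : cch t k x = 0 := by
      unfold cch
      rw [indicator_of_notMem (by simp only [mem_Ioo]; rintro ⟨_, _⟩; linarith),
        indicator_of_notMem (by simp only [mem_Ioo]; rintro ⟨_, _⟩; linarith)]; simp
    rw [this]; exact (hasDerivAt_const x (0:ℝ)).congr_of_eventuallyEq e

lemma chi_deriv_ae {t : ℝ} {k : ℕ} (ht : 1 / ((k:ℝ) + 1) ≤ t) : ∀ᵐ x, HasDerivAt (chi t k) (cch t k x) x := by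
  have : ∀ a : ℝ, ∀ᵐ x : ℝ, x ≠ a := fun a => by
    rw [ae_iff]; simp
  filter_upwards [this t, this (-t), this (t - 1 / ((k:ℝ) + 1)), this (-t + 1 / ((k:ℝ) + 1))] with x h1 h2 h3 h4
    using chi_deriv ht h1 h2 h3 h4

lemma cch_meas (t k) : Measurable (cch t k) := by
  unfold cch
  exact (measurable_const.indicator measurableSet_Ioo).sub (measurable_const.indicator measurableSet_Ioo)

lemma cch_int {t : ℝ} {k : ℕ} {F : ℝ → ℝ} (hF : LocallyIntegrable F) :
    ∫ x, F x * cch t k x = (∫ σ in Ioo (0:ℝ) 1, F (-t + 1 * σ / ((k:ℝ)+1))) - ∫ σ in Ioo (0:ℝ) 1, F (t + (-1) * σ / ((k:ℝ)+1)) := by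
  have hk : (0:ℝ) < (k:ℝ) + 1 := by positivity
  have hδ : 0 < 1 / ((k:ℝ) + 1) := by positivity
  have hi : ∀ a b, IntegrableOn F (Ioo a b) := fun a b =>
    (hF.integrableOn_isCompact (isCompact_Icc (a := a) (b := b))).mono_set Ioo_subset_Icc_self
  have e : ∀ x, F x * cch t k x = (Ioo (-t) (-t + 1 / ((k:ℝ) + 1))).indicator (fun x => ((k:ℝ) + 1) * F x) x -
      (Ioo (t - 1 / ((k:ℝ) + 1)) t).indicator (fun x => ((k:ℝ) + 1) * F x) x := by
    intro x; unfold cch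
    simp only [indicator]; split_ifs <;> ring
  simp_rw [e]
  rw [integral_sub ((integrable_indicator_iff measurableSet_Ioo).2 ((hi _ _).const_mul _))
    ((integrable_indicator_iff measurableSet_Ioo).2 ((hi _ _).const_mul _)), integral_indicator measurableSet_Ioo,
    integral_indicator measurableSet_Ioo, integral_const_mul, integral_const_mul]
  have hI : ∀ (G : ℝ → ℝ) (a b : ℝ), a ≤ b → ∫ x in Ioo a b, G x = ∫ x in a..b, G x := fun G a b h => by
    rw [intervalIntegral.integral_of_le h, integral_Ioc_eq_integral_Ioo]
  rw [hI _ _ _ (by linarith), hI _ _ _ (by linarith), hI _ _ _ (by norm_num), hI _ _ _ (by norm_num)]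
  congr 1
  · have := intervalIntegral.integral_comp_add_div (a := 0) (b := 1) F hk.ne' (-t)
    simp only [one_mul]
    rw [this]; simp
  · have := intervalIntegral.integral_comp_sub_div (a := 0) (b := 1) F hk.ne' t
    rw [show (fun σ => F (t + -1 * σ / ((k:ℝ)+1))) = fun σ => F (t - σ / ((k:ℝ)+1)) by
      ext σ; congr 1; ring]
    rw [this]; simp

lemma inn_meas {F : ℝ × ℝ → ℝ} (hF : Measurable F) : Measurable fun y => ∫ σ in Ioo (0:ℝ) 1, F (σ, y) :=
  (hF.stronglyMeasurable.integral_prod_left' (μ := volume.restrict (Ioo (0:ℝ) 1))).measurable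

lemma inn_bd {h : ℝ → ℝ} {C : ℝ} (hC : ∀ σ, |h σ| ≤ C) : |∫ σ in Ioo (0:ℝ) 1, h σ| ≤ C := by
  have := norm_setIntegral_le_of_norm_le_const (μ := volume) (s := Ioo (0:ℝ) 1) (C := C) (f := h) (by simp)
    (fun σ _ => hC σ)
  simpa [Measure.real] using this

lemma bm_ion {h : ℝ → ℝ} (hm : Measurable h) {C : ℝ} (hC : ∀ σ, |h σ| ≤ C) (a b : ℝ) : IntegrableOn h (Ioo a b) :=
  Measure.integrableOn_of_bounded (M := C) (by simp) hm.aestronglyMeasurable (Eventually.of_forall hC)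

lemma bm_icc {h : ℝ → ℝ} (hm : Measurable h) {C : ℝ} (hC : ∀ σ, |h σ| ≤ C) (a b : ℝ) : IntegrableOn h (Icc a b) :=
  Measure.integrableOn_of_bounded (M := C) (by simp) hm.aestronglyMeasurable (Eventually.of_forall hC)

lemma side {g : ℝ × ℝ → ℝ} (hg : BM g) {R c e s : ℝ} (he : e = 1 ∨ e = -1) (hG : GoodX g R c) (hs : s ≤ R)
    {W : ℕ → ℝ × ℝ → ℝ} (hWm : ∀ k, Measurable (W k)) {C : ℝ} (hWb : ∀ k p, |W k p| ≤ C) {w : ℝ → ℝ}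
    (hw : ∀ σ ∈ Ioo (0:ℝ) 1, ∀ y ∈ Ioo (-s) s, Tendsto (fun k => W k (σ, y)) atTop (𝓝 (w y))) :
    Tendsto (fun k : ℕ => ∫ y in Ioo (-s) s, ∫ σ in Ioo (0:ℝ) 1, g (c + e * σ / ((k:ℝ) + 1), y) * W k (σ, y))
      atTop (𝓝 (∫ y in Ioo (-s) s, g (c, y) * w y)) := by
  obtain ⟨gm, M, hM⟩ := hg
  have hM0 := (abs_nonneg _).trans (hM 0)
  have hC0 := (abs_nonneg _).trans (hWb 0 0)
  -- measurable pieces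
  have m1 : ∀ k : ℕ, Measurable fun p : ℝ × ℝ => g (c + e * p.1 / ((k:ℝ) + 1), p.2) := fun k =>
    gm.comp (by fun_prop)
  have m2 : Measurable fun p : ℝ × ℝ => g (c, p.2) := gm.comp (by fun_prop)
  have b3 : ∀ k p, |g (c, p.2) * W k p| ≤ M * C := fun k p => by
    rw [abs_mul]; exact mul_le_mul (hM _) (hWb _ _) (abs_nonneg _) hM0
  have b1 : ∀ k : ℕ, ∀ p : ℝ × ℝ, |g (c + e * p.1 / ((k:ℝ) + 1), p.2) * W k p| ≤ M * C := fun k p => by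
    rw [abs_mul]; exact mul_le_mul (hM _) (hWb _ _) (abs_nonneg _) hM0
  have b4 : ∀ k : ℕ, ∀ p : ℝ × ℝ, |(|g (c + e * p.1 / ((k:ℝ) + 1), p.2) - g (c, p.2)|)| ≤ 2 * M := fun k p => by
    rw [abs_abs]
    calc _ ≤ |g _| + |g _| := abs_sub _ _
      _ ≤ 2 * M := by linarith [hM (c + e * p.1 / ((k:ℝ) + 1), p.2), hM (c, p.2)]
  -- the second limit
  have L2 : Tendsto (fun k : ℕ => ∫ y in Ioo (-s) s, ∫ σ in Ioo (0:ℝ) 1, g (c, y) * W k (σ, y))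
      atTop (𝓝 (∫ y in Ioo (-s) s, g (c, y) * w y)) := by
    refine tendsto_integral_of_dominated_convergence (fun _ => M * C) (fun k => (inn_meas (m2.mul (hWm k))).aestronglyMeasurable)
      (integrable_const _) (fun k => Eventually.of_forall fun y => inn_bd fun σ => b3 k (σ, y)) ?_
    refine (ae_restrict_iff' measurableSet_Ioo).2 (Eventually.of_forall fun y hy => ?_)
    have := tendsto_integral_of_dominated_convergence (μ := volume.restrict (Ioo (0:ℝ) 1)) (F := fun k σ => g (c, y) * W k (σ, y))
      (f := fun σ => g (c, y) * w y) (fun _ => M * C)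
      (fun k => (((hWm k).comp (by fun_prop : Measurable fun σ : ℝ => (σ, y))).const_mul _).aestronglyMeasurable)
      (integrable_const _) (fun k => Eventually.of_forall fun σ => b3 k (σ, y))
      ((ae_restrict_iff' measurableSet_Ioo).2 (Eventually.of_forall fun σ hσ => (hw σ hσ y hy).const_mul _))
    simpa [Measure.real] using this
  -- the first
  have L1 : Tendsto (fun k : ℕ => (∫ y in Ioo (-s) s, ∫ σ in Ioo (0:ℝ) 1, g (c + e * σ / ((k:ℝ) + 1), y) * W k (σ, y)) -
      ∫ y in Ioo (-s) s, ∫ σ in Ioo (0:ℝ) 1, g (c, y) * W k (σ, y)) atTop (𝓝 0) := by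
    have hG' := (hG.const_mul C)
    rw [mul_zero] at hG'
    refine squeeze_zero_norm (fun k => ?_) hG'
    have mA : Measurable fun y : ℝ => ∫ σ in Icc (-1:ℝ) 1, |g (c + σ / ((k:ℝ) + 1), y) - g (c, y)| := by
      have : Measurable fun p : ℝ × ℝ => |g (c + p.1 / ((k:ℝ) + 1), p.2) - g (c, p.2)| :=
        ((gm.comp (by fun_prop : Measurable fun p : ℝ × ℝ => (c + p.1 / ((k:ℝ) + 1), p.2))).sub m2).abs
      exact (this.stronglyMeasurable.integral_prod_left' (μ := volume.restrict (Icc (-1:ℝ) 1))).measurable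
    have bA : ∀ y : ℝ, |(∫ σ in Icc (-1:ℝ) 1, |g (c + σ / ((k:ℝ) + 1), y) - g (c, y)|)| ≤ 2 * M * 2 := by
      intro y
      have := norm_setIntegral_le_of_norm_le_const (μ := volume) (s := Icc (-1:ℝ) 1) (C := 2 * M)
        (f := fun σ => |g (c + σ / ((k:ℝ) + 1), y) - g (c, y)|) (by simp)
        (fun σ _ => by
          rw [norm_abs_eq_norm, Real.norm_eq_abs]
          calc _ ≤ |g _| + |g _| := abs_sub _ _
            _ ≤ 2 * M := by linarith [hM (c + σ / ((k:ℝ) + 1), y), hM (c, y)])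
      refine this.trans (le_of_eq ?_)
      simp [Measure.real]; norm_num
    have nA : ∀ y : ℝ, 0 ≤ ∫ σ in Icc (-1:ℝ) 1, |g (c + σ / ((k:ℝ) + 1), y) - g (c, y)| := fun y =>
      integral_nonneg fun σ => abs_nonneg _
    have m5 : Measurable fun p : ℝ × ℝ => g (c + e * p.1 / ((k:ℝ) + 1), p.2) * W k p := (m1 k).mul (hWm k)
    have m6 : Measurable fun p : ℝ × ℝ => g (c, p.2) * W k p := m2.mul (hWm k)
    rw [← integral_sub (bm_ion (inn_meas m5) (fun y => inn_bd fun σ => b1 k (σ, y)) _ _)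
      (bm_ion (inn_meas m6) (fun y => inn_bd fun σ => b3 k (σ, y)) _ _)]
    calc _ ≤ ∫ y in Ioo (-s) s, C * ∫ σ in Icc (-1:ℝ) 1, |g (c + σ / ((k:ℝ) + 1), y) - g (c, y)| := by
          refine norm_integral_le_of_norm_le ((bm_ion mA bA _ _).const_mul C) (Eventually.of_forall fun y => ?_)
          have hy := (by fun_prop : Measurable fun σ : ℝ => (σ, y))
          have mB : Measurable fun σ => |g (c + σ / ((k:ℝ) + 1), y) - g (c, y)| :=
            ((gm.comp (by fun_prop : Measurable fun σ : ℝ => (c + σ / ((k:ℝ) + 1), y))).sub measurable_const).abs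
          have bB : ∀ σ, |(|g (c + σ / ((k:ℝ) + 1), y) - g (c, y)|)| ≤ 2 * M := fun σ => by
            rw [abs_abs]
            calc _ ≤ |g _| + |g _| := abs_sub _ _
              _ ≤ 2 * M := by linarith [hM (c + σ / ((k:ℝ) + 1), y), hM (c, y)]
          have i5 : IntegrableOn (fun σ => g (c + e * σ / ((k:ℝ) + 1), y) * W k (σ, y)) (Ioo 0 1) :=
            bm_ion (m5.comp hy) (fun σ => b1 k (σ, y)) _ _
          have i6 : IntegrableOn (fun σ => g (c, y) * W k (σ, y)) (Ioo 0 1) :=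
            bm_ion (m6.comp hy) (fun σ => b3 k (σ, y)) _ _
          rw [← integral_sub i5 i6]
          calc _ ≤ ∫ σ in Ioo (0:ℝ) 1, C * |g (c + e * σ / ((k:ℝ) + 1), y) - g (c, y)| := by
                refine norm_integral_le_of_norm_le ((bm_ion ((((m1 k).sub m2).abs).comp hy) (fun σ => b4 k (σ, y)) _ _).const_mul C)
                  (Eventually.of_forall fun σ => ?_)
                rw [← sub_mul, norm_mul, mul_comm]
                exact mul_le_mul_of_nonneg_right (hWb _ _) (abs_nonneg _)
            _ = C * ∫ σ in Ioo (0:ℝ) 1, |g (c + e * σ / ((k:ℝ) + 1), y) - g (c, y)| := integral_const_mul _ _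
            _ ≤ _ := by
              refine mul_le_mul_of_nonneg_left ?_ hC0
              rcases he with rfl | rfl
              · simp only [one_mul]
                exact setIntegral_mono_set (bm_icc mB bB _ _) (Eventually.of_forall fun σ => abs_nonneg _)
                  (HasSubset.Subset.eventuallyLE fun σ hσ => ⟨by linarith [hσ.1], hσ.2.le⟩)
              · have e1 : ∫ σ in Ioo (0:ℝ) 1, |g (c + -1 * σ / ((k:ℝ) + 1), y) - g (c, y)| =
                    ∫ σ in Ioo (-1:ℝ) 0, |g (c + σ / ((k:ℝ) + 1), y) - g (c, y)| := by
                  rw [← integral_Ioc_eq_integral_Ioo, ← integral_Ioc_eq_integral_Ioo,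
                    ← intervalIntegral.integral_of_le (by norm_num), ← intervalIntegral.integral_of_le (by norm_num)]
                  have := intervalIntegral.integral_comp_neg (a := 0) (b := 1) (fun σ => |g (c + σ / ((k:ℝ) + 1), y) - g (c, y)|)
                  simp only [neg_zero] at this
                  rw [← this]; simp only [neg_one_mul]
                rw [e1]
                exact setIntegral_mono_set (bm_icc mB bB _ _) (Eventually.of_forall fun σ => abs_nonneg _)
                  (HasSubset.Subset.eventuallyLE fun σ hσ => ⟨hσ.1.le, by linarith [hσ.2]⟩)
      _ = C * ∫ y in Ioo (-s) s, ∫ σ in Icc (-1:ℝ) 1, |g (c + σ / ((k:ℝ) + 1), y) - g (c, y)| := integral_const_mul _ _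
      _ ≤ _ := by
          refine mul_le_mul_of_nonneg_left ?_ hC0
          exact setIntegral_mono_set (bm_icc mA bA _ _) (Eventually.of_forall fun y => nA y)
            (HasSubset.Subset.eventuallyLE fun σ hσ => ⟨by linarith [hσ.1], by linarith [hσ.2]⟩)
  have := L1.add L2
  simpa using this

/-- limit of vertical side terms -/
lemma vert {g : ℝ × ℝ → ℝ} (hg : BM g) {R t s : ℝ} (h1 : GoodX g R t) (h2 : GoodX g R (-t)) (hs : s ≤ R)
    {ϑ : ℝ × ℝ → ℝ} (hϑ : Lip ϑ) (hϑb : ∃ C, ∀ p, |ϑ p| ≤ C) :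
    Tendsto (fun k : ℕ => ∫ p, g p * ϑ p * chi s k p.2 * cch t k p.1) atTop
      (𝓝 ((∫ y in Ioo (-s) s, g (-t, y) * ϑ (-t, y)) - ∫ y in Ioo (-s) s, g (t, y) * ϑ (t, y))) := by
  obtain ⟨C, hC⟩ := hϑb
  have hC0 := (abs_nonneg _).trans (hC 0)
  have cm : ∀ k, Measurable (chi s k) := fun k => (chi_lip s k).choose_spec.continuous.measurable
  have key : ∀ (c e : ℝ), (e = 1 ∨ e = -1) → GoodX g R c → Tendsto (fun k : ℕ => ∫ y in Ioo (-s) s, ∫ σ in Ioo (0:ℝ) 1,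
      g (c + e * σ / ((k:ℝ) + 1), y) * (ϑ (c + e * σ / ((k:ℝ) + 1), y) * chi s k y))
      atTop (𝓝 (∫ y in Ioo (-s) s, g (c, y) * ϑ (c, y))) := by
    intro c e he hG
    refine side hg he hG hs (W := fun k p => ϑ (c + e * p.1 / ((k:ℝ) + 1), p.2) * chi s k p.2) (C := C)
      (w := fun y => ϑ (c, y)) (fun k => ?_) (fun k p => ?_) (fun σ hσ y hy => ?_)
    · exact (hϑ.meas.comp (by fun_prop)).mul ((cm k).comp measurable_snd)
    · rw [abs_mul]
      calc _ ≤ C * 1 := mul_le_mul (hC _) (chi_abs _ _ _) (abs_nonneg _) hC0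
        _ = C := mul_one _
    · have a1 : Tendsto (fun k : ℕ => (c + e * σ / ((k:ℝ) + 1), y)) atTop (𝓝 (c, y)) := by
        refine Tendsto.prodMk_nhds ?_ tendsto_const_nhds
        have := (tendsto_one_div_add_atTop_nhds_zero_nat (𝕜 := ℝ)).const_mul (e * σ) |>.const_add c
        simpa [div_eq_mul_inv] using this
      have a2 := (hϑ.cont.tendsto (c, y)).comp a1
      have := a2.mul (chi_tendsto (abs_lt.2 hy))
      simpa using this
  refine ((key (-t) 1 (Or.inl rfl) h2).sub (key t (-1) (Or.inr rfl) h1)).congr fun k => ?_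
  obtain ⟨gm, M, hM⟩ := hg
  have hM0 := (abs_nonneg _).trans (hM 0)
  have FB : BM (fun p => g p * ϑ p * chi s k p.2) :=
    (BM.mul ⟨gm, M, hM⟩ ⟨hϑ.meas, C, hC⟩).mul ⟨(cm k).comp measurable_snd, 1, fun p => chi_abs _ _ _⟩
  have hcb : ∀ x, |cch t k x| ≤ 2 * ((k:ℝ) + 1) := by
    intro x
    have hk : (0:ℝ) ≤ (k:ℝ) + 1 := by positivity
    unfold cch; simp only [indicator]
    split_ifs
    · simp; linarith
    · rw [sub_zero, abs_of_nonneg hk]; linarith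
    · rw [zero_sub, abs_neg, abs_of_nonneg hk]; linarith
    · simp; linarith
  have hInt : Integrable (fun p : ℝ × ℝ => g p * ϑ p * chi s k p.2 * cch t k p.1) := by
    refine BM.int (FB.mul ⟨(cch_meas t k).comp measurable_fst, _, fun p => hcb _⟩) (K := Icc (-(|t| + 1)) (|t| + 1) ×ˢ Icc (-s) s)
      (isCompact_Icc.prod isCompact_Icc) ?_
    intro p hp
    by_cases hy : p.2 ∈ Icc (-s) s
    · have hx : p.1 ∉ Icc (-(|t| + 1)) (|t| + 1) := fun h => hp ⟨h, hy⟩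
      have : cch t k p.1 = 0 := by
        have hδ : 1 / ((k:ℝ) + 1) ≤ 1 := by rw [div_le_one (by positivity)]; linarith [(Nat.cast_nonneg k : (0:ℝ) ≤ k)]
        unfold cch
        rw [indicator_of_notMem, indicator_of_notMem, sub_zero]
        · rintro ⟨a, b⟩; exact hx ⟨by linarith [neg_abs_le t, le_abs_self t], by linarith [neg_abs_le t, le_abs_self t]⟩
        · rintro ⟨a, b⟩; exact hx ⟨by linarith [neg_abs_le t, le_abs_self t], by linarith [neg_abs_le t, le_abs_self t]⟩
      rw [this, mul_zero]
    · have : chi s k p.2 = 0 := chi_zero (by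
        by_contra h; push Not at h; exact hy ⟨(abs_lt.1 h).1.le, (abs_lt.1 h).2.le⟩)
      rw [this]; ring
  rw [Measure.volume_eq_prod] at hInt ⊢
  rw [integral_prod_symm _ hInt]
  have mF : ∀ e : ℝ, ∀ c : ℝ, Measurable fun p : ℝ × ℝ => (fun p => g p * ϑ p * chi s k p.2) (c + e * p.1 / ((k:ℝ) + 1), p.2) := fun e c =>
    FB.meas.comp (by fun_prop)
  obtain ⟨Fm, N, hN⟩ := FB
  have e1 : ∀ y, ∫ x, g (x, y) * ϑ (x, y) * chi s k (x, y).2 * cch t k (x, y).1 =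
      (Ioo (-s) s).indicator (fun y => (∫ σ in Ioo (0:ℝ) 1, g (-t + 1 * σ / ((k:ℝ) + 1), y) * (ϑ (-t + 1 * σ / ((k:ℝ) + 1), y) * chi s k y)) -
        ∫ σ in Ioo (0:ℝ) 1, g (t + (-1) * σ / ((k:ℝ) + 1), y) * (ϑ (t + (-1) * σ / ((k:ℝ) + 1), y) * chi s k y)) y := by
    intro y
    rw [cch_int (F := fun x => g (x, y) * ϑ (x, y) * chi s k y)
      (locInt (Fm.comp (by fun_prop : Measurable fun x : ℝ => (x, y))).aestronglyMeasurable (C := N) (fun x => hN (x, y)))]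
    by_cases hy : y ∈ Ioo (-s) s
    · rw [indicator_of_mem hy]; simp only [mul_assoc]
    · rw [indicator_of_notMem hy]
      have : chi s k y = 0 := chi_zero (by
        by_contra h; push Not at h; exact hy (abs_lt.1 h))
      simp [this]
  simp_rw [e1]
  rw [integral_indicator measurableSet_Ioo, integral_sub]
  · refine bm_ion (C := N) ?_ (fun y => inn_bd fun σ => ?_) _ _
    · have := inn_meas (mF 1 (-t)); simpa only [mul_assoc] using this
    · have := hN (-t + 1 * σ / ((k:ℝ) + 1), y); simpa only [mul_assoc] using this
  · refine bm_ion (C := N) ?_ (fun y => inn_bd fun σ => ?_) _ _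
    · have := inn_meas (mF (-1) t); simpa only [mul_assoc] using this
    · have := hN (t + (-1) * σ / ((k:ℝ) + 1), y); simpa only [mul_assoc] using this

/-- function of first variable: derivative -/
lemma fderiv_fst {a : ℝ → ℝ} {a' : ℝ} {p : ℝ × ℝ} (h : HasDerivAt a a' p.1) :
    DifferentiableAt ℝ (fun q : ℝ × ℝ => a q.1) p ∧ d1 (fun q : ℝ × ℝ => a q.1) p = a' ∧ d2 (fun q : ℝ × ℝ => a q.1) p = 0 := by
  have : HasFDerivAt (fun q : ℝ × ℝ => a q.1) (a' • ContinuousLinearMap.fst ℝ ℝ ℝ) p :=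
    h.comp_hasFDerivAt p (hasFDerivAt_fst)
  refine ⟨this.differentiableAt, ?_, ?_⟩ <;> simp only [d1, d2] <;> rw [this.fderiv] <;> simp

lemma fderiv_snd {a : ℝ → ℝ} {a' : ℝ} {p : ℝ × ℝ} (h : HasDerivAt a a' p.2) :
    DifferentiableAt ℝ (fun q : ℝ × ℝ => a q.2) p ∧ d1 (fun q : ℝ × ℝ => a q.2) p = 0 ∧ d2 (fun q : ℝ × ℝ => a q.2) p = a' := by
  have : HasFDerivAt (fun q : ℝ × ℝ => a q.2) (a' • ContinuousLinearMap.snd ℝ ℝ ℝ) p :=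
    h.comp_hasFDerivAt p (hasFDerivAt_snd)
  refine ⟨this.differentiableAt, ?_, ?_⟩ <;> simp only [d1, d2] <;> rw [this.fderiv] <;> simp

lemma ae_fst {P : ℝ → Prop} (h : ∀ᵐ x, P x) : ∀ᵐ p : ℝ × ℝ, P p.1 := by
  rw [Measure.volume_eq_prod]; exact Measure.quasiMeasurePreserving_fst.ae h
lemma ae_snd {P : ℝ → Prop} (h : ∀ᵐ x, P x) : ∀ᵐ p : ℝ × ℝ, P p.2 := by
  rw [Measure.volume_eq_prod]; exact Measure.quasiMeasurePreserving_snd.ae h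

lemma chi_tst {R t s : ℝ} (ht : t < R) (hs : s < R) (k : ℕ) :
    Tst (Metric.ball (0 : ℝ × ℝ) R) (fun p => chi t k p.1 * chi s k p.2) := by
  obtain ⟨C, hC⟩ := chi_lip t k
  obtain ⟨D, hD⟩ := chi_lip s k
  have z : ∀ t x : ℝ, x ∉ Icc (-t) t → chi t k x = 0 := fun t x h => chi_zero (by
        by_contra h'; push Not at h'; exact h ⟨(abs_lt.1 h').1.le, (abs_lt.1 h').2.le⟩)
  refine tst_prod hC hD isCompact_Icc isCompact_Icc (z t) (z s) ?_
  rintro ⟨x, y⟩ ⟨hx, hy⟩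
  simp only [Metric.mem_ball, dist_zero_right, Prod.norm_def, Real.norm_eq_abs]
  exact max_lt ((abs_le.2 hx).trans_lt ht) ((abs_le.2 hy).trans_lt hs)

theorem BT {H f G : ℝ × ℝ → ℝ} (hH : Lip H) (hf : BM f) (hG : BM G) {R t s : ℝ}
    (hw : Weak (Metric.ball 0 R) H f G) (ht0 : 0 < t) (ht : t < R) (hs0 : 0 < s) (hs : s < R)
    (a1 : GoodX (fun p => f p * d2 H p) R t) (a2 : GoodX (fun p => f p * d2 H p) R (-t))
    (b1 : GoodX (fun p => f p.swap * d1 H p.swap) R s) (b2 : GoodX (fun p => f p.swap * d1 H p.swap) R (-s))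
    {ϑ : ℝ × ℝ → ℝ} (hϑ : Lip ϑ) (hϑb : ∃ C, ∀ p, |ϑ p| ≤ C) :
    ∫ p in Ioo (-t) t ×ˢ Ioo (-s) s, (f p * br H ϑ p + G p * ϑ p) =
      ((∫ y in Ioo (-s) s, f (t, y) * d2 H (t, y) * ϑ (t, y)) - ∫ y in Ioo (-s) s, f (-t, y) * d2 H (-t, y) * ϑ (-t, y)) -
      ((∫ x in Ioo (-t) t, f (x, s) * d1 H (x, s) * ϑ (x, s)) - ∫ x in Ioo (-t) t, f (x, -s) * d1 H (x, -s) * ϑ (x, -s)) := by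
  have V := vert (hf.mul hH.bm_d2) a1 a2 hs.le hϑ hϑb
  have V' := vert ((hf.mul hH.bm_d1).comp measurable_swap) b1 b2 ht.le (hϑ.comp lipschitz_swap)
    ⟨hϑb.choose, fun p => hϑb.choose_spec _⟩
  have e' : ∀ k, ∫ p : ℝ × ℝ, f p.swap * d1 H p.swap * ϑ p.swap * chi t k p.2 * cch s k p.1 =
      ∫ p : ℝ × ℝ, f p * d1 H p * ϑ p * chi t k p.1 * cch s k p.2 := fun k =>
    mp_swap.integral_comp MeasurableEquiv.prodComm.measurableEmbedding
      (fun p : ℝ × ℝ => f p * d1 H p * ϑ p * chi t k p.1 * cch s k p.2)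
  simp_rw [e'] at V'
  have hQ : MeasurableSet (Ioo (-t) t ×ˢ Ioo (-s) s) := measurableSet_Ioo.prod measurableSet_Ioo
  have cm : ∀ t k, Measurable (chi t k) := fun t k => (chi_lip t k).choose_spec.continuous.measurable
  -- bounds
  have hB : BM (fun p => f p * br H ϑ p + G p * ϑ p) := (hf.mul (BM.br hH hϑ)).add (hG.mul ⟨hϑ.meas, hϑb⟩)
  have V0 : Tendsto (fun k => ∫ p : ℝ × ℝ, (f p * br H ϑ p + G p * ϑ p) * (chi t k p.1 * chi s k p.2)) atTop
      (𝓝 (∫ p in Ioo (-t) t ×ˢ Ioo (-s) s, (f p * br H ϑ p + G p * ϑ p))) := by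
    rw [← integral_indicator hQ]
    obtain ⟨Bm, N, hN⟩ := hB
    have z : ∀ k, ∀ p : ℝ × ℝ, p ∉ Ioo (-t) t ×ˢ Ioo (-s) s → chi t k p.1 * chi s k p.2 = 0 := by
      intro k p hp
      by_cases hx : p.1 ∈ Ioo (-t) t
      · rw [chi_zero (t := s), mul_zero]
        by_contra h; push Not at h; exact hp ⟨hx, abs_lt.1 h⟩
      · rw [chi_zero (t := t), zero_mul]
        by_contra h; push Not at h; exact hx (abs_lt.1 h)
    refine tendsto_int (C := N) (K := Icc (-t) t ×ˢ Icc (-s) s) (fun k => ?_) (fun k p => ?_) (isCompact_Icc.prod isCompact_Icc)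
      (fun k p hp => ?_) (Eventually.of_forall fun p => ?_)
    · exact (Bm.mul (((cm t k).comp measurable_fst).mul ((cm s k).comp measurable_snd))).aestronglyMeasurable
    · rw [norm_mul, norm_mul]
      have h0 := (abs_nonneg _).trans (hN 0)
      calc _ ≤ N * (1 * 1) := mul_le_mul (hN p) (mul_le_mul (chi_abs _ _ _) (chi_abs _ _ _) (abs_nonneg _) (by norm_num))
            (by positivity) h0
        _ = N := by ring
    · rw [z k p (fun h => hp ⟨Ioo_subset_Icc_self h.1, Ioo_subset_Icc_self h.2⟩), mul_zero]
    · by_cases hp : p ∈ Ioo (-t) t ×ˢ Ioo (-s) s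
      · rw [indicator_of_mem hp]
        have := ((chi_tendsto (abs_lt.2 hp.1)).mul (chi_tendsto (abs_lt.2 hp.2))).const_mul (f p * br H ϑ p + G p * ϑ p)
        simpa using this
      · rw [indicator_of_notMem hp]; simp_rw [z _ p hp]; simp
  have ev : ∀ᶠ k : ℕ in atTop, (∫ p : ℝ × ℝ, (f p * br H ϑ p + G p * ϑ p) * (chi t k p.1 * chi s k p.2)) +
      (∫ p : ℝ × ℝ, f p * d2 H p * ϑ p * chi s k p.2 * cch t k p.1) -
      (∫ p : ℝ × ℝ, f p * d1 H p * ϑ p * chi t k p.1 * cch s k p.2) = 0 := by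
    have small : ∀ a : ℝ, 0 < a → ∀ᶠ k : ℕ in atTop, 1 / ((k:ℝ) + 1) ≤ a := fun a ha =>
      (tendsto_one_div_add_atTop_nhds_zero_nat (𝕜 := ℝ)).eventually (Iic_mem_nhds ha)
    filter_upwards [small t ht0, small s hs0] with k k1 k2
    have T := (chi_tst ht hs k).mul hϑ
    have hwk := hw _ T
    have hcb : ∀ t x, |cch t k x| ≤ 2 * ((k:ℝ) + 1) := by
      intro t x
      have hk : (0:ℝ) ≤ (k:ℝ) + 1 := by positivity
      unfold cch; simp only [indicator]
      split_ifs
      · simp; linarith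
      · rw [sub_zero, abs_of_nonneg hk]; linarith
      · rw [zero_sub, abs_neg, abs_of_nonneg hk]; linarith
      · simp; linarith
    have bc : ∀ t, BM (fun p : ℝ × ℝ => chi t k p.1) := fun t => ⟨(cm t k).comp measurable_fst, 1, fun p => chi_abs _ _ _⟩
    have bc' : ∀ t, BM (fun p : ℝ × ℝ => chi t k p.2) := fun t => ⟨(cm t k).comp measurable_snd, 1, fun p => chi_abs _ _ _⟩
    have bd : ∀ t, BM (fun p : ℝ × ℝ => cch t k p.1) := fun t => ⟨(cch_meas t k).comp measurable_fst, _, fun p => hcb _ _⟩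
    have bd' : ∀ t, BM (fun p : ℝ × ℝ => cch t k p.2) := fun t => ⟨(cch_meas t k).comp measurable_snd, _, fun p => hcb _ _⟩
    have bϑ : BM ϑ := ⟨hϑ.meas, hϑb⟩
    have zc : ∀ {r x : ℝ}, |r| + 1 < |x| → cch r k x = 0 := by
      intro r x hx
      have hδ : 1 / ((k:ℝ) + 1) ≤ 1 := by rw [div_le_one (by positivity)]; linarith [(Nat.cast_nonneg k : (0:ℝ) ≤ k)]
      unfold cch
      rw [indicator_of_notMem, indicator_of_notMem, sub_zero]
      · rintro ⟨a, b⟩; exact absurd hx (not_lt.2 (abs_le.2 ⟨by linarith [neg_abs_le r, le_abs_self r], by linarith [neg_abs_le r, le_abs_self r]⟩))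
      · rintro ⟨a, b⟩; exact absurd hx (not_lt.2 (abs_le.2 ⟨by linarith [neg_abs_le r, le_abs_self r], by linarith [neg_abs_le r, le_abs_self r]⟩))
    let K := Metric.closedBall (0 : ℝ × ℝ) (t + s + 1)
    have hK : IsCompact K := isCompact_closedBall _ _
    have big : ∀ p : ℝ × ℝ, p ∉ K → t + s + 1 < |p.1| ∨ t + s + 1 < |p.2| := by
      intro p hp
      by_contra h; push Not at h
      apply hp; simpa [K, Prod.norm_def] using h
    have i0 : Integrable (fun p : ℝ × ℝ => (f p * br H ϑ p + G p * ϑ p) * (chi t k p.1 * chi s k p.2)) := by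
      refine (hB.mul ((bc t).mul (bc' s))).int hK fun p hp => ?_
      rcases big p hp with h | h
      · rw [chi_zero (t := t) (by linarith)]; ring
      · rw [chi_zero (t := s) (by linarith)]; ring
    have i1 : Integrable (fun p : ℝ × ℝ => f p * d2 H p * ϑ p * chi s k p.2 * cch t k p.1) := by
      refine ((((hf.mul hH.bm_d2).mul bϑ).mul (bc' s)).mul (bd t)).int hK fun p hp => ?_
      rcases big p hp with h | h
      · rw [zc (r := t) (by rw [abs_of_pos ht0]; linarith)]; ring
      · rw [chi_zero (t := s) (by linarith)]; ring
    have i2 : Integrable (fun p : ℝ × ℝ => f p * d1 H p * ϑ p * chi t k p.1 * cch s k p.2) := by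
      refine ((((hf.mul hH.bm_d1).mul bϑ).mul (bc t)).mul (bd' s)).int hK fun p hp => ?_
      rcases big p hp with h | h
      · rw [chi_zero (t := t) (by linarith)]; ring
      · rw [zc (r := s) (by rw [abs_of_pos hs0]; linarith)]; ring
    have i01 : Integrable (fun p : ℝ × ℝ => (f p * br H ϑ p + G p * ϑ p) * (chi t k p.1 * chi s k p.2) +
      f p * d2 H p * ϑ p * chi s k p.2 * cch t k p.1) := i0.add i1
    rw [← integral_add i0 i1, ← integral_sub i01 i2]
    have hwk' : ∫ p, (f p * br H (fun p => ϑ p * (chi t k p.1 * chi s k p.2)) p + G p * (ϑ p * (chi t k p.1 * chi s k p.2))) = 0 := by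
      rw [integral_add (T.int_br hH hf) (T.int hG), hwk]; ring
    rw [← hwk']
    apply integral_congr_ae
    filter_upwards [hϑ.ae_diff, ae_fst (chi_deriv_ae k1), ae_snd (chi_deriv_ae k2)] with p p1 p2 p3
    obtain ⟨q1, q2, q3⟩ := fderiv_fst p2
    obtain ⟨r1, r2, r3⟩ := fderiv_snd p3
    rw [br_mul p1 (g := fun p : ℝ × ℝ => chi t k p.1 * chi s k p.2) (q1.mul r1), br_mul q1 r1]
    simp only [br, q2, q3, r2, r3]
    ring
  have L := (V0.add V).sub V'
  have := tendsto_nhds_unique (L.congr' ev) tendsto_const_nhds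
  simp only [Prod.swap_prod_mk] at this
  linarith

/-- clamp -/
def cl (t x : ℝ) : ℝ := max (-t) (min t x)
lemma cl_lip (t : ℝ) : LipschitzWith 1 (cl t) := (LipschitzWith.id.const_min t).const_max (-t)
lemma cl_in {t x : ℝ} (h : |x| ≤ t) : cl t x = x := by
  obtain ⟨a, b⟩ := abs_le.1 h
  rw [cl, min_eq_right b, max_eq_right a]
lemma cl_ge {t x : ℝ} (ht : 0 ≤ t) (h : t ≤ x) : cl t x = t := by
  rw [cl, min_eq_left h, max_eq_right (by linarith)]
lemma cl_le {t x : ℝ} (ht : 0 ≤ t) (h : x ≤ -t) : cl t x = -t := by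
  rw [cl, min_eq_right (by linarith), max_eq_left (by linarith)]
lemma cl_abs {t : ℝ} (ht : 0 ≤ t) (x : ℝ) : |cl t x| ≤ t :=
  abs_le.2 ⟨le_max_left _ _, max_le (by linarith) (min_le_left _ _)⟩
lemma cl_sub (t x y : ℝ) : |cl t x - cl t y| ≤ |x - y| := by
  simpa [Real.dist_eq] using (cl_lip t).dist_le_mul x y

lemma cl_ev {t x : ℝ} (ht : 0 ≤ t) (h : t < |x|) : (cl t x = t ∨ cl t x = -t) ∧ ∀ᶠ y in 𝓝 x, cl t y = cl t x := by
  rcases lt_or_ge x 0 with a | a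
  · rw [abs_of_neg a] at h
    refine ⟨Or.inr (cl_le ht (by linarith)), ?_⟩
    filter_upwards [Iio_mem_nhds (show x < -t by linarith)] with y hy
    simp only [mem_Iio] at hy
    rw [cl_le ht (by linarith), cl_le ht (by linarith)]
  · rw [abs_of_nonneg a] at h
    refine ⟨Or.inl (cl_ge ht (by linarith)), ?_⟩
    filter_upwards [Ioi_mem_nhds h] with y hy
    simp only [mem_Ioi] at hy
    rw [cl_ge ht (by linarith), cl_ge ht (by linarith)]

/-- constant extension from a rectangle -/
def ext (t s : ℝ) (H : ℝ × ℝ → ℝ) (p : ℝ × ℝ) : ℝ := H (cl t p.1, cl s p.2)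

lemma ext_lip {H : ℝ × ℝ → ℝ} (hH : Lip H) (t s : ℝ) : Lip (ext t s H) := by
  refine hH.comp (g := fun p => (cl t p.1, cl s p.2)) (D := 1) (LipschitzWith.of_dist_le_mul fun p q => ?_)
  simp only [Prod.dist_eq, NNReal.coe_one, one_mul, Real.dist_eq]
  exact max_le_max (cl_sub _ _ _) (cl_sub _ _ _)

lemma ext_bm {f : ℝ × ℝ → ℝ} (hf : BM f) (t s : ℝ) : BM (ext t s f) :=
  hf.comp (((cl_lip t).continuous.measurable.comp measurable_fst).prodMk ((cl_lip s).continuous.measurable.comp measurable_snd))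

lemma ext_swap (t s : ℝ) (H : ℝ × ℝ → ℝ) : (fun p : ℝ × ℝ => ext t s H p.swap) = ext s t (fun p => H p.swap) := rfl

lemma ae_ne (a : ℝ) : ∀ᵐ x : ℝ, x ≠ a := by rw [ae_iff]; simp

lemma abs_ne_ae {t : ℝ} (ht : 0 ≤ t) : ∀ᵐ x : ℝ, |x| ≠ t := by
  filter_upwards [ae_ne t, ae_ne (-t)] with x h1 h2 h
  rcases (abs_eq ht).1 h with h | h
  · exact h1 h
  · exact h2 h

lemma ext_d2 {H : ℝ × ℝ → ℝ} {t s : ℝ} (ht : 0 ≤ t) (hs : 0 ≤ s)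
    (h1 : ∀ᵐ y, DifferentiableAt ℝ H (t, y)) (h2 : ∀ᵐ y, DifferentiableAt ℝ H (-t, y)) (hd : ∀ᵐ p, DifferentiableAt ℝ (ext t s H) p) :
    ∀ᵐ p, d2 (ext t s H) p = if |p.2| < s then d2 H (cl t p.1, p.2) else 0 := by
  filter_upwards [ae_snd h1, ae_snd h2, ae_fst (abs_ne_ae ht), ae_snd (abs_ne_ae hs), hd] with p p1 p2 p3 p4 p5
  have L := hasDerivAt_line2 (F := ext t s H) (x := p.1) (y := p.2) p5
  rcases lt_or_gt_of_ne p4 with a | a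
  · rw [if_pos a]
    have ev : ∀ᶠ y in 𝓝 p.2, |y| < s := (continuous_abs.tendsto p.2).eventually (gt_mem_nhds a)
    rcases lt_or_gt_of_ne p3 with b | b
    · rw [cl_in b.le]
      have ev' : ∀ᶠ x in 𝓝 p.1, |x| < t := (continuous_abs.tendsto p.1).eventually (gt_mem_nhds b)
      have : ext t s H =ᶠ[𝓝 p] H := by
        filter_upwards [(continuous_fst.tendsto p).eventually ev', (continuous_snd.tendsto p).eventually ev] with q q1 q2
        simp only [ext]; rw [cl_in q1.le, cl_in q2.le]
      simp only [d2]; rw [this.fderiv_eq]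
    · obtain ⟨c1, -⟩ := cl_ev ht b
      have D : DifferentiableAt ℝ H (cl t p.1, p.2) := by
        rcases c1 with c | c <;> rw [c] <;> assumption
      have L' := hasDerivAt_line2 D
      refine L.unique (L'.congr_of_eventuallyEq ?_)
      filter_upwards [ev] with y hy
      simp only [ext]; rw [cl_in hy.le]
  · rw [if_neg (not_lt.2 a.le)]
    obtain ⟨-, c2⟩ := cl_ev hs a
    refine L.unique ((hasDerivAt_const _ (H (cl t p.1, cl s p.2))).congr_of_eventuallyEq ?_)
    filter_upwards [c2] with y hy
    simp only [ext]; rw [hy]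

lemma ext_d1 {H : ℝ × ℝ → ℝ} {t s : ℝ} (ht : 0 ≤ t) (hs : 0 ≤ s)
    (h1 : ∀ᵐ x, DifferentiableAt ℝ H (x, s)) (h2 : ∀ᵐ x, DifferentiableAt ℝ H (x, -s)) (hd : ∀ᵐ p, DifferentiableAt ℝ (ext t s H) p) :
    ∀ᵐ p, d1 (ext t s H) p = if |p.1| < t then d1 H (p.1, cl s p.2) else 0 := by
  have sd : ∀ {F : ℝ × ℝ → ℝ} {p : ℝ × ℝ}, DifferentiableAt ℝ F p.swap → DifferentiableAt ℝ (fun q : ℝ × ℝ => F q.swap) p := by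
    intro F p h
    exact DifferentiableAt.comp (g := F) p h (ContinuousLinearEquiv.prodComm ℝ ℝ ℝ).differentiableAt
  have := ext_d2 (H := fun p => H p.swap) hs ht (h1.mono fun x hx => sd hx) (h2.mono fun x hx => sd hx)
    ((ae_swap hd).mono fun p hp => sd (F := ext t s H) hp)
  filter_upwards [ae_swap this] with p hp
  rw [← ext_swap, d2_swap, d2_swap] at hp
  simpa using hp

/-- one dimensional estimate on the right collar -/
lemma collar_r {h : ℝ → ℝ} {C : ℝ≥0} (hh : LipschitzWith C h) {h' : ℝ → ℝ} (hd : ∀ᵐ x, HasDerivAt h (h' x) x)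
    {θ : ℝ → ℝ} (hθ : Measurable θ) {Θ : ℝ} (hb : ∀ x, |θ x| ≤ Θ) {t L : ℝ} (hL : t + 1 < L) (h0 : h L = 0) (ht : 0 ≤ t) :
    |h t + ∫ σ in Ioo (0:ℝ) 1, θ (t + 1 + (-1) * σ / (((0:ℕ):ℝ) + 1))| ≤ ∫ x in Ioo t L, |h' x + θ x * cch (t + 1) 0 x| := by
  have i1 := lip_ftc_int hh hd t L
  have e1 := lip_ftc hh hd t L
  rw [h0] at e1
  have i1' : IntegrableOn h' (Ioo t L) := by
    rw [intervalIntegrable_iff_integrableOn_Ioo_of_le (by linarith)] at i1; exact i1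
  have e1' : ∫ x in Ioo t L, h' x = 0 - h t := by
    rw [← integral_Ioc_eq_integral_Ioo, ← intervalIntegral.integral_of_le (by linarith)]; exact e1
  have e2 : ∀ x ∈ Ioo t L, θ x * cch (t + 1) 0 x = (Ioo t (t+1)).indicator (fun x => - θ x) x := by
    intro x hx
    unfold cch
    rw [indicator_of_notMem (by simp only [mem_Ioo]; rintro ⟨a, b⟩; norm_num at b; linarith [hx.1])]
    by_cases h : x ∈ Ioo t (t+1)
    · rw [indicator_of_mem h, indicator_of_mem (by norm_num; exact h)]; norm_num
    · rw [indicator_of_notMem h, indicator_of_notMem (by norm_num; simpa using h)]; simp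
  have e3 : ∫ x in Ioo t L, θ x * cch (t + 1) 0 x = - ∫ σ in Ioo (0:ℝ) 1, θ (t + 1 + (-1) * σ / (((0:ℕ):ℝ) + 1)) := by
    rw [setIntegral_congr_fun measurableSet_Ioo e2, integral_indicator measurableSet_Ioo, Measure.restrict_restrict measurableSet_Ioo,
      inter_eq_left.2 (Ioo_subset_Ioo_right hL.le), integral_neg]
    congr 1
    rw [← integral_Ioc_eq_integral_Ioo, ← intervalIntegral.integral_of_le (by linarith),
      ← integral_Ioc_eq_integral_Ioo, ← intervalIntegral.integral_of_le (by norm_num)]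
    have := intervalIntegral.integral_comp_sub_left (a := 0) (b := 1) θ (t + 1)
    simp only [sub_zero, add_sub_cancel_right] at this
    rw [← this]; congr 1; ext σ; norm_num; congr 1
  have i2 : IntegrableOn (fun x => θ x * cch (t + 1) 0 x) (Ioo t L) := by
    refine IntegrableOn.congr_fun ?_ (fun x hx => (e2 x hx).symm) measurableSet_Ioo
    exact bm_ion (hθ.neg.indicator measurableSet_Ioo) (C := Θ) (fun x => by
      simp only [indicator]; split_ifs
      · simp only [Pi.neg_apply]; rw [abs_neg]; exact hb x
      · simpa using (abs_nonneg _).trans (hb 0)) _ _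
  have e4 : h t + ∫ σ in Ioo (0:ℝ) 1, θ (t + 1 + (-1) * σ / (((0:ℕ):ℝ) + 1)) = - ∫ x in Ioo t L, (h' x + θ x * cch (t + 1) 0 x) := by
    rw [integral_add i1' i2, e1', e3]; ring
  rw [e4, abs_neg, ← Real.norm_eq_abs]
  exact norm_integral_le_integral_norm _

lemma collar_l {h : ℝ → ℝ} {C : ℝ≥0} (hh : LipschitzWith C h) {h' : ℝ → ℝ} (hd : ∀ᵐ x, HasDerivAt h (h' x) x)
    {θ : ℝ → ℝ} (hθ : Measurable θ) {Θ : ℝ} (hb : ∀ x, |θ x| ≤ Θ) {t L : ℝ} (hL : t + 1 < L) (h0 : h (-L) = 0) (ht : 0 ≤ t) :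
    |h (-t) + ∫ σ in Ioo (0:ℝ) 1, θ (-(t + 1) + 1 * σ / (((0:ℕ):ℝ) + 1))| ≤ ∫ x in Ioo (-L) (-t), |h' x + θ x * cch (t + 1) 0 x| := by
  have hd' : ∀ᵐ x, HasDerivAt (fun x => h (-x)) (-h' (-x)) x := by
    have := (Measure.measurePreserving_neg (volume : Measure ℝ)).quasiMeasurePreserving.ae hd
    filter_upwards [this] with x hx
    have := HasDerivAt.comp (h₂ := h) (h := fun x => -x) x hx (hasDerivAt_neg x)
    simp only [mul_neg, mul_one] at this
    exact this
  have hh' : LipschitzWith C (fun x => h (-x)) := by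
    have := hh.comp (LipschitzWith.id.neg : LipschitzWith 1 (-id : ℝ → ℝ))
    rw [mul_one] at this
    exact this
  have := collar_r hh' hd' (θ := fun x => θ (-x)) (hθ.comp measurable_neg) (fun x => hb _) hL h0 ht
  have e : ∫ x in Ioo t L, |-h' (-x) + θ (-x) * cch (t + 1) 0 x| = ∫ x in Ioo (-L) (-t), |h' x + θ x * cch (t + 1) 0 x| := by
    have o : ∀ x, cch (t+1) 0 (-x) = - cch (t+1) 0 x := by
      intro x
      have a1 : ∀ T δ : ℝ, -x ∈ Ioo (-T) (-T + δ) ↔ x ∈ Ioo (T - δ) T := fun T δ => by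
        simp only [mem_Ioo]; constructor <;> rintro ⟨a, b⟩ <;> constructor <;> linarith
      have a2 : ∀ T δ : ℝ, -x ∈ Ioo (T - δ) T ↔ x ∈ Ioo (-T) (-T + δ) := fun T δ => by
        simp only [mem_Ioo]; constructor <;> rintro ⟨a, b⟩ <;> constructor <;> linarith
      unfold cch
      simp only [indicator, a1, a2]; ring
    rw [← integral_Ioc_eq_integral_Ioo, ← integral_Ioc_eq_integral_Ioo, ← intervalIntegral.integral_of_le (by linarith),
      ← intervalIntegral.integral_of_le (by linarith)]
    have := intervalIntegral.integral_comp_neg (a := t) (b := L) (fun x => |h' x + θ x * cch (t + 1) 0 x|)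
    rw [← this]
    congr 1; ext x
    rw [o, show h' (-x) + θ (-x) * -cch (t + 1) 0 x = -(-h' (-x) + θ (-x) * cch (t + 1) 0 x) by ring, abs_neg]
  rw [e] at this
  refine le_trans (le_of_eq ?_) this
  congr 3; ext σ; congr 1; ring

lemma ae_yx {P : ℝ × ℝ → Prop} (h : ∀ᵐ p, P p) : ∀ᵐ y : ℝ, ∀ᵐ x : ℝ, P (x, y) := by
  have := ae_swap h
  rw [Measure.volume_eq_prod] at this
  exact Measure.ae_ae_of_ae_prod this

lemma diff_swap {F : ℝ × ℝ → ℝ} {p : ℝ × ℝ} (h : DifferentiableAt ℝ F p.swap) : DifferentiableAt ℝ (fun q : ℝ × ℝ => F q.swap) p :=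
  DifferentiableAt.comp (g := F) p h (ContinuousLinearEquiv.prodComm ℝ ℝ ℝ).differentiableAt

/-- good rectangles for `H` -/
structure Geo (H : ℝ × ℝ → ℝ) (t s : ℝ) : Prop where
  ht : 0 < t
  hs : 0 < s
  hl : Lip H
  r : ∀ᵐ y, DifferentiableAt ℝ H (t, y)
  l : ∀ᵐ y, DifferentiableAt ℝ H (-t, y)
  u : ∀ᵐ x, DifferentiableAt ℝ H (x, s)
  d : ∀ᵐ x, DifferentiableAt ℝ H (x, -s)

lemma Geo.swap {H : ℝ × ℝ → ℝ} {t s : ℝ} (h : Geo H t s) : Geo (fun p => H p.swap) s t :=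
  ⟨h.hs, h.ht, h.hl.comp lipschitz_swap, h.u.mono fun _ hx => diff_swap hx, h.d.mono fun _ hx => diff_swap hx,
    h.r.mono fun _ hx => diff_swap hx, h.l.mono fun _ hx => diff_swap hx⟩

/-- plateau -/
def phi (t s : ℝ) (p : ℝ × ℝ) : ℝ := chi (t + 1) 0 p.1 * chi (s + 1) 0 p.2
/-- crossing density -/
def PP (H : ℝ × ℝ → ℝ) (t s : ℝ) (p : ℝ × ℝ) : ℝ := br (ext t s H) (phi t s) p

/-- vertical part of crossing density -/
def pv (H : ℝ × ℝ → ℝ) (t s : ℝ) (p : ℝ × ℝ) : ℝ := d2 (ext t s H) p * cch (t + 1) 0 p.1 * chi (s + 1) 0 p.2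

lemma chi_m (t : ℝ) (k : ℕ) : Measurable (chi t k) := (chi_lip t k).choose_spec.continuous.measurable

lemma cch_bd (t : ℝ) (k : ℕ) (x : ℝ) : |cch t k x| ≤ 2 * ((k:ℝ) + 1) := by
  have hk : (0:ℝ) ≤ (k:ℝ) + 1 := by positivity
  unfold cch; simp only [indicator]
  split_ifs
  · simp; linarith
  · rw [sub_zero, abs_of_nonneg hk]; linarith
  · rw [zero_sub, abs_neg, abs_of_nonneg hk]; linarith
  · simp; linarith

lemma cch_zero {t : ℝ} {k : ℕ} {x : ℝ} (h : |t| + 1 < |x|) : cch t k x = 0 := by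
  have hδ : 1 / ((k:ℝ) + 1) ≤ 1 := by rw [div_le_one (by positivity)]; linarith [(Nat.cast_nonneg k : (0:ℝ) ≤ k)]
  unfold cch
  rw [indicator_of_notMem, indicator_of_notMem, sub_zero]
  · rintro ⟨a, b⟩; exact absurd h (not_lt.2 (abs_le.2 ⟨by linarith [neg_abs_le t, le_abs_self t], by linarith [neg_abs_le t, le_abs_self t]⟩))
  · rintro ⟨a, b⟩; exact absurd h (not_lt.2 (abs_le.2 ⟨by linarith [neg_abs_le t, le_abs_self t], by linarith [neg_abs_le t, le_abs_self t]⟩))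

lemma pv_bm {H : ℝ × ℝ → ℝ} (hH : Lip H) (t s : ℝ) : BM (pv H t s) :=
  ((ext_lip hH t s).bm_d2.mul ⟨(cch_meas _ _).comp measurable_fst, _, fun p => cch_bd _ _ _⟩).mul
    ⟨(chi_m _ _).comp measurable_snd, 1, fun p => chi_abs _ _ _⟩

lemma pv_cpt {H : ℝ × ℝ → ℝ} {t s : ℝ} (ht : 0 < t) (hs : 0 < s) (p : ℝ × ℝ) (hp : p ∉ Metric.closedBall (0 : ℝ × ℝ) (t + s + 2)) :
    pv H t s p = 0 := by
  have : t + s + 2 < |p.1| ∨ t + s + 2 < |p.2| := by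
    by_contra h; push Not at h
    apply hp; simpa [Prod.norm_def] using h
  unfold pv
  rcases this with h | h
  · rw [cch_zero (by rw [abs_of_pos (by linarith)]; linarith)]; ring
  · rw [chi_zero (by linarith)]; ring

lemma phi_lip (t s : ℝ) : Lip (phi t s) := by
  obtain ⟨C, hC⟩ := chi_lip (t+1) 0
  obtain ⟨D, hD⟩ := chi_lip (s+1) 0
  exact (Lip.fst.comp1 hC).mul (Lip.snd.comp1 hD) (fun p => chi_abs _ _ _) (fun p => chi_abs _ _ _)

lemma PP_swap (H : ℝ × ℝ → ℝ) (t s : ℝ) (p : ℝ × ℝ) : PP (fun q => H q.swap) s t p = - PP H t s p.swap := by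
  unfold PP
  rw [← ext_swap, ← br_swap]
  congr 1
  ext q; simp only [phi, Prod.fst_swap, Prod.snd_swap]; ring

lemma pv_swap (H : ℝ × ℝ → ℝ) (t s : ℝ) (p : ℝ × ℝ) : pv (fun q => H q.swap) s t p =
    d1 (ext t s H) p.swap * cch (s + 1) 0 p.1 * chi (t + 1) 0 p.2 := by
  unfold pv
  rw [← ext_swap, d2_swap]

lemma PP_ae {H : ℝ × ℝ → ℝ} {t s : ℝ} (ht : 0 < t) (hs : 0 < s) :
    ∀ᵐ p, PP H t s p = pv H t s p - pv (fun q => H q.swap) s t p.swap := by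
  filter_upwards [ae_fst (chi_deriv_ae (t := t + 1) (k := 0) (by norm_num; linarith)),
    ae_snd (chi_deriv_ae (t := s + 1) (k := 0) (by norm_num; linarith))] with p p2 p3
  obtain ⟨q1, q2, q3⟩ := fderiv_fst p2
  obtain ⟨r1, r2, r3⟩ := fderiv_snd p3
  rw [pv_swap]
  unfold PP phi pv
  rw [br_mul q1 r1]
  simp only [br, q2, q3, r2, r3, Prod.swap_swap, Prod.fst_swap, Prod.snd_swap]
  ring

lemma PP_int {H : ℝ × ℝ → ℝ} {t s : ℝ} (hH : Lip H) (ht : 0 < t) (hs : 0 < s) {θ : ℝ × ℝ → ℝ} (hθ : BM θ) :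
    ∫ p, θ p * PP H t s p = (∫ p, θ p * pv H t s p) - ∫ p : ℝ × ℝ, θ p.swap * pv (fun q => H q.swap) s t p := by
  have e : ∫ p : ℝ × ℝ, θ p.swap * pv (fun q => H q.swap) s t p = ∫ p : ℝ × ℝ, θ p * pv (fun q => H q.swap) s t p.swap := by
    have := mp_swap.integral_comp MeasurableEquiv.prodComm.measurableEmbedding
      (fun p : ℝ × ℝ => θ p * pv (fun q => H q.swap) s t p.swap)
    simpa using this
  have hK : IsCompact (Metric.closedBall (0 : ℝ × ℝ) (t + s + 2)) := isCompact_closedBall _ _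
  have i1 : Integrable fun p => θ p * pv H t s p :=
    (hθ.mul (pv_bm hH t s)).int hK fun p hp => by rw [pv_cpt ht hs p hp, mul_zero]
  have i2 : Integrable fun p : ℝ × ℝ => θ p * pv (fun q => H q.swap) s t p.swap :=
    (hθ.mul ((pv_bm (hH.comp lipschitz_swap) s t).comp measurable_swap)).int hK fun p hp => by
      rw [pv_cpt hs ht p.swap (by
        rw [show s + t + 2 = t + s + 2 by ring]
        intro h; apply hp
        simpa [Prod.norm_def, and_comm] using h), mul_zero]
  rw [e, ← integral_sub i1 i2]
  apply integral_congr_ae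
  filter_upwards [PP_ae (H := H) ht hs] with p hp
  rw [hp]; ring

/-- average on right collar -/
def avR (t : ℝ) (θ : ℝ × ℝ → ℝ) (y : ℝ) : ℝ := ∫ σ in Ioo (0:ℝ) 1, θ (t + 1 + (-1) * σ / (((0:ℕ):ℝ) + 1), y)
/-- average on left collar -/
def avL (t : ℝ) (θ : ℝ × ℝ → ℝ) (y : ℝ) : ℝ := ∫ σ in Ioo (0:ℝ) 1, θ (-(t + 1) + 1 * σ / (((0:ℕ):ℝ) + 1), y)

lemma avR_meas (t : ℝ) {θ : ℝ × ℝ → ℝ} (hθ : Measurable θ) : Measurable (avR t θ) :=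
  inn_meas (F := fun p => θ (t + 1 + (-1) * p.1 / (((0:ℕ):ℝ) + 1), p.2)) (hθ.comp (by fun_prop))
lemma avL_meas (t : ℝ) {θ : ℝ × ℝ → ℝ} (hθ : Measurable θ) : Measurable (avL t θ) :=
  inn_meas (F := fun p => θ (-(t + 1) + 1 * p.1 / (((0:ℕ):ℝ) + 1), p.2)) (hθ.comp (by fun_prop))
lemma avR_bd (t : ℝ) {θ : ℝ × ℝ → ℝ} {C : ℝ} (hθ : ∀ p, |θ p| ≤ C) (y : ℝ) : |avR t θ y| ≤ C := inn_bd fun _ => hθ _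
lemma avL_bd (t : ℝ) {θ : ℝ × ℝ → ℝ} {C : ℝ} (hθ : ∀ p, |θ p| ≤ C) (y : ℝ) : |avL t θ y| ≤ C := inn_bd fun _ => hθ _

lemma chi_one {s y : ℝ} (h : |y| ≤ s) : chi (s + 1) 0 y = 1 := by
  have : 1 ≤ (s + 1 - |y|) * (((0:ℕ):ℝ) + 1) := by norm_num; linarith
  unfold chi; rw [min_eq_left this, max_eq_right (by norm_num)]

/-- multiplication by extended functions -/
lemma av_ext {t s : ℝ} (ht : 0 < t) (f θ : ℝ × ℝ → ℝ) {y : ℝ} (hy : |y| < s) :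
    avR t (fun p => ext t s f p * θ p) y = f (t, y) * avR t θ y ∧ avL t (fun p => ext t s f p * θ p) y = f (-t, y) * avL t θ y := by
  constructor
  · unfold avR
    rw [← integral_const_mul]
    refine setIntegral_congr_fun measurableSet_Ioo fun σ hσ => ?_
    have : cl t (t + 1 + (-1) * σ / (((0:ℕ):ℝ) + 1)) = t := cl_ge ht.le (by norm_num; linarith [hσ.2])
    simp only [ext]
    rw [this, cl_in hy.le]
  · unfold avL
    rw [← integral_const_mul]
    refine setIntegral_congr_fun measurableSet_Ioo fun σ hσ => ?_
    have : cl t (-(t + 1) + 1 * σ / (((0:ℕ):ℝ) + 1)) = -t := cl_le ht.le (by norm_num; linarith [hσ.2])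
    simp only [ext]
    rw [this, cl_in hy.le]

lemma pv_int {H : ℝ × ℝ → ℝ} {t s : ℝ} (g : Geo H t s) {θ : ℝ × ℝ → ℝ} (hθ : BM θ) :
    ∫ p, θ p * pv H t s p = (∫ y in Ioo (-s) s, d2 H (-t, y) * avL t θ y) - ∫ y in Ioo (-s) s, d2 H (t, y) * avR t θ y := by
  have ht := g.ht
  have hs := g.hs
  have hK : IsCompact (Metric.closedBall (0 : ℝ × ℝ) (t + s + 2)) := isCompact_closedBall _ _
  have i1 : Integrable fun p => θ p * pv H t s p :=
    (hθ.mul (pv_bm g.hl t s)).int hK fun p hp => by rw [pv_cpt ht hs p hp, mul_zero]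
  have D2 := ext_d2 ht.le hs.le g.r g.l (ext_lip g.hl t s).ae_diff
  have e : ∀ᵐ y : ℝ, ∫ x, θ (x, y) * pv H t s (x, y) = (Ioo (-s) s).indicator (fun y => d2 H (-t, y) * avL t θ y - d2 H (t, y) * avR t θ y) y := by
    filter_upwards [ae_yx D2] with y hy
    obtain ⟨θm, Θ, hΘ⟩ := hθ
    have θl : ∀ c : ℝ, LocallyIntegrable (fun x => c * θ (x, y)) := fun c =>
      locInt ((θm.comp (by fun_prop : Measurable fun x : ℝ => (x, y))).const_mul c).aestronglyMeasurable (C := |c| * Θ)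
        (fun x => by rw [norm_mul]; exact mul_le_mul_of_nonneg_left (hΘ _) (abs_nonneg _))
    by_cases h : y ∈ Ioo (-s) s
    · rw [indicator_of_mem h]
      have hys : |y| < s := abs_lt.2 h
      have : ∫ x, θ (x, y) * pv H t s (x, y) = ∫ x, (d2 H (cl t x, y) * θ (x, y)) * cch (t + 1) 0 x := by
        apply integral_congr_ae
        filter_upwards [hy] with x hx
        unfold pv
        rw [hx]
        simp only [if_pos hys, chi_one hys.le]; ring
      rw [this, cch_int]
      · unfold avL avR
        rw [← integral_const_mul, ← integral_const_mul]
        congr 1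
        · refine setIntegral_congr_fun measurableSet_Ioo fun σ hσ => ?_
          have : cl t (-(t + 1) + 1 * σ / (((0:ℕ):ℝ) + 1)) = -t := cl_le ht.le (by norm_num; linarith [hσ.2])
          simp only [this]
        · refine setIntegral_congr_fun measurableSet_Ioo fun σ hσ => ?_
          have : cl t (t + 1 + (-1) * σ / (((0:ℕ):ℝ) + 1)) = t := cl_ge ht.le (by norm_num; linarith [hσ.2])
          simp only [this]
      · obtain ⟨C, hC⟩ := g.hl
        refine locInt (C := C * Θ) (Measurable.aestronglyMeasurable ?_) (fun x => ?_)
        · exact ((measurable_d2 H).comp ((cl_lip t).continuous.measurable.prodMk measurable_const)).mul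
            (θm.comp (by fun_prop : Measurable fun x : ℝ => (x, y)))
        · rw [norm_mul]; exact mul_le_mul (d2_le hC _) (hΘ _) (abs_nonneg _) C.2
    · rw [indicator_of_notMem h]
      have hys : ¬ |y| < s := fun h' => h (abs_lt.1 h')
      rw [← integral_zero ℝ ℝ (μ := volume)]
      apply integral_congr_ae
      filter_upwards [hy] with x hx
      unfold pv
      rw [hx]
      simp only [if_neg hys]; ring
  rw [Measure.volume_eq_prod] at i1 ⊢
  rw [integral_prod_symm _ i1, integral_congr_ae e, integral_indicator measurableSet_Ioo]
  obtain ⟨θm, Θ, hΘ⟩ := hθ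
  obtain ⟨C, hC⟩ := g.hl
  rw [integral_sub]
  · refine bm_ion (C := C * Θ) (((measurable_d2 H).comp (by fun_prop)).mul (avL_meas t θm)) (fun y => ?_) _ _
    show |d2 H (-t, y) * avL t θ y| ≤ _
    rw [abs_mul]; exact mul_le_mul (d2_le hC _) (avL_bd t hΘ _) (abs_nonneg _) C.2
  · refine bm_ion (C := C * Θ) (((measurable_d2 H).comp (by fun_prop)).mul (avR_meas t θm)) (fun y => ?_) _ _
    show |d2 H (t, y) * avR t θ y| ≤ _
    rw [abs_mul]; exact mul_le_mul (d2_le hC _) (avR_bd t hΘ _) (abs_nonneg _) C.2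

/-- residual -/
def rq (H : ℝ × ℝ → ℝ) (t s : ℝ) (ϑ θ : ℝ × ℝ → ℝ) (p : ℝ × ℝ) : ℝ := br (ext t s H) ϑ p + θ p * PP H t s p

lemma rq_swap (H ϑ θ : ℝ × ℝ → ℝ) (t s : ℝ) (p : ℝ × ℝ) :
    rq (fun q => H q.swap) s t (fun q => ϑ q.swap) (fun q => θ q.swap) p = - rq H t s ϑ θ p.swap := by
  unfold rq; rw [PP_swap, ← ext_swap, br_swap]; ring

lemma PP_bm {H : ℝ × ℝ → ℝ} (hH : Lip H) (t s : ℝ) : BM (PP H t s) := BM.br (ext_lip hH t s) (phi_lip t s)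

lemma rq_bm {H ϑ θ : ℝ × ℝ → ℝ} (hH : Lip H) (hϑ : Lip ϑ) (hθ : BM θ) (t s : ℝ) : BM (rq H t s ϑ θ) :=
  (BM.br (ext_lip hH t s) hϑ).add (hθ.mul (PP_bm hH t s))

/-- two intervals -/
def SS (t L : ℝ) : Set ℝ := Ioo (-L) (-t) ∪ Ioo t L
lemma SS_meas (t L : ℝ) : MeasurableSet (SS t L) := measurableSet_Ioo.union measurableSet_Ioo
lemma SS_bdd (t L : ℝ) : Bornology.IsBounded (SS t L) := (Metric.isBounded_Ioo _ _).union (Metric.isBounded_Ioo _ _)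

lemma rq_col {H ϑ θ : ℝ × ℝ → ℝ} {t s : ℝ} (g : Geo H t s) (hϑ : Lip ϑ) :
    ∀ᵐ y : ℝ, |y| < s → ∀ᵐ x : ℝ, t < |x| → rq H t s ϑ θ (x, y) =
      d2 H (cl t x, y) * (d1 ϑ (x, y) + θ (x, y) * cch (t + 1) 0 x) := by
  have ht := g.ht
  have hs := g.hs
  have D2 := ext_d2 ht.le hs.le g.r g.l (ext_lip g.hl t s).ae_diff
  have D1 := ext_d1 ht.le hs.le g.u g.d (ext_lip g.hl t s).ae_diff
  filter_upwards [ae_yx D2, ae_yx D1, ae_yx (PP_ae (H := H) ht hs)] with y y2 y1 y3 hy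
  filter_upwards [y2, y1, y3] with x x2 x1 x3 hx
  simp only [if_pos hy] at x2
  simp only [if_neg (not_lt.2 hx.le)] at x1
  unfold rq
  rw [x3, pv_swap]
  unfold br pv
  simp only [Prod.swap_prod_mk]
  rw [x2, x1]
  simp only [chi_one hy.le]
  ring

lemma colRL {H ϑ θ : ℝ × ℝ → ℝ} {t s L : ℝ} (g : Geo H t s) (hϑ : Lip ϑ) (h0 : ∀ p, p ∉ Metric.ball (0 : ℝ × ℝ) L → ϑ p = 0)
    (hL : t + 1 < L) (hθ : BM θ) :
    ∀ᵐ y : ℝ, |y| < s → |d2 H (t, y)| * |ϑ (t, y) + avR t θ y| + |d2 H (-t, y)| * |ϑ (-t, y) + avL t θ y| ≤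
      ∫ x in SS t L, |rq H t s ϑ θ (x, y)| := by
  have ht := g.ht
  have qb := rq_bm g.hl hϑ hθ t s
  obtain ⟨C, hC⟩ := hϑ
  filter_upwards [rq_col (θ := θ) g ⟨C, hC⟩, ae_yx hC.ae_differentiableAt] with y hq hd hy
  specialize hq hy
  have hl : LipschitzWith C fun x => ϑ (x, y) :=
    LipschitzWith.of_dist_le_mul fun p q => by simpa [Prod.dist_eq] using hC.dist_le_mul (p, y) (q, y)
  have hd' : ∀ᵐ x, HasDerivAt (fun x => ϑ (x, y)) (d1 ϑ (x, y)) x := hd.mono fun x hx => hasDerivAt_line1 hx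
  obtain ⟨Θ, hΘ⟩ := hθ.bdd
  have θm : Measurable fun x => θ (x, y) := hθ.meas.comp (by fun_prop)
  have z : ∀ x, L ≤ |x| → ϑ (x, y) = 0 := fun x hx => h0 _ fun hb => by
    simp [Prod.norm_def] at hb; linarith [hb.1]
  have c1 := collar_r hl hd' θm (fun x => hΘ _) hL (z L (le_abs_self L)) ht.le
  have c2 := collar_l hl hd' θm (fun x => hΘ _) hL (z (-L) (by rw [abs_neg]; exact le_abs_self L)) ht.le
  obtain ⟨Cq, hCq⟩ := qb.bdd
  have qi : ∀ a b, IntegrableOn (fun x => |rq H t s ϑ θ (x, y)|) (Ioo a b) := fun a b =>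
    bm_ion (C := Cq) ((qb.meas.comp (by fun_prop : Measurable fun x : ℝ => (x, y))).abs) (fun x => by rw [abs_abs]; exact hCq _) a b
  unfold SS
  rw [setIntegral_union _ measurableSet_Ioo (qi _ _) (qi _ _), add_comm]
  · refine add_le_add ((mul_le_mul_of_nonneg_left c2 (abs_nonneg _)).trans ?_) ((mul_le_mul_of_nonneg_left c1 (abs_nonneg _)).trans ?_)
    · rw [← integral_const_mul]
      apply le_of_eq
      apply setIntegral_congr_ae measurableSet_Ioo
      filter_upwards [hq] with x hx hxm
      rw [hx (lt_abs.2 (Or.inr (by linarith [hxm.2]))), cl_le ht.le hxm.2.le, abs_mul]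
    · rw [← integral_const_mul]
      apply le_of_eq
      apply setIntegral_congr_ae measurableSet_Ioo
      filter_upwards [hq] with x hx hxm
      rw [hx (lt_abs.2 (Or.inl hxm.1)), cl_ge ht.le hxm.1.le, abs_mul]
  · rw [Set.disjoint_left]; intro x a b; linarith [a.2, b.1]

lemma cl_av {Θ a b : ℝ} (hb : |b| ≤ Θ) : |cl Θ a + b| ≤ |a + b| := by
  have h2 := cl_sub Θ a (-b)
  rw [cl_in (x := -b) (by rwa [abs_neg])] at h2
  simpa using h2

lemma vertest {H f ϑ θ : ℝ × ℝ → ℝ} {t s L M Θ : ℝ} (g : Geo H t s) (hf : Measurable f) (hM : ∀ p, |f p| ≤ M) (hM0 : 0 ≤ M) (hϑ : Lip ϑ)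
    (h0 : ∀ p, p ∉ Metric.ball (0 : ℝ × ℝ) L → ϑ p = 0) (hL : t + 1 < L) (hθ : Measurable θ) (hΘ : ∀ p, |θ p| ≤ Θ) :
    |(∫ p, (ext t s f p * θ p) * pv H t s p) + ((∫ y in Ioo (-s) s, f (-t, y) * d2 H (-t, y) * cl Θ (ϑ (-t, y))) -
      ∫ y in Ioo (-s) s, f (t, y) * d2 H (t, y) * cl Θ (ϑ (t, y)))| ≤ M * ∫ p in SS t L ×ˢ Ioo (-s) s, |rq H t s ϑ θ p| := by
  have ht := g.ht
  have bf : BM f := ⟨hf, M, hM⟩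
  have bθ : BM θ := ⟨hθ, Θ, hΘ⟩
  have hΘ0 : 0 ≤ Θ := (abs_nonneg _).trans (hΘ 0)
  have key := colRL g hϑ h0 hL bθ
  have qb := rq_bm g.hl hϑ bθ t s
  rw [pv_int g ((ext_bm bf t s).mul bθ)]
  have e1 : ∫ y in Ioo (-s) s, d2 H (-t, y) * avL t (fun p => ext t s f p * θ p) y = ∫ y in Ioo (-s) s, f (-t, y) * d2 H (-t, y) * avL t θ y :=
    setIntegral_congr_fun measurableSet_Ioo fun y hy => by simp only [(av_ext ht f θ (abs_lt.2 hy)).2]; ring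
  have e2 : ∫ y in Ioo (-s) s, d2 H (t, y) * avR t (fun p => ext t s f p * θ p) y = ∫ y in Ioo (-s) s, f (t, y) * d2 H (t, y) * avR t θ y :=
    setIntegral_congr_fun measurableSet_Ioo fun y hy => by simp only [(av_ext ht f θ (abs_lt.2 hy)).1]; ring
  rw [e1, e2]
  obtain ⟨C, hC⟩ := g.hl
  have m0 : ∀ c : ℝ, Measurable fun y : ℝ => f (c, y) * d2 H (c, y) := fun c =>
    (hf.comp (by fun_prop : Measurable fun y : ℝ => (c, y))).mul ((measurable_d2 H).comp (by fun_prop : Measurable fun y : ℝ => (c, y)))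
  have ii : ∀ (c : ℝ) (w : ℝ → ℝ), Measurable w → (∀ y, |w y| ≤ Θ) → IntegrableOn (fun y => f (c, y) * d2 H (c, y) * w y) (Ioo (-s) s) := by
    intro c w hw hb
    refine bm_ion (C := M * C * Θ) ((m0 c).mul hw) (fun y => ?_) _ _
    show |f (c, y) * d2 H (c, y) * w y| ≤ _
    rw [abs_mul, abs_mul]
    exact mul_le_mul (mul_le_mul (hM _) (d2_le hC _) (abs_nonneg _) hM0) (hb y) (abs_nonneg _) (by positivity)
  have wT : ∀ c : ℝ, Measurable fun y => cl Θ (ϑ (c, y)) := fun c =>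
    (cl_lip Θ).continuous.measurable.comp (hϑ.meas.comp (by fun_prop : Measurable fun y : ℝ => (c, y)))
  have wb : ∀ c y : ℝ, |cl Θ (ϑ (c, y))| ≤ Θ := fun c y => cl_abs hΘ0 _
  have i1 := ii (-t) _ (avL_meas t hθ) (avL_bd t hΘ)
  have i2 := ii t _ (avR_meas t hθ) (avR_bd t hΘ)
  have i3 := ii (-t) _ (wT (-t)) (wb (-t))
  have i4 := ii t _ (wT t) (wb t)
  rw [← integral_sub i1 i2, ← integral_sub i3 i4, ← integral_add (by exact i1.sub i2) (by exact i3.sub i4)]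
  have Q : IntegrableOn (fun p => |rq H t s ϑ θ p|) (SS t L ×ˢ Ioo (-s) s) :=
    (qb.abs).intOn ((SS_bdd t L).prod (Metric.isBounded_Ioo _ _))
  have hfub : ∫ p in SS t L ×ˢ Ioo (-s) s, |rq H t s ϑ θ p| = ∫ y in Ioo (-s) s, ∫ x in SS t L, |rq H t s ϑ θ (x, y)| := by
    rw [IntegrableOn, Measure.volume_eq_prod, ← Measure.prod_restrict] at Q
    rw [Measure.volume_eq_prod, ← Measure.prod_restrict, integral_prod_symm _ Q]
  have Q' : IntegrableOn (fun y => ∫ x in SS t L, |rq H t s ϑ θ (x, y)|) (Ioo (-s) s) := by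
    rw [IntegrableOn, Measure.volume_eq_prod, ← Measure.prod_restrict] at Q
    exact Q.integral_prod_right
  rw [hfub, ← integral_const_mul, ← Real.norm_eq_abs]
  refine norm_integral_le_of_norm_le (Q'.const_mul M) ?_
  rw [ae_restrict_iff' measurableSet_Ioo]
  filter_upwards [key] with y hy hys
  specialize hy (abs_lt.2 hys)
  have a1 := cl_av (a := ϑ (t, y)) (avR_bd t hΘ y)
  have a2 := cl_av (a := ϑ (-t, y)) (avL_bd t hΘ y)
  rw [Real.norm_eq_abs]
  calc _ = |f (-t, y) * (d2 H (-t, y) * (cl Θ (ϑ (-t, y)) + avL t θ y)) + -(f (t, y) * (d2 H (t, y) * (cl Θ (ϑ (t, y)) + avR t θ y)))| := by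
        congr 1; ring
    _ ≤ _ := abs_add_le _ _
    _ ≤ M * (|d2 H (-t, y)| * |ϑ (-t, y) + avL t θ y|) + M * (|d2 H (t, y)| * |ϑ (t, y) + avR t θ y|) := by
        rw [abs_neg, abs_mul, abs_mul, abs_mul, abs_mul]
        exact add_le_add (mul_le_mul (hM _) (mul_le_mul_of_nonneg_left a2 (abs_nonneg _)) (by positivity) hM0)
          (mul_le_mul (hM _) (mul_le_mul_of_nonneg_left a1 (abs_nonneg _)) (by positivity) hM0)
    _ = M * (|d2 H (t, y)| * |ϑ (t, y) + avR t θ y| + |d2 H (-t, y)| * |ϑ (-t, y) + avL t θ y|) := by ring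
    _ ≤ _ := mul_le_mul_of_nonneg_left hy hM0

lemma br_eq (H E : ℝ × ℝ → ℝ) (p : ℝ × ℝ) : br H E p = fderiv ℝ E p (d2 H p, - d1 H p) := by
  have : ((d2 H p, - d1 H p) : ℝ × ℝ) = d2 H p • (1, 0) + (- d1 H p) • ((0 : ℝ), (1 : ℝ)) := by ext <;> simp
  rw [this, map_add, map_smul, map_smul]
  simp only [br, d1, d2, smul_eq_mul]; ring

lemma br_cl {H ϑ : ℝ × ℝ → ℝ} (hϑ : Lip ϑ) (Θ : ℝ) : ∀ᵐ p, |br H (fun p => cl Θ (ϑ p)) p| ≤ |br H ϑ p| := by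
  filter_upwards [hϑ.ae_diff, (hϑ.comp1 (cl_lip Θ)).ae_diff] with p h1 h2
  rw [br_eq, br_eq]
  have t1 := (h1.hasFDerivAt.hasLineDerivAt (d2 H p, - d1 H p)).tendsto_slope_zero.abs
  have t2 := (h2.hasFDerivAt.hasLineDerivAt (d2 H p, - d1 H p)).tendsto_slope_zero.abs
  refine le_of_tendsto_of_tendsto' t2 t1 fun c => ?_
  rw [smul_eq_mul, smul_eq_mul, abs_mul, abs_mul]
  exact mul_le_mul_of_nonneg_left (cl_sub _ _ _) (abs_nonneg _)

lemma rq_center {H ϑ θ : ℝ × ℝ → ℝ} {t s : ℝ} {p : ℝ × ℝ} (hp : p ∈ Ioo (-t) t ×ˢ Ioo (-s) s) : rq H t s ϑ θ p = br H ϑ p := by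
  have ev : ∀ᶠ q in 𝓝 p, q ∈ Ioo (-t) t ×ˢ Ioo (-s) s := (isOpen_Ioo.prod isOpen_Ioo).mem_nhds hp
  have e1 : ext t s H =ᶠ[𝓝 p] H := ev.mono fun q hq => by
    simp only [ext]; rw [cl_in (abs_lt.2 hq.1).le, cl_in (abs_lt.2 hq.2).le]
  have e2 : phi t s =ᶠ[𝓝 p] fun _ => 1 := ev.mono fun q hq => by
    simp only [phi]; rw [chi_one (abs_lt.2 hq.1).le, chi_one (abs_lt.2 hq.2).le, one_mul]
  unfold rq PP br d1 d2
  rw [e1.fderiv_eq, e2.fderiv_eq]; simp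

lemma setint_swap (F : ℝ × ℝ → ℝ) {A B : Set ℝ} (hA : MeasurableSet A) (hB : MeasurableSet B) :
    ∫ p in A ×ˢ B, F p.swap = ∫ p in B ×ˢ A, F p := by
  rw [← integral_indicator (hA.prod hB), ← integral_indicator (hB.prod hA)]
  rw [← mp_swap.integral_comp MeasurableEquiv.prodComm.measurableEmbedding]
  congr 1; ext p
  by_cases h : p ∈ B ×ˢ A
  · rw [indicator_of_mem h, indicator_of_mem (show p.swap ∈ A ×ˢ B from ⟨h.2, h.1⟩), Prod.swap_swap]
  · rw [indicator_of_notMem h, indicator_of_notMem (fun h' => h ⟨h'.2, h'.1⟩)]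

lemma regions {F : ℝ × ℝ → ℝ} (hF : BM F) (h0 : ∀ p, 0 ≤ F p) {t s L : ℝ} (ht0 : 0 < t) (hs0 : 0 < s) (ht : t < L) (hs : s < L) :
    (∫ p in SS t L ×ˢ Ioo (-s) s, F p) + (∫ p in Ioo (-t) t ×ˢ SS s L, F p) + (∫ p in Ioo (-t) t ×ˢ Ioo (-s) s, F p) ≤
      ∫ p in Metric.ball (0 : ℝ × ℝ) L, F p := by
  have b1 : Bornology.IsBounded (SS t L ×ˢ Ioo (-s) s) := (SS_bdd t L).prod (Metric.isBounded_Ioo _ _)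
  have b2 : Bornology.IsBounded (Ioo (-t) t ×ˢ SS s L) := (Metric.isBounded_Ioo _ _).prod (SS_bdd s L)
  have b3 : Bornology.IsBounded (Ioo (-t) t ×ˢ Ioo (-s) s) := (Metric.isBounded_Ioo _ _).prod (Metric.isBounded_Ioo _ _)
  have m2 : MeasurableSet (Ioo (-t) t ×ˢ SS s L) := measurableSet_Ioo.prod (SS_meas s L)
  have m3 : MeasurableSet (Ioo (-t) t ×ˢ Ioo (-s) s) := measurableSet_Ioo.prod measurableSet_Ioo
  rw [← setIntegral_union _ m2 (hF.intOn b1) (hF.intOn b2), ← setIntegral_union _ m3 (hF.intOn (b1.union b2)) (hF.intOn b3)]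
  · refine setIntegral_mono_set (hF.intOn Metric.isBounded_ball) (Eventually.of_forall h0) (HasSubset.Subset.eventuallyLE ?_)
    intro p hp
    have k : ∀ {a x}, a < L → x ∈ Ioo (-a) a → |x| < L := fun h hx => (abs_lt.2 hx).trans h
    have k' : ∀ {a x}, 0 < a → x ∈ SS a L → |x| < L := fun h hx => by
      rcases hx with hx | hx
      · exact abs_lt.2 ⟨hx.1, by linarith [hx.2, hx.1]⟩
      · exact abs_lt.2 ⟨by linarith [hx.1, hx.2], hx.2⟩
    have : |p.1| < L ∧ |p.2| < L := by
      rcases hp with (hp | hp) | hp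
      · exact ⟨k' ht0 hp.1, k hs hp.2⟩
      · exact ⟨k ht hp.1, k' hs0 hp.2⟩
      · exact ⟨k ht hp.1, k hs hp.2⟩
    simpa [Prod.norm_def] using this
  · rw [Set.disjoint_left]; rintro p (⟨a, b⟩ | ⟨a, b⟩) ⟨c, d⟩
    · rcases a with a | a <;> linarith [a.1, a.2, c.1, c.2]
    · rcases b with a | a <;> linarith [a.1, a.2, d.1, d.2]
  · rw [Set.disjoint_left]; rintro p ⟨a, b⟩ ⟨c, d⟩
    rcases a with a | a <;> linarith [a.1, a.2, c.1, c.2]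

theorem DE {H f G ϑ θ : ℝ × ℝ → ℝ} {R t s L M Θ : ℝ} (g : Geo H t s) (hf : Measurable f) (hM : ∀ p, |f p| ≤ M) (hG : BM G)
    (hw : Weak (Metric.ball 0 R) H f G) (ht : t < R) (hs : s < R)
    (a1 : GoodX (fun p => f p * d2 H p) R t) (a2 : GoodX (fun p => f p * d2 H p) R (-t))
    (b1 : GoodX (fun p => f p.swap * d1 H p.swap) R s) (b2 : GoodX (fun p => f p.swap * d1 H p.swap) R (-s))
    (hϑ : Lip ϑ) (h0 : ∀ p, p ∉ Metric.ball (0 : ℝ × ℝ) L → ϑ p = 0) (hL : t + 1 < L) (hL' : s + 1 < L)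
    (hθ : Measurable θ) (hΘ : ∀ p, |θ p| ≤ Θ) :
    |∫ p, ext t s f p * θ p * PP H t s p| ≤ M * (∫ p in Metric.ball (0 : ℝ × ℝ) L, |rq H t s ϑ θ p|) +
      Θ * ∫ p in Ioo (-t) t ×ˢ Ioo (-s) s, |G p| := by
  have hM0 : 0 ≤ M := (abs_nonneg _).trans (hM 0)
  have hΘ0 : 0 ≤ Θ := (abs_nonneg _).trans (hΘ 0)
  have bθ : BM θ := ⟨hθ, Θ, hΘ⟩
  have bf : BM f := ⟨hf, M, hM⟩
  have E1 := PP_int g.hl g.ht g.hs ((ext_bm bf t s).mul bθ)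
  have V1 := vertest g hf hM hM0 hϑ h0 hL hθ hΘ
  have V2 := vertest (f := fun p => f p.swap) (θ := fun p => θ p.swap) (ϑ := fun p => ϑ p.swap) (L := L)
    g.swap (hf.comp measurable_swap) (fun p => hM _) hM0 (hϑ.comp lipschitz_swap)
    (fun p hp => h0 _ fun h => hp (by simpa [Prod.norm_def, and_comm] using h)) hL' (hθ.comp measurable_swap) (fun p => hΘ _)
  simp only [rq_swap, abs_neg, d2_swap, Prod.swap_prod_mk] at V2
  rw [setint_swap (fun p => |rq H t s ϑ θ p|) (SS_meas s L) measurableSet_Ioo] at V2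
  have hT : Lip fun p => cl Θ (ϑ p) := hϑ.comp1 (cl_lip Θ)
  have B := BT g.hl bf hG hw g.ht ht g.hs hs a1 a2 b1 b2 hT ⟨Θ, fun p => cl_abs hΘ0 _⟩
  have qb := rq_bm g.hl hϑ bθ t s
  have bQ : Bornology.IsBounded (Ioo (-t) t ×ˢ Ioo (-s) s) := (Metric.isBounded_Ioo _ _).prod (Metric.isBounded_Ioo _ _)
  have Bb : |∫ p in Ioo (-t) t ×ˢ Ioo (-s) s, (f p * br H (fun p => cl Θ (ϑ p)) p + G p * cl Θ (ϑ p))| ≤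
      M * (∫ p in Ioo (-t) t ×ˢ Ioo (-s) s, |rq H t s ϑ θ p|) + Θ * ∫ p in Ioo (-t) t ×ˢ Ioo (-s) s, |G p| := by
    have i1 := (qb.abs.intOn bQ).const_mul M
    have i2 := (hG.abs.intOn bQ).const_mul Θ
    rw [← integral_const_mul, ← integral_const_mul, ← integral_add i1 i2, ← Real.norm_eq_abs]
    refine norm_integral_le_of_norm_le (by exact i1.add i2) ?_
    rw [ae_restrict_iff' (measurableSet_Ioo.prod measurableSet_Ioo)]
    filter_upwards [br_cl (H := H) hϑ Θ] with p h1 hp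
    rw [rq_center hp, Real.norm_eq_abs]
    refine (abs_add_le _ _).trans ?_
    rw [abs_mul, abs_mul, mul_comm |G p|]
    exact add_le_add (mul_le_mul (hM _) h1 (abs_nonneg _) hM0) (mul_le_mul_of_nonneg_right (cl_abs hΘ0 _) (abs_nonneg _))
  have Rg := mul_le_mul_of_nonneg_left (regions qb.abs (fun p => abs_nonneg _) g.ht g.hs (by linarith : t < L) (by linarith : s < L)) hM0
  rw [E1]
  simp only [ext] at V1 V2 ⊢
  rw [B] at Bb
  simp only [Prod.fst_swap, Prod.snd_swap, Prod.swap_prod_mk] at V1 V2 Bb ⊢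
  rw [mul_add, mul_add] at Rg
  rw [abs_le] at V1 V2 Bb ⊢
  constructor <;> linarith [V1.1, V1.2, V2.1, V2.2, Bb.1, Bb.2]

section HB
variable {α : Type*} [MeasurableSpace α] {μ : Measure α} [IsFiniteMeasure μ]

lemma bdd_int {f : α → ℝ} (hf : Measurable f) {C : ℝ} (hC : ∀ x, |f x| ≤ C) : Integrable f μ :=
  Integrable.of_bound hf.aestronglyMeasurable C (Eventually.of_forall hC)

lemma lp2_int (q : Lp ℝ 2 μ) : Integrable q μ := (Lp.memLp q).integrable (by norm_num)

lemma lp2_l1 : ∃ C : ℝ, 0 ≤ C ∧ ∀ q : Lp ℝ 2 μ, ∫ x, |q x| ∂μ ≤ C * ‖q‖ := by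
  refine ⟨((μ univ) ^ (1 / (1:ℝ≥0∞).toReal - 1 / (2:ℝ≥0∞).toReal)).toReal, ENNReal.toReal_nonneg, fun q => ?_⟩
  have h := eLpNorm_le_eLpNorm_mul_rpow_measure_univ (p := 1) (q := 2) (μ := μ) (f := q) (by norm_num) (Lp.aestronglyMeasurable q)
  have e : ∫ x, |q x| ∂μ = (eLpNorm q 1 μ).toReal := by
    rw [eLpNorm_one_eq_lintegral_enorm, ← integral_norm_eq_lintegral_enorm (Lp.aestronglyMeasurable q)]; rfl
  rw [e, Lp.norm_def, mul_comm, ← ENNReal.toReal_mul]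
  refine ENNReal.toReal_mono ?_ h
  refine ENNReal.mul_ne_top (Lp.eLpNorm_ne_top q) (ENNReal.rpow_ne_top_of_nonneg (by norm_num) (measure_ne_top _ _))

theorem HBdual (p fe : α → ℝ) (hp : Measurable p) {Cp : ℝ} (hpC : ∀ x, |p x| ≤ Cp) (hfe : Measurable fe) {M ε : ℝ} (hM : 0 ≤ M) (hε : 0 ≤ ε)
    (hfM : ∀ x, |fe x| ≤ M) (D : Submodule ℝ (α → ℝ)) (hD : ∀ b ∈ D, Measurable b ∧ ∃ C, ∀ x, |b x| ≤ C)
    (hineq : ∀ b ∈ D, ∀ θ : α → ℝ, Measurable θ → ∀ Θ, (∀ x, |θ x| ≤ Θ) →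
      ∫ x, fe x * θ x * p x ∂μ ≤ M * (∫ x, |b x + θ x * p x| ∂μ) + ε * Θ) :
    ∃ f0 : α → ℝ, Measurable f0 ∧ (∀ x, |f0 x| ≤ M) ∧ (∀ b ∈ D, ∫ x, f0 x * b x ∂μ = 0) ∧ ∫ x, |fe x - f0 x| * |p x| ∂μ ≤ ε := by
  classical
  have li : ∀ θ : Lp ℝ ∞ μ, Integrable θ μ := fun θ => (Lp.memLp θ).integrable (by norm_num)
  have fpm : Measurable fun x => fe x * p x := hfe.mul hp
  have fpb : ∀ x, |fe x * p x| ≤ M * Cp := fun x => by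
    rw [abs_mul]; exact mul_le_mul (hfM x) (hpC x) (abs_nonneg _) hM
  have lfi : ∀ θ : Lp ℝ ∞ μ, Integrable (fun x => fe x * p x * θ x) μ := fun θ =>
    (li θ).bdd_mul fpm.aestronglyMeasurable (Eventually.of_forall fpb)
  let ℓ : (Lp ℝ 2 μ × Lp ℝ ∞ μ) →ₗ[ℝ] ℝ :=
    { toFun := fun z => ∫ x, fe x * p x * z.2 x ∂μ
      map_add' := by
        intro z w
        rw [← integral_add (lfi _) (lfi _)]
        apply integral_congr_ae
        filter_upwards [Lp.coeFn_add z.2 w.2] with x hx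
        simp only [Prod.snd_add]
        rw [hx]; simp only [Pi.add_apply]; ring
      map_smul' := by
        intro c z
        simp only [RingHom.id_apply, smul_eq_mul]
        rw [← integral_const_mul]
        apply integral_congr_ae
        filter_upwards [Lp.coeFn_smul c z.2] with x hx
        simp only [Prod.smul_snd]
        rw [hx]; simp only [Pi.smul_apply, smul_eq_mul]; ring }
  let S : Submodule ℝ (Lp ℝ 2 μ × Lp ℝ ∞ μ) :=
    { carrier := {z | ∃ b ∈ D, ∀ᵐ x ∂μ, z.1 x = b x + z.2 x * p x}
      zero_mem' := by
        refine ⟨0, D.zero_mem, ?_⟩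
        filter_upwards [Lp.coeFn_zero ℝ 2 μ, Lp.coeFn_zero ℝ ∞ μ] with x h1 h2
        simp only [Prod.fst_zero, Prod.snd_zero]
        rw [h1, h2]; simp
      add_mem' := by
        rintro z w ⟨b, hb, h1⟩ ⟨c, hc, h2⟩
        refine ⟨b + c, D.add_mem hb hc, ?_⟩
        filter_upwards [h1, h2, Lp.coeFn_add z.1 w.1, Lp.coeFn_add z.2 w.2] with x a1 a2 a3 a4
        simp only [Prod.fst_add, Prod.snd_add]
        rw [a3, a4]; simp only [Pi.add_apply]; rw [a1, a2]; ring
      smul_mem' := by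
        rintro k z ⟨b, hb, h1⟩
        refine ⟨k • b, D.smul_mem k hb, ?_⟩
        filter_upwards [h1, Lp.coeFn_smul k z.1, Lp.coeFn_smul k z.2] with x a1 a3 a4
        simp only [Prod.smul_fst, Prod.smul_snd]
        rw [a3, a4]; simp only [Pi.smul_apply, smul_eq_mul]; rw [a1]; ring }
  obtain ⟨Λ, hΛ1, hΛ2⟩ := exists_extension_of_le_sublinear ⟨S, ℓ.domRestrict S⟩
    (fun z => M * (∫ x, |z.1 x| ∂μ) + ε * ‖z.2‖)
    (by
      intro c hc z
      have : ∫ x, |(c • z).1 x| ∂μ = c * ∫ x, |z.1 x| ∂μ := by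
        rw [← integral_const_mul]
        apply integral_congr_ae
        filter_upwards [Lp.coeFn_smul c z.1] with x hx
        simp only [Prod.smul_fst]; rw [hx]; simp [abs_mul, abs_of_pos hc]
      simp only [this, Prod.smul_snd, norm_smul, Real.norm_eq_abs, abs_of_pos hc]; ring)
    (by
      intro z w
      have : ∫ x, |(z + w).1 x| ∂μ ≤ (∫ x, |z.1 x| ∂μ) + ∫ x, |w.1 x| ∂μ := by
        rw [← integral_add (lp2_int _).abs (lp2_int _).abs]
        apply integral_mono_ae (lp2_int _).abs ((lp2_int _).abs.add (lp2_int _).abs)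
        filter_upwards [Lp.coeFn_add z.1 w.1] with x hx
        simp only [Prod.fst_add]; rw [hx]; exact abs_add_le _ _
      have h2 := norm_add_le z.2 w.2
      have := mul_le_mul_of_nonneg_left this hM
      have := mul_le_mul_of_nonneg_left h2 hε
      simp only [Prod.snd_add]
      linarith)
    (by
      rintro ⟨z, b, hb, hz⟩
      let θ : α → ℝ := fun x => cl ‖z.2‖ ((Lp.aestronglyMeasurable z.2).mk z.2 x)
      have hθm : Measurable θ := (cl_lip _).continuous.measurable.comp (Lp.aestronglyMeasurable z.2).stronglyMeasurable_mk.measurable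
      have hθ : ∀ᵐ x ∂μ, z.2 x = θ x := by
        filter_upwards [(Lp.aestronglyMeasurable z.2).ae_eq_mk, (ae_le_eLpNormEssSup (f := z.2) (μ := μ))] with x h1 h2
        have : |z.2 x| ≤ ‖z.2‖ := by
          rw [Lp.norm_def, eLpNorm_exponent_top, ← Real.norm_eq_abs, ← toReal_enorm]
          refine ENNReal.toReal_mono ?_ h2
          have := Lp.eLpNorm_ne_top z.2
          rwa [eLpNorm_exponent_top] at this
        show _ = cl _ _
        rw [← h1, cl_in this]
      have := hineq b hb θ hθm ‖z.2‖ (fun x => cl_abs (norm_nonneg _) _)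
      show ∫ x, fe x * p x * z.2 x ∂μ ≤ _
      calc _ = ∫ x, fe x * θ x * p x ∂μ := integral_congr_ae (by filter_upwards [hθ] with x hx; rw [hx]; ring)
        _ ≤ _ := this
        _ = _ := by
          congr 2
          exact integral_congr_ae (by filter_upwards [hθ, hz] with x h1 h2; simp only [h2, h1]))
  obtain ⟨C, hC0, hC⟩ := lp2_l1 (μ := μ)
  have hb1 : ∀ q : Lp ℝ 2 μ, |Λ (q, 0)| ≤ M * ∫ x, |q x| ∂μ := by
    intro q
    rw [abs_le]
    constructor
    · have h := hΛ2 (-q, 0)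
      have e : ((-q, 0) : Lp ℝ 2 μ × Lp ℝ ∞ μ) = -(q, 0) := by simp
      rw [e, map_neg] at h
      have e2 : ∫ x, |(-q : Lp ℝ 2 μ) x| ∂μ = ∫ x, |q x| ∂μ := by
        apply integral_congr_ae
        filter_upwards [Lp.coeFn_neg q] with x hx
        rw [hx]; simp
      simp only [Prod.fst_neg, Prod.snd_neg, e2, neg_zero, norm_zero, mul_zero, add_zero] at h
      linarith
    · have h := hΛ2 (q, 0)
      simpa using h
  let Λ1 : Lp ℝ 2 μ →L[ℝ] ℝ := (Λ.comp (LinearMap.inl ℝ _ _)).mkContinuous (M * C) (fun q => by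
    refine (hb1 q).trans ?_
    rw [mul_assoc]; exact mul_le_mul_of_nonneg_left (hC q) hM)
  let f1 : Lp ℝ 2 μ := (InnerProductSpace.toDual ℝ (Lp ℝ 2 μ)).symm Λ1
  have hf1 : ∀ q : Lp ℝ 2 μ, Λ (q, 0) = ∫ x, f1 x * q x ∂μ := by
    intro q
    have h : ⟪f1, q⟫ = Λ1 q := InnerProductSpace.toDual_symm_apply
    rw [L2.inner_def] at h
    calc _ = Λ1 q := rfl
      _ = _ := by rw [← h]; exact integral_congr_ae (Eventually.of_forall fun x => by simp [mul_comm])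
  let f2 : α → ℝ := (Lp.aestronglyMeasurable f1).mk f1
  have hf2m : Measurable f2 := (Lp.aestronglyMeasurable f1).stronglyMeasurable_mk.measurable
  have hf2 : ∀ᵐ x ∂μ, f1 x = f2 x := (Lp.aestronglyMeasurable f1).ae_eq_mk
  have hf2i : Integrable f2 μ := (lp2_int f1).congr hf2
  have hrep : ∀ b : α → ℝ, Measurable b → ∀ Cb, (∀ x, |b x| ≤ Cb) → ∃ q : Lp ℝ 2 μ, (∀ᵐ x ∂μ, q x = b x) ∧
      Λ (q, 0) = ∫ x, f2 x * b x ∂μ := by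
    intro b hb Cb hCb
    have hm : MemLp b 2 μ := MemLp.of_bound hb.aestronglyMeasurable Cb (Eventually.of_forall hCb)
    refine ⟨hm.toLp b, hm.coeFn_toLp, ?_⟩
    rw [hf1]
    apply integral_congr_ae
    filter_upwards [hf2, hm.coeFn_toLp] with x h1 h2
    rw [h1, h2]
  -- bound
  have hbd : ∀ᵐ x ∂μ, |f2 x| ≤ M := by
    let A : Set α := {x | M < |f2 x|}
    have hA : MeasurableSet A := measurableSet_lt measurable_const hf2m.abs
    let b : α → ℝ := A.indicator fun x => if 0 ≤ f2 x then 1 else -1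
    have hb : Measurable b := (Measurable.ite (measurableSet_le measurable_const hf2m) measurable_const measurable_const).indicator hA
    have hb1' : ∀ x, |b x| = A.indicator (fun _ => (1:ℝ)) x := by
      intro x
      show |A.indicator _ x| = _
      simp only [indicator]; split_ifs <;> simp
    have hb2 : ∀ x, |b x| ≤ 1 := fun x => by rw [hb1']; simp only [indicator]; split_ifs <;> norm_num
    obtain ⟨q, h1, h2⟩ := hrep b hb 1 hb2
    have h3 := (le_abs_self _).trans (hb1 q)
    have h4 : ∫ x, |q x| ∂μ = ∫ x, A.indicator (fun _ => (1:ℝ)) x ∂μ :=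
      integral_congr_ae (by filter_upwards [h1] with x hx; rw [hx, hb1'])
    rw [h2, h4, ← integral_const_mul, ← sub_nonpos] at h3
    have ia : Integrable (fun x => f2 x * b x) μ := hf2i.mul_bdd (c := 1) hb.aestronglyMeasurable (Eventually.of_forall hb2)
    have ib : Integrable (fun x => M * A.indicator (fun _ => (1:ℝ)) x) μ := ((integrable_const 1).indicator hA).const_mul M
    rw [← integral_sub ia ib] at h3
    have key : ∀ x, f2 x * b x - M * A.indicator (fun _ => (1:ℝ)) x = A.indicator (fun x => |f2 x| - M) x := by
      intro x
      show f2 x * A.indicator _ x - _ = _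
      by_cases hx : x ∈ A
      · simp only [indicator_of_mem hx]
        split_ifs with h
        · rw [abs_of_nonneg h]; ring
        · rw [abs_of_neg (not_le.1 h)]; ring
      · simp only [indicator_of_notMem hx]; ring
    have nn : ∀ x, 0 ≤ f2 x * b x - M * A.indicator (fun _ => (1:ℝ)) x := by
      intro x; rw [key]; exact indicator_nonneg (fun x hx => by have : M < |f2 x| := hx; linarith) _
    have h5 := (integral_eq_zero_iff_of_nonneg nn (ia.sub ib)).1 (le_antisymm h3 (integral_nonneg nn))
    filter_upwards [h5] with x hx
    simp only [key, Pi.zero_apply] at hx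
    by_contra hc
    have hxA : x ∈ A := not_le.1 hc
    rw [indicator_of_mem hxA] at hx
    have : M < |f2 x| := hxA
    linarith
  let f0 : α → ℝ := fun x => cl M (f2 x)
  have hf0m : Measurable f0 := (cl_lip M).continuous.measurable.comp hf2m
  have hf0M : ∀ x, |f0 x| ≤ M := fun x => cl_abs hM _
  have hf0 : ∀ᵐ x ∂μ, f2 x = f0 x := by filter_upwards [hbd] with x hx; exact (cl_in hx).symm
  refine ⟨f0, hf0m, hf0M, ?_, ?_⟩
  · intro b hb
    obtain ⟨hbm, Cb, hCb⟩ := hD b hb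
    obtain ⟨q, h1, h2⟩ := hrep b hbm Cb hCb
    have hz : ((q, 0) : Lp ℝ 2 μ × Lp ℝ ∞ μ) ∈ S := ⟨b, hb, by
      filter_upwards [h1, Lp.coeFn_zero ℝ ∞ μ] with x a1 a2
      rw [a1, a2]; simp⟩
    have h3 : Λ (q, 0) = ∫ x, fe x * p x * (0 : Lp ℝ ∞ μ) x ∂μ := hΛ1 ⟨(q, 0), hz⟩
    have h4 : ∫ x, fe x * p x * (0 : Lp ℝ ∞ μ) x ∂μ = 0 := by
      rw [← integral_zero α ℝ (μ := μ)]
      apply integral_congr_ae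
      filter_upwards [Lp.coeFn_zero ℝ ∞ μ] with x a2
      rw [a2]; simp
    rw [← h4, ← h3, h2]
    apply integral_congr_ae
    filter_upwards [hf0] with x hx
    rw [hx]
  · let θ : α → ℝ := fun x => if 0 ≤ (fe x - f0 x) * p x then 1 else -1
    have hθ : Measurable θ := Measurable.ite (measurableSet_le measurable_const ((hfe.sub hf0m).mul hp)) measurable_const measurable_const
    have hθ1 : ∀ x, |θ x| ≤ 1 := fun x => by show |if _ then _ else _| ≤ _; split_ifs <;> simp
    have tpm : Measurable fun x => θ x * p x := hθ.mul hp
    have tpb : ∀ x, |θ x * p x| ≤ Cp := fun x => by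
      rw [abs_mul]; exact (mul_le_of_le_one_left (abs_nonneg _) (hθ1 x)).trans (hpC x)
    obtain ⟨q, h1, h2⟩ := hrep _ tpm Cp tpb
    have hm : MemLp θ ∞ μ := MemLp.of_bound hθ.aestronglyMeasurable 1 (Eventually.of_forall hθ1)
    have hn : ‖hm.toLp θ‖ ≤ 1 := by
      refine Lp.norm_le_of_ae_bound (C := 1) (by norm_num) ?_ |>.trans (by simp)
      filter_upwards [hm.coeFn_toLp] with x hx; rw [hx]; exact hθ1 x
    have hz : ((q, hm.toLp θ) : Lp ℝ 2 μ × Lp ℝ ∞ μ) ∈ S := ⟨0, D.zero_mem, by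
      filter_upwards [h1, hm.coeFn_toLp] with x a1 a2
      rw [a1, a2]; simp⟩
    have h3 : Λ (q, hm.toLp θ) = ∫ x, fe x * p x * (hm.toLp θ) x ∂μ := hΛ1 ⟨(q, hm.toLp θ), hz⟩
    have h4 : ∫ x, fe x * p x * (hm.toLp θ) x ∂μ = ∫ x, fe x * p x * θ x ∂μ := by
      apply integral_congr_ae
      filter_upwards [hm.coeFn_toLp] with x a2
      rw [a2]
    have h5 : Λ (0, hm.toLp θ) ≤ ε := by
      refine (hΛ2 _).trans ?_
      have : ∫ x, |(0 : Lp ℝ 2 μ) x| ∂μ = 0 := by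
        rw [← integral_zero α ℝ (μ := μ)]
        apply integral_congr_ae
        filter_upwards [Lp.coeFn_zero ℝ 2 μ] with x a2
        rw [a2]; simp
      simp only [this, mul_zero, zero_add]
      exact mul_le_of_le_one_right hε hn
    have h6 : Λ (q, hm.toLp θ) = Λ (q, 0) + Λ (0, hm.toLp θ) := by rw [← map_add]; simp
    have i1 : Integrable (fun x => fe x * p x * θ x) μ :=
      bdd_int (C := M * Cp) (fpm.mul hθ) fun x => by
        show |fe x * p x * θ x| ≤ _
        rw [abs_mul]; exact (mul_le_of_le_one_right (abs_nonneg _) (hθ1 x)).trans (fpb x)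
    have i2 : Integrable (fun x => f0 x * (θ x * p x)) μ :=
      bdd_int (C := M * Cp) (hf0m.mul tpm) fun x => by
        show |f0 x * (θ x * p x)| ≤ _
        rw [abs_mul]; exact mul_le_mul (hf0M x) (tpb x) (abs_nonneg _) hM
    have h7 : ∫ x, f2 x * (θ x * p x) ∂μ = ∫ x, f0 x * (θ x * p x) ∂μ :=
      integral_congr_ae (by filter_upwards [hf0] with x hx; rw [hx])
    have h8 : ∫ x, |fe x - f0 x| * |p x| ∂μ = (∫ x, fe x * p x * θ x ∂μ) - ∫ x, f0 x * (θ x * p x) ∂μ := by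
      rw [← integral_sub i1 i2]
      congr 1; ext x
      have : |fe x - f0 x| * |p x| = (fe x - f0 x) * p x * θ x := by
        show _ = _ * (if _ then _ else _)
        rw [← abs_mul]
        split_ifs with h
        · rw [abs_of_nonneg h]; ring
        · rw [abs_of_neg (not_le.1 h)]; ring
      rw [this]; ring
    rw [h8, ← h7, ← h2, ← h4, ← h3, h6]; linarith
end HB

/-- good rectangles for the pair -/
structure GoodSq (H f : ℝ × ℝ → ℝ) (R t s : ℝ) : Prop where
  g : Geo H t s
  ht : t < R
  hs : s < R
  a1 : GoodX (fun p => f p * d2 H p) R t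
  a2 : GoodX (fun p => f p * d2 H p) R (-t)
  b1 : GoodX (fun p => f p.swap * d1 H p.swap) R s
  b2 : GoodX (fun p => f p.swap * d1 H p.swap) R (-s)

lemma phi_tst {t s : ℝ} (ht : 0 < t) (hs : 0 < s) : Tst (Metric.ball 0 (t + s + 2)) (phi t s) := by
  refine Tst.of_closed (K := Metric.closedBall 0 (t + s + 1)) (phi_lip t s) (isCompact_closedBall _ _) (fun p hp => ?_)
    (Metric.closedBall_subset_ball (by linarith))
  have : t + s + 1 < |p.1| ∨ t + s + 1 < |p.2| := by
    by_contra h; push Not at h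
    apply hp; simpa [Prod.norm_def] using h
  unfold phi
  rcases this with h | h
  · rw [chi_zero (by linarith)]; ring
  · rw [chi_zero (x := p.2) (by linarith)]; ring

theorem SQ1 {H f G : ℝ × ℝ → ℝ} {R t s M : ℝ} (hf : Measurable f) (hM : ∀ p, |f p| ≤ M) (hG : BM G)
    (hw : Weak (Metric.ball 0 R) H f G) (hg : GoodSq H f R t s) :
    |∫ p, ext t s f p ^ 2 * PP H t s p| ≤ 2 * M * ∫ p in Ioo (-t) t ×ˢ Ioo (-s) s, |G p| := by
  obtain ⟨g, ht, hs, a1, a2, b1, b2⟩ := hg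
  have hM0 : 0 ≤ M := (abs_nonneg _).trans (hM 0)
  set L := t + s + 2 with hL
  have ht0 := g.ht
  have hs0 := g.hs
  set W := Metric.ball (0 : ℝ × ℝ) L with hW
  have hWm : MeasurableSet W := Metric.isOpen_ball.measurableSet
  have hWc : volume W ≠ ⊤ := Metric.isBounded_ball.measure_lt_top.ne
  have hfin : IsFiniteMeasure (volume.restrict W) := ⟨by simpa using hWc.lt_top⟩
  have bf : BM f := ⟨hf, M, hM⟩
  have pb := PP_bm g.hl t s
  obtain ⟨Cp, hCp⟩ := pb.bdd
  have feb := ext_bm bf t s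
  have hph := phi_tst ht0 hs0
  have p0 : ∀ p, p ∉ W → PP H t s p = 0 := fun p hp => br_zero fun h => hp (hph.sub h)
  let D : Submodule ℝ (ℝ × ℝ → ℝ) :=
    { carrier := {b | BM b ∧ ∃ ϑ, Tst W ϑ ∧ ∀ᵐ p, b p = br (ext t s H) ϑ p}
      zero_mem' := by
        refine ⟨BM.const 0, fun p => 0 * phi t s p, hph.mul (Lip.const 0), Eventually.of_forall fun p => ?_⟩
        simp only [br, d1_const_mul, d2_const_mul]; simp
      add_mem' := by
        rintro b c ⟨hb, ϑ, h1, h2⟩ ⟨hc, ϑ', h1', h2'⟩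
        refine ⟨hb.add hc, _, h1.add h1', ?_⟩
        filter_upwards [h2, h2', h1.lip.ae_diff, h1'.lip.ae_diff] with p x1 x2 x3 x4
        simp only [br, d1_add x3 x4, d2_add x3 x4, Pi.add_apply]
        rw [x1, x2]; simp only [br]; ring
      smul_mem' := by
        rintro k b ⟨hb, ϑ, h1, h2⟩
        refine ⟨(BM.const k).mul hb, _, h1.mul (Lip.const k), ?_⟩
        filter_upwards [h2] with p x1
        simp only [br, d1_const_mul, d2_const_mul, Pi.smul_apply, smul_eq_mul]
        rw [x1]; simp only [br]; ring }
  have restr : ∀ F : ℝ × ℝ → ℝ, (∀ p, p ∉ W → F p = 0) → ∫ p in W, F p = ∫ p, F p := fun F h =>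
    setIntegral_eq_integral_of_forall_compl_eq_zero h
  obtain ⟨f0, m0, bd0, w0, e0⟩ := HBdual (μ := volume.restrict W) (PP H t s) (ext t s f) pb.meas hCp feb.meas hM0
    (ε := ∫ p in Ioo (-t) t ×ˢ Ioo (-s) s, |G p|) (integral_nonneg fun p => abs_nonneg _) (fun p => hM _) D
    (fun b hb => ⟨hb.1.meas, hb.1.bdd⟩) (by
      rintro b ⟨hb, ϑ, h1, h2⟩ θ hθ Θ hΘ
      rw [restr _ (fun p hp => by rw [p0 p hp, mul_zero])]
      refine (le_abs_self _).trans ((DE (L := L) g hf hM hG hw ht hs a1 a2 b1 b2 h1.lip (fun p hp => h1.zero hp) (by linarith) (by linarith) hθ hΘ).trans ?_)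
      rw [mul_comm Θ]
      refine le_of_eq ?_
      congr 2
      apply integral_congr_ae
      filter_upwards [ae_restrict_of_ae h2] with p hp
      rw [hp]; rfl)
  have W0 : Weak W (ext t s H) f0 (fun _ => 0) := by
    intro ϑ hϑ
    have := w0 (br (ext t s H) ϑ) ⟨BM.br (ext_lip g.hl t s) hϑ.lip, ϑ, hϑ, Eventually.of_forall fun p => rfl⟩
    rw [restr _ (fun p hp => by rw [br_zero fun h => hp (hϑ.sub h), mul_zero])] at this
    rw [this]; simp
  have S0 : ∫ p, f0 p ^ 2 * PP H t s p = 0 := by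
    have := T0 (ext_lip g.hl t s) ⟨m0, M, bd0⟩ W0 (phi t s) hph
    simp only [zero_mul, integral_zero, neg_zero] at this
    exact this
  have bf0 : BM f0 := ⟨m0, M, bd0⟩
  have hK : IsCompact (Metric.closedBall (0 : ℝ × ℝ) L) := isCompact_closedBall _ _
  have i1 : Integrable fun p => ext t s f p ^ 2 * PP H t s p :=
    (feb.sq.mul pb).int hK fun p hp => by rw [p0 p fun h => hp (Metric.ball_subset_closedBall h), mul_zero]
  have i2 : Integrable fun p => f0 p ^ 2 * PP H t s p :=
    (bf0.sq.mul pb).int hK fun p hp => by rw [p0 p fun h => hp (Metric.ball_subset_closedBall h), mul_zero]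
  have i3 : Integrable fun p => 2 * M * (|ext t s f p - f0 p| * |PP H t s p|) :=
    (((feb.sub bf0).abs.mul pb.abs).int hK fun p hp => by rw [p0 p fun h => hp (Metric.ball_subset_closedBall h), abs_zero, mul_zero]).const_mul _
  rw [restr _ (fun p hp => by rw [p0 p hp, abs_zero, mul_zero])] at e0
  rw [← sub_zero (∫ p, ext t s f p ^ 2 * PP H t s p), ← S0, ← integral_sub i1 i2, ← Real.norm_eq_abs]
  refine (norm_integral_le_of_norm_le i3 (Eventually.of_forall fun p => ?_)).trans ?_
  · have e : ext t s f p ^ 2 * PP H t s p - f0 p ^ 2 * PP H t s p = (ext t s f p + f0 p) * ((ext t s f p - f0 p) * PP H t s p) := by ring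
    rw [e, Real.norm_eq_abs, abs_mul, abs_mul]
    refine mul_le_mul_of_nonneg_right ((abs_add_le _ _).trans ?_) (by positivity)
    have h1 : |ext t s f p| ≤ M := hM _
    linarith [bd0 p]
  · rw [integral_const_mul]; exact mul_le_mul_of_nonneg_left e0 (by positivity)

lemma av_one (t y : ℝ) : avR t (fun _ => 1) y = 1 ∧ avL t (fun _ => 1) y = 1 := by
  constructor <;> simp [avR, avL]

lemma pv_sq {H f : ℝ × ℝ → ℝ} {t s : ℝ} (g : Geo H t s) (hf : BM f) :
    ∫ p, ext t s f p ^ 2 * pv H t s p = (∫ y in Ioo (-s) s, f (-t, y) ^ 2 * d2 H (-t, y)) - ∫ y in Ioo (-s) s, f (t, y) ^ 2 * d2 H (t, y) := by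
  have h := pv_int g ((ext_bm hf.sq t s).mul (BM.const 1))
  have e1 : ∫ y in Ioo (-s) s, d2 H (-t, y) * avL t (fun p => ext t s (fun p => f p ^ 2) p * 1) y = ∫ y in Ioo (-s) s, f (-t, y) ^ 2 * d2 H (-t, y) :=
    setIntegral_congr_fun measurableSet_Ioo fun y hy => by
      simp only [(av_ext g.ht (fun p => f p ^ 2) (fun _ => 1) (abs_lt.2 hy)).2, (av_one t y).2]; ring
  have e2 : ∫ y in Ioo (-s) s, d2 H (t, y) * avR t (fun p => ext t s (fun p => f p ^ 2) p * 1) y = ∫ y in Ioo (-s) s, f (t, y) ^ 2 * d2 H (t, y) :=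
    setIntegral_congr_fun measurableSet_Ioo fun y hy => by
      simp only [(av_ext g.ht (fun p => f p ^ 2) (fun _ => 1) (abs_lt.2 hy)).1, (av_one t y).1]; ring
  rw [e1, e2] at h
  rw [← h]; congr 1; ext p; simp only [ext, mul_one]

theorem SQ {H f G : ℝ × ℝ → ℝ} {R t s M : ℝ} (hf : Measurable f) (hM : ∀ p, |f p| ≤ M) (hG : BM G)
    (hw : Weak (Metric.ball 0 R) H f G) (hg : GoodSq H f R t s) :
    |((∫ y in Ioo (-s) s, f (-t, y) ^ 2 * d2 H (-t, y)) - ∫ y in Ioo (-s) s, f (t, y) ^ 2 * d2 H (t, y)) -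
      ((∫ x in Ioo (-t) t, f (x, -s) ^ 2 * d1 H (x, -s)) - ∫ x in Ioo (-t) t, f (x, s) ^ 2 * d1 H (x, s))| ≤
      2 * M * ∫ p in Ioo (-t) t ×ˢ Ioo (-s) s, |G p| := by
  have bf : BM f := ⟨hf, M, hM⟩
  have h := SQ1 hf hM hG hw hg
  rw [PP_int hg.g.hl hg.g.ht hg.g.hs (ext_bm bf t s).sq, pv_sq hg.g bf] at h
  have h2 := pv_sq hg.g.swap (bf.comp measurable_swap)
  simp only [d2_swap, Prod.swap_prod_mk] at h2
  have e : ∫ p : ℝ × ℝ, ext s t (fun p => f p.swap) p ^ 2 * pv (fun q => H q.swap) s t p =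
    ∫ p : ℝ × ℝ, ext t s f p.swap ^ 2 * pv (fun q => H q.swap) s t p := rfl
  rw [← e, h2] at h
  exact h

/-- tent -/
def tent (ε x : ℝ) : ℝ := max 0 (ε - |x|)
/-- derivative of the tent -/
def dtent (ε x : ℝ) : ℝ := (Ioo (-ε) 0).indicator (fun _ => (1:ℝ)) x - (Ioo 0 ε).indicator (fun _ => (1:ℝ)) x

lemma tent_lip (ε : ℝ) : LipschitzWith 1 (tent ε) := by
  have : LipschitzWith 1 fun x : ℝ => ε - |x| := LipschitzWith.of_dist_le_mul fun x y => by
    simp only [Real.dist_eq, NNReal.coe_one, one_mul]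
    calc _ = |(|y| - |x|)| := by congr 1; ring
      _ ≤ |y - x| := abs_abs_sub_abs_le_abs_sub _ _
      _ = _ := abs_sub_comm _ _
  exact this.const_max 0
lemma tent_m (ε : ℝ) : Measurable (tent ε) := (tent_lip ε).continuous.measurable
lemma tent_nn (ε x : ℝ) : 0 ≤ tent ε x := le_max_left _ _
lemma tent_zero {ε x : ℝ} (h : ε ≤ |x|) : tent ε x = 0 := max_eq_left (by linarith)
lemma tent_in {ε x : ℝ} (h : |x| ≤ ε) : tent ε x = ε - |x| := max_eq_right (by linarith)
lemma tent_le {ε : ℝ} (hε : 0 ≤ ε) (x : ℝ) : tent ε x ≤ ε := max_le hε (by linarith [abs_nonneg x])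
lemma tent_abs {ε : ℝ} (hε : 0 ≤ ε) (x : ℝ) : |tent ε x| ≤ ε := by rw [abs_of_nonneg (tent_nn _ _)]; exact tent_le hε x
lemma dtent_m (ε : ℝ) : Measurable (dtent ε) :=
  (measurable_const.indicator measurableSet_Ioo).sub (measurable_const.indicator measurableSet_Ioo)
lemma dtent_abs (ε x : ℝ) : |dtent ε x| ≤ 2 := by
  unfold dtent; simp only [indicator]; split_ifs <;> norm_num
lemma dtent_zero {ε x : ℝ} (hε : 0 < ε) (h : ε ≤ |x|) : dtent ε x = 0 := by
  unfold dtent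
  rw [indicator_of_notMem, indicator_of_notMem, sub_zero]
  · rintro ⟨a, b⟩; rw [abs_of_pos a] at h; linarith
  · rintro ⟨a, b⟩; rw [abs_of_neg b] at h; linarith

lemma tent_deriv {ε : ℝ} (hε : 0 < ε) : ∀ᵐ x, HasDerivAt (tent ε) (dtent ε x) x := by
  filter_upwards [ae_ne 0, ae_ne ε, ae_ne (-ε)] with x h0 h1 h2
  by_cases hx : ε < |x|
  · rw [dtent_zero hε hx.le]
    have : tent ε =ᶠ[𝓝 x] fun _ => 0 := by
      filter_upwards [(isOpen_lt continuous_const continuous_abs).mem_nhds hx] with y hy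
      exact tent_zero (le_of_lt hy)
    exact (hasDerivAt_const x 0).congr_of_eventuallyEq this
  · have hx' : |x| < ε := lt_of_le_of_ne (not_lt.1 hx) fun h => by
      rcases abs_eq hε.le |>.1 h with h | h
      · exact h1 h
      · exact h2 h
    obtain ⟨ha, hb⟩ := abs_lt.1 hx'
    rcases lt_or_gt_of_ne h0 with h | h
    · have : tent ε =ᶠ[𝓝 x] fun y => ε + y := by
        filter_upwards [isOpen_Ioo.mem_nhds (show x ∈ Ioo (-ε) 0 from ⟨ha, h⟩)] with y hy
        rw [tent_in (by rw [abs_of_neg hy.2]; linarith [hy.1]), abs_of_neg hy.2]; ring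
      have e : dtent ε x = 1 := by
        unfold dtent; rw [indicator_of_mem (show x ∈ Ioo (-ε) 0 from ⟨ha, h⟩), indicator_of_notMem (fun hh => by linarith [hh.1]), sub_zero]
      rw [e]; exact ((hasDerivAt_id x).const_add ε).congr_of_eventuallyEq this
    · have : tent ε =ᶠ[𝓝 x] fun y => ε - y := by
        filter_upwards [isOpen_Ioo.mem_nhds (show x ∈ Ioo 0 ε from ⟨h, hb⟩)] with y hy
        rw [tent_in (by rw [abs_of_pos hy.1]; linarith [hy.2]), abs_of_pos hy.1]
      have e : dtent ε x = -1 := by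
        unfold dtent; rw [indicator_of_mem (show x ∈ Ioo 0 ε from ⟨h, hb⟩), indicator_of_notMem (fun hh => by linarith [hh.2]), zero_sub]
      rw [e]; exact ((hasDerivAt_id x).const_sub ε).congr_of_eventuallyEq this

lemma int_tail {ε a : ℝ} (ha : 0 ≤ a) : ∫ t in Ioo 0 ε, (Ioi a).indicator (fun _ => (1:ℝ)) t = max 0 (ε - a) := by
  rw [setIntegral_indicator measurableSet_Ioi]
  have : Ioo 0 ε ∩ Ioi a = Ioo a ε := by
    ext x; simp only [mem_inter_iff, mem_Ioo, mem_Ioi]; constructor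
    · rintro ⟨⟨h1, h2⟩, h3⟩; exact ⟨h3, h2⟩
    · rintro ⟨h1, h2⟩; exact ⟨⟨by linarith, h2⟩, h1⟩
  rw [this]; simp [max_comm]

/-- tent product -/
def eta (ε : ℝ) (p : ℝ × ℝ) : ℝ := tent ε p.1 * tent ε p.2

lemma eta_lip {ε : ℝ} (hε : 0 ≤ ε) : Lip (eta ε) :=
  (Lip.fst.comp1 (tent_lip ε)).mul (Lip.snd.comp1 (tent_lip ε)) (fun p => tent_abs hε _) (fun p => tent_abs hε _)
lemma eta_nn (ε : ℝ) (p : ℝ × ℝ) : 0 ≤ eta ε p := mul_nonneg (tent_nn _ _) (tent_nn _ _)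
lemma eta_zero {ε : ℝ} {p : ℝ × ℝ} (hp : p ∉ Metric.ball (0 : ℝ × ℝ) ε) : eta ε p = 0 := by
  have : ε ≤ |p.1| ∨ ε ≤ |p.2| := by
    by_contra h; push Not at h
    apply hp; simpa [Prod.norm_def] using h
  unfold eta
  rcases this with h | h <;> rw [tent_zero h] <;> ring
lemma eta_bm {ε : ℝ} (hε : 0 ≤ ε) : BM (eta ε) := ⟨(eta_lip hε).meas, ε * ε, fun p => by
  unfold eta; rw [abs_mul]; exact mul_le_mul (tent_abs hε _) (tent_abs hε _) (abs_nonneg _) hε⟩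

lemma br_eta {H : ℝ × ℝ → ℝ} {ε : ℝ} (hε : 0 < ε) : ∀ᵐ p, br H (eta ε) p =
    d2 H p * (dtent ε p.1 * tent ε p.2) - d1 H p * (tent ε p.1 * dtent ε p.2) := by
  filter_upwards [ae_fst (tent_deriv hε), ae_snd (tent_deriv hε)] with p p2 p3
  obtain ⟨q1, q2, q3⟩ := fderiv_fst p2
  obtain ⟨r1, r2, r3⟩ := fderiv_snd p3
  unfold eta
  rw [br_mul q1 r1]
  simp only [br, q2, q3, r2, r3]
  ring

lemma sq_bdd (ε : ℝ) : Bornology.IsBounded (Ioo 0 ε ×ˢ Ioo 0 ε) := (Metric.isBounded_Ioo _ _).prod (Metric.isBounded_Ioo _ _)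

lemma fin_restr {α : Type*} [MeasurableSpace α] {μ : Measure α} {s : Set α} (h : μ s < ⊤) : IsFiniteMeasure (μ.restrict s) := ⟨by simpa using h⟩

lemma ball_zero (ε : ℝ) : Metric.ball (0 : ℝ × ℝ) ε = Ioo (-ε) ε ×ˢ Ioo (-ε) ε := by
  ext p; simp [Prod.norm_def, abs_lt]

/-- indicator factor -/
def one (a t : ℝ) : ℝ := (Ioi |a|).indicator (fun _ => (1:ℝ)) t

lemma one_m {α : Type*} [MeasurableSpace α] {f g : α → ℝ} (hf : Measurable f) (hg : Measurable g) : Measurable fun x => one (f x) (g x) := by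
  have : (fun x => one (f x) (g x)) = {x | |f x| < g x}.indicator fun _ => (1:ℝ) := by
    ext x; simp [one, indicator]
  rw [this]; exact measurable_const.indicator (measurableSet_lt hf.abs hg)
lemma one_abs (a t : ℝ) : |one a t| ≤ 1 := by unfold one; simp only [indicator]; split_ifs <;> norm_num
lemma one_int (ε a : ℝ) : ∫ t in Ioo 0 ε, one a t = tent ε a := int_tail (abs_nonneg a)

lemma int_area {F : ℝ × ℝ → ℝ} (hF : BM F) {ε : ℝ} (hε : 0 < ε) :
    IntegrableOn (fun q : ℝ × ℝ => ∫ p in Ioo (-q.1) q.1 ×ˢ Ioo (-q.2) q.2, F p) (Ioo 0 ε ×ˢ Ioo 0 ε) ∧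
    ∫ q in Ioo 0 ε ×ˢ Ioo 0 ε, ∫ p in Ioo (-q.1) q.1 ×ˢ Ioo (-q.2) q.2, F p = ∫ p, F p * eta ε p := by
  have hQ : MeasurableSet (Ioo 0 ε ×ˢ Ioo 0 ε) := measurableSet_Ioo.prod measurableSet_Ioo
  have f1 : IsFiniteMeasure ((volume : Measure (ℝ × ℝ)).restrict (Ioo 0 ε ×ˢ Ioo 0 ε)) := fin_restr (sq_bdd ε).measure_lt_top
  have f2 : IsFiniteMeasure ((volume : Measure (ℝ × ℝ)).restrict (Metric.ball 0 ε)) := fin_restr Metric.isBounded_ball.measure_lt_top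
  obtain ⟨hFm, C, hC⟩ := hF
  have hC0 : 0 ≤ C := (abs_nonneg _).trans (hC 0)
  have e : ∀ q ∈ Ioo 0 ε ×ˢ Ioo 0 ε, ∫ p in Ioo (-q.1) q.1 ×ˢ Ioo (-q.2) q.2, F p = ∫ p in Metric.ball (0 : ℝ × ℝ) ε, one p.1 q.1 * one p.2 q.2 * F p := by
    rintro q ⟨h1, h2⟩
    have hs : Ioo (-q.1) q.1 ×ˢ Ioo (-q.2) q.2 ⊆ Metric.ball (0 : ℝ × ℝ) ε := by
      rw [ball_zero]; exact prod_mono (Ioo_subset_Ioo (by linarith [h1.2]) h1.2.le) (Ioo_subset_Ioo (by linarith [h2.2]) h2.2.le)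
    have hm : MeasurableSet (Ioo (-q.1) q.1 ×ˢ Ioo (-q.2) q.2) := measurableSet_Ioo.prod measurableSet_Ioo
    rw [← inter_eq_self_of_subset_right hs, ← setIntegral_indicator hm]
    congr 1; ext p
    simp only [indicator, one, mem_prod, mem_Ioo, mem_Ioi, abs_lt]
    split_ifs <;> simp_all
  have int : Integrable (fun z : (ℝ × ℝ) × (ℝ × ℝ) => one z.2.1 z.1.1 * one z.2.2 z.1.2 * F z.2)
      (((volume : Measure (ℝ × ℝ)).restrict (Ioo 0 ε ×ˢ Ioo 0 ε)).prod ((volume : Measure (ℝ × ℝ)).restrict (Metric.ball 0 ε))) := by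
    refine bdd_int (C := 1 * 1 * C) ?_ fun z => ?_
    · exact ((one_m (by fun_prop) (by fun_prop)).mul (one_m (by fun_prop) (by fun_prop))).mul (hFm.comp measurable_snd)
    · rw [abs_mul, abs_mul]
      exact mul_le_mul (mul_le_mul (one_abs _ _) (one_abs _ _) (abs_nonneg _) zero_le_one) (hC _) (abs_nonneg _) (by norm_num)
  constructor
  · refine IntegrableOn.congr_fun (f := fun q : ℝ × ℝ => ∫ p in Metric.ball (0 : ℝ × ℝ) ε, one p.1 q.1 * one p.2 q.2 * F p) ?_ (fun q hq => (e q hq).symm) hQ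
    exact int.integral_prod_left
  · rw [setIntegral_congr_fun hQ e, integral_integral_swap (by exact int)]
    have : ∀ p : ℝ × ℝ, ∫ q in Ioo 0 ε ×ˢ Ioo 0 ε, one p.1 q.1 * one p.2 q.2 * F p = F p * eta ε p := by
      intro p
      rw [integral_mul_const, Measure.volume_eq_prod, setIntegral_prod_mul (one p.1) (one p.2), one_int, one_int, mul_comm]; rfl
    simp only [this]
    exact setIntegral_eq_integral_of_forall_compl_eq_zero fun p hp => by rw [eta_zero hp, mul_zero]

lemma int_side {F : ℝ × ℝ → ℝ} (hF : BM F) {ε : ℝ} (hε : 0 < ε) :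
    IntegrableOn (fun q : ℝ × ℝ => ∫ y in Ioo (-q.2) q.2, F (q.1, y)) (Ioo 0 ε ×ˢ Ioo 0 ε) ∧
    ∫ q in Ioo 0 ε ×ˢ Ioo 0 ε, ∫ y in Ioo (-q.2) q.2, F (q.1, y) =
      ∫ p : ℝ × ℝ, F p * ((Ioo 0 ε).indicator (fun _ => (1:ℝ)) p.1 * tent ε p.2) := by
  have hQ : MeasurableSet (Ioo 0 ε ×ˢ Ioo 0 ε) := measurableSet_Ioo.prod measurableSet_Ioo
  have f1 : IsFiniteMeasure ((volume : Measure (ℝ × ℝ)).restrict (Ioo 0 ε ×ˢ Ioo 0 ε)) := fin_restr (sq_bdd ε).measure_lt_top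
  obtain ⟨hFm, C, hC⟩ := hF
  have hC0 : 0 ≤ C := (abs_nonneg _).trans (hC 0)
  have e : ∀ q ∈ Ioo 0 ε ×ˢ Ioo 0 ε, ∫ y in Ioo (-q.2) q.2, F (q.1, y) = ∫ y in Ioo (-ε) ε, one y q.2 * F (q.1, y) := by
    rintro q ⟨h1, h2⟩
    have hs : Ioo (-q.2) q.2 ⊆ Ioo (-ε) ε := (Ioo_subset_Ioo (by linarith [h2.2]) h2.2.le)
    rw [← inter_eq_self_of_subset_right hs, ← setIntegral_indicator measurableSet_Ioo]
    congr 1; ext p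
    simp only [indicator, one, mem_Ioo, mem_Ioi, abs_lt]
    split_ifs <;> simp_all
  have int : Integrable (fun z : (ℝ × ℝ) × ℝ => one z.2 z.1.2 * F (z.1.1, z.2))
      (((volume : Measure (ℝ × ℝ)).restrict (Ioo 0 ε ×ˢ Ioo 0 ε)).prod ((volume : Measure ℝ).restrict (Ioo (-ε) ε))) := by
    refine bdd_int (C := 1 * C) ?_ fun z => ?_
    · exact (one_m (by fun_prop) (by fun_prop)).mul (hFm.comp (by fun_prop))
    · rw [abs_mul]
      exact mul_le_mul (one_abs _ _) (hC _) (abs_nonneg _) (by norm_num)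
  constructor
  · refine IntegrableOn.congr_fun (f := fun q : ℝ × ℝ => ∫ y in Ioo (-ε) ε, one y q.2 * F (q.1, y)) ?_ (fun q hq => (e q hq).symm) hQ
    exact int.integral_prod_left
  · rw [setIntegral_congr_fun hQ e, integral_integral_swap (by exact int)]
    have : ∀ y : ℝ, ∫ q in Ioo 0 ε ×ˢ Ioo 0 ε, one y q.2 * F (q.1, y) = ∫ x in Ioo 0 ε, F (x, y) * tent ε y := by
      intro y
      have h := setIntegral_prod_mul (μ := volume) (ν := volume) (fun x => F (x, y)) (one y) (Ioo 0 ε) (Ioo 0 ε)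
      rw [one_int, ← Measure.volume_eq_prod, ← integral_mul_const] at h
      rw [← h]; congr 1; ext q; ring
    simp only [this]
    have hk : Integrable (fun p : ℝ × ℝ => F p * tent ε p.2) ((volume.restrict (Ioo 0 ε)).prod (volume.restrict (Ioo (-ε) ε))) := by
      refine bdd_int (C := C * ε) (hFm.mul ((tent_m ε).comp measurable_snd)) fun p => ?_
      show |F p * tent ε p.2| ≤ _
      rw [abs_mul]; exact mul_le_mul (hC _) (tent_abs hε.le _) (abs_nonneg _) hC0
    rw [← integral_prod_symm (fun p : ℝ × ℝ => F p * tent ε p.2) hk, Measure.prod_restrict, ← Measure.volume_eq_prod,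
      ← integral_indicator (measurableSet_Ioo.prod measurableSet_Ioo)]
    congr 1; ext p
    by_cases h1 : p.1 ∈ Ioo 0 ε
    · by_cases h2 : p.2 ∈ Ioo (-ε) ε
      · rw [indicator_of_mem (show p ∈ Ioo 0 ε ×ˢ Ioo (-ε) ε from ⟨h1, h2⟩), indicator_of_mem h1, one_mul]
      · rw [indicator_of_notMem (fun h => h2 h.2), tent_zero (not_lt.1 fun h => h2 (abs_lt.1 h))]; ring
    · rw [indicator_of_notMem (fun h => h1 h.1), indicator_of_notMem h1]; ring

lemma mp_neg1 : MeasurePreserving (fun p : ℝ × ℝ => (-p.1, p.2)) volume volume :=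
  (Measure.measurePreserving_neg (volume : Measure ℝ)).prod (MeasurePreserving.id volume)

lemma neg1_int (F : ℝ × ℝ → ℝ) : ∫ p : ℝ × ℝ, F (-p.1, p.2) = ∫ p, F p := by
  let e : (ℝ × ℝ) ≃ᵐ (ℝ × ℝ) := (MeasurableEquiv.neg ℝ).prodCongr (MeasurableEquiv.refl ℝ)
  exact mp_neg1.integral_comp e.measurableEmbedding F

lemma int_side2 {F : ℝ × ℝ → ℝ} (hF : BM F) {ε : ℝ} (hε : 0 < ε) :
    IntegrableOn (fun q : ℝ × ℝ => (∫ y in Ioo (-q.2) q.2, F (-q.1, y)) - ∫ y in Ioo (-q.2) q.2, F (q.1, y)) (Ioo 0 ε ×ˢ Ioo 0 ε) ∧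
    ∫ q in Ioo 0 ε ×ˢ Ioo 0 ε, ((∫ y in Ioo (-q.2) q.2, F (-q.1, y)) - ∫ y in Ioo (-q.2) q.2, F (q.1, y)) =
      ∫ p : ℝ × ℝ, F p * (dtent ε p.1 * tent ε p.2) := by
  have hm : Measurable fun p : ℝ × ℝ => (-p.1, p.2) := by fun_prop
  obtain ⟨i1, e1⟩ := int_side hF hε
  obtain ⟨i2, e2⟩ := int_side (hF.comp hm) hε
  refine ⟨i2.sub i1, ?_⟩
  rw [integral_sub i2 i1, e1, e2]
  have h := neg1_int fun p => F p * ((Ioo 0 ε).indicator (fun _ => (1:ℝ)) (-p.1) * tent ε p.2)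
  simp only [neg_neg] at h
  rw [h, ← integral_sub]
  · congr 1; ext p
    have : (Ioo 0 ε).indicator (fun _ => (1:ℝ)) (-p.1) = (Ioo (-ε) 0).indicator (fun _ => (1:ℝ)) p.1 := by
      simp only [indicator, mem_Ioo]
      by_cases h : 0 < -p.1 ∧ -p.1 < ε
      · rw [if_pos h, if_pos ⟨by linarith, by linarith⟩]
      · rw [if_neg h, if_neg fun h' => h ⟨by linarith [h'.2], by linarith [h'.1]⟩]
    rw [this]; unfold dtent; ring
  · have b : BM fun p : ℝ × ℝ => (Ioo 0 ε).indicator (fun _ => (1:ℝ)) (-p.1) * tent ε p.2 := by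
      refine ⟨((measurable_const.indicator measurableSet_Ioo).comp (measurable_fst.neg)).mul ((tent_m ε).comp measurable_snd), 1 * ε, fun p => ?_⟩
      rw [abs_mul]
      refine mul_le_mul ?_ (tent_abs hε.le _) (abs_nonneg _) zero_le_one
      simp only [indicator]; split_ifs <;> norm_num
    refine (hF.mul b).int (isCompact_closedBall 0 ε) fun p hp => ?_
    have : ε < |p.1| ∨ ε < |p.2| := by
      by_contra h; push Not at h
      apply hp; simpa [Prod.norm_def] using h
    rcases this with h | h
    · rw [indicator_of_notMem, zero_mul, mul_zero]
      rintro ⟨h1, h2⟩; rw [abs_of_neg (by linarith)] at h; linarith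
    · rw [tent_zero h.le]; ring
  · have b : BM fun p : ℝ × ℝ => (Ioo 0 ε).indicator (fun _ => (1:ℝ)) p.1 * tent ε p.2 := by
      refine ⟨((measurable_const.indicator measurableSet_Ioo).comp (measurable_fst)).mul ((tent_m ε).comp measurable_snd), 1 * ε, fun p => ?_⟩
      rw [abs_mul]
      refine mul_le_mul ?_ (tent_abs hε.le _) (abs_nonneg _) zero_le_one
      simp only [indicator]; split_ifs <;> norm_num
    refine (hF.mul b).int (isCompact_closedBall 0 ε) fun p hp => ?_
    have : ε < |p.1| ∨ ε < |p.2| := by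
      by_contra h; push Not at h
      apply hp; simpa [Prod.norm_def] using h
    rcases this with h | h
    · rw [indicator_of_notMem, zero_mul, mul_zero]
      rintro ⟨h1, h2⟩; rw [abs_of_pos (by linarith)] at h; linarith
    · rw [tent_zero h.le]; ring

lemma ae_neg {P : ℝ → Prop} (h : ∀ᵐ x, P x) : ∀ᵐ x : ℝ, P (-x) :=
  (Measure.measurePreserving_neg (volume : Measure ℝ)).quasiMeasurePreserving.ae h

lemma goodSq_ae {H f : ℝ × ℝ → ℝ} (hH : Lip H) (hf : BM f) (R : ℝ) :
    ∀ᵐ q : ℝ × ℝ, 0 < q.1 → 0 < q.2 → q.1 < R → q.2 < R → GoodSq H f R q.1 q.2 := by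
  have g1 := goodX_ae (hf.mul hH.bm_d2) R
  have g2 := goodX_ae ((hf.mul hH.bm_d1).comp (T := Prod.swap) measurable_swap) R
  have l1 := hH.line2
  have l2 := ae_yx hH.ae_diff
  filter_upwards [ae_fst g1, ae_fst (ae_neg g1), ae_snd g2, ae_snd (ae_neg g2), ae_fst l1, ae_fst (ae_neg l1),
    ae_snd l2, ae_snd (ae_neg l2)] with q a1 a2 a3 a4 a5 a6 a7 a8 h1 h2 h3 h4
  exact ⟨⟨h1, h2, hH, a5, a6, a7, a8⟩, h3, h4, a1, a2, a3, a4⟩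

theorem SQeta {H f G : ℝ × ℝ → ℝ} {R M ε : ℝ} (hH : Lip H) (hf : Measurable f) (hM : ∀ p, |f p| ≤ M) (hG : BM G)
    (hw : Weak (Metric.ball 0 R) H f G) (hε : 0 < ε) (hR : ε ≤ R) :
    |∫ p, f p ^ 2 * br H (eta ε) p| ≤ 2 * M * ∫ p, |G p| * eta ε p := by
  have bf : BM f := ⟨hf, M, hM⟩
  have hQ : MeasurableSet (Ioo 0 ε ×ˢ Ioo 0 ε) := measurableSet_Ioo.prod measurableSet_Ioo
  have b1 : BM fun p => f p ^ 2 * d2 H p := bf.sq.mul hH.bm_d2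
  have b2 : BM fun p => f p ^ 2 * d1 H p := bf.sq.mul hH.bm_d1
  obtain ⟨i1, e1⟩ := int_side2 b1 hε
  obtain ⟨i2, e2⟩ := int_side2 (b2.comp (T := Prod.swap) measurable_swap) hε
  obtain ⟨i3, e3⟩ := int_area hG.abs hε
  simp only [Prod.swap_prod_mk] at i2 e2
  have i2' : IntegrableOn (fun q : ℝ × ℝ => ((∫ x in Ioo (-q.1) q.1, f (x,-q.2)^2*d1 H (x,-q.2)) - ∫ x in Ioo (-q.1) q.1, f (x,q.2)^2*d1 H (x,q.2))) (Ioo 0 ε ×ˢ Ioo 0 ε) := by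
    rw [← integrable_indicator_iff hQ] at i2 ⊢
    have := mp_swap.integrable_comp_of_integrable i2
    refine this.congr (Eventually.of_forall fun q => ?_)
    simp only [indicator, Function.comp, mem_prod, Prod.fst_swap, Prod.snd_swap, and_comm]
  have e2' := setint_swap (fun q : ℝ × ℝ => ((∫ x in Ioo (-q.1) q.1, f (x,-q.2)^2*d1 H (x,-q.2)) - ∫ x in Ioo (-q.1) q.1, f (x,q.2)^2*d1 H (x,q.2))) (measurableSet_Ioo (a := 0) (b := ε)) (measurableSet_Ioo (a := 0) (b := ε))
  simp only [Prod.fst_swap, Prod.snd_swap] at e2'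
  rw [e2'] at e2
  have e4 := mp_swap.integral_comp MeasurableEquiv.prodComm.measurableEmbedding (fun p : ℝ × ℝ => f p ^ 2 * d1 H p * (tent ε p.1 * dtent ε p.2))
  simp only [Prod.fst_swap, Prod.snd_swap] at e4
  have ip : ∀ (F : ℝ × ℝ → ℝ) (a b : ℝ → ℝ), BM F → Measurable a → Measurable b → (∀ x, |a x| ≤ 2 + ε) → (∀ x, |b x| ≤ 2 + ε) →
      (∀ x, ε ≤ |x| → a x = 0) → (∀ x, ε ≤ |x| → b x = 0) → Integrable fun p : ℝ × ℝ => F p * (a p.1 * b p.2) := by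
    intro F a b hF ha hb ha' hb' ha0 hb0
    have bb : BM fun p : ℝ × ℝ => a p.1 * b p.2 := by
      refine ⟨(ha.comp measurable_fst).mul (hb.comp measurable_snd), (2 + ε) * (2 + ε), fun p => ?_⟩
      rw [abs_mul]
      exact mul_le_mul (ha' _) (hb' _) (abs_nonneg _) (by linarith)
    refine (hF.mul bb).int (isCompact_closedBall 0 ε) fun p hp => ?_
    have : ε < |p.1| ∨ ε < |p.2| := by
      by_contra h; push Not at h
      apply hp; simpa [Prod.norm_def] using h
    rcases this with h | h
    · rw [ha0 _ h.le]; ring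
    · rw [hb0 _ h.le]; ring
  have t1 : ∀ x, |tent ε x| ≤ 2 + ε := fun x => (tent_abs hε.le x).trans (by linarith)
  have t2 : ∀ x, |dtent ε x| ≤ 2 + ε := fun x => (dtent_abs ε x).trans (by linarith)
  have key : ∫ p, f p ^ 2 * br H (eta ε) p = ∫ q in Ioo 0 ε ×ˢ Ioo 0 ε,
      (((∫ y in Ioo (-q.2) q.2, f (-q.1,y)^2*d2 H (-q.1,y)) - ∫ y in Ioo (-q.2) q.2, f (q.1,y)^2*d2 H (q.1,y)) -
      ((∫ x in Ioo (-q.1) q.1, f (x,-q.2)^2*d1 H (x,-q.2)) - ∫ x in Ioo (-q.1) q.1, f (x,q.2)^2*d1 H (x,q.2))) := by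
    rw [integral_sub (by exact i1) (by exact i2'), e1, e2]
    have : ∫ p : ℝ × ℝ, f p.swap ^ 2 * d1 H p.swap * (dtent ε p.1 * tent ε p.2) = ∫ p : ℝ × ℝ, f p ^ 2 * d1 H p * (tent ε p.1 * dtent ε p.2) := by
      rw [← e4]; congr 1; ext p; ring
    rw [this, ← integral_sub]
    · refine integral_congr_ae ?_
      filter_upwards [br_eta (H := H) hε] with p hp
      rw [hp]; ring
    · exact ip _ _ _ b1 (dtent_m ε) (tent_m ε) t2 t1 (fun _ h => dtent_zero hε h) fun _ h => tent_zero h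
    · exact ip _ _ _ b2 (tent_m ε) (dtent_m ε) t1 t2 (fun _ h => tent_zero h) fun _ h => dtent_zero hε h
  rw [key, ← e3, ← integral_const_mul, ← Real.norm_eq_abs]
  refine norm_integral_le_of_norm_le (i3.const_mul _) ?_
  rw [ae_restrict_iff' hQ]
  filter_upwards [goodSq_ae hH bf R] with q hq hqm
  rw [Real.norm_eq_abs]
  exact SQ hf hM hG hw (hq hqm.1.1 hqm.2.1 (hqm.1.2.trans_le hR) (hqm.2.2.trans_le hR))

lemma eta_tst {ε R : ℝ} (hε : 0 < ε) (hR : ε < R) : Tst (Metric.ball 0 R) (eta ε) :=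
  Tst.of_closed (eta_lip hε.le) (isCompact_closedBall 0 ε)
    (fun p hp => eta_zero fun h => hp (Metric.ball_subset_closedBall h)) (Metric.closedBall_subset_ball hR)

/-- product rule with the source -/
lemma weak_mul {U : Set (ℝ × ℝ)} {H f G ζ : ℝ × ℝ → ℝ} (hH : Lip H) (bf : BM f) (hG : BM G) (hζ : Lip ζ) (bζ : BM ζ)
    (hw : Weak U H f G) {φ : ℝ × ℝ → ℝ} (hφ : Tst U φ) :
    ∫ p, f p * ζ p * br H φ p = - (∫ p, G p * ζ p * φ p) - ∫ p, f p * br H ζ p * φ p := by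
  have h := hw _ (hφ.mul hζ)
  have e : ∫ p, f p * br H (fun p => ζ p * φ p) p = (∫ p, f p * ζ p * br H φ p) + ∫ p, f p * br H ζ p * φ p := by
    rw [← integral_add (hφ.int_br hH (bf.mul bζ)) (hφ.int (bf.mul (BM.br hH hζ)))]
    refine integral_congr_ae ?_
    filter_upwards [hζ.ae_diff, hφ.lip.ae_diff] with p h1 h2
    rw [br_mul h1 h2]; ring
  rw [e] at h
  have : ∫ p, G p * (ζ p * φ p) = ∫ p, G p * ζ p * φ p := by congr 1; ext p; ring
  rw [this] at h; linarith

lemma weak_one {U : Set (ℝ × ℝ)} {H : ℝ × ℝ → ℝ} (hH : Lip H) : Weak U H (fun _ => 1) (fun _ => 0) :=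
  (NL hH).mono (subset_univ _)

lemma br_sq {H ζ : ℝ × ℝ → ℝ} {p : ℝ × ℝ} (h : DifferentiableAt ℝ ζ p) : br H (fun p => ζ p * ζ p) p = 2 * ζ p * br H ζ p := by
  rw [br_mul h h]; ring

theorem Deta0 {H f G ζ : ℝ × ℝ → ℝ} {R M Z ε : ℝ} (hH : Lip H) (hf : Measurable f) (hM : ∀ p, |f p| ≤ M) (hG : BM G)
    (hζ : Lip ζ) (hZ : ∀ p, |ζ p| ≤ Z)
    (hw : Weak (Metric.ball 0 R) H f G) (hε : 0 < ε) (hR : ε < R) :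
    |(∫ p, f p ^ 2 * br H (eta ε) p) + 2 * ∫ p, f p * G p * eta ε p| ≤ 4 * (M + Z) * ∫ p, |G p - br H ζ p| * eta ε p := by
  have bf : BM f := ⟨hf, M, hM⟩
  have bζ : BM ζ := ⟨hζ.meas, Z, hZ⟩
  have bb : BM (br H ζ) := BM.br hH hζ
  have hη := eta_tst hε hR
  have w2 : Weak (Metric.ball 0 R) H (fun p => f p - ζ p) (fun p => G p - br H ζ p) := by
    intro φ hφ
    have h1 := hw φ hφ
    have h2 := weak_mul hH (BM.const 1) (BM.const 0) hζ bζ (weak_one hH) hφ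
    simp only [one_mul, zero_mul, integral_zero, neg_zero, zero_sub] at h2
    have e1 : ∫ p, (f p - ζ p) * br H φ p = (∫ p, f p * br H φ p) - ∫ p, ζ p * br H φ p := by
      rw [← integral_sub (hφ.int_br hH bf) (hφ.int_br hH bζ)]; congr 1; ext p; ring
    have e2 : ∫ p, (G p - br H ζ p) * φ p = (∫ p, G p * φ p) - ∫ p, br H ζ p * φ p := by
      rw [← integral_sub (hφ.int hG) (hφ.int bb)]; congr 1; ext p; ring
    rw [e1, e2, h1, h2]; ring
  have key := SQeta hH (hf.sub hζ.meas) (fun p => (abs_sub _ _).trans (add_le_add (hM p) (hZ p))) (hG.sub bb) w2 hε hR.le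
  have h1 := weak_mul hH bf hG hζ bζ hw hη
  have h2 := weak_mul hH (BM.const 1) (BM.const 0) (hζ.mul hζ hZ hZ) (bζ.mul bζ) (weak_one hH) hη
  simp only [one_mul, zero_mul, integral_zero, neg_zero, zero_sub] at h2
  have h3 : ∫ p, br H (fun p => ζ p * ζ p) p * eta ε p = 2 * ∫ p, ζ p * br H ζ p * eta ε p := by
    rw [← integral_const_mul]
    refine integral_congr_ae ?_
    filter_upwards [hζ.ae_diff] with p hp
    rw [br_sq hp]; ring
  rw [h3] at h2
  have e1 : ∫ p, (f p - ζ p) ^ 2 * br H (eta ε) p = (∫ p, f p ^ 2 * br H (eta ε) p) - 2 * (∫ p, f p * ζ p * br H (eta ε) p)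
      + ∫ p, ζ p * ζ p * br H (eta ε) p := by
    rw [← integral_const_mul, ← integral_sub (hη.int_br hH bf.sq) ((hη.int_br hH (bf.mul bζ)).const_mul 2), ← integral_add
      (by exact (hη.int_br hH bf.sq).sub ((hη.int_br hH (bf.mul bζ)).const_mul 2)) (hη.int_br hH (bζ.mul bζ))]
    congr 1; ext p; ring
  have e2 : ∫ p, (ζ p - f p) * (G p - br H ζ p) * eta ε p = (∫ p, G p * ζ p * eta ε p) - (∫ p, ζ p * br H ζ p * eta ε p) -
      (∫ p, f p * G p * eta ε p) + ∫ p, f p * br H ζ p * eta ε p := by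
    rw [← integral_sub (hη.int (hG.mul bζ)) (hη.int (bζ.mul bb)), ← integral_sub (by exact (hη.int (hG.mul bζ)).sub (hη.int (bζ.mul bb))) (hη.int (bf.mul hG)),
      ← integral_add (by exact ((hη.int (hG.mul bζ)).sub (hη.int (bζ.mul bb))).sub (hη.int (bf.mul hG))) (hη.int (bf.mul bb))]
    congr 1; ext p; ring
  have e3 : |∫ p, (ζ p - f p) * (G p - br H ζ p) * eta ε p| ≤ (M + Z) * ∫ p, |G p - br H ζ p| * eta ε p := by
    rw [← integral_const_mul, ← Real.norm_eq_abs]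
    refine norm_integral_le_of_norm_le ((hη.int (hG.sub bb).abs).const_mul _) (Eventually.of_forall fun p => ?_)
    rw [Real.norm_eq_abs, abs_mul, abs_mul, abs_of_nonneg (eta_nn ε p), ← mul_assoc]
    refine mul_le_mul_of_nonneg_right (mul_le_mul_of_nonneg_right ((abs_sub _ _).trans ?_) (abs_nonneg _)) (eta_nn ε p)
    linarith [hM p, hZ p]
  simp only [Pi.sub_apply] at key
  rw [abs_le] at key e3 ⊢
  constructor <;> linarith [key.1, key.2, e3.1, e3.2]

lemma d1_tr (H : ℝ × ℝ → ℝ) (c p : ℝ × ℝ) : d1 (fun q => H (q + c)) p = d1 H (p + c) := by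
  unfold d1; rw [fderiv_comp_add_right]
lemma d2_tr (H : ℝ × ℝ → ℝ) (c p : ℝ × ℝ) : d2 (fun q => H (q + c)) p = d2 H (p + c) := by
  unfold d2; rw [fderiv_comp_add_right]
lemma br_tr (H E : ℝ × ℝ → ℝ) (c p : ℝ × ℝ) : br (fun q => H (q + c)) (fun q => E (q + c)) p = br H E (p + c) := by
  simp only [br, d1_tr, d2_tr]
lemma lip_add (c : ℝ × ℝ) : LipschitzWith 1 (fun p : ℝ × ℝ => p + c) :=
  LipschitzWith.of_dist_le_mul fun p q => by simp
lemma tst_tr {U : Set (ℝ × ℝ)} {φ : ℝ × ℝ → ℝ} (h : Tst U φ) (c : ℝ × ℝ) : Tst ((· + c) ⁻¹' U) (fun p => φ (p + c)) := by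
  refine Tst.of_closed (K := (· + c) ⁻¹' tsupport φ) (h.lip.comp (lip_add c)) ?_ (fun p hp => image_eq_zero_of_notMem_tsupport hp) (preimage_mono h.sub)
  exact (Homeomorph.addRight c).isCompact_preimage.2 h.cpt

theorem Deta {H f G ζ : ℝ × ℝ → ℝ} {R M Z ε : ℝ} (c : ℝ × ℝ) (hH : Lip H) (hf : Measurable f) (hM : ∀ p, |f p| ≤ M) (hG : BM G)
    (hζ : Lip ζ) (hZ : ∀ p, |ζ p| ≤ Z)
    (hw : Weak (Metric.ball c R) H f G) (hε : 0 < ε) (hR : ε < R) :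
    |(∫ p, f p ^ 2 * br H (fun q => eta ε (q - c)) p) + 2 * ∫ p, f p * G p * eta ε (p - c)| ≤
      4 * (M + Z) * ∫ p, |G p - br H ζ p| * eta ε (p - c) := by
  have ma : Measurable fun p : ℝ × ℝ => p + c := by fun_prop
  have w : Weak (Metric.ball 0 R) (fun p => H (p + c)) (fun p => f (p + c)) (fun p => G (p + c)) := by
    intro φ hφ
    have := hw (fun p => φ (p - c)) (by
      have := tst_tr hφ (-c)
      simp only [← sub_eq_add_neg] at this
      refine this.mono fun p hp => ?_
      simpa [dist_eq_norm] using hp)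
    rw [← integral_add_right_eq_self _ c, ← integral_add_right_eq_self (fun p => G p * φ (p - c)) c] at this
    simp only [← br_tr, add_sub_cancel_right] at this
    exact this
  have := Deta0 (hH.comp (lip_add c)) (hf.comp ma) (fun p => hM _) (hG.comp ma) (hζ.comp (lip_add c)) (fun p => hZ _) w hε hR
  rw [← integral_add_right_eq_self (fun p => f p ^ 2 * _) c, ← integral_add_right_eq_self (fun p => f p * G p * _) c, ← integral_add_right_eq_self (fun p => |G p - br H ζ p| * _) c]
  simp only [← br_tr, add_sub_cancel_right]
  exact this

theorem DetaB {b1 b2 f G ζ : ℝ × ℝ → ℝ} {R M Z ε : ℝ} (c : ℝ × ℝ) (h1 : BM b1) (h2 : BM b2)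
    (hf : Measurable f) (hM : ∀ p, |f p| ≤ M) (hG : BM G)
    (hζ : Lip ζ) (hZ : ∀ p, |ζ p| ≤ Z) (hD : Div (Metric.ball c R) b1 b2 (fun _ => 0))
    (hw : Div (Metric.ball c R) (fun p => f p * b1 p) (fun p => f p * b2 p) G) (hε : 0 < ε) (hR : ε < R) :
    |(∫ p, f p ^ 2 * (b1 p * d1 (fun q => eta ε (q - c)) p + b2 p * d2 (fun q => eta ε (q - c)) p)) + 2 * ∫ p, f p * G p * eta ε (p - c)| ≤
      4 * (M + Z) * ∫ p, |G p - (b1 p * d1 ζ p + b2 p * d2 ζ p)| * eta ε (p - c) := by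
  obtain ⟨H, hH, hHb⟩ := poincare (r' := (ε + R) / 2) (by linarith) (by linarith) h1 h2 hD
  have bre : ∀ E : ℝ × ℝ → ℝ, ∀ᵐ p, p ∈ Metric.ball c ((ε + R) / 2) → br H E p = b1 p * d1 E p + b2 p * d2 E p := by
    intro E
    filter_upwards [hHb] with p hp hpb
    obtain ⟨x1, x2⟩ := hp hpb
    rw [br, x1, x2]; ring
  have w : Weak (Metric.ball c ((ε + R) / 2)) H f G := by
    intro φ hφ
    rw [← hw φ (hφ.mono (Metric.ball_subset_ball (by linarith)))]
    refine integral_congr_ae ?_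
    filter_upwards [bre φ] with p hp
    by_cases h : p ∈ Metric.ball c ((ε + R) / 2)
    · rw [hp h]; ring
    · rw [br_zero fun h' => h (hφ.sub h'), d1_zero fun h' => h (hφ.sub h'), d2_zero fun h' => h (hφ.sub h')]; ring
  have key := Deta c hH hf hM hG hζ hZ w hε (by linarith)
  have te : Tst (Metric.ball c ((ε + R) / 2)) (fun q => eta ε (q - c)) := by
    have := tst_tr (eta_tst hε (show ε < (ε + R) / 2 by linarith)) (-c)
    simp only [← sub_eq_add_neg] at this
    refine this.mono fun p hp => ?_
    simpa [dist_eq_norm] using hp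
  have e1 : ∫ p, f p ^ 2 * br H (fun q => eta ε (q - c)) p = ∫ p, f p ^ 2 * (b1 p * d1 (fun q => eta ε (q - c)) p + b2 p * d2 (fun q => eta ε (q - c)) p) := by
    refine integral_congr_ae ?_
    filter_upwards [bre (fun q => eta ε (q - c))] with p hp
    by_cases h : p ∈ Metric.ball c ((ε + R) / 2)
    · rw [hp h]
    · rw [br_zero fun h' => h (te.sub h'), d1_zero fun h' => h (te.sub h'), d2_zero fun h' => h (te.sub h')]; ring
  have e2 : ∫ p, |G p - br H ζ p| * eta ε (p - c) = ∫ p, |G p - (b1 p * d1 ζ p + b2 p * d2 ζ p)| * eta ε (p - c) := by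
    refine integral_congr_ae ?_
    filter_upwards [bre ζ] with p hp
    by_cases h : p ∈ Metric.ball c ((ε + R) / 2)
    · rw [hp h]
    · rw [show eta ε (p - c) = 0 from te.zero h]; ring
  rw [e1, e2] at key
  exact key

/-- radii -/
def ee (n : ℕ) : ℝ := 1 / ((n:ℝ) + 1)
lemma ee_pos (n : ℕ) : 0 < ee n := by unfold ee; positivity
lemma ee_le (n : ℕ) : ee n ≤ 1 := by
  unfold ee; rw [div_le_one (by positivity)]; have : (0:ℝ) ≤ n := by positivity
  linarith
lemma ee_lim : Tendsto ee atTop (𝓝 0) := tendsto_one_div_add_atTop_nhds_zero_nat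

lemma vol_ball (c : ℝ × ℝ) {r : ℝ} (hr : 0 ≤ r) : (volume : Measure (ℝ × ℝ)).real (Metric.closedBall c r) = 4 * r ^ 2 := by
  have : Metric.closedBall c r = Metric.closedBall c.1 r ×ˢ Metric.closedBall c.2 r := by
    rw [closedBall_prod_same]
  rw [this, Measure.volume_eq_prod, measureReal_prod_prod, Real.closedBall_eq_Icc, Real.closedBall_eq_Icc]
  simp only [Real.volume_real_Icc]
  rw [max_eq_left (by linarith), max_eq_left (by linarith)]; ring

lemma leb2 {g : ℝ × ℝ → ℝ} (hg : BM g) :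
    ∀ᵐ c, Tendsto (fun n => (ee n ^ 2)⁻¹ * ∫ p in Metric.closedBall c (ee n), |g p - g c|) atTop (𝓝 0) := by
  obtain ⟨gm, M, hM⟩ := hg
  have hl : LocallyIntegrable g := locInt gm.aestronglyMeasurable (C := M) (fun x => hM x)
  filter_upwards [IsUnifLocDoublingMeasure.ae_tendsto_average_norm_sub volume hl 1] with x hx
  have h1 : Tendsto ee atTop (𝓝[>] 0) :=
    tendsto_nhdsWithin_iff.2 ⟨ee_lim, Eventually.of_forall fun n => ee_pos n⟩
  have := (hx (fun _ => x) ee h1 (Eventually.of_forall fun n => Metric.mem_closedBall_self (by have := ee_pos n; linarith))).const_mul 4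
  rw [mul_zero] at this
  refine this.congr fun n => ?_
  rw [setAverage_eq, vol_ball x (ee_pos n).le]
  simp only [smul_eq_mul, Real.norm_eq_abs]
  have := (ee_pos n).ne'
  field_simp

lemma d_aff {ε v1 v2 : ℝ} {c p : ℝ × ℝ} (hp : p ∈ Metric.ball c ε) :
    d1 (fun q : ℝ × ℝ => v1 * cl ε (q.1 - c.1) + v2 * cl ε (q.2 - c.2)) p = v1 ∧
    d2 (fun q : ℝ × ℝ => v1 * cl ε (q.1 - c.1) + v2 * cl ε (q.2 - c.2)) p = v2 := by
  have e : (fun q : ℝ × ℝ => v1 * cl ε (q.1 - c.1) + v2 * cl ε (q.2 - c.2)) =ᶠ[𝓝 p]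
      fun q : ℝ × ℝ => v1 * (q.1 - c.1) + v2 * (q.2 - c.2) := by
    filter_upwards [Metric.isOpen_ball.mem_nhds hp] with q hq
    rw [Metric.mem_ball, Prod.dist_eq, max_lt_iff, Real.dist_eq, Real.dist_eq] at hq
    rw [cl_in hq.1.le, cl_in hq.2.le]
  have h : HasFDerivAt (fun q : ℝ × ℝ => v1 * (q.1 - c.1) + v2 * (q.2 - c.2))
      (v1 • ContinuousLinearMap.fst ℝ ℝ ℝ + v2 • ContinuousLinearMap.snd ℝ ℝ ℝ) p :=
    ((hasFDerivAt_fst.sub_const _).const_mul _).add ((hasFDerivAt_snd.sub_const _).const_mul _)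
  unfold d1 d2
  rw [e.fderiv_eq, h.fderiv]; simp

/-- the defect functional on shifted tents -/
def De (f b1 b2 G : ℝ × ℝ → ℝ) (ε : ℝ) (c : ℝ × ℝ) : ℝ :=
  (∫ p, f p ^ 2 * (b1 p * d1 (fun q => eta ε (q - c)) p + b2 p * d2 (fun q => eta ε (q - c)) p)) + 2 * ∫ p, f p * G p * eta ε (p - c)

lemma eta_le {ε : ℝ} (hε : 0 ≤ ε) (p : ℝ × ℝ) : eta ε p ≤ ε ^ 2 := by
  rw [pow_two]; exact mul_le_mul (tent_le hε _) (tent_le hε _) (tent_nn _ _) hε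

lemma eta_int_le {F : ℝ × ℝ → ℝ} (hF : BM F) (h0 : ∀ p, 0 ≤ F p) {ε : ℝ} (hε : 0 < ε) (c : ℝ × ℝ) :
    ∫ p, F p * eta ε (p - c) ≤ ε ^ 2 * ∫ p in Metric.closedBall c ε, F p := by
  rw [← integral_const_mul, ← integral_indicator measurableSet_closedBall]
  have bs : BM fun p : ℝ × ℝ => eta ε (p - c) := (eta_bm hε.le).comp (by fun_prop)
  have z : ∀ p, p ∉ Metric.closedBall c ε → eta ε (p - c) = 0 := fun p hp => eta_zero fun h => hp (by
    rw [mem_ball_zero_iff, ← dist_eq_norm] at h; exact Metric.mem_closedBall.2 h.le)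
  refine integral_mono ((hF.mul bs).int (isCompact_closedBall c ε) fun p hp => by rw [z p hp, mul_zero])
    ((integrable_indicator_iff measurableSet_closedBall).2 ((hF.intOn Metric.isBounded_closedBall).const_mul _)) fun p => ?_
  by_cases hp : p ∈ Metric.closedBall c ε
  · simp only [indicator_of_mem hp]; rw [mul_comm]
    exact mul_le_mul_of_nonneg_right (eta_le hε.le _) (h0 p)
  · simp only [indicator_of_notMem hp]; rw [z p hp, mul_zero]

lemma De_bd {b1 b2 f G : ℝ × ℝ → ℝ} {R M N ε : ℝ} (c : ℝ × ℝ) (h1 : BM b1) (h2 : BM b2)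
    (hf : Measurable f) (hM : ∀ p, |f p| ≤ M) (hG : BM G) (hN : ∀ p, |G p| ≤ N) (hD : Div (Metric.ball c R) b1 b2 (fun _ => 0))
    (hw : Div (Metric.ball c R) (fun p => f p * b1 p) (fun p => f p * b2 p) G) (hε : 0 < ε) (hR : ε < R) :
    |De f b1 b2 G ε c| ≤ ε ^ 4 * (16 * M * N) := by
  have hM0 : 0 ≤ M := (abs_nonneg _).trans (hM 0)
  have h := DetaB c h1 h2 hf hM hG (Lip.const 0) (Z := 0) (by simp) hD hw hε hR
  have z : ∀ p, d1 (fun _ : ℝ × ℝ => (0:ℝ)) p = 0 ∧ d2 (fun _ : ℝ × ℝ => (0:ℝ)) p = 0 := fun p => by simp [d1, d2]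
  simp only [(z _).1, (z _).2, mul_zero, add_zero, sub_zero] at h
  refine h.trans ?_
  have k := eta_int_le hG.abs (fun p => abs_nonneg _) hε c
  have k2 : ∫ p in Metric.closedBall c ε, |G p| ≤ N * (4 * ε ^ 2) := by
    rw [← vol_ball c hε.le]
    have := norm_setIntegral_le_of_norm_le_const (μ := volume) (s := Metric.closedBall c ε) (f := fun p => |G p|) (C := N) Metric.isBounded_closedBall.measure_lt_top (fun p _ => by simpa using hN p)
    exact (le_abs_self _).trans this
  calc 4 * M * ∫ p, |G p| * eta ε (p - c) ≤ 4 * M * (ε ^ 2 * (N * (4 * ε ^ 2))) := by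
        refine mul_le_mul_of_nonneg_left (k.trans (mul_le_mul_of_nonneg_left k2 (by positivity))) (by positivity)
    _ = _ := by ring

lemma De_lim {b1 b2 f G : ℝ × ℝ → ℝ} {R M v1 v2 : ℝ} (c : ℝ × ℝ) (h1 : BM b1) (h2 : BM b2)
    (hf : Measurable f) (hM : ∀ p, |f p| ≤ M) (hG : BM G) (hD : Div (Metric.ball c R) b1 b2 (fun _ => 0))
    (hw : Div (Metric.ball c R) (fun p => f p * b1 p) (fun p => f p * b2 p) G) (hR : 0 < R)
    (l1 : Tendsto (fun n => (ee n ^ 2)⁻¹ * ∫ p in Metric.closedBall c (ee n), |b1 p - b1 c|) atTop (𝓝 0))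
    (l2 : Tendsto (fun n => (ee n ^ 2)⁻¹ * ∫ p in Metric.closedBall c (ee n), |b2 p - b2 c|) atTop (𝓝 0))
    (l3 : Tendsto (fun n => (ee n ^ 2)⁻¹ * ∫ p in Metric.closedBall c (ee n), |G p - G c|) atTop (𝓝 0))
    (hv : G c = b1 c * v1 + b2 c * v2) :
    Tendsto (fun n => (ee n ^ 4)⁻¹ * De f b1 b2 G (ee n) c) atTop (𝓝 0) := by
  have hM0 : 0 ≤ M := (abs_nonneg _).trans (hM 0)
  have lim := ((l3.add (l1.const_mul |v1|)).add (l2.const_mul |v2|)).const_mul (4 * (M + (|v1| + |v2|)))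
  simp only [mul_zero, add_zero] at lim
  refine squeeze_zero_norm' ?_ lim
  filter_upwards [(ee_lim.eventually (gt_mem_nhds hR))] with n hn
  set ε := ee n with hεd
  have hε : 0 < ε := ee_pos n
  have hζ : Lip (fun q : ℝ × ℝ => v1 * cl ε (q.1 - c.1) + v2 * cl ε (q.2 - c.2)) := by
    have a1 : Lip fun q : ℝ × ℝ => cl ε (q.1 - c.1) := (Lip.fst.sub (Lip.const c.1)).comp1 (cl_lip ε)
    have a2 : Lip fun q : ℝ × ℝ => cl ε (q.2 - c.2) := (Lip.snd.sub (Lip.const c.2)).comp1 (cl_lip ε)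
    exact ((Lip.const v1).mul a1 (M := |v1|) (fun _ => le_rfl) (fun p => cl_abs hε.le _)).add
      ((Lip.const v2).mul a2 (M := |v2|) (fun _ => le_rfl) (fun p => cl_abs hε.le _))
  have hZ : ∀ q : ℝ × ℝ, |v1 * cl ε (q.1 - c.1) + v2 * cl ε (q.2 - c.2)| ≤ |v1| + |v2| := by
    intro q
    refine (abs_add_le _ _).trans (add_le_add ?_ ?_) <;>
    · rw [abs_mul]; exact mul_le_of_le_one_right (abs_nonneg _) ((cl_abs hε.le _).trans (ee_le n))
  have h := DetaB c h1 h2 hf hM hG hζ hZ hD hw hε hn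
  have e : ∀ p, |G p - (b1 p * d1 (fun q : ℝ × ℝ => v1 * cl ε (q.1 - c.1) + v2 * cl ε (q.2 - c.2)) p +
      b2 p * d2 (fun q : ℝ × ℝ => v1 * cl ε (q.1 - c.1) + v2 * cl ε (q.2 - c.2)) p)| * eta ε (p - c) =
      |G p - (b1 p * v1 + b2 p * v2)| * eta ε (p - c) := by
    intro p
    by_cases hp : p ∈ Metric.ball c ε
    · rw [(d_aff hp).1, (d_aff hp).2]
    · rw [eta_zero fun h => hp (by rwa [mem_ball_zero_iff, ← dist_eq_norm] at h)]; ring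
  simp only [e] at h
  have bq : BM fun p => G p - (b1 p * v1 + b2 p * v2) := hG.sub ((h1.mul (BM.const v1)).add (h2.mul (BM.const v2)))
  have k := eta_int_le bq.abs (fun p => abs_nonneg _) hε c
  have hb := Metric.isBounded_closedBall (x := c) (r := ε)
  have i3 : IntegrableOn (fun p => |G p - G c|) (Metric.closedBall c ε) := (hG.sub (BM.const _)).abs.intOn hb
  have i1 : IntegrableOn (fun p => |v1| * |b1 p - b1 c|) (Metric.closedBall c ε) := ((h1.sub (BM.const _)).abs.intOn hb).const_mul _
  have i2 : IntegrableOn (fun p => |v2| * |b2 p - b2 c|) (Metric.closedBall c ε) := ((h2.sub (BM.const _)).abs.intOn hb).const_mul _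
  have k2 : ∫ p in Metric.closedBall c ε, |G p - (b1 p * v1 + b2 p * v2)| ≤
      (∫ p in Metric.closedBall c ε, |G p - G c|) + |v1| * (∫ p in Metric.closedBall c ε, |b1 p - b1 c|) + |v2| * ∫ p in Metric.closedBall c ε, |b2 p - b2 c| := by
    rw [← integral_const_mul, ← integral_const_mul, ← integral_add i3 i1, ← integral_add (by exact i3.add i1) i2]
    refine integral_mono (bq.abs.intOn hb) (by exact (i3.add i1).add i2) fun p => ?_
    have : G p - (b1 p * v1 + b2 p * v2) = (G p - G c) + (- (v1 * (b1 p - b1 c))) + (- (v2 * (b2 p - b2 c))) := by rw [hv]; ring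
    simp only
    rw [this, ← abs_mul, ← abs_mul, ← abs_neg (v1 * _), ← abs_neg (v2 * _)]
    exact (abs_add_le _ _).trans (add_le_add (abs_add_le _ _) le_rfl)
  have hMZ : 0 ≤ 4 * (M + (|v1| + |v2|)) := by positivity
  rw [Real.norm_eq_abs, abs_mul, abs_of_nonneg (by positivity : 0 ≤ (ε ^ 4)⁻¹)]
  have h' : |De f b1 b2 G ε c| ≤ 4 * (M + (|v1| + |v2|)) * (ε ^ 2 * ((∫ p in Metric.closedBall c ε, |G p - G c|) + |v1| * (∫ p in Metric.closedBall c ε, |b1 p - b1 c|) + |v2| * ∫ p in Metric.closedBall c ε, |b2 p - b2 c|)) :=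
    h.trans (mul_le_mul_of_nonneg_left (k.trans (mul_le_mul_of_nonneg_left k2 (by positivity))) hMZ)
  refine (mul_le_mul_of_nonneg_left h' (by positivity)).trans (le_of_eq ?_)
  have := hε.ne'
  field_simp

lemma tent_int {ε : ℝ} (hε : 0 < ε) : ∫ x, tent ε x = ε ^ 2 := by
  rw [← setIntegral_eq_integral_of_forall_compl_eq_zero (s := Ioc (-ε) ε), ← intervalIntegral.integral_of_le (by linarith)]
  · have hc := (tent_lip ε).continuous
    rw [← intervalIntegral.integral_add_adjacent_intervals (b := 0) (hc.intervalIntegrable _ _) (hc.intervalIntegrable _ _)]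
    have e1 : ∫ x in (-ε)..0, tent ε x = ∫ x in (-ε)..0, (ε + x) := by
      refine intervalIntegral.integral_congr fun x hx => ?_
      rw [uIcc_of_le (by linarith)] at hx
      show tent ε x = ε + x
      rw [tent_in (by rw [abs_of_nonpos hx.2]; linarith [hx.1]), abs_of_nonpos hx.2]; ring
    have e2 : ∫ x in (0:ℝ)..ε, tent ε x = ∫ x in (0:ℝ)..ε, (ε - x) := by
      refine intervalIntegral.integral_congr fun x hx => ?_
      rw [uIcc_of_le (by linarith)] at hx
      show tent ε x = ε - x
      rw [tent_in (by rw [abs_of_nonneg hx.1]; linarith [hx.2]), abs_of_nonneg hx.1]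
    rw [e1, e2, intervalIntegral.integral_add (by simp) (by simp), intervalIntegral.integral_sub (by simp) (by simp)]
    simp; ring
  · intro x hx
    refine tent_zero (le_of_not_gt fun h => hx ?_)
    exact ⟨(abs_lt.1 h).1, (abs_lt.1 h).2.le⟩

lemma eta_int {ε : ℝ} (hε : 0 < ε) : ∫ p, eta ε p = ε ^ 4 := by
  unfold eta
  rw [Measure.volume_eq_prod, integral_prod_mul (tent ε) (tent ε), tent_int hε]; ring

/-- averaged test function -/
def cv (ε : ℝ) (ψ : ℝ × ℝ → ℝ) (p : ℝ × ℝ) : ℝ := (ε ^ 4)⁻¹ * ∫ z, ψ (p - z) * eta ε z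

lemma cv_near {ψ : ℝ × ℝ → ℝ} {ε L : ℝ} (hε : 0 < ε) (hb : BM ψ) (hL : ∀ p q, |ψ p - ψ q| ≤ L * dist p q) (hL0 : 0 ≤ L) (p : ℝ × ℝ) :
    |cv ε ψ p - ψ p| ≤ L * ε := by
  have te := eta_tst hε (lt_add_one ε)
  have b : BM fun z => ψ (p - z) := hb.comp (by fun_prop)
  have e : cv ε ψ p - ψ p = (ε ^ 4)⁻¹ * ∫ z, (ψ (p - z) - ψ p) * eta ε z := by
    simp only [sub_mul]
    rw [integral_sub (te.int b) (te.int (BM.const _)), integral_const_mul, eta_int hε]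
    unfold cv; have := hε.ne'
    field_simp
  rw [e, abs_mul, abs_of_nonneg (by positivity)]
  have : |∫ z, (ψ (p - z) - ψ p) * eta ε z| ≤ ∫ z, (L * ε) * eta ε z := by
    rw [← Real.norm_eq_abs]
    refine norm_integral_le_of_norm_le (te.int (BM.const _)) (Eventually.of_forall fun z => ?_)
    rw [Real.norm_eq_abs, abs_mul, abs_of_nonneg (eta_nn _ _)]
    by_cases hz : z ∈ Metric.ball (0 : ℝ × ℝ) ε
    · refine mul_le_mul_of_nonneg_right ((hL _ _).trans (mul_le_mul_of_nonneg_left ?_ hL0)) (eta_nn _ _)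
      rw [dist_eq_norm, sub_sub_cancel_left, norm_neg]
      exact (mem_ball_zero_iff.1 hz).le
    · rw [eta_zero hz, mul_zero, mul_zero]
  rw [integral_const_mul, eta_int hε] at this
  refine (mul_le_mul_of_nonneg_left this (by positivity)).trans (le_of_eq ?_)
  have := hε.ne'
  field_simp

lemma fub {a ψ w : ℝ × ℝ → ℝ} (ha : BM a) (hψ : BM ψ) (hw : BM w) {r r' : ℝ}
    (hψ0 : ∀ p, p ∉ Metric.closedBall (0 : ℝ × ℝ) r → ψ p = 0) (hw0 : ∀ p, p ∉ Metric.closedBall (0 : ℝ × ℝ) r' → w p = 0) :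
    Measurable (fun x => ∫ p, a p * w (p - x)) ∧ Measurable (fun p => ∫ z, ψ (p - z) * w z) ∧
    Integrable (fun x => ψ x * ∫ p, a p * w (p - x)) ∧
    ∫ x, ψ x * ∫ p, a p * w (p - x) = ∫ p, a p * ∫ z, ψ (p - z) * w z := by
  obtain ⟨am, A, hA⟩ := ha
  obtain ⟨wm, W, hW⟩ := hw
  obtain ⟨ψm, P, hP⟩ := hψ
  have hA0 := (abs_nonneg _).trans (hA 0)
  have hW0 := (abs_nonneg _).trans (hW 0)
  have hP0 := (abs_nonneg _).trans (hP 0)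
  have m0 : Measurable fun z : (ℝ × ℝ) × (ℝ × ℝ) => a z.2 * w (z.2 - z.1) :=
    (am.comp measurable_snd).mul (wm.comp (by fun_prop))
  have m : Measurable fun z : (ℝ × ℝ) × (ℝ × ℝ) => ψ z.1 * (a z.2 * w (z.2 - z.1)) :=
    (ψm.comp measurable_fst).mul m0
  have int : Integrable (fun z : (ℝ × ℝ) × (ℝ × ℝ) => ψ z.1 * (a z.2 * w (z.2 - z.1))) := by
    have : (volume : Measure ((ℝ × ℝ) × (ℝ × ℝ))).IsAddHaarMeasure := by
      rw [Measure.volume_eq_prod]; infer_instance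
    refine int_bdd m.aestronglyMeasurable (C := P * (A * W)) (fun z => ?_)
      ((isCompact_closedBall (0 : ℝ × ℝ) r).prod (isCompact_closedBall (0 : ℝ × ℝ) (r' + r))) fun z hz => ?_
    · rw [Real.norm_eq_abs, abs_mul, abs_mul]
      exact mul_le_mul (hP _) (mul_le_mul (hA _) (hW _) (abs_nonneg _) hA0) (by positivity) hP0
    · by_cases h1 : z.1 ∈ Metric.closedBall (0 : ℝ × ℝ) r
      · rw [hw0 (z.2 - z.1)]
        · ring
        · intro h2; apply hz; refine ⟨h1, ?_⟩
          rw [mem_closedBall_zero_iff] at *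
          calc ‖z.2‖ = ‖(z.2 - z.1) + z.1‖ := by rw [sub_add_cancel]
            _ ≤ _ := (norm_add_le _ _).trans (add_le_add h2 h1)
      · rw [hψ0 _ h1, zero_mul]
  rw [Measure.volume_eq_prod] at int
  refine ⟨(m0.stronglyMeasurable.integral_prod_right' (ν := volume)).measurable, ?_, ?_, ?_⟩
  · have : Measurable fun z : (ℝ × ℝ) × (ℝ × ℝ) => ψ (z.1 - z.2) * w z.2 := (ψm.comp (by fun_prop)).mul (wm.comp (by fun_prop))
    exact (this.stronglyMeasurable.integral_prod_right' (ν := volume)).measurable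
  · have := int.integral_prod_left
    simp only [integral_const_mul] at this
    exact this
  · simp_rw [← integral_const_mul]
    rw [integral_integral_swap (by exact int)]
    congr 1; ext p
    rw [← integral_sub_left_eq_self _ _ p]
    congr 1; ext x
    rw [sub_sub_cancel]; ring

lemma d_refl {φ : ℝ × ℝ → ℝ} (h : Differentiable ℝ φ) (p z : ℝ × ℝ) : d1 (fun z => φ (p - z)) z = - d1 φ (p - z) ∧
    d2 (fun z => φ (p - z)) z = - d2 φ (p - z) := by
  have : HasFDerivAt (fun z => φ (p - z)) ((fderiv ℝ φ (p - z)).comp (-(ContinuousLinearMap.id ℝ (ℝ × ℝ)))) z :=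
    (h (p - z)).hasFDerivAt.comp z ((hasFDerivAt_id z).const_sub p)
  unfold d1 d2
  rw [this.fderiv]; simp

lemma cv_parts {φ : ℝ × ℝ → ℝ} (h : ContDiff ℝ (⊤ : ℕ∞) φ) (hφ : Lip φ) {ε : ℝ} (hε : 0 < ε) (p : ℝ × ℝ) :
    ∫ z, φ (p - z) * d1 (eta ε) z = ∫ z, d1 φ (p - z) * eta ε z ∧
    ∫ z, φ (p - z) * d2 (eta ε) z = ∫ z, d2 φ (p - z) * eta ε z := by
  have te := eta_tst hε (lt_add_one ε)
  have hd : Differentiable ℝ φ := h.differentiable (by simp)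
  have l : Lip fun z => φ (p - z) := hφ.comp (D := 1) (LipschitzWith.of_dist_le_mul fun a b => by
    rw [dist_eq_norm, dist_eq_norm, show p - a - (p - b) = -(a - b) by abel, norm_neg]; simp)
  have p1 := parts1 l te.lip te.cpt
  have p2 := parts2 l te.lip te.cpt
  simp only [(d_refl hd p _).1, (d_refl hd p _).2, neg_mul, integral_neg, neg_inj] at p1 p2
  exact ⟨p1.symm, p2.symm⟩

theorem Tprime {U : Set (ℝ × ℝ)} (hU : IsOpen U) {b1 b2 f G : ℝ × ℝ → ℝ} (h1 : BM b1) (h2 : BM b2) (hf : BM f) (hG : BM G)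
    (hD : Div U b1 b2 (fun _ => 0)) (hw : Div U (fun p => f p * b1 p) (fun p => f p * b2 p) G)
    (hz : ∀ᵐ p, p ∈ U → b1 p = 0 → b2 p = 0 → G p = 0) :
    Div U (fun p => f p ^ 2 * b1 p) (fun p => f p ^ 2 * b2 p) (fun p => 2 * (f p * G p)) := by
  have ba1 := hf.sq.mul h1
  have ba2 := hf.sq.mul h2
  have bg := hf.mul hG
  refine Div.of_smooth hU ba1 ba2 ((BM.const 2).mul bg) fun φ hφ hc hs => ?_
  have tφ : Tst U φ := Tst.of_smooth hφ hc hs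
  have tu : Tst univ φ := tφ.mono (subset_univ _)
  have t1 : Tst univ (d1 φ) := Tst.of_smooth (smooth_d1 hφ) (cpt_d1 hc) (subset_univ _)
  have t2 : Tst univ (d2 φ) := Tst.of_smooth (smooth_d2 hφ) (cpt_d2 hc) (subset_univ _)
  obtain ⟨fm, M, hM⟩ := hf
  obtain ⟨N, hN⟩ := hG.bdd
  obtain ⟨δ, hδ, hδU⟩ := hc.exists_thickening_subset_open hU hs
  have hball : ∀ c ∈ tsupport φ, Metric.ball c δ ⊆ U := fun c hc' => (Metric.ball_subset_thickening hc' δ).trans hδU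
  obtain ⟨r, hr⟩ := hc.isBounded.subset_closedBall (0 : ℝ × ℝ)
  have z0 : ∀ p, p ∉ Metric.closedBall (0 : ℝ × ℝ) r → p ∉ tsupport φ := fun p hp h => hp (hr h)
  have div_mono : ∀ {V W : Set (ℝ × ℝ)} {x y z : ℝ × ℝ → ℝ}, V ⊆ W → Div W x y z → Div V x y z := fun hVW h φ hφ => h φ (hφ.mono hVW)
  -- formula for the averaged defect
  have ez : ∀ ε : ℝ, ∀ p, p ∉ Metric.closedBall (0 : ℝ × ℝ) ε → p ∉ tsupport (eta ε) := fun ε p hp h => hp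
    (closure_minimal (s := Function.support (eta ε)) (fun q hq => by_contra fun h => hq (eta_zero fun h' => h (Metric.ball_subset_closedBall h'))) Metric.isClosed_closedBall h)
  have hDe : ∀ n c, De f b1 b2 G (ee n) c = (∫ p, (f p ^ 2 * b1 p) * d1 (eta (ee n)) (p - c)) + (∫ p, (f p ^ 2 * b2 p) * d2 (eta (ee n)) (p - c))
      + 2 * ∫ p, (f p * G p) * eta (ee n) (p - c) := by
    intro n c
    have te := tst_tr (eta_tst (ee_pos n) (lt_add_one (ee n))) (-c)
    simp only [← sub_eq_add_neg] at te
    unfold De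
    rw [← integral_add]
    · congr 2; ext p
      have x1 := d1_tr (eta (ee n)) (-c) p
      have x2 := d2_tr (eta (ee n)) (-c) p
      simp only [← sub_eq_add_neg] at x1 x2
      rw [x1, x2]; ring
    · have := te.int1 ba1
      simp only [sub_eq_add_neg, d1_tr] at this ⊢
      exact this
    · have := te.int2 ba2
      simp only [sub_eq_add_neg, d2_tr] at this ⊢
      exact this
  have el : ∀ n, Lip (eta (ee n)) := fun n => eta_lip (ee_pos n).le
  have F0 := fun n => fub bg tu.bm (eta_bm (ee_pos n).le) (fun p hp => image_eq_zero_of_notMem_tsupport (z0 p hp)) (fun p hp => image_eq_zero_of_notMem_tsupport (ez (ee n) p hp))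
  have F1 := fun n => fub ba1 tu.bm (el n).bm_d1 (fun p hp => image_eq_zero_of_notMem_tsupport (z0 p hp)) (fun p hp => d1_zero (ez (ee n) p hp))
  have F2 := fun n => fub ba2 tu.bm (el n).bm_d2 (fun p hp => image_eq_zero_of_notMem_tsupport (z0 p hp)) (fun p hp => d2_zero (ez (ee n) p hp))
  have Dm : ∀ n, Measurable (De f b1 b2 G (ee n)) := by
    intro n
    rw [show De f b1 b2 G (ee n) = _ from funext (hDe n)]
    exact ((F1 n).1.add (F2 n).1).add ((F0 n).1.const_mul 2)
  have S : ∀ n, ∫ c, φ c * ((ee n ^ 4)⁻¹ * De f b1 b2 G (ee n) c) =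
      (∫ p, (f p ^ 2 * b1 p) * cv (ee n) (d1 φ) p) + (∫ p, (f p ^ 2 * b2 p) * cv (ee n) (d2 φ) p) + 2 * ∫ p, (f p * G p) * cv (ee n) φ p := by
    intro n
    have q1 := (F1 n).2.2.2; have q2 := (F2 n).2.2.2; have q0 := (F0 n).2.2.2
    simp only [(cv_parts hφ tφ.lip (ee_pos n) _).1] at q1
    simp only [(cv_parts hφ tφ.lip (ee_pos n) _).2] at q2
    have : ∀ c, φ c * ((ee n ^ 4)⁻¹ * De f b1 b2 G (ee n) c) = (ee n ^ 4)⁻¹ * ((φ c * ∫ p, (f p ^ 2 * b1 p) * d1 (eta (ee n)) (p - c)) +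
       (φ c * ∫ p, (f p ^ 2 * b2 p) * d2 (eta (ee n)) (p - c)) + 2 * (φ c * ∫ p, (f p * G p) * eta (ee n) (p - c))) := fun c => by rw [hDe]; ring
    simp only [this]
    rw [integral_const_mul, integral_add (by exact (F1 n).2.2.1.add (F2 n).2.2.1) ((F0 n).2.2.1.const_mul 2), integral_add (F1 n).2.2.1 (F2 n).2.2.1, integral_const_mul, q0, q1, q2]
    simp only [cv]
    have : ∀ (a J : ℝ × ℝ → ℝ), ∫ p, a p * ((ee n ^ 4)⁻¹ * J p) = (ee n ^ 4)⁻¹ * ∫ p, a p * J p := fun a J => by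
      rw [← integral_const_mul]; congr 1; ext p; ring
    rw [this (fun p => f p ^ 2 * b1 p), this (fun p => f p ^ 2 * b2 p), this (fun p => f p * G p)]; ring
  -- limit of the averaged functionals
  have lim : ∀ (a ψ : ℝ × ℝ → ℝ), BM a → Tst univ ψ → (∀ p, p ∉ Metric.closedBall (0 : ℝ × ℝ) r → ψ p = 0) →
      Tendsto (fun n => ∫ p, a p * cv (ee n) ψ p) atTop (𝓝 (∫ p, a p * ψ p)) := by
    intro a ψ ha hψ hψ0
    obtain ⟨L, hL0, hL⟩ := hψ.lip.bd
    obtain ⟨am, A, hA⟩ := ha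
    have hA0 := (abs_nonneg _).trans (hA 0)
    obtain ⟨P, hP⟩ := hψ.bm.bdd
    have hP0 := (abs_nonneg _).trans (hP 0)
    have cn := fun n p => cv_near (ee_pos n) hψ.bm hL hL0 p
    refine tendsto_int (C := A * (P + L)) (fun n => ?_) (fun n p => ?_) (isCompact_closedBall (0 : ℝ × ℝ) (r + 1)) (fun n p hp => ?_) ?_
    · exact (am.mul ((fub ⟨am, A, hA⟩ hψ.bm (eta_bm (ee_pos n).le) hψ0 (fun p hp => image_eq_zero_of_notMem_tsupport (ez (ee n) p hp))).2.1.const_mul _)).aestronglyMeasurable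
    · rw [Real.norm_eq_abs, abs_mul]
      refine mul_le_mul (hA _) ?_ (abs_nonneg _) hA0
      have := cn n p
      have h3 : |cv (ee n) ψ p| ≤ |ψ p| + |cv (ee n) ψ p - ψ p| := by
        have := abs_add_le (ψ p) (cv (ee n) ψ p - ψ p); rwa [add_sub_cancel] at this
      have h4 : L * ee n ≤ L := mul_le_of_le_one_right hL0 (ee_le n)
      linarith [hP p]
    · have : cv (ee n) ψ p = 0 := by
        unfold cv
        rw [integral_eq_zero_of_ae, mul_zero]
        refine Eventually.of_forall fun z => ?_
        by_cases h : z ∈ Metric.ball (0 : ℝ × ℝ) (ee n)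
        · show ψ (p - z) * _ = 0
          rw [hψ0 (p - z), zero_mul]
          intro h'; apply hp
          rw [mem_closedBall_zero_iff] at h' ⊢
          rw [mem_ball_zero_iff] at h
          have : ‖p‖ ≤ ‖p - z‖ + ‖z‖ := by simpa using norm_add_le (p - z) z
          linarith [ee_le n]
        · show _ * eta (ee n) z = 0
          rw [eta_zero h, mul_zero]
      rw [this, mul_zero]
    · refine Eventually.of_forall fun p => Tendsto.const_mul _ ?_
      rw [tendsto_iff_dist_tendsto_zero]
      refine squeeze_zero (g := fun n => L * ee n) (fun _ => dist_nonneg) (fun n => cn n p) ?_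
      simpa using ee_lim.const_mul L
  have L1 := ((lim _ _ ba1 t1 fun p hp => d1_zero (z0 p hp)).add (lim _ _ ba2 t2 fun p hp => d2_zero (z0 p hp))).add
    ((lim _ _ bg tu fun p hp => image_eq_zero_of_notMem_tsupport (z0 p hp)).const_mul 2)
  simp only [← S] at L1
  obtain ⟨n0, hn0⟩ := eventually_atTop.1 (ee_lim.eventually (gt_mem_nhds hδ))
  have L2 : Tendsto (fun n => ∫ c, φ c * ((ee (n + n0) ^ 4)⁻¹ * De f b1 b2 G (ee (n + n0)) c)) atTop (𝓝 (∫ _ : ℝ × ℝ, (0:ℝ))) := by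
    obtain ⟨P, hP⟩ := tφ.bm.bdd
    have hP0 := (abs_nonneg _).trans (hP 0)
    have hM0 := (abs_nonneg _).trans (hM 0)
    have hN0 := (abs_nonneg _).trans (hN 0)
    refine tendsto_int (C := P * (16 * M * N)) (fun n => ?_) (fun n c => ?_) hc (fun n c hc' => ?_) ?_
    · exact (hφ.continuous.measurable.mul ((Dm _).const_mul _)).aestronglyMeasurable
    · rw [Real.norm_eq_abs, abs_mul]
      by_cases hc' : c ∈ tsupport φ
      · refine mul_le_mul (hP c) ?_ (abs_nonneg _) hP0
        have := De_bd c h1 h2 fm hM hG hN (div_mono (hball c hc') hD) (div_mono (hball c hc') hw) (ee_pos (n + n0)) (hn0 _ (by omega))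
        have pos := ee_pos (n + n0)
        rw [abs_mul, abs_of_nonneg (by positivity)]
        refine (mul_le_mul_of_nonneg_left this (by positivity)).trans (le_of_eq ?_)
        have := pos.ne'
        field_simp
      · rw [image_eq_zero_of_notMem_tsupport hc']; simp; positivity
    · rw [image_eq_zero_of_notMem_tsupport hc', zero_mul]
    · filter_upwards [leb2 h1, leb2 h2, leb2 hG, hz] with c l1 l2 l3 hzc
      by_cases hc' : c ∈ tsupport φ
      · have : ∃ v1 v2, G c = b1 c * v1 + b2 c * v2 := by
          by_cases x1 : b1 c = 0
          · by_cases x2 : b2 c = 0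
            · exact ⟨0, 0, by rw [hzc (hs hc') x1 x2]; ring⟩
            · exact ⟨0, G c / b2 c, by field_simp; ring⟩
          · exact ⟨G c / b1 c, 0, by field_simp; ring⟩
        obtain ⟨v1, v2, hv⟩ := this
        have := De_lim c h1 h2 fm hM hG (div_mono (hball c hc') hD) (div_mono (hball c hc') hw) hδ l1 l2 l3 hv
        have := ((tendsto_add_atTop_iff_nat n0).2 this).const_mul (φ c)
        simpa using this
      · rw [image_eq_zero_of_notMem_tsupport hc']; simp
  have := tendsto_nhds_unique ((tendsto_add_atTop_iff_nat n0).2 L1) L2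
  rw [integral_zero] at this
  rw [integral_add (t1.int ba1) (t2.int ba2)]
  have e : ∫ p, 2 * (f p * G p) * φ p = 2 * ∫ p, f p * G p * φ p := by
    rw [← integral_const_mul]; congr 1; ext p; ring
  rw [e]; linarith

/-- a BV bound -/
def BVin (U : Set (ℝ × ℝ)) (v : ℝ × ℝ → ℝ) (μ : Measure (ℝ × ℝ)) : Prop :=
  ∀ φ : ℝ × ℝ → ℝ, ContDiff ℝ (⊤ : ℕ∞) φ → HasCompactSupport φ → tsupport φ ⊆ U →
    |∫ p, v p * d1 φ p| ≤ ∫ p, |φ p| ∂μ ∧ |∫ p, v p * d2 φ p| ≤ ∫ p, |φ p| ∂μ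

lemma bv_trans {U : Set (ℝ × ℝ)} {v : ℝ × ℝ → ℝ} {μ : Measure (ℝ × ℝ)} [IsFiniteMeasure μ]
    (hv : BM v) (hB : BVin U v μ) {ζ : ℝ × ℝ → ℝ} (hζ : ContDiff ℝ (⊤ : ℕ∞) ζ) (h1 : ∀ p, |ζ p| ≤ 1)
    {c : ℝ × ℝ} {s : ℝ} (hs : tsupport ζ ⊆ Metric.closedBall c s) (w : ℝ × ℝ)
    (hU : Metric.closedBall c (s + ‖w‖) ⊆ U) :
    |(∫ p, v p * ζ (p + w)) - ∫ p, v p * ζ p| ≤ 2 * ‖w‖ * μ.real (Metric.closedBall c (s + ‖w‖)) := by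
  have hc : HasCompactSupport ζ := HasCompactSupport.of_support_subset_isCompact (isCompact_closedBall c s)
    ((subset_tsupport ζ).trans hs)
  have hdz : ∀ q, q ∉ Metric.closedBall c s → fderiv ℝ ζ q = 0 := fun q hq => fderiv_of_notMem_tsupport ℝ (fun h => hq (hs h))
  have hz : ∀ q, q ∉ Metric.closedBall c s → ζ q = 0 := fun q hq => image_eq_zero_of_notMem_tsupport (fun h => hq (hs h))
  have hfc : Continuous (fderiv ℝ ζ) := hζ.continuous_fderiv (by simp)
  obtain ⟨C, hC⟩ := hfc.bounded_above_of_compact_support (hc.fderiv ℝ)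
  obtain ⟨vm, M, hM⟩ := hv
  have hM0 : 0 ≤ M := (abs_nonneg _).trans (hM 0)
  have hC0 : 0 ≤ C := (norm_nonneg _).trans (hC 0)
  have hmv : ∀ {τ r : ℝ} {p : ℝ × ℝ}, |τ| ≤ r → p ∉ Metric.closedBall c (s + r * ‖w‖) → p + τ • w ∉ Metric.closedBall c s := by
    intro τ r p hτ hp h
    refine hp (Metric.mem_closedBall.2 ?_)
    have e1 := dist_triangle p (p + τ • w) c
    have e2 : dist p (p + τ • w) = |τ| * ‖w‖ := by rw [dist_self_add_right, norm_smul, Real.norm_eq_abs]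
    have e3 := Metric.mem_closedBall.1 h
    have e4 : |τ| * ‖w‖ ≤ r * ‖w‖ := mul_le_mul_of_nonneg_right hτ (norm_nonneg _)
    linarith
  set F' : ℝ → ℝ × ℝ → ℝ := fun τ p => v p * fderiv ℝ ζ (p + τ • w) w with hF'
  have hder : ∀ τ ∈ Icc (0:ℝ) 1, HasDerivAt (fun τ => ∫ p, v p * ζ (p + τ • w)) (∫ p, F' τ p) τ := by
    intro τ hτ
    have mF : ∀ t : ℝ, Measurable fun p => v p * ζ (p + t • w) := fun t => vm.mul (hζ.continuous.measurable.comp (by fun_prop))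
    refine (hasDerivAt_integral_of_dominated_loc_of_deriv_le (F := fun τ p => v p * ζ (p + τ • w)) (F' := F') (s := Metric.ball τ 1)
      (bound := (Metric.closedBall c (s + 2 * ‖w‖)).indicator fun _ => M * (C * ‖w‖)) (Metric.ball_mem_nhds τ one_pos)
      (Eventually.of_forall fun t => (mF t).aestronglyMeasurable) ?_ ?_ ?_ ?_ ?_).2
    · refine int_bdd (mF τ).aestronglyMeasurable (C := M * 1) (fun p => ?_) (isCompact_closedBall c (s + 1 * ‖w‖)) fun p hp => ?_
      · rw [Real.norm_eq_abs, abs_mul]; exact mul_le_mul (hM p) (h1 _) (abs_nonneg _) hM0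
      · rw [hz _ (hmv (by rw [abs_of_nonneg hτ.1]; exact hτ.2) hp), mul_zero]
    · refine (vm.mul (Continuous.measurable ?_)).aestronglyMeasurable
      exact (hfc.comp (by fun_prop : Continuous fun p : ℝ × ℝ => p + τ • w)).clm_apply continuous_const
    · refine Eventually.of_forall fun p t ht => ?_
      have ht2 : |t| ≤ 2 := by
        rw [Metric.mem_ball, Real.dist_eq, abs_lt] at ht
        rw [abs_le]; constructor <;> linarith [hτ.1, hτ.2]
      by_cases hp : p ∈ Metric.closedBall c (s + 2 * ‖w‖)
      · rw [indicator_of_mem hp, hF', norm_mul]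
        exact mul_le_mul (hM p) (((fderiv ℝ ζ _).le_opNorm w).trans (mul_le_mul_of_nonneg_right (hC _) (norm_nonneg _))) (norm_nonneg _) hM0
      · rw [indicator_of_notMem hp, hF']; simp [hdz _ (hmv ht2 hp)]
    · exact (integrable_indicator_iff measurableSet_closedBall).2 (integrableOn_const (isCompact_closedBall _ _).measure_lt_top.ne)
    · refine Eventually.of_forall fun p t _ => ?_
      have e1 : HasDerivAt (fun t : ℝ => p + t • w) w t := by
        simpa using ((hasDerivAt_id t).smul_const w).const_add p
      exact ((hζ.differentiable (by simp) (p + t • w)).hasFDerivAt.comp_hasDerivAt t e1).const_mul (v p)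
  have key := norm_image_sub_le_of_norm_deriv_le_segment_01' (f := fun τ => ∫ p, v p * ζ (p + τ • w)) (f' := fun τ => ∫ p, F' τ p)
    (C := 2 * ‖w‖ * μ.real (Metric.closedBall c (s + ‖w‖))) (fun τ hτ => (hder τ hτ).hasDerivWithinAt) ?_
  · simpa using key
  intro τ hτ
  have hτ1 : |τ| ≤ 1 := by rw [abs_of_nonneg hτ.1]; exact hτ.2.le
  set φ : ℝ × ℝ → ℝ := fun p => ζ (p + τ • w) with hφ
  have φs : ContDiff ℝ (⊤ : ℕ∞) φ := hζ.comp (by fun_prop)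
  have φz : ∀ p, p ∉ Metric.closedBall c (s + ‖w‖) → φ p = 0 := fun p hp => hz _ (hmv hτ1 (by rwa [one_mul]))
  have φt : tsupport φ ⊆ Metric.closedBall c (s + ‖w‖) :=
    closure_minimal (s := Function.support _) (fun p hp => by_contra fun h => hp (φz p h)) Metric.isClosed_closedBall
  have φc : HasCompactSupport φ := (isCompact_closedBall c (s + ‖w‖)).of_isClosed_subset (isClosed_tsupport _) φt
  have φb : ∫ p, |φ p| ∂μ ≤ μ.real (Metric.closedBall c (s + ‖w‖)) := by
    rw [← integral_indicator_one measurableSet_closedBall]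
    refine integral_mono_of_nonneg (Eventually.of_forall fun p => abs_nonneg _) ((integrable_indicator_iff measurableSet_closedBall).2 (integrableOn_const (measure_lt_top _ _).ne)) (Eventually.of_forall fun p => ?_)
    by_cases hp : p ∈ Metric.closedBall c (s + ‖w‖)
    · simp only [indicator_of_mem hp]; exact h1 _
    · simp only [indicator_of_notMem hp, φz p hp, abs_zero]; exact le_rfl
  obtain ⟨b1, b2⟩ := hB φ φs φc (φt.trans hU)
  have hv : BM v := ⟨vm, M, hM⟩
  have tφ : Tst univ φ := Tst.of_smooth φs φc (subset_univ _)
  have i1 : Integrable fun p => v p * d1 φ p := tφ.int1 hv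
  have i2 : Integrable fun p => v p * d2 φ p := tφ.int2 hv
  have e : ∫ p, F' τ p = w.1 * (∫ p, v p * d1 φ p) + w.2 * ∫ p, v p * d2 φ p := by
    rw [← integral_const_mul, ← integral_const_mul, ← integral_add (i1.const_mul _) (i2.const_mul _)]
    congr 1; ext p
    simp only [hF', hφ, d1_tr, d2_tr, fderiv_eq]; ring
  show ‖∫ p, F' τ p‖ ≤ _
  rw [e, Real.norm_eq_abs]
  have w1 : |w.1| ≤ ‖w‖ := norm_fst_le w
  have w2 : |w.2| ≤ ‖w‖ := norm_snd_le w
  have a1 : |w.1 * ∫ p, v p * d1 φ p| ≤ ‖w‖ * μ.real (Metric.closedBall c (s + ‖w‖)) := by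
    rw [abs_mul]; exact mul_le_mul w1 (b1.trans φb) (abs_nonneg _) (norm_nonneg _)
  have a2 : |w.2 * ∫ p, v p * d2 φ p| ≤ ‖w‖ * μ.real (Metric.closedBall c (s + ‖w‖)) := by
    rw [abs_mul]; exact mul_le_mul w2 (b2.trans φb) (abs_nonneg _) (norm_nonneg _)
  refine (abs_add_le _ _).trans ?_
  linarith

lemma bv_shift {U : Set (ℝ × ℝ)} {v : ℝ × ℝ → ℝ} {μ : Measure (ℝ × ℝ)} [IsFiniteMeasure μ]
    (hv : BM v) (hB : BVin U v μ) {c : ℝ × ℝ} {s s' : ℝ} (h0 : 0 ≤ s) (hs : s < s') (z : ℝ × ℝ)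
    (hU : Metric.closedBall c (s' + ‖z‖) ⊆ U) :
    ∫ p in Metric.closedBall c s, |v (p + z) - v p| ≤ 2 * ‖z‖ * μ.real (Metric.closedBall c (s' + ‖z‖)) := by
  set W : ℝ × ℝ → ℝ := fun p => v (p + z) - v p with hW
  have vz : BM fun p => v (p + z) := hv.comp (by fun_prop)
  have bW : BM W := vz.sub hv
  set g : ℝ × ℝ → ℝ := (Metric.closedBall c s).indicator fun p => if 0 ≤ W p then 1 else -1 with hg
  have gm : Measurable g := (Measurable.ite (measurableSet_le measurable_const bW.meas) measurable_const measurable_const).indicator measurableSet_closedBall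
  have gb : ∀ p, ‖g p‖ ≤ 1 := by
    intro p
    by_cases hp : p ∈ Metric.closedBall c s
    · simp only [hg, indicator_of_mem hp]; split_ifs <;> simp
    · simp only [hg, indicator_of_notMem hp]; simp
  have gz : ∀ p, p ∉ Metric.closedBall c s → g p = 0 := fun p hp => indicator_of_notMem hp _
  have gl : LocallyIntegrable g := locInt gm.aestronglyMeasurable gb
  obtain ⟨M, hM⟩ := bW.bdd
  have hM0 : 0 ≤ M := (abs_nonneg _).trans (hM 0)
  obtain ⟨N, hN⟩ := (ee_lim.eventually (gt_mem_nhds (sub_pos.2 hs))).exists_forall_of_atTop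
  have mz : ∀ n p, p ∉ Metric.closedBall c s' → mol (n + N) g p = 0 := by
    intro n p hp
    refine mol_zero (n + N) gz (fun h => hp ?_)
    rw [cthickening_closedBall (by positivity) h0] at h
    have := hN (n + N) (by omega)
    unfold ee at this
    exact Metric.closedBall_subset_closedBall (by linarith) h
  have lim : Tendsto (fun n => ∫ p, W p * mol (n + N) g p) atTop (𝓝 (∫ p, W p * g p)) := by
    refine tendsto_int (C := M * 1) (K := Metric.closedBall c s') (fun n => (bW.meas.mul (mol_contDiff _ gl).continuous.measurable).aestronglyMeasurable) (fun n p => ?_) (isCompact_closedBall _ _) (fun n p hp => by rw [mz n p hp, mul_zero]) ?_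
    · rw [norm_mul]; exact mul_le_mul (hM p) (mol_bound _ gb p) (norm_nonneg _) hM0
    · filter_upwards [mol_tendsto gl] with p hp
      exact (hp.comp (tendsto_add_atTop_nat N)).const_mul _
  have e0 : ∫ p in Metric.closedBall c s, |v (p + z) - v p| = ∫ p, W p * g p := by
    rw [← integral_indicator measurableSet_closedBall]
    congr 1; ext p
    by_cases hp : p ∈ Metric.closedBall c s
    · simp only [hg, indicator_of_mem hp]
      split_ifs with h
      · rw [mul_one, abs_of_nonneg h]
      · rw [abs_of_neg (not_le.1 h)]; simp [hW]
    · simp only [hg, indicator_of_notMem hp, mul_zero]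
  rw [e0]
  refine le_of_tendsto' lim fun n => ?_
  have ms : ContDiff ℝ (⊤ : ℕ∞) (mol (n + N) g) := mol_contDiff _ gl
  have ts : tsupport (mol (n + N) g) ⊆ Metric.closedBall c s' :=
    closure_minimal (s := Function.support _) (fun p hp => by_contra fun h => hp (mz n p h)) Metric.isClosed_closedBall
  have key := bv_trans hv hB ms (fun p => mol_bound _ gb p) ts (-z) (by rwa [norm_neg])
  rw [norm_neg] at key
  refine le_trans (le_of_eq ?_) ((le_abs_self _).trans key)
  have bm : BM (mol (n + N) g) := ⟨ms.continuous.measurable, 1, fun p => mol_bound _ gb p⟩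
  have e1 : ∫ p, v p * mol (n + N) g (p + -z) = ∫ p, v (p + z) * mol (n + N) g p := by
    rw [← integral_add_right_eq_self _ z]; simp
  rw [e1, ← integral_sub]
  · congr 1; ext p; simp only [hW]; ring
  · exact (vz.mul bm).int (isCompact_closedBall c s') fun p hp => by rw [mz n p hp, mul_zero]
  · exact (hv.mul bm).int (isCompact_closedBall c s') fun p hp => by rw [mz n p hp, mul_zero]

lemma bv_dens {U : Set (ℝ × ℝ)} {v : ℝ × ℝ → ℝ} {μ : Measure (ℝ × ℝ)} [IsFiniteMeasure μ]
    (hv : BM v) (hB : BVin U v μ) {c : ℝ × ℝ} {r σ : ℝ} (hr : 0 < r) (hσ : 0 < σ) (hσ1 : σ ≤ 1)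
    (hU : Metric.closedBall c (3 * r) ⊆ U) {Z : Set (ℝ × ℝ)} (hZ : MeasurableSet Z) (hz0 : ∀ p ∈ Z, v p = 0)
    (hd : (volume : Measure (ℝ × ℝ)).real (Metric.closedBall c (2 * r) \ Z) ≤ 2 * (σ * r) ^ 2) :
    ∫ p in Metric.closedBall c r, |v p| ≤ 4 * σ * r * μ.real (Metric.closedBall c (3 * r)) := by
  set t := σ * r with ht
  have t0 : 0 < t := mul_pos hσ hr
  have tr : t ≤ r := by rw [ht]; nlinarith
  set A := Metric.closedBall c r
  set D := Metric.closedBall (0 : ℝ × ℝ) t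
  have fA : IsFiniteMeasure (volume.restrict A) := fin_restr (isCompact_closedBall _ _).measure_lt_top
  have fD : IsFiniteMeasure (volume.restrict D) := fin_restr (isCompact_closedBall _ _).measure_lt_top
  obtain ⟨vm, M, hM⟩ := hv
  have hv : BM v := ⟨vm, M, hM⟩
  set K : ℝ := μ.real (Metric.closedBall c (3 * r))
  have K0 : 0 ≤ K := measureReal_nonneg
  -- joint integrability
  have mJ : Measurable fun q : (ℝ × ℝ) × (ℝ × ℝ) => |v (q.2 + q.1) - v q.2| := by
    have a1 : Measurable fun q : (ℝ × ℝ) × (ℝ × ℝ) => v (q.2 + q.1) := vm.comp (by fun_prop)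
    have a2 : Measurable fun q : (ℝ × ℝ) × (ℝ × ℝ) => v q.2 := vm.comp (by fun_prop)
    exact (a1.sub a2).abs
  have bJ : ∀ x y, |v x - v y| ≤ 2 * M := fun x y => by
    have := abs_sub (v x) (v y); linarith [hM x, hM y]
  have iJ : Integrable (fun q : (ℝ × ℝ) × (ℝ × ℝ) => |v (q.2 + q.1) - v q.2|) ((volume.restrict D).prod (volume.restrict A)) :=
    bdd_int mJ (C := 2 * M) (fun q => by rw [abs_abs]; exact bJ _ _)
  have up : ∫ z in D, ∫ x in A, |v (x + z) - v x| ≤ 4 * t ^ 2 * (2 * t * K) := by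
    have : ∫ z in D, ∫ x in A, |v (x + z) - v x| ≤ ∫ z in D, 2 * t * K := by
      refine setIntegral_mono_on iJ.integral_prod_left (integrable_const _) measurableSet_closedBall fun z hz => ?_
      have zt : ‖z‖ ≤ t := mem_closedBall_zero_iff.1 hz
      have sub : Metric.closedBall c (2 * r + ‖z‖) ⊆ Metric.closedBall c (3 * r) := Metric.closedBall_subset_closedBall (by linarith)
      refine (bv_shift hv hB hr.le (by linarith : r < 2 * r) z (sub.trans hU)).trans ?_
      have m1 : μ.real (Metric.closedBall c (2 * r + ‖z‖)) ≤ K := measureReal_mono sub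
      exact mul_le_mul (by linarith) m1 measureReal_nonneg (by linarith)
    refine this.trans (le_of_eq ?_)
    rw [setIntegral_const, vol_ball 0 t0.le, smul_eq_mul]
  rw [integral_integral_swap (by exact iJ)] at up
  have lo : ∫ x in A, 2 * t ^ 2 * |v x| ≤ ∫ x in A, ∫ z in D, |v (x + z) - v x| := by
    refine setIntegral_mono_on (bdd_int (by fun_prop) (C := 2 * t ^ 2 * M) fun x => ?_) iJ.integral_prod_right measurableSet_closedBall fun x hx => ?_
    · rw [abs_of_nonneg (by positivity)]; exact mul_le_mul_of_nonneg_left (hM x) (by positivity)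
    set S := D ∩ (fun z => x + z) ⁻¹' Z with hS
    have mS : MeasurableSet S := measurableSet_closedBall.inter (hZ.preimage (by fun_prop))
    have vS : 2 * t ^ 2 ≤ volume.real S := by
      have e1 : volume.real D = volume.real S + volume.real (D \ (fun z => x + z) ⁻¹' Z) := by
        rw [hS, measureReal_inter_add_sdiff (hZ.preimage (by fun_prop)) (isCompact_closedBall _ _).measure_lt_top.ne]
      have e2 : volume.real (D \ (fun z => x + z) ⁻¹' Z) ≤ 2 * t ^ 2 := by
        refine le_trans ?_ hd
        have e3 : volume.real ((fun z => x + z) ⁻¹' (Metric.closedBall c (2 * r) \ Z)) = volume.real (Metric.closedBall c (2 * r) \ Z) := by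
          simp only [Measure.real, measure_preimage_add]
        rw [← e3]
        refine measureReal_mono (fun z hz => ⟨?_, hz.2⟩) ?_
        · have h1 := Metric.mem_closedBall.1 hx
          have h2 : ‖z‖ ≤ t := mem_closedBall_zero_iff.1 hz.1
          show dist (x + z) c ≤ 2 * r
          have h3 := dist_triangle (x + z) x c
          rw [dist_self_add_left] at h3; linarith
        · rw [measure_preimage_add]
          exact ((measure_mono sdiff_subset).trans_lt (isCompact_closedBall c (2 * r)).measure_lt_top).ne
      rw [vol_ball 0 t0.le] at e1
      linarith
    calc 2 * t ^ 2 * |v x| ≤ volume.real S * |v x| := mul_le_mul_of_nonneg_right vS (abs_nonneg _)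
      _ = ∫ z in S, |v x| := by rw [setIntegral_const, smul_eq_mul]
      _ = ∫ z in S, |v (x + z) - v x| := setIntegral_congr_fun mS fun z hz => by
          show |v x| = |v (x + z) - v x|
          rw [hz0 _ hz.2, zero_sub, abs_neg]
      _ ≤ ∫ z in D, |v (x + z) - v x| := by
          refine setIntegral_mono_set ?_ (Eventually.of_forall fun _ => abs_nonneg _) (LE.le.eventuallyLE inter_subset_left)
          exact bdd_int (by fun_prop) (C := 2 * M) fun z => by rw [abs_abs]; exact bJ _ _
  rw [integral_const_mul] at lo
  have fin := lo.trans up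
  have e : 4 * t ^ 2 * (2 * t * K) = 2 * t ^ 2 * (4 * σ * r * K) := by rw [ht]; ring
  rw [e] at fin
  exact le_of_mul_le_mul_left fin (by positivity)

lemma dens_real {μ : Measure (ℝ × ℝ)} [IsFiniteMeasure μ] {c : ℝ × ℝ} {L : ℝ≥0∞} (hL : L ≠ ⊤) (S : ℝ → Set (ℝ × ℝ))
    (h : Tendsto (fun r => μ (S r) / volume (Metric.closedBall c r)) (𝓝[>] 0) (𝓝 L)) {k : ℝ} (hk : 0 < k) {a : ℝ} (ha : L.toReal < a) :
    ∀ᶠ n in atTop, μ.real (S (k * ee n)) ≤ a * (4 * (k * ee n) ^ 2) := by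
  have h1 : Tendsto (fun n => k * ee n) atTop (𝓝[>] 0) := by
    refine tendsto_nhdsWithin_iff.2 ⟨by simpa using ee_lim.const_mul k, Eventually.of_forall fun n => mul_pos hk (ee_pos n)⟩
  have h2 := ((ENNReal.tendsto_toReal hL).comp (h.comp h1)).eventually (gt_mem_nhds ha)
  filter_upwards [h2] with n hn
  simp only [Function.comp, ENNReal.toReal_div] at hn
  have hp : 0 < k * ee n := mul_pos hk (ee_pos n)
  have e : (volume (Metric.closedBall c (k * ee n))).toReal = 4 * (k * ee n) ^ 2 := vol_ball c hp.le
  rw [e, div_lt_iff₀ (by positivity)] at hn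
  exact hn.le

lemma bv_zero {U : Set (ℝ × ℝ)} {v : ℝ × ℝ → ℝ} {μ : Measure (ℝ × ℝ)} [IsFiniteMeasure μ] (hO : IsOpen U)
    (hv : BM v) (hB : BVin U v μ) :
    ∀ᵐ c, c ∈ U → v c = 0 → Tendsto (fun n => (ee n ^ 3)⁻¹ * ∫ p in Metric.closedBall c (ee n), |v p|) atTop (𝓝 0) := by
  set Z : Set (ℝ × ℝ) := {p | v p = 0} with hZ
  have mZ : MeasurableSet Z := measurableSet_eq_fun hv.meas measurable_const
  filter_upwards [Besicovitch.ae_tendsto_rnDeriv μ (volume : Measure (ℝ × ℝ)), μ.rnDeriv_lt_top volume, 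
    Besicovitch.ae_tendsto_measure_inter_div_of_measurableSet (volume : Measure (ℝ × ℝ)) mZ.compl] with c h1 h2 h3 cU cZ
  have h3' : Zᶜ.indicator (1 : ℝ × ℝ → ℝ≥0∞) c = 0 := indicator_of_notMem (show c ∉ Zᶜ from fun h => h cZ) _
  rw [h3'] at h3
  set L := μ.rnDeriv volume c
  rw [Metric.tendsto_atTop]
  intro ε hε
  have L0 : 0 ≤ L.toReal := ENNReal.toReal_nonneg
  obtain ⟨σ, s0, s1, s2⟩ : ∃ σ : ℝ, 0 < σ ∧ σ ≤ 1 ∧ 144 * σ * (L.toReal + 1) < ε := by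
    refine ⟨min 1 (ε / (145 * (L.toReal + 1))), lt_min one_pos (by positivity), min_le_left _ _, ?_⟩
    have : min 1 (ε / (145 * (L.toReal + 1))) ≤ ε / (145 * (L.toReal + 1)) := min_le_right _ _
    calc 144 * min 1 (ε / (145 * (L.toReal + 1))) * (L.toReal + 1) ≤ 144 * (ε / (145 * (L.toReal + 1))) * (L.toReal + 1) := by gcongr
      _ = 144 / 145 * ε := by field_simp
      _ < ε := by linarith
  have E1 := dens_real (S := fun r => Metric.closedBall c r) h2.ne h1 (by norm_num : (0:ℝ) < 3) (lt_add_one L.toReal)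
  obtain ⟨R, R0, hR⟩ := Metric.isOpen_iff.1 hO c cU
  have E2 : ∀ᶠ n in atTop, 3 * ee n < R := by
    have := ee_lim.const_mul 3
    rw [mul_zero] at this
    exact this.eventually (gt_mem_nhds R0)
  have E3 : ∀ᶠ n in atTop, (volume : Measure (ℝ × ℝ)).real (Metric.closedBall c (2 * ee n) \ Z) ≤ 2 * (σ * ee n) ^ 2 := by
    have h4 : Tendsto (fun n => 2 * ee n) atTop (𝓝[>] 0) := by
      refine tendsto_nhdsWithin_iff.2 ⟨by simpa using ee_lim.const_mul 2, Eventually.of_forall fun n => mul_pos two_pos (ee_pos n)⟩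
    have h5 := ((ENNReal.tendsto_toReal (by simp)).comp (h3.comp h4)).eventually (gt_mem_nhds (show (0:ℝ≥0∞).toReal < σ ^ 2 / 8 by simp; positivity))
    filter_upwards [h5] with n hn
    simp only [Function.comp, ENNReal.toReal_div] at hn
    have hp : 0 < 2 * ee n := mul_pos two_pos (ee_pos n)
    have e : (volume (Metric.closedBall c (2 * ee n))).toReal = 4 * (2 * ee n) ^ 2 := vol_ball c hp.le
    rw [e, div_lt_iff₀ (by positivity)] at hn
    have e2 : Metric.closedBall c (2 * ee n) \ Z = Zᶜ ∩ Metric.closedBall c (2 * ee n) := by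
      rw [Set.sdiff_eq, inter_comm]
    rw [e2]
    refine hn.le.trans (le_of_eq ?_); ring
  obtain ⟨N, hN⟩ := (E1.and (E2.and E3)).exists_forall_of_atTop
  refine ⟨N, fun n hn => ?_⟩
  obtain ⟨a1, a2, a3⟩ := hN n hn
  have r0 := ee_pos n
  have I0 : 0 ≤ ∫ p in Metric.closedBall c (ee n), |v p| := integral_nonneg fun _ => abs_nonneg _
  have key := bv_dens hv hB r0 s0 s1 (fun p hp => hR (lt_of_le_of_lt (Metric.mem_closedBall.1 hp) a2)) mZ (fun p hp => hp) a3
  rw [Real.dist_eq, sub_zero, abs_of_nonneg (by positivity), inv_mul_lt_iff₀ (by positivity)]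
  calc _ ≤ _ := key
    _ ≤ 4 * σ * ee n * ((L.toReal + 1) * (4 * (3 * ee n) ^ 2)) := by gcongr
    _ = ee n ^ 3 * (144 * σ * (L.toReal + 1)) := by ring
    _ < _ := by gcongr

lemma eta_lipc {ε : ℝ} (hε : 0 < ε) : LipschitzWith (Real.toNNReal (2 * ε)) (eta ε) := by
  refine LipschitzWith.of_dist_le_mul fun p q => ?_
  rw [Real.coe_toNNReal _ (by positivity), Real.dist_eq]
  have tl : ∀ a b : ℝ, |tent ε a - tent ε b| ≤ |a - b| := by
    intro a b
    unfold tent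
    refine (abs_max_sub_max_le_max 0 (ε - |a|) 0 (ε - |b|)).trans ?_
    have := abs_abs_sub_abs_le b a
    rw [abs_sub_comm b a] at this
    rw [show ε - |a| - (ε - |b|) = |b| - |a| by ring]
    exact max_le (by simp) this
  have e : eta ε p - eta ε q = (tent ε p.1 - tent ε q.1) * tent ε p.2 + tent ε q.1 * (tent ε p.2 - tent ε q.2) := by
    unfold eta; ring
  have h1 : |p.1 - q.1| ≤ dist p q := by rw [Prod.dist_eq]; exact le_max_left _ _
  have h2 : |p.2 - q.2| ≤ dist p q := by rw [Prod.dist_eq]; exact le_max_right _ _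
  rw [e]
  refine (abs_add_le _ _).trans ?_
  rw [abs_mul, abs_mul]
  have a1 : |tent ε p.1 - tent ε q.1| * |tent ε p.2| ≤ dist p q * ε :=
    mul_le_mul ((tl _ _).trans h1) (tent_abs hε.le _) (abs_nonneg _) dist_nonneg
  have a2 : |tent ε q.1| * |tent ε p.2 - tent ε q.2| ≤ ε * dist p q :=
    mul_le_mul (tent_abs hε.le _) ((tl _ _).trans h2) (abs_nonneg _) hε.le
  linarith

lemma G_zero {U : Set (ℝ × ℝ)} {v1 v2 w1 w2 G : ℝ × ℝ → ℝ} {μ1 μ2 : Measure (ℝ × ℝ)} [IsFiniteMeasure μ1] [IsFiniteMeasure μ2]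
    (hO : IsOpen U) (hv1 : BM v1) (hv2 : BM v2) (hB1 : BVin U v1 μ1) (hB2 : BVin U v2 μ2) (hw1 : BM w1) (hw2 : BM w2) (hG : BM G) {K : ℝ}
    (k1 : ∀ p, |w1 p| ≤ K * |v1 p|) (k2 : ∀ p, |w2 p| ≤ K * |v2 p|) (hD : Div U w1 w2 G) :
    ∀ᵐ c, c ∈ U → v1 c = 0 → v2 c = 0 → G c = 0 := by
  filter_upwards [bv_zero hO hv1 hB1, bv_zero hO hv2 hB2, leb2 hG] with c l1 l2 l3 cU z1 z2
  have l1 := l1 cU z1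
  have l2 := l2 cU z2
  obtain ⟨R, R0, hR⟩ := Metric.isOpen_iff.1 hO c cU
  have lim : Tendsto (fun n => ((ee n ^ 2)⁻¹ * ∫ p in Metric.closedBall c (ee n), |G p - G c|) + (2 * K * ((ee n ^ 3)⁻¹ * ∫ p in Metric.closedBall c (ee n), |v1 p|)
      + 2 * K * ((ee n ^ 3)⁻¹ * ∫ p in Metric.closedBall c (ee n), |v2 p|))) atTop (𝓝 0) := by
    simpa using l3.add ((l1.const_mul (2 * K)).add (l2.const_mul (2 * K)))
  have bound : ∀ᶠ n in atTop, |G c| ≤ ((ee n ^ 2)⁻¹ * ∫ p in Metric.closedBall c (ee n), |G p - G c|) + (2 * K * ((ee n ^ 3)⁻¹ * ∫ p in Metric.closedBall c (ee n), |v1 p|)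
      + 2 * K * ((ee n ^ 3)⁻¹ * ∫ p in Metric.closedBall c (ee n), |v2 p|)) := by
    filter_upwards [ee_lim.eventually (gt_mem_nhds R0)] with n hn
    have e0 := ee_pos n
    set ε := ee n
    set φ : ℝ × ℝ → ℝ := fun p => eta ε (p + -c) with hφ
    have tφ : Tst U φ := (tst_tr (eta_tst e0 hn) (-c)).mono (by
      intro p hp
      refine hR ?_
      have : p + -c ∈ Metric.ball 0 R := hp
      rw [mem_ball_zero_iff, ← sub_eq_add_neg, ← dist_eq_norm] at this
      exact this)
    have zz : ∀ p, p ∉ Metric.closedBall c ε → p + -c ∉ Metric.closedBall (0 : ℝ × ℝ) ε := by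
      intro p hp h
      rw [mem_closedBall_zero_iff, ← sub_eq_add_neg, ← dist_eq_norm] at h
      exact hp h
    have ts : tsupport (eta ε) ⊆ Metric.closedBall 0 ε := 
      closure_minimal (s := Function.support _) (fun p hp => by_contra fun h => hp (eta_zero fun h' => h (Metric.ball_subset_closedBall h'))) Metric.isClosed_closedBall
    have db : ∀ (w v : ℝ × ℝ → ℝ) (D : ℝ × ℝ → ℝ), BM v → (∀ p, |w p| ≤ K * |v p|) → (∀ p, |D p| ≤ 2 * ε) → (∀ p, p ∉ Metric.closedBall c ε → D p = 0) →
        |∫ p, w p * D p| ≤ ε ^ 4 * (2 * K * ((ε ^ 3)⁻¹ * ∫ p in Metric.closedBall c ε, |v p|)) := by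
      intro w v D bv kw hD1 hD2
      have e1 : ε ^ 4 * (2 * K * ((ε ^ 3)⁻¹ * ∫ p in Metric.closedBall c ε, |v p|)) = ∫ p in Metric.closedBall c ε, 2 * ε * K * |v p| := by
        rw [integral_const_mul]; field_simp
      rw [e1, ← integral_indicator measurableSet_closedBall, ← Real.norm_eq_abs]
      refine norm_integral_le_of_norm_le ((integrable_indicator_iff measurableSet_closedBall).2 ?_) (Eventually.of_forall fun p => ?_)
      · exact ((BM.const _).mul bv.abs).intOn Metric.isBounded_closedBall
      · by_cases hp : p ∈ Metric.closedBall c ε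
        · rw [indicator_of_mem hp, norm_mul]
          have := mul_le_mul (kw p) (hD1 p) (abs_nonneg _) ((abs_nonneg _).trans (kw p))
          rw [Real.norm_eq_abs, Real.norm_eq_abs]; linarith
        · rw [indicator_of_notMem hp, hD2 p hp]; simp
    have c2 : ((Real.toNNReal (2 * ε) : ℝ≥0) : ℝ) = 2 * ε := Real.coe_toNNReal _ (by positivity)
    have f1 := db w1 v1 (d1 φ) hv1 k1 (fun p => by rw [hφ, d1_tr, ← c2]; exact d1_le (eta_lipc e0) _) (fun p hp => by rw [hφ, d1_tr]; exact d1_zero fun h => zz p hp (ts h))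
    have f2 := db w2 v2 (d2 φ) hv2 k2 (fun p => by rw [hφ, d2_tr, ← c2]; exact d2_le (eta_lipc e0) _) (fun p hp => by rw [hφ, d2_tr]; exact d2_zero fun h => zz p hp (ts h))
    have hd := hD φ tφ
    rw [integral_add (tφ.int1 hw1) (tφ.int2 hw2)] at hd
    have i1 : ∫ p, φ p = ε ^ 4 := by
      rw [hφ, integral_add_right_eq_self (fun p => eta ε p), eta_int e0]
    have f3 : |(∫ p, G p * φ p) - G c * ε ^ 4| ≤ ε ^ 4 * ((ε ^ 2)⁻¹ * ∫ p in Metric.closedBall c ε, |G p - G c|) := by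
      have bF : BM fun p => |G p - G c| := (hG.sub (BM.const _)).abs
      have h := eta_int_le bF (fun p => abs_nonneg _) e0 c
      have e1 : ε ^ 4 * ((ε ^ 2)⁻¹ * ∫ p in Metric.closedBall c ε, |G p - G c|) = ε ^ 2 * ∫ p in Metric.closedBall c ε, |G p - G c| := by
        field_simp
      rw [e1]
      refine le_trans ?_ h
      have e2 : (∫ p, G p * φ p) - G c * ε ^ 4 = ∫ p, (G p - G c) * φ p := by
        rw [← i1, ← integral_const_mul, ← integral_sub (tφ.int hG) (tφ.int (BM.const _))]
        congr 1; ext p; ring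
      rw [e2]
      refine (abs_integral_le_integral_abs).trans (le_of_eq ?_)
      congr 1; ext p
      rw [abs_mul, abs_of_nonneg (show 0 ≤ φ p from eta_nn _ _)]; simp only [hφ, sub_eq_add_neg]
    have f4 : |G c| * ε ^ 4 ≤ ε ^ 4 * (((ε ^ 2)⁻¹ * ∫ p in Metric.closedBall c ε, |G p - G c|) + (2 * K * ((ε ^ 3)⁻¹ * ∫ p in Metric.closedBall c ε, |v1 p|)
      + 2 * K * ((ε ^ 3)⁻¹ * ∫ p in Metric.closedBall c ε, |v2 p|))) := by
      rw [← abs_of_pos (show 0 < ε ^ 4 by positivity), ← abs_mul, abs_of_pos (show 0 < ε ^ 4 by positivity)]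
      have g1 : G c * ε ^ 4 = -((∫ p, G p * φ p) - G c * ε ^ 4) - (∫ p, w1 p * d1 φ p) - (∫ p, w2 p * d2 φ p) := by linarith
      rw [g1]
      rw [abs_le] at f1 f2 f3 ⊢
      constructor <;> linarith [f1.1, f1.2, f2.1, f2.2, f3.1, f3.2]
    rw [mul_comm] at f4
    exact le_of_mul_le_mul_left f4 (by positivity)
  have : |G c| ≤ 0 := ge_of_tendsto lim bound
  exact abs_nonpos_iff.1 this

abbrev R3 := ℝ × (ℝ × ℝ)

def cvt (k : ℝ → ℝ) (u : R3 → ℝ) (t : ℝ) (x : ℝ × ℝ) : ℝ := ∫ s, k (t - s) * u (s, x)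

lemma cvt_meas {k : ℝ → ℝ} (hk : Continuous k) {u : R3 → ℝ} (hu : Measurable u) :
    Measurable fun q : R3 => cvt k u q.1 q.2 := by
  unfold cvt
  have : Measurable fun z : R3 × ℝ => k (z.1.1 - z.2) * u (z.2, z.1.2) :=
    (hk.measurable.comp (by fun_prop)).mul (hu.comp (by fun_prop))
  exact (this.stronglyMeasurable.integral_prod_right').measurable

lemma cvt_bdd {k : ℝ → ℝ} (hk : Continuous k) (hc : HasCompactSupport k) {u : R3 → ℝ} {M : ℝ} (hM : ∀ q, |u q| ≤ M) :
    ∀ t x, |cvt k u t x| ≤ (∫ s, |k s|) * M := by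
  intro t x
  rw [← integral_sub_left_eq_self (fun s => |k s|) volume t, ← integral_mul_const, ← Real.norm_eq_abs]
  refine norm_integral_le_of_norm_le ?_ (Eventually.of_forall fun s => ?_)
  · exact ((hk.integrable_of_hasCompactSupport hc).abs.comp_sub_left t).mul_const M
  · rw [norm_mul]; exact mul_le_mul_of_nonneg_left (hM _) (norm_nonneg _)

lemma cvt_slice {u : R3 → ℝ} (hu : Measurable u) {M : ℝ} (hM : ∀ q, |u q| ≤ M) (x : ℝ × ℝ) :
    LocallyIntegrable fun s => u (s, x) :=
  locInt (hu.comp (by fun_prop)).aestronglyMeasurable (C := M) fun s => hM _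

lemma cvt_conv (k : ℝ → ℝ) (u : R3 → ℝ) (x : ℝ × ℝ) :
    (fun t => cvt k u t x) = convolution k (fun s => u (s, x)) (ContinuousLinearMap.mul ℝ ℝ) volume := by
  ext t
  rw [convolution_def]
  unfold cvt
  rw [← integral_sub_left_eq_self _ volume t]
  simp

lemma cvt_deriv {k : ℝ → ℝ} (hk : ContDiff ℝ 1 k) (hc : HasCompactSupport k) {u : R3 → ℝ} (hu : Measurable u) {M : ℝ} (hM : ∀ q, |u q| ≤ M)
    (t : ℝ) (x : ℝ × ℝ) : HasDerivAt (fun t => cvt k u t x) (cvt (deriv k) u t x) t := by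
  have e := congrFun (cvt_conv (deriv k) u x) t
  rw [cvt_conv, e]
  exact hc.hasDerivAt_convolution_left _ hk (cvt_slice hu hM x) t

lemma cvt_mol (n : ℕ) (u : R3 → ℝ) (t : ℝ) (x : ℝ × ℝ) : cvt (ker ℝ n) u t x = mol n (fun s => u (s, x)) t := by
  unfold cvt mol
  rw [← integral_sub_left_eq_self _ volume t]
  simp

lemma cvt_mb (n : ℕ) {u : R3 → ℝ} {M : ℝ} (hM : ∀ q, |u q| ≤ M) (t : ℝ) (x : ℝ × ℝ) : |cvt (ker ℝ n) u t x| ≤ M := by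
  rw [cvt_mol]; exact mol_bound n (g := fun s => u (s, x)) (fun s => hM _) t

lemma cvt_lim {u : R3 → ℝ} (hu : Measurable u) {M : ℝ} (hM : ∀ q, |u q| ≤ M) :
    ∀ᵐ q : R3, Tendsto (fun n => cvt (ker ℝ n) u q.1 q.2) atTop (𝓝 (u q)) := by
  have ms : MeasurableSet {q : R3 | Tendsto (fun n => cvt (ker ℝ n) u q.1 q.2) atTop (𝓝 (u q))} :=
    measurableSet_tendsto_fun (fun n => cvt_meas (ker_cont n) hu) hu
  have ms' : MeasurableSet {q : (ℝ × ℝ) × ℝ | Tendsto (fun n => cvt (ker ℝ n) u q.2 q.1) atTop (𝓝 (u q.swap))} :=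
    ms.preimage measurable_swap
  have h : ∀ᵐ q : (ℝ × ℝ) × ℝ, Tendsto (fun n => cvt (ker ℝ n) u q.2 q.1) atTop (𝓝 (u q.swap)) := by
    rw [Measure.volume_eq_prod, Measure.ae_prod_iff_ae_ae ms']
    refine Eventually.of_forall fun x => ?_
    filter_upwards [mol_tendsto (cvt_slice hu hM x)] with t ht
    simp only [cvt_mol]
    exact ht
  have sw : MeasurePreserving (Prod.swap : R3 → (ℝ × ℝ) × ℝ) := by
    rw [Measure.volume_eq_prod, Measure.volume_eq_prod]; exact Measure.measurePreserving_swap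
  exact sw.quasiMeasurePreserving.ae h

lemma cvt_fub {k : ℝ → ℝ} (hk : Continuous k) (hc : HasCompactSupport k) {u : R3 → ℝ} (hu : Measurable u) {M : ℝ} (hM : ∀ q, |u q| ≤ M)
    {h : ℝ × ℝ → ℝ} (hh : Integrable h) (t : ℝ) :
    Integrable (fun q : R3 => h q.2 * (k (t - q.1) * u q)) ∧
    ∫ x, h x * cvt k u t x = ∫ q : R3, h q.2 * (k (t - q.1) * u q) := by
  have i1 : Integrable fun s => k (t - s) := (hk.integrable_of_hasCompactSupport hc).comp_sub_left t
  have i2 : Integrable (fun q : R3 => k (t - q.1) * h q.2) := by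
    rw [Measure.volume_eq_prod]; exact i1.mul_prod hh
  have i3 : Integrable (fun q : R3 => h q.2 * (k (t - q.1) * u q)) := by
    have := i2.mul_bdd (c := M) hu.aestronglyMeasurable (Eventually.of_forall fun q => hM q)
    refine this.congr (Eventually.of_forall fun q => ?_)
    simp only; ring
  refine ⟨i3, ?_⟩
  rw [Measure.volume_eq_prod] at i3
  refine Eq.trans ?_ (integral_prod_symm (fun q : R3 => h q.2 * (k (t - q.1) * u q)) i3).symm
  congr 1; ext x
  rw [cvt, ← integral_const_mul]

/-- weak solutions -/
def Sol (T : ℝ) (U : Set (ℝ × ℝ)) (r v1 v2 : ℝ × ℝ → ℝ) (u : R3 → ℝ) : Prop :=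
  ∀ φ : R3 → ℝ, ContDiff ℝ (⊤ : ℕ∞) φ → HasCompactSupport φ → tsupport φ ⊆ Ioo 0 T ×ˢ U →
    ∫ q : R3, r q.2 * u q * (fderiv ℝ φ q (1, 0) + fderiv ℝ φ q (0, (v1 q.2, v2 q.2))) = 0

lemma slice_div {T : ℝ} {U : Set (ℝ × ℝ)} (hO : IsOpen U) {r v1 v2 : ℝ × ℝ → ℝ} (hr : BM r) (h1 : BM v1) (h2 : BM v2)
    {u : R3 → ℝ} (hu : Measurable u) {M : ℝ} (hM : ∀ q, |u q| ≤ M) (hs : Sol T U r v1 v2 u) (n : ℕ) {t : ℝ}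
    (ht : Metric.closedBall t (ee n) ⊆ Ioo 0 T) :
    Div U (fun x => cvt (ker ℝ n) u t x * (r x * v1 x)) (fun x => cvt (ker ℝ n) u t x * (r x * v2 x))
      (fun x => -(r x * cvt (deriv (ker ℝ n)) u t x)) := by
  set k := ker ℝ n with hk
  have ks : ContDiff ℝ (⊤ : ℕ∞) k := ker_contDiff n
  have kc : HasCompactSupport k := ker_cpt n
  have dc : Continuous (deriv k) := ks.continuous_deriv (by simp)
  have dcc : HasCompactSupport (deriv k) := kc.deriv
  have bf : BM fun x => cvt k u t x := ⟨(cvt_meas ks.continuous hu).comp (by fun_prop : Measurable fun x : ℝ × ℝ => ((t, x) : R3)), _, fun x => cvt_bdd ks.continuous kc hM t x⟩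
  have bg : BM fun x => cvt (deriv k) u t x := ⟨(cvt_meas dc hu).comp (by fun_prop : Measurable fun x : ℝ × ℝ => ((t, x) : R3)), _, fun x => cvt_bdd dc dcc hM t x⟩
  refine Div.of_smooth hO (bf.mul (hr.mul h1)) (bf.mul (hr.mul h2)) (hr.mul bg).neg ?_
  intro ψ ψs ψc ψU
  have tψ : Tst U ψ := Tst.of_smooth ψs ψc ψU
  set φ : R3 → ℝ := fun q => k (t - q.1) * ψ q.2 with hφ
  have φs : ContDiff ℝ (⊤ : ℕ∞) φ := (ks.comp (by fun_prop)).mul (ψs.comp (by fun_prop))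
  have φt : tsupport φ ⊆ Metric.closedBall t (ee n) ×ˢ tsupport ψ := by
    refine closure_minimal (s := Function.support _) (fun q hq => ?_) (Metric.isClosed_closedBall.prod (isClosed_tsupport _))
    by_contra h
    refine hq ?_
    by_cases h' : q.1 ∈ Metric.closedBall t (ee n)
    · have : q.2 ∉ tsupport ψ := fun h'' => h ⟨h', h''⟩
      simp only [hφ, image_eq_zero_of_notMem_tsupport this, mul_zero]
    · have : ee n ≤ ‖t - q.1‖ := by
        rw [Metric.mem_closedBall, dist_comm, dist_eq_norm, not_le] at h'
        exact h'.le
      simp only [hφ, hk, ker_zero n _ this, zero_mul]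
  have φc : HasCompactSupport φ := ((isCompact_closedBall t (ee n)).prod ψc).of_isClosed_subset (isClosed_tsupport _) φt
  have key := hs φ φs φc (φt.trans (prod_mono ht ψU))
  have hd : ∀ q : R3, ∀ w : R3, fderiv ℝ φ q w = -(w.1 * (deriv k (t - q.1) * ψ q.2)) + k (t - q.1) * fderiv ℝ ψ q.2 w.2 := by
    intro q w
    have a1 : HasFDerivAt (fun q : R3 => k (t - q.1)) (deriv k (t - q.1) • (-(ContinuousLinearMap.fst ℝ ℝ (ℝ × ℝ)))) q :=
      (ks.differentiable (by simp) (t - q.1)).hasDerivAt.comp_hasFDerivAt q (hasFDerivAt_fst.const_sub t)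
    have a2 : HasFDerivAt (fun q : R3 => ψ q.2) ((fderiv ℝ ψ q.2).comp (ContinuousLinearMap.snd ℝ ℝ (ℝ × ℝ))) q :=
      (ψs.differentiable (by simp) q.2).hasFDerivAt.comp q hasFDerivAt_snd
    rw [HasFDerivAt.fderiv (f := φ) (a1.mul a2)]
    simp; ring
  have i1 : Integrable fun x => r x * ψ x := tψ.int hr
  have i2 : Integrable fun x => r x * (v1 x * d1 ψ x + v2 x * d2 ψ x) := by
    refine ((tψ.int1 (hr.mul h1)).add (tψ.int2 (hr.mul h2))).congr (Eventually.of_forall fun x => ?_)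
    simp only [Pi.add_apply]; ring
  obtain ⟨j1, k1⟩ := cvt_fub dc dcc hu hM i1 t
  obtain ⟨j2, k2⟩ := cvt_fub ks.continuous kc hu hM i2 t
  have e1 : ∫ q : R3, r q.2 * u q * (fderiv ℝ φ q (1, 0) + fderiv ℝ φ q (0, (v1 q.2, v2 q.2))) =
      (∫ q : R3, r q.2 * (v1 q.2 * d1 ψ q.2 + v2 q.2 * d2 ψ q.2) * (k (t - q.1) * u q)) - ∫ q : R3, r q.2 * ψ q.2 * (deriv k (t - q.1) * u q) := by
    rw [← integral_sub j2 j1]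
    congr 1; ext q
    rw [hd, hd, fderiv_eq ψ q.2 (v1 q.2, v2 q.2)]
    simp; ring
  rw [e1, ← k1, ← k2] at key
  have e2 : ∫ x, (cvt k u t x * (r x * v1 x) * d1 ψ x + cvt k u t x * (r x * v2 x) * d2 ψ x) = ∫ x, r x * (v1 x * d1 ψ x + v2 x * d2 ψ x) * cvt k u t x := by
    congr 1; ext x; ring
  have e3 : ∫ x, -(r x * cvt (deriv k) u t x) * ψ x = -∫ x, r x * ψ x * cvt (deriv k) u t x := by
    rw [← integral_neg]; congr 1; ext x; ring
  rw [e2, e3]; linarith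

lemma slice_sq {T : ℝ} {U : Set (ℝ × ℝ)} (hO : IsOpen U) {r v1 v2 : ℝ × ℝ → ℝ} (hr : BM r) (h1 : BM v1) (h2 : BM v2)
    {μ1 μ2 : Measure (ℝ × ℝ)} [IsFiniteMeasure μ1] [IsFiniteMeasure μ2] (hB1 : BVin U v1 μ1) (hB2 : BVin U v2 μ2)
    (hr0 : ∀ x, r x ≠ 0) (hD : Div U (fun x => r x * v1 x) (fun x => r x * v2 x) (fun _ => 0))
    {u : R3 → ℝ} (hu : Measurable u) {M : ℝ} (hM : ∀ q, |u q| ≤ M) (hs : Sol T U r v1 v2 u) (n : ℕ) {t : ℝ}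
    (ht : Metric.closedBall t (ee n) ⊆ Ioo 0 T) :
    Div U (fun x => cvt (ker ℝ n) u t x ^ 2 * (r x * v1 x)) (fun x => cvt (ker ℝ n) u t x ^ 2 * (r x * v2 x))
      (fun x => 2 * (cvt (ker ℝ n) u t x * -(r x * cvt (deriv (ker ℝ n)) u t x))) := by
  have hw := slice_div hO hr h1 h2 hu hM hs n ht
  set k := ker ℝ n with hk
  have ks : ContDiff ℝ (⊤ : ℕ∞) k := ker_contDiff n
  have kc : HasCompactSupport k := ker_cpt n
  have dc : Continuous (deriv k) := ks.continuous_deriv (by simp)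
  have dcc : HasCompactSupport (deriv k) := kc.deriv
  have bf : BM fun x => cvt k u t x := ⟨(cvt_meas ks.continuous hu).comp (by fun_prop : Measurable fun x : ℝ × ℝ => ((t, x) : R3)), _, fun x => cvt_bdd ks.continuous kc hM t x⟩
  have bg : BM fun x => cvt (deriv k) u t x := ⟨(cvt_meas dc hu).comp (by fun_prop : Measurable fun x : ℝ × ℝ => ((t, x) : R3)), _, fun x => cvt_bdd dc dcc hM t x⟩
  have bG : BM fun x => -(r x * cvt (deriv k) u t x) := (hr.mul bg).neg
  refine Tprime hO (hr.mul h1) (hr.mul h2) bf bG hD hw ?_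
  obtain ⟨_, K, hK⟩ := bf.mul hr
  have kk : ∀ (v : ℝ × ℝ → ℝ) p, |cvt k u t p * (r p * v p)| ≤ K * |v p| := fun v p => by
    rw [← mul_assoc, abs_mul]; exact mul_le_mul_of_nonneg_right (hK p) (abs_nonneg _)
  filter_upwards [G_zero hO h1 h2 hB1 hB2 (bf.mul (hr.mul h1)) (bf.mul (hr.mul h2)) bG (kk v1) (kk v2) hw] with p hp pU z1 z2
  exact hp pU ((mul_eq_zero.1 z1).resolve_left (hr0 p)) ((mul_eq_zero.1 z2).resolve_left (hr0 p))

lemma haar3 : (volume : Measure R3).IsAddHaarMeasure := by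
  have : (volume : Measure (ℝ × ℝ)).IsAddHaarMeasure := by rw [Measure.volume_eq_prod]; infer_instance
  rw [Measure.volume_eq_prod]; infer_instance

lemma int3 {g : R3 → ℝ} (hg : Measurable g) {C : ℝ} (hb : ∀ x, |g x| ≤ C)
    {K : Set R3} (hK : IsCompact K) (h0 : ∀ x, x ∉ K → g x = 0) : Integrable g := by
  have := haar3
  exact int_bdd hg.aestronglyMeasurable hb hK h0

lemma dprops {φ : R3 → ℝ} (φs : ContDiff ℝ (⊤ : ℕ∞) φ) (φc : HasCompactSupport φ) {v1 v2 : ℝ × ℝ → ℝ} (h1 : BM v1) (h2 : BM v2) :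
    ∃ C : ℝ, 0 ≤ C ∧ (∀ q, |φ q| ≤ C) ∧ Measurable (fun q => fderiv ℝ φ q (1, 0)) ∧ Measurable (fun q : R3 => fderiv ℝ φ q (0, (v1 q.2, v2 q.2))) ∧
      (∀ q, |fderiv ℝ φ q (1, 0)| ≤ C) ∧ (∀ q : R3, |fderiv ℝ φ q (0, (v1 q.2, v2 q.2))| ≤ C) ∧
      (∀ q, q ∉ tsupport φ → ∀ w, fderiv ℝ φ q w = 0) := by
  have hfc : Continuous (fderiv ℝ φ) := φs.continuous_fderiv (by simp)
  obtain ⟨C, hC⟩ := hfc.bounded_above_of_compact_support (φc.fderiv ℝ)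
  obtain ⟨C', hC'⟩ := φs.continuous.bounded_above_of_compact_support φc
  have hC0 : 0 ≤ C := (norm_nonneg _).trans (hC 0)
  obtain ⟨m1, M1, hM1⟩ := h1
  obtain ⟨m2, M2, hM2⟩ := h2
  have hs : ∀ q : R3, ‖((0 : ℝ), (v1 q.2, v2 q.2))‖ ≤ max M1 M2 := by
    intro q
    rw [Prod.norm_def, Prod.norm_def, norm_zero, max_eq_right (by positivity)]
    exact max_le_max (hM1 _) (hM2 _)
  have h0 : 0 ≤ max M1 M2 := (norm_nonneg _).trans (hs 0)
  refine ⟨max (max C' C) (C * max M1 M2), ((mul_nonneg hC0 h0).trans (le_max_right _ _)), fun q => (hC' q).trans ((le_max_left _ _).trans (le_max_left _ _)), by fun_prop, ?_, fun q => ?_, fun q => ?_, fun q hq w => ?_⟩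
  · have : Measurable fun q : R3 => ((0 : ℝ), (v1 q.2, v2 q.2)) := by fun_prop
    exact (isBoundedBilinearMap_apply (𝕜 := ℝ) (E := R3) (F := ℝ)).continuous.measurable.comp (hfc.measurable.prodMk this)
  · have h := (fderiv ℝ φ q).le_opNorm (1, 0)
    have e : ‖((1 : ℝ), (0 : ℝ × ℝ))‖ = 1 := by simp [Prod.norm_def]
    rw [e, mul_one] at h
    exact (h.trans (hC q)).trans ((le_max_right _ _).trans (le_max_left _ _))
  · exact ((fderiv ℝ φ q).le_opNorm _).trans ((mul_le_mul (hC q) (hs q) (norm_nonneg _) hC0).trans (le_max_right _ _))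
  · rw [fderiv_of_notMem_tsupport ℝ hq]; simp

lemma sol_sq {T : ℝ} {U : Set (ℝ × ℝ)} (hO : IsOpen U) {r v1 v2 : ℝ × ℝ → ℝ} (hr : BM r) (h1 : BM v1) (h2 : BM v2)
    {μ1 μ2 : Measure (ℝ × ℝ)} [IsFiniteMeasure μ1] [IsFiniteMeasure μ2] (hB1 : BVin U v1 μ1) (hB2 : BVin U v2 μ2)
    (hr0 : ∀ x, r x ≠ 0) (hD : Div U (fun x => r x * v1 x) (fun x => r x * v2 x) (fun _ => 0))
    {u : R3 → ℝ} (hu : Measurable u) {M : ℝ} (hM : ∀ q, |u q| ≤ M) (hs : Sol T U r v1 v2 u) :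
    Sol T U r v1 v2 (fun q => u q ^ 2) := by
  intro φ φs φc φU
  obtain ⟨C, C0, bφ, mA, mS, bA, bS, zD⟩ := dprops φs φc h1 h2
  set A : R3 → ℝ := fun q => fderiv ℝ φ q (1, 0) with hA
  set S : R3 → ℝ := fun q => fderiv ℝ φ q (0, (v1 q.2, v2 q.2)) with hS
  have mr : Measurable fun q : R3 => r q.2 := hr.meas.comp (by fun_prop)
  obtain ⟨Mr, hMr⟩ := hr.bdd
  have Mr0 : 0 ≤ Mr := (abs_nonneg _).trans (hMr 0)
  have M0 : 0 ≤ M := (abs_nonneg _).trans (hM 0)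
  have φm : Measurable φ := φs.continuous.measurable
  have zφ : ∀ q, q ∉ tsupport φ → φ q = 0 := fun q hq => image_eq_zero_of_notMem_tsupport hq
  set K1 : Set ℝ := Prod.fst '' tsupport φ with hK1
  have cK1 : IsCompact K1 := φc.isCompact.image continuous_fst
  have sK1 : K1 ⊆ Ioo 0 T := by rintro t ⟨q, hq, rfl⟩; exact (φU hq).1
  obtain ⟨δ, δ0, hδ⟩ := cK1.exists_cthickening_subset_open isOpen_Ioo sK1
  obtain ⟨N, hN⟩ := (ee_lim.eventually (gt_mem_nhds δ0)).exists_forall_of_atTop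
  have hball : ∀ n, N ≤ n → ∀ t ∈ K1, Metric.closedBall t (ee n) ⊆ Ioo 0 T := fun n hn t ht =>
    ((Metric.closedBall_subset_closedBall (hN n hn).le).trans (Metric.closedBall_subset_cthickening ht δ)).trans hδ
  have key : ∀ n, N ≤ n → ∫ q : R3, r q.2 * cvt (ker ℝ n) u q.1 q.2 ^ 2 * (A q + S q) = 0 := by
    intro n hn
    set k := ker ℝ n with hk
    have ks : ContDiff ℝ (⊤ : ℕ∞) k := ker_contDiff n
    have kc : HasCompactSupport k := ker_cpt n
    have dc : Continuous (deriv k) := ks.continuous_deriv (by simp)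
    have dcc : HasCompactSupport (deriv k) := kc.deriv
    set f : R3 → ℝ := fun q => cvt k u q.1 q.2 with hf
    set g : R3 → ℝ := fun q => cvt (deriv k) u q.1 q.2 with hg
    have mf : Measurable f := cvt_meas ks.continuous hu
    have mg : Measurable g := cvt_meas dc hu
    have bf : ∀ q, |f q| ≤ M := fun q => cvt_mb n hM _ _
    obtain ⟨Mg, bg⟩ : ∃ Mg, ∀ q, |g q| ≤ Mg := ⟨_, fun q => cvt_bdd dc dcc hM q.1 q.2⟩
    have Mg0 : 0 ≤ Mg := (abs_nonneg _).trans (bg 0)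
    have bf2 : ∀ q, |f q ^ 2| ≤ M ^ 2 := fun q => by rw [abs_pow]; exact pow_le_pow_left₀ (abs_nonneg _) (bf q) 2
    have brf : ∀ q : R3, |r q.2 * f q ^ 2| ≤ Mr * M ^ 2 := fun q => by
      rw [abs_mul]; exact mul_le_mul (hMr _) (bf2 q) (abs_nonneg _) Mr0
    have brg : ∀ q : R3, |r q.2 * (2 * (f q * g q))| ≤ Mr * (2 * (M * Mg)) := fun q => by
      rw [abs_mul, abs_mul, abs_mul, abs_two]
      exact mul_le_mul (hMr _) (mul_le_mul_of_nonneg_left (mul_le_mul (bf q) (bg q) (abs_nonneg _) M0) two_pos.le) (by positivity) Mr0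
    have iS : Integrable fun q : R3 => r q.2 * f q ^ 2 * S q := by
      refine int3 ((mr.mul (mf.pow_const 2)).mul mS) (C := Mr * M ^ 2 * C) (fun q => ?_) φc.isCompact fun q hq => by simp only [hS, zD q hq, mul_zero]
      show |r q.2 * f q ^ 2 * S q| ≤ _
      rw [abs_mul]; exact mul_le_mul (brf q) (bS q) (abs_nonneg _) (by positivity)
    have iA : Integrable fun q : R3 => r q.2 * f q ^ 2 * A q := by
      refine int3 ((mr.mul (mf.pow_const 2)).mul mA) (C := Mr * M ^ 2 * C) (fun q => ?_) φc.isCompact fun q hq => by simp only [hA, zD q hq, mul_zero]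
      show |r q.2 * f q ^ 2 * A q| ≤ _
      rw [abs_mul]; exact mul_le_mul (brf q) (bA q) (abs_nonneg _) (by positivity)
    have iG : Integrable fun q : R3 => r q.2 * (2 * (f q * g q)) * φ q := by
      refine int3 ((mr.mul ((mf.mul mg).const_mul 2)).mul φm) (C := Mr * (2 * (M * Mg)) * C) (fun q => ?_) φc.isCompact fun q hq => by simp only [zφ q hq, mul_zero]
      show |r q.2 * (2 * (f q * g q)) * φ q| ≤ _
      rw [abs_mul]; exact mul_le_mul (brg q) (bφ q) (abs_nonneg _) (by positivity)
    -- space equation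
    have sp : ∫ q : R3, (r q.2 * f q ^ 2 * S q - r q.2 * (2 * (f q * g q)) * φ q) = 0 := by
      have iSG := iS.sub iG
      rw [Measure.volume_eq_prod] at iSG
      refine (integral_prod _ iSG).trans ?_
      refine integral_eq_zero_of_ae (Eventually.of_forall fun t => ?_)
      simp only [Pi.sub_apply, Pi.zero_apply]
      by_cases ht : t ∈ K1
      · have hsq := slice_sq hO hr h1 h2 hB1 hB2 hr0 hD hu hM hs n (hball n hn t ht)
        set ψ : ℝ × ℝ → ℝ := fun x => φ (t, x) with hψ
        have ψs : ContDiff ℝ (⊤ : ℕ∞) ψ := φs.comp (by fun_prop)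
        have ψt : tsupport ψ ⊆ (fun x : ℝ × ℝ => ((t, x) : R3)) ⁻¹' tsupport φ :=
          closure_minimal (s := Function.support _) (fun x hx => subset_tsupport φ hx) ((isClosed_tsupport φ).preimage (by fun_prop))
        have ψc : HasCompactSupport ψ := (φc.isCompact.image continuous_snd).of_isClosed_subset (isClosed_tsupport _) fun x hx => ⟨(t, x), ψt hx, rfl⟩
        have tψ : Tst U ψ := Tst.of_smooth ψs ψc fun x hx => (φU (ψt hx)).2
        have hq := hsq ψ tψ
        have bft : BM fun x => cvt k u t x := ⟨mf.comp (by fun_prop : Measurable fun x : ℝ × ℝ => ((t, x) : R3)), M, fun x => bf (t, x)⟩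
        have bgt : BM fun x => cvt (deriv k) u t x := ⟨mg.comp (by fun_prop : Measurable fun x : ℝ × ℝ => ((t, x) : R3)), Mg, fun x => bg (t, x)⟩
        have dψ : ∀ x, v1 x * d1 ψ x + v2 x * d2 ψ x = S (t, x) := by
          intro x
          have hh : HasFDerivAt ψ ((fderiv ℝ φ (t, x)).comp (ContinuousLinearMap.inr ℝ ℝ (ℝ × ℝ))) x :=
            (φs.differentiable (by simp) (t, x)).hasFDerivAt.comp x (hasFDerivAt_prodMk_right t x)
          rw [← fderiv_eq ψ x (v1 x, v2 x), hh.fderiv]; simp [hS]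
        have ii1 : Integrable fun x => r x * f (t, x) ^ 2 * S (t, x) := by
          refine ((tψ.int1 (bft.sq.mul (hr.mul h1))).add (tψ.int2 (bft.sq.mul (hr.mul h2)))).congr (Eventually.of_forall fun x => ?_)
          simp only [Pi.add_apply]; rw [← dψ]; simp only [hf]; ring
        have ii2 : Integrable fun x => r x * (2 * (f (t, x) * g (t, x))) * φ (t, x) := 
          tψ.int (hr.mul ((BM.const 2).mul (bft.mul bgt)))
        rw [integral_sub ii1 ii2]
        have e1 : ∫ x, r x * f (t, x) ^ 2 * S (t, x) = ∫ x, (cvt k u t x ^ 2 * (r x * v1 x) * d1 ψ x + cvt k u t x ^ 2 * (r x * v2 x) * d2 ψ x) := by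
          congr 1; ext x; rw [← dψ]; simp only [hf]; ring
        have e2 : ∫ x, r x * (2 * (f (t, x) * g (t, x))) * φ (t, x) = -∫ x, 2 * (cvt k u t x * -(r x * cvt (deriv k) u t x)) * ψ x := by
          rw [← integral_neg]; congr 1; ext x; simp only [hf, hg, hψ]; ring
        rw [e1, e2, hq]; ring
      · refine integral_eq_zero_of_ae (Eventually.of_forall fun x => ?_)
        have : ((t, x) : R3) ∉ tsupport φ := fun h => ht ⟨_, h, rfl⟩
        simp only [hS, zD _ this, zφ _ this, mul_zero, sub_zero, Pi.zero_apply]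
    have tm : ∫ q : R3, (r q.2 * f q ^ 2 * A q + r q.2 * (2 * (f q * g q)) * φ q) = 0 := by
      have iAG := iA.add iG
      rw [Measure.volume_eq_prod] at iAG
      refine (integral_prod_symm _ iAG).trans ?_
      refine integral_eq_zero_of_ae (Eventually.of_forall fun x => ?_)
      simp only [Pi.add_apply, Pi.zero_apply]
      have e : ∀ t, r x * f (t, x) ^ 2 * A (t, x) + r x * (2 * (f (t, x) * g (t, x))) * φ (t, x) = r x * (f (t, x) ^ 2 * A (t, x) + 2 * (f (t, x) * g (t, x)) * φ (t, x)) := fun t => by ring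
      simp only [e]
      rw [integral_const_mul]
      have zt : ∀ t, t ∉ K1 → ((t, x) : R3) ∉ tsupport φ := fun t ht h => ht ⟨_, h, rfl⟩
      have mt : Measurable fun t : ℝ => ((t, x) : R3) := by fun_prop
      have hd : ∀ t, HasDerivAt (fun t => f (t, x) ^ 2 * φ (t, x)) (f (t, x) ^ 2 * A (t, x) + 2 * (f (t, x) * g (t, x)) * φ (t, x)) t := by
        intro t
        have a1 : HasDerivAt (fun t => f (t, x)) (g (t, x)) t := cvt_deriv (ks.of_le (by simp)) kc hu hM t x
        have a2 : HasDerivAt (fun t => φ (t, x)) (A (t, x)) t := by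
          have := (φs.differentiable (by simp) (t, x)).hasFDerivAt.comp_hasDerivAt t ((hasDerivAt_id t).prodMk (hasDerivAt_const t x))
          exact this
        have a3 := (a1.pow 2).mul a2
        refine a3.congr_deriv ?_
        simp only [Pi.pow_apply]; push_cast; ring
      rw [integral_eq_zero_of_hasDerivAt_of_integrable hd, mul_zero]
      · refine int_bdd (C := M ^ 2 * C + 2 * (M * Mg) * C) (((mf.pow_const 2).mul mA).add (((mf.mul mg).const_mul 2).mul φm) |>.comp mt).aestronglyMeasurable (fun t => ?_) cK1 fun t ht => by simp only [hA, zD _ (zt t ht), zφ _ (zt t ht), mul_zero, add_zero]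
        rw [Real.norm_eq_abs]
        refine (abs_add_le _ _).trans (add_le_add ?_ ?_)
        · rw [abs_mul]; exact mul_le_mul (bf2 _) (bA _) (abs_nonneg _) (by positivity)
        · rw [abs_mul, abs_mul, abs_mul, abs_two]
          exact mul_le_mul (mul_le_mul_of_nonneg_left (mul_le_mul (bf _) (bg _) (abs_nonneg _) M0) two_pos.le) (bφ _) (abs_nonneg _) (by positivity)
      · refine int_bdd (C := M ^ 2 * C) (((mf.pow_const 2).mul φm).comp mt).aestronglyMeasurable (fun t => ?_) cK1 fun t ht => by simp only [zφ _ (zt t ht), mul_zero]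
        rw [Real.norm_eq_abs, abs_mul]; exact mul_le_mul (bf2 _) (bφ _) (abs_nonneg _) (by positivity)
    rw [integral_sub iS iG] at sp
    rw [integral_add iA iG] at tm
    have : ∫ q : R3, r q.2 * f q ^ 2 * (A q + S q) = (∫ q : R3, r q.2 * f q ^ 2 * A q) + ∫ q : R3, r q.2 * f q ^ 2 * S q := by
      rw [← integral_add iA iS]; congr 1; ext q; ring
    rw [this]; linarith
  have := haar3
  have lim : Tendsto (fun n => ∫ q : R3, r q.2 * cvt (ker ℝ n) u q.1 q.2 ^ 2 * (A q + S q)) atTop (𝓝 (∫ q : R3, r q.2 * u q ^ 2 * (A q + S q))) := by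
    refine tendsto_int (C := Mr * M ^ 2 * (C + C)) (fun n => ((mr.mul ((cvt_meas (ker_cont n) hu).pow_const 2)).mul (mA.add mS)).aestronglyMeasurable) (fun n q => ?_) φc.isCompact (fun n q hq => by simp only [hA, hS, zD q hq, add_zero, mul_zero]) ?_
    · rw [Real.norm_eq_abs, abs_mul, abs_mul, abs_pow]
      exact mul_le_mul (mul_le_mul (hMr _) (pow_le_pow_left₀ (abs_nonneg _) (cvt_mb n hM _ _) 2) (by positivity) Mr0) ((abs_add_le _ _).trans (add_le_add (bA q) (bS q))) (abs_nonneg _) (by positivity)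
    · filter_upwards [cvt_lim hu hM] with q hq
      exact ((hq.pow 2).const_mul _).mul_const _
  refine tendsto_nhds_unique lim (tendsto_const_nhds.congr' ?_)
  filter_upwards [eventually_ge_atTop N] with n hn
  exact (key n hn).symm

lemma sol_int {r v1 v2 : ℝ × ℝ → ℝ} (hr : BM r) (h1 : BM v1) (h2 : BM v2) {u : R3 → ℝ} (hu : Measurable u) {M : ℝ} (hM : ∀ q, |u q| ≤ M)
    {φ : R3 → ℝ} (φs : ContDiff ℝ (⊤ : ℕ∞) φ) (φc : HasCompactSupport φ) :
    Integrable fun q : R3 => r q.2 * u q * (fderiv ℝ φ q (1, 0) + fderiv ℝ φ q (0, (v1 q.2, v2 q.2))) := by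
  obtain ⟨C, C0, bφ, mA, mS, bA, bS, zD⟩ := dprops φs φc h1 h2
  have mr : Measurable fun q : R3 => r q.2 := hr.meas.comp (by fun_prop)
  obtain ⟨Mr, hMr⟩ := hr.bdd
  have Mr0 : 0 ≤ Mr := (abs_nonneg _).trans (hMr 0)
  have M0 : 0 ≤ M := (abs_nonneg _).trans (hM 0)
  refine int3 ((mr.mul hu).mul (mA.add mS)) (C := Mr * M * (C + C)) (fun q => ?_) φc.isCompact fun q hq => by simp only [zD q hq, add_zero, mul_zero]
  show |r q.2 * u q * (fderiv ℝ φ q (1, 0) + fderiv ℝ φ q (0, (v1 q.2, v2 q.2)))| ≤ _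
  rw [abs_mul, abs_mul]
  exact mul_le_mul (mul_le_mul (hMr _) (hM q) (by positivity) Mr0) ((abs_add_le _ _).trans (add_le_add (bA q) (bS q))) (abs_nonneg _) (by positivity)

/-- bounded weak solutions -/
structure Good (T : ℝ) (U : Set (ℝ × ℝ)) (r v1 v2 : ℝ × ℝ → ℝ) (u : R3 → ℝ) : Prop where
  meas : Measurable u
  bdd : ∃ M : ℝ, ∀ q, |u q| ≤ M
  sol : Sol T U r v1 v2 u

lemma Good.add {T : ℝ} {U : Set (ℝ × ℝ)} {r v1 v2 : ℝ × ℝ → ℝ} (hr : BM r) (h1 : BM v1) (h2 : BM v2) {u w : R3 → ℝ}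
    (hu : Good T U r v1 v2 u) (hw : Good T U r v1 v2 w) : Good T U r v1 v2 (fun q => u q + w q) := by
  obtain ⟨um, ⟨M, hM⟩, us⟩ := hu
  obtain ⟨wm, ⟨N, hN⟩, ws⟩ := hw
  refine ⟨um.add wm, ⟨M + N, fun q => (abs_add_le _ _).trans (add_le_add (hM q) (hN q))⟩, fun φ φs φc φU => ?_⟩
  have a := us φ φs φc φU
  have b := ws φ φs φc φU
  have e := integral_add (sol_int hr h1 h2 um hM φs φc) (sol_int hr h1 h2 wm hN φs φc)
  rw [a, b, add_zero] at e
  refine Eq.trans ?_ e; congr 1; ext q; ring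

lemma Good.smul {T : ℝ} {U : Set (ℝ × ℝ)} {r v1 v2 : ℝ × ℝ → ℝ} {u : R3 → ℝ}
    (hu : Good T U r v1 v2 u) (a : ℝ) : Good T U r v1 v2 (fun q => a * u q) := by
  obtain ⟨um, ⟨M, hM⟩, us⟩ := hu
  refine ⟨um.const_mul a, ⟨|a| * M, fun q => by rw [abs_mul]; exact mul_le_mul_of_nonneg_left (hM q) (abs_nonneg _)⟩, fun φ φs φc φU => ?_⟩
  have e := integral_const_mul (μ := volume) a (fun q : R3 => r q.2 * u q * (fderiv ℝ φ q (1, 0) + fderiv ℝ φ q (0, (v1 q.2, v2 q.2))))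
  rw [us φ φs φc φU, mul_zero] at e
  refine Eq.trans ?_ e; congr 1; ext q; ring

lemma Good.one {T : ℝ} {U : Set (ℝ × ℝ)} {r v1 v2 : ℝ × ℝ → ℝ} (hr : BM r) (h1 : BM v1) (h2 : BM v2)
    (hD : Div U (fun x => r x * v1 x) (fun x => r x * v2 x) (fun _ => 0)) : Good T U r v1 v2 (fun _ => 1) := by
  refine ⟨measurable_const, ⟨1, fun q => by simp⟩, fun φ φs φc φU => ?_⟩
  obtain ⟨C, C0, bφ, mA, mS, bA, bS, zD⟩ := dprops φs φc h1 h2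
  have zφ : ∀ q, q ∉ tsupport φ → φ q = 0 := fun q hq => image_eq_zero_of_notMem_tsupport hq
  have mr : Measurable fun q : R3 => r q.2 := hr.meas.comp (by fun_prop)
  obtain ⟨Mr, hMr⟩ := hr.bdd
  have Mr0 : 0 ≤ Mr := (abs_nonneg _).trans (hMr 0)
  have iA : Integrable fun q : R3 => r q.2 * fderiv ℝ φ q (1, 0) := by
    refine int3 (mr.mul mA) (C := Mr * C) (fun q => ?_) φc.isCompact fun q hq => by simp only [zD q hq, mul_zero]
    show |r q.2 * fderiv ℝ φ q (1, 0)| ≤ _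
    rw [abs_mul]; exact mul_le_mul (hMr _) (bA q) (abs_nonneg _) Mr0
  have iS : Integrable fun q : R3 => r q.2 * fderiv ℝ φ q (0, (v1 q.2, v2 q.2)) := by
    refine int3 (mr.mul mS) (C := Mr * C) (fun q => ?_) φc.isCompact fun q hq => by simp only [zD q hq, mul_zero]
    show |r q.2 * fderiv ℝ φ q (0, (v1 q.2, v2 q.2))| ≤ _
    rw [abs_mul]; exact mul_le_mul (hMr _) (bS q) (abs_nonneg _) Mr0
  have eA : ∫ q : R3, r q.2 * fderiv ℝ φ q (1, 0) = 0 := by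
    rw [Measure.volume_eq_prod] at iA
    refine (integral_prod_symm _ iA).trans ?_
    refine integral_eq_zero_of_ae (Eventually.of_forall fun x => ?_)
    simp only [Pi.zero_apply]
    rw [integral_const_mul]
    have cK1 : IsCompact (Prod.fst '' tsupport φ) := φc.isCompact.image continuous_fst
    have zt : ∀ t, t ∉ Prod.fst '' tsupport φ → ((t, x) : R3) ∉ tsupport φ := fun t ht h => ht ⟨_, h, rfl⟩
    have mt : Measurable fun t : ℝ => ((t, x) : R3) := by fun_prop
    have hd : ∀ t, HasDerivAt (fun t => φ (t, x)) (fderiv ℝ φ (t, x) (1, 0)) t := by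
      intro t
      exact (φs.differentiable (by simp) (t, x)).hasFDerivAt.comp_hasDerivAt t ((hasDerivAt_id t).prodMk (hasDerivAt_const t x))
    rw [integral_eq_zero_of_hasDerivAt_of_integrable hd, mul_zero]
    · exact int_bdd (C := C) (mA.comp mt).aestronglyMeasurable (fun t => bA _) cK1 fun t ht => zD _ (zt t ht) _
    · exact int_bdd (C := C) (φs.continuous.measurable.comp mt).aestronglyMeasurable (fun t => bφ _) cK1 fun t ht => zφ _ (zt t ht)
  have eS : ∫ q : R3, r q.2 * fderiv ℝ φ q (0, (v1 q.2, v2 q.2)) = 0 := by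
    rw [Measure.volume_eq_prod] at iS
    refine (integral_prod _ iS).trans ?_
    refine integral_eq_zero_of_ae (Eventually.of_forall fun t => ?_)
    simp only [Pi.zero_apply]
    set ψ : ℝ × ℝ → ℝ := fun x => φ (t, x) with hψ
    have ψs : ContDiff ℝ (⊤ : ℕ∞) ψ := φs.comp (by fun_prop)
    have ψt : tsupport ψ ⊆ (fun x : ℝ × ℝ => ((t, x) : R3)) ⁻¹' tsupport φ :=
      closure_minimal (s := Function.support _) (fun x hx => subset_tsupport φ hx) ((isClosed_tsupport φ).preimage (by fun_prop))
    have ψc : HasCompactSupport ψ := (φc.isCompact.image continuous_snd).of_isClosed_subset (isClosed_tsupport _) fun x hx => ⟨(t, x), ψt hx, rfl⟩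
    have tψ : Tst U ψ := Tst.of_smooth ψs ψc fun x hx => (φU (ψt hx)).2
    have hq := hD ψ tψ
    simp only [zero_mul, integral_zero, neg_zero] at hq
    refine Eq.trans ?_ hq; congr 1; ext x
    have hh : HasFDerivAt ψ ((fderiv ℝ φ (t, x)).comp (ContinuousLinearMap.inr ℝ ℝ (ℝ × ℝ))) x :=
      (φs.differentiable (by simp) (t, x)).hasFDerivAt.comp x (hasFDerivAt_prodMk_right t x)
    have e := fderiv_eq ψ x (v1 x, v2 x)
    rw [hh.fderiv] at e
    simp only [ContinuousLinearMap.comp_apply, ContinuousLinearMap.inr_apply] at e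
    rw [e]; ring
  have e := integral_add iA iS
  rw [eA, eS, add_zero] at e
  refine Eq.trans ?_ e; congr 1; ext q; ring

lemma Good.beta {T : ℝ} {U : Set (ℝ × ℝ)} (hO : IsOpen U) {r v1 v2 : ℝ × ℝ → ℝ} (hr : BM r) (h1 : BM v1) (h2 : BM v2)
    {μ1 μ2 : Measure (ℝ × ℝ)} [IsFiniteMeasure μ1] [IsFiniteMeasure μ2] (hB1 : BVin U v1 μ1) (hB2 : BVin U v2 μ2)
    (hr0 : ∀ x, r x ≠ 0) (hD : Div U (fun x => r x * v1 x) (fun x => r x * v2 x) (fun _ => 0))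
    {u : R3 → ℝ} (hu : Good T U r v1 v2 u) {β : ℝ → ℝ} (hβ : Continuous β) : Sol T U r v1 v2 (fun q => β (u q)) := by
  have sq : ∀ {w : R3 → ℝ}, Good T U r v1 v2 w → Good T U r v1 v2 (fun q => w q ^ 2) := by
    intro w hw
    obtain ⟨wm, ⟨N, hN⟩, ws⟩ := hw
    exact ⟨wm.pow_const 2, ⟨N ^ 2, fun q => by rw [abs_pow]; exact pow_le_pow_left₀ (abs_nonneg _) (hN q) 2⟩, sol_sq hO hr h1 h2 hB1 hB2 hr0 hD wm hN ws⟩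
  have mul : ∀ {w z : R3 → ℝ}, Good T U r v1 v2 w → Good T U r v1 v2 z → Good T U r v1 v2 (fun q => w q * z q) := by
    intro w z hw hz
    have a := ((sq (hw.add hr h1 h2 hz)).smul (1 / 2)).add hr h1 h2 (((sq hw).smul (-(1 / 2))).add hr h1 h2 ((sq hz).smul (-(1 / 2))))
    convert a using 2
    ring
  have pow : ∀ n : ℕ, Good T U r v1 v2 (fun q => u q ^ n) := by
    intro n
    induction n with
    | zero => simpa using Good.one hr h1 h2 hD
    | succ n ih => simp only [pow_succ]; exact mul ih hu
  have poly : ∀ p : Polynomial ℝ, Good T U r v1 v2 (fun q => p.eval (u q)) := by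
    intro p
    induction p using Polynomial.induction_on' with
    | add p q hp hq => simp only [Polynomial.eval_add]; exact hp.add hr h1 h2 hq
    | monomial n a => simp only [Polynomial.eval_monomial]; exact (pow n).smul a
  obtain ⟨um, ⟨M, hM⟩, us⟩ := hu
  intro φ φs φc φU
  have iD := sol_int hr h1 h2 (u := fun _ => 1) measurable_const (M := 1) (by simp) φs φc
  set J : R3 → ℝ := fun q => r q.2 * 1 * (fderiv ℝ φ q (1, 0) + fderiv ℝ φ q (0, (v1 q.2, v2 q.2))) with hJ
  obtain ⟨Nb, hNb⟩ : ∃ Nb, ∀ x ∈ Icc (-M) M, |β x| ≤ Nb := by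
    obtain ⟨Nb, h⟩ := isCompact_Icc.exists_bound_of_continuousOn (hβ.continuousOn (s := Icc (-M) M))
    exact ⟨Nb, h⟩
  have uI : ∀ q, u q ∈ Icc (-M) M := fun q => abs_le.1 (hM q)
  have iβ := sol_int hr h1 h2 (u := fun q => β (u q)) (hβ.measurable.comp um) (M := Nb) (fun q => hNb _ (uI q)) φs φc
  have bound : ∀ ε > 0, |∫ q : R3, r q.2 * β (u q) * (fderiv ℝ φ q (1, 0) + fderiv ℝ φ q (0, (v1 q.2, v2 q.2)))| ≤ ε * ∫ q, |J q| := by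
    intro ε hε
    obtain ⟨p, hp⟩ := exists_polynomial_near_of_continuousOn (-M) M β hβ.continuousOn ε hε
    obtain ⟨pm, ⟨P, hP⟩, ps⟩ := poly p
    have z := ps φ φs φc φU
    have e0 := integral_sub iβ (sol_int hr h1 h2 pm hP φs φc)
    rw [show (∫ q : R3, r q.2 * p.eval (u q) * (fderiv ℝ φ q (1, 0) + fderiv ℝ φ q (0, (v1 q.2, v2 q.2)))) = 0 from z, sub_zero] at e0
    rw [← e0, ← integral_const_mul, ← Real.norm_eq_abs]
    refine norm_integral_le_of_norm_le (iD.abs.const_mul ε) (Eventually.of_forall fun q => ?_)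
    have e : r q.2 * β (u q) * (fderiv ℝ φ q (1, 0) + fderiv ℝ φ q (0, (v1 q.2, v2 q.2))) - r q.2 * p.eval (u q) * (fderiv ℝ φ q (1, 0) + fderiv ℝ φ q (0, (v1 q.2, v2 q.2))) = (β (u q) - p.eval (u q)) * J q := by
      simp only [hJ]; ring
    rw [e, norm_mul, Real.norm_eq_abs, Real.norm_eq_abs, abs_sub_comm]
    exact mul_le_mul_of_nonneg_right (hp _ (uI q)).le (abs_nonneg _)
  have lim : Tendsto (fun ε : ℝ => ε * ∫ q, |J q|) (𝓝[>] 0) (𝓝 0) := by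
    have : Tendsto (fun ε : ℝ => ε * ∫ q, |J q|) (𝓝 0) (𝓝 (0 * ∫ q, |J q|)) := tendsto_id.mul_const _
    rw [zero_mul] at this
    exact this.mono_left nhdsWithin_le_nhds
  have := ge_of_tendsto lim (eventually_nhdsWithin_of_forall fun ε hε => bound ε hε)
  exact abs_nonpos_iff.1 this

abbrev E2 := EuclideanSpace ℝ (Fin 2)

/-- identification of the Euclidean plane with the product -/
def LL : E2 ≃L[ℝ] ℝ × ℝ := (EuclideanSpace.equiv (Fin 2) ℝ).trans (ContinuousLinearEquiv.finTwoArrow ℝ ℝ)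

lemma LL_apply (x : E2) : LL x = (x 0, x 1) := rfl

lemma LL_mp : MeasurePreserving (LL : E2 → ℝ × ℝ) := by
  have a := PiLp.volume_preserving_ofLp (Fin 2)
  have b := volume_preserving_finTwoArrow ℝ
  exact b.comp a

/-- time-space version -/
def TS : (ℝ × E2) ≃L[ℝ] R3 := (ContinuousLinearEquiv.refl ℝ ℝ).prodCongr LL

lemma TS_apply (q : ℝ × E2) : TS q = (q.1, LL q.2) := rfl
lemma TS_symm_apply (q : R3) : TS.symm q = (q.1, LL.symm q.2) := rfl

lemma TS_mp : MeasurePreserving (TS : ℝ × E2 → R3) := by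
  have := (MeasurePreserving.id (volume : Measure ℝ)).prod LL_mp
  exact this

lemma LL_int (f : ℝ × ℝ → ℝ) : ∫ x, f (LL x) = ∫ p, f p :=
  LL_mp.integral_comp LL.toHomeomorph.measurableEmbedding f

lemma TS_int (f : R3 → ℝ) : ∫ x, f (TS x) = ∫ p, f p :=
  TS_mp.integral_comp TS.toHomeomorph.measurableEmbedding f

lemma LL_single0 : LL (EuclideanSpace.single 0 1) = (1, 0) := by simp [LL_apply]
lemma LL_single1 : LL (EuclideanSpace.single 1 1) = (0, 1) := by simp [LL_apply]

lemma fderiv_LL {φ : ℝ × ℝ → ℝ} (x v : E2) : fderiv ℝ (fun y => φ (LL y)) x v = fderiv ℝ φ (LL x) (LL v) := by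
  have := LL.comp_right_fderiv (f := φ) (x := x)
  have h : (fun y => φ (LL y)) = φ ∘ LL := rfl
  rw [h, this]; rfl

lemma fderiv_TS {φ : R3 → ℝ} (x v : ℝ × E2) : fderiv ℝ (fun y => φ (TS y)) x v = fderiv ℝ φ (TS x) (TS v) := by
  have := TS.comp_right_fderiv (f := φ) (x := x)
  have h : (fun y => φ (TS y)) = φ ∘ TS := rfl
  rw [h, this]; rfl

/-- test functions pull back -/
lemma test_pull {E F : Type*} [NormedAddCommGroup E] [NormedSpace ℝ E] [NormedAddCommGroup F] [NormedSpace ℝ F]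
    (K : E ≃L[ℝ] F) {φ : F → ℝ} (h1 : ContDiff ℝ (⊤ : ℕ∞) φ) (h2 : HasCompactSupport φ) {U : Set F} (h3 : tsupport φ ⊆ U) :
    ContDiff ℝ (⊤ : ℕ∞) (fun y => φ (K y)) ∧ HasCompactSupport (fun y => φ (K y)) ∧ tsupport (fun y => φ (K y)) ⊆ K ⁻¹' U := by
  refine ⟨h1.comp K.contDiff, h2.comp_homeomorph K.toHomeomorph, ?_⟩
  refine closure_minimal (s := Function.support _) (t := K ⁻¹' tsupport φ) (fun y hy => subset_tsupport φ hy) ((isClosed_tsupport φ).preimage K.continuous) |>.trans ?_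
  exact preimage_mono h3

lemma fderiv_off {E : Type*} [NormedAddCommGroup E] [NormedSpace ℝ E] {φ : E → ℝ} {U : Set E} (h : tsupport φ ⊆ U) {x : E} (hx : x ∉ U) : fderiv ℝ φ x = 0 :=
  fderiv_of_notMem_tsupport ℝ (fun hh => hx (h hh))

lemma fderiv_single (φ : E2 → ℝ) (x v : E2) : fderiv ℝ φ x v = v 0 * fderiv ℝ φ x (EuclideanSpace.single 0 1) + v 1 * fderiv ℝ φ x (EuclideanSpace.single 1 1) := by
  have : v = v 0 • EuclideanSpace.single 0 1 + v 1 • EuclideanSpace.single 1 1 := by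
    ext i; fin_cases i <;> simp
  conv_lhs => rw [this]
  simp

lemma BM.clip {ρ : E2 → ℝ} (hm : Measurable ρ) {a b : ℝ} (hab : a < b) : BM (fun p => max a (min (ρ (LL.symm p)) b)) := by
  refine ⟨by have := hm.comp LL.symm.continuous.measurable; exact measurable_const.max (this.min measurable_const), max |a| |b|, fun p => ?_⟩
  exact abs_le_max_abs_abs (le_max_left _ _) (max_le hab.le (min_le_right _ _))

lemma BM.comp_B {B : E2 → E2} (hm : Measurable B) {M : ℝ} (hb : ∀ x, ‖B x‖ ≤ M) (i : Fin 2) : BM (fun p => B (LL.symm p) i) := by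
  refine ⟨?_, M, fun p => ?_⟩
  · have e : Continuous (fun y : E2 => y i) := by fun_prop
    exact e.measurable.comp (hm.comp LL.symm.continuous.measurable)
  · exact (PiLp.norm_apply_le (B (LL.symm p)) i).trans (hb _)

lemma BV_pull {Ω : Set E2} {B : E2 → E2} {DBp DBn : Fin 2 → Fin 2 → Measure E2}
    (hDBp : ∀ i j, IsFiniteMeasure (DBp i j)) (hDBn : ∀ i j, IsFiniteMeasure (DBn i j))
    (hBV : ∀ (i j : Fin 2), ∀ φ : E2 → ℝ, ContDiff ℝ (⊤ : ℕ∞) φ →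
      HasCompactSupport φ → tsupport φ ⊆ Ω →
      (∫ x in Ω, B x i * fderiv ℝ φ x (EuclideanSpace.single j 1)) =
        -((∫ x, φ x ∂(DBp i j)) - (∫ x, φ x ∂(DBn i j)))) (i : Fin 2) :
    ∃ μ : Measure (ℝ × ℝ), IsFiniteMeasure μ ∧ BVin (LL.symm ⁻¹' Ω) (fun p => B (LL.symm p) i) μ := by
  set ν : Measure E2 := (DBp i 0 + DBn i 0) + (DBp i 1 + DBn i 1) with hν
  have fν : IsFiniteMeasure ν := by
    have := hDBp; have := hDBn
    infer_instance
  refine ⟨ν.map LL, inferInstance, fun φ h1 h2 h3 => ?_⟩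
  obtain ⟨t1, t2, t3⟩ := test_pull LL h1 h2 h3
  have t3' : tsupport (fun y => φ (LL y)) ⊆ Ω := fun x hx => by simpa using t3 hx
  have key : ∀ j : Fin 2, |∫ p, B (LL.symm p) i * fderiv ℝ φ p (LL (EuclideanSpace.single j 1))| ≤ ∫ p, |φ p| ∂(ν.map LL) := by
    intro j
    have e := hBV i j _ t1 t2 t3'
    rw [setIntegral_eq_integral_of_forall_compl_eq_zero (fun x hx => by rw [fderiv_off t3' hx]; simp)] at e
    have e' := LL_int (fun p => B (LL.symm p) i * fderiv ℝ φ p (LL (EuclideanSpace.single j 1)))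
    simp only [ContinuousLinearEquiv.symm_apply_apply] at e'
    simp only [fderiv_LL] at e
    rw [← e', e, LL.toHomeomorph.measurableEmbedding.integral_map (μ := ν) (fun p => |φ p|) |> (fun h => (show ∫ p, |φ p| ∂(ν.map LL) = ∫ x, |φ (LL x)| ∂ν from h))]
    have i1 : ∀ m : Measure E2, IsFiniteMeasure m → Integrable (fun y => φ (LL y)) m := fun m hm => t1.continuous.integrable_of_hasCompactSupport t2
    have hle : DBp i j + DBn i j ≤ ν := by
      fin_cases j
      · exact Measure.le_add_right le_rfl
      · exact Measure.le_add_left le_rfl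
    have q1 : ∫ y, |φ (LL y)| ∂(DBp i j + DBn i j) ≤ ∫ y, |φ (LL y)| ∂ν :=
      integral_mono_measure hle (Eventually.of_forall fun _ => abs_nonneg _) (i1 ν fν).abs
    rw [integral_add_measure (i1 _ (hDBp i j)).abs (i1 _ (hDBn i j)).abs] at q1
    have q2 := abs_integral_le_integral_abs (μ := DBp i j) (f := fun y => φ (LL y))
    have q3 := abs_integral_le_integral_abs (μ := DBn i j) (f := fun y => φ (LL y))
    rw [abs_neg]
    exact (abs_sub _ _).trans ((add_le_add q2 q3).trans q1)
  refine ⟨?_, ?_⟩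
  · have := key 0; rw [LL_single0] at this; exact this
  · have := key 1; rw [LL_single1] at this; exact this

lemma TS_zero (v : E2) : TS (0, v) = (0, (v 0, v 1)) := rfl
lemma TS_one : TS (1, 0) = (1, 0) := by
  rw [TS_apply]; simp

lemma final
    (Ω : Set E2) (hΩ : IsOpen Ω)
    (B : E2 → E2)
    (hBmeas : Measurable B) (MB : ℝ) (hBbd : ∀ x, ‖B x‖ ≤ MB)
    (DBp DBn : Fin 2 → Fin 2 → Measure E2)
    (hDBp : ∀ i j, IsFiniteMeasure (DBp i j)) (hDBn : ∀ i j, IsFiniteMeasure (DBn i j))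
    (hBV : ∀ (i j : Fin 2), ∀ φ : E2 → ℝ, ContDiff ℝ (⊤ : ℕ∞) φ →
      HasCompactSupport φ → tsupport φ ⊆ Ω →
      (∫ x in Ω, B x i * fderiv ℝ φ x (EuclideanSpace.single j 1)) =
        -((∫ x, φ x ∂(DBp i j)) - (∫ x, φ x ∂(DBn i j))))
    (ρ : E2 → ℝ) (hρmeas : Measurable ρ)
    (C₁ C₂ : ℝ) (hC₁ : 0 < C₁) (hC : C₁ < C₂)
    (hρbd : ∀ᵐ x ∂(volume.restrict Ω), C₁ ≤ ρ x ∧ ρ x ≤ C₂)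
    (hρdiv : ∀ ψ : E2 → ℝ, ContDiff ℝ (⊤ : ℕ∞) ψ → HasCompactSupport ψ →
      tsupport ψ ⊆ Ω → (∫ x in Ω, ρ x * ⟪B x, gradient ψ x⟫) = 0)
    (T : ℝ) (u : ℝ × E2 → ℝ) (um : Measurable u)
    (ub : ∃ Mu : ℝ, ∀ p, |u p| ≤ Mu)
    (us : ∀ φ : ℝ × E2 → ℝ, ContDiff ℝ (⊤ : ℕ∞) φ → HasCompactSupport φ →
          tsupport φ ⊆ Set.Ioo 0 T ×ˢ Ω →
          (∫ p in Set.Ioo 0 T ×ˢ Ω,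
            (ρ p.2 * u p * fderiv ℝ φ p (1, 0)
              + ρ p.2 * u p * fderiv ℝ φ p (0, B p.2))) = 0)
    (β : ℝ → ℝ) (hβ : Continuous β)
    (φ : ℝ × E2 → ℝ) (φs : ContDiff ℝ (⊤ : ℕ∞) φ) (φc : HasCompactSupport φ)
    (φU : tsupport φ ⊆ Set.Ioo 0 T ×ˢ Ω) :
            (∫ p in Set.Ioo 0 T ×ˢ Ω,
              (ρ p.2 * β (u p) * fderiv ℝ φ p (1, 0)
                + ρ p.2 * β (u p) * fderiv ℝ φ p (0, B p.2))) = 0 := by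
  obtain ⟨μ1, f1, b1⟩ := BV_pull hDBp hDBn hBV 0
  obtain ⟨μ2, f2, b2⟩ := BV_pull hDBp hDBn hBV 1
  set U := LL.symm ⁻¹' Ω with hU
  have oU : IsOpen U := hΩ.preimage LL.symm.continuous
  set r : ℝ × ℝ → ℝ := fun p => max C₁ (min (ρ (LL.symm p)) C₂) with hr
  have rBM : BM r := BM.clip hρmeas hC
  have v1BM := BM.comp_B hBmeas hBbd 0
  have v2BM := BM.comp_B hBmeas hBbd 1
  have r0 : ∀ x, r x ≠ 0 := fun x => (lt_of_lt_of_le hC₁ (le_max_left _ _)).ne'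
  have req : ∀ x : E2, C₁ ≤ ρ x ∧ ρ x ≤ C₂ → r (LL x) = ρ x := fun x hx => by
    simp only [hr, ContinuousLinearEquiv.symm_apply_apply]
    rw [min_eq_left hx.2, max_eq_right hx.1]
  have hv : ∀ x : E2, LL (B x) = (B (LL.symm (LL x)) 0, B (LL.symm (LL x)) 1) := fun x => by
    rw [ContinuousLinearEquiv.symm_apply_apply, LL_apply]
  have hD : Div U (fun x => r x * B (LL.symm x) 0) (fun x => r x * B (LL.symm x) 1) (fun _ => 0) := by
    refine Div.of_smooth oU (rBM.mul v1BM) (rBM.mul v2BM) (BM.const 0) (fun ψ h1 h2 h3 => ?_)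
    obtain ⟨t1, t2, t3⟩ := test_pull LL h1 h2 h3
    have t3' : tsupport (fun y => ψ (LL y)) ⊆ Ω := fun x hx => by simpa [hU] using t3 hx
    have e := hρdiv _ t1 t2 t3'
    simp only [zero_mul, integral_zero, neg_zero]
    refine Eq.trans ?_ e
    rw [← LL_int]
    rw [← setIntegral_eq_integral_of_forall_compl_eq_zero (s := Ω)]
    · refine integral_congr_ae ?_
      filter_upwards [hρbd] with x hx
      rw [req x hx, real_inner_comm, inner_gradient_left, fderiv_LL, fderiv_eq, hv]
      ring
    · intro x hx
      have : fderiv ℝ ψ (LL x) = 0 := fderiv_off h3 (by simpa [hU] using hx)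
      simp [d1, d2, this]
  have pre : ∀ q : ℝ × E2, TS q ∈ Ioo 0 T ×ˢ U ↔ q ∈ Ioo 0 T ×ˢ Ω := fun q => by
    simp [TS_apply, hU]
  have prei : TS ⁻¹' (Ioo 0 T ×ˢ U) = Ioo 0 T ×ˢ Ω := by ext q; exact pre q
  have hae : ∀ᵐ q : ℝ × E2 ∂(volume.restrict (Ioo 0 T ×ˢ Ω)), r (LL q.2) = ρ q.2 := by
    rw [Measure.volume_eq_prod, ← Measure.prod_restrict]
    have := (Measure.quasiMeasurePreserving_snd (μ := volume.restrict (Ioo 0 T)) (ν := (volume : Measure E2).restrict Ω)).ae hρbd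
    filter_upwards [this] with q hq using req _ hq
  have conv : ∀ (w : ℝ × E2 → ℝ) (χ : R3 → ℝ), tsupport χ ⊆ Ioo 0 T ×ˢ U →
      ∫ q : R3, r q.2 * w (TS.symm q) * (fderiv ℝ χ q (1, 0) + fderiv ℝ χ q (0, (B (LL.symm q.2) 0, B (LL.symm q.2) 1)))
      = ∫ p in Set.Ioo 0 T ×ˢ Ω, (ρ p.2 * w p * fderiv ℝ (fun y => χ (TS y)) p (1, 0)
                + ρ p.2 * w p * fderiv ℝ (fun y => χ (TS y)) p (0, B p.2)) := by
    intro w χ h3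
    rw [← TS_int]
    rw [← setIntegral_eq_integral_of_forall_compl_eq_zero (s := Ioo 0 T ×ˢ Ω)]
    · refine integral_congr_ae ?_
      filter_upwards [hae] with q hq
      rw [fderiv_TS, fderiv_TS, TS_one, TS_zero, ContinuousLinearEquiv.symm_apply_apply, ← hq]
      simp only [TS_apply, ContinuousLinearEquiv.symm_apply_apply]
      ring
    · intro q hq
      have : fderiv ℝ χ (TS q) = 0 := fderiv_off h3 (fun h => hq ((pre q).1 h))
      simp [this]
  have good : Good T U r (fun p => B (LL.symm p) 0) (fun p => B (LL.symm p) 1) (fun q => u (TS.symm q)) := by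
    refine ⟨um.comp TS.symm.continuous.measurable, ?_, ?_⟩
    · obtain ⟨N, hN⟩ := ub
      exact ⟨N, fun q => hN _⟩
    · intro χ h1 h2 h3
      obtain ⟨t1, t2, t3⟩ := test_pull TS h1 h2 h3
      rw [prei] at t3
      exact (conv u χ h3).trans (us _ t1 t2 t3)
  have sol := Good.beta oU rBM v1BM v2BM b1 b2 r0 hD good hβ
  obtain ⟨t1, t2, t3⟩ := test_pull TS.symm φs φc φU
  have t3' : tsupport (fun y => φ (TS.symm y)) ⊆ Ioo 0 T ×ˢ U := fun q hq => by
    have := t3 hq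
    rw [mem_preimage, ← pre] at this
    simpa using this
  have e := sol _ t1 t2 t3'
  have e2 := conv (fun q => β (u q)) _ t3'
  simp only [ContinuousLinearEquiv.symm_apply_apply] at e2
  exact e2.symm.trans e

end Renorm

/-- **Renormalization property of steady nearly incompressible BV vector fields in 2D.**
Let `Ω ⊆ ℝ²` be open and simply connected, and let `B` be a bounded BV vector field with
bounded support (derivative represented by finite signed Radon measures
`(DB)_{ij} = DBp i j - DBn i j`), steady nearly incompressible with density
`C₁ ≤ ρ ≤ C₂`.  Then every bounded weak solution `u` of `∂_t(ρu) + div(ρuB) = 0` on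
`(0,T) × Ω` is renormalized: for every smooth `β : ℝ → ℝ`, `β(u)` is again a weak
solution. -/
theorem renormalization_steady_nearly_incompressible_BV
    (Ω : Set (EuclideanSpace ℝ (Fin 2))) (hΩ : IsOpen Ω)
    (hsc : SimplyConnectedSpace Ω)
    (B : EuclideanSpace ℝ (Fin 2) → EuclideanSpace ℝ (Fin 2))
    (hBmeas : Measurable B) (MB : ℝ) (hBbd : ∀ x, ‖B x‖ ≤ MB)
    (hBsupp : Bornology.IsBounded (Function.support B))
    (DBp DBn : Fin 2 → Fin 2 → Measure (EuclideanSpace ℝ (Fin 2)))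
    (hDBp : ∀ i j, IsFiniteMeasure (DBp i j)) (hDBn : ∀ i j, IsFiniteMeasure (DBn i j))
    (hBV : ∀ (i j : Fin 2), ∀ φ : EuclideanSpace ℝ (Fin 2) → ℝ, ContDiff ℝ (⊤ : ℕ∞) φ →
      HasCompactSupport φ → tsupport φ ⊆ Ω →
      (∫ x in Ω, B x i * fderiv ℝ φ x (EuclideanSpace.single j 1)) =
        -((∫ x, φ x ∂(DBp i j)) - (∫ x, φ x ∂(DBn i j))))
    (ρ : EuclideanSpace ℝ (Fin 2) → ℝ) (hρmeas : Measurable ρ)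
    (C₁ C₂ : ℝ) (hC₁ : 0 < C₁) (hC : C₁ < C₂)
    (hρbd : ∀ᵐ x ∂(volume.restrict Ω), C₁ ≤ ρ x ∧ ρ x ≤ C₂)
    (hρdiv : ∀ ψ : EuclideanSpace ℝ (Fin 2) → ℝ, ContDiff ℝ (⊤ : ℕ∞) ψ → HasCompactSupport ψ →
      tsupport ψ ⊆ Ω → (∫ x in Ω, ρ x * ⟪B x, gradient ψ x⟫) = 0) :
    ∀ T : ℝ, 0 < T →
      ∀ u : ℝ × EuclideanSpace ℝ (Fin 2) → ℝ, Measurable u →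
        (∃ Mu : ℝ, ∀ p, |u p| ≤ Mu) →
        (∀ φ : ℝ × EuclideanSpace ℝ (Fin 2) → ℝ, ContDiff ℝ (⊤ : ℕ∞) φ → HasCompactSupport φ →
          tsupport φ ⊆ Set.Ioo 0 T ×ˢ Ω →
          (∫ p in Set.Ioo 0 T ×ˢ Ω,
            (ρ p.2 * u p * fderiv ℝ φ p (1, 0)
              + ρ p.2 * u p * fderiv ℝ φ p (0, B p.2))) = 0) →
        ∀ β : ℝ → ℝ, ContDiff ℝ (⊤ : ℕ∞) β →
          ∀ φ : ℝ × EuclideanSpace ℝ (Fin 2) → ℝ, ContDiff ℝ (⊤ : ℕ∞) φ → HasCompactSupport φ →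
            tsupport φ ⊆ Set.Ioo 0 T ×ˢ Ω →
            (∫ p in Set.Ioo 0 T ×ˢ Ω,
              (ρ p.2 * β (u p) * fderiv ℝ φ p (1, 0)
                + ρ p.2 * β (u p) * fderiv ℝ φ p (0, B p.2))) = 0 := by
  intro T hT u um ub us β hβ φ φs φc φU
  exact Renorm.final Ω hΩ B hBmeas MB hBbd DBp DBn hDBp hDBn hBV ρ hρmeas C₁ C₂ hC₁ hC hρbd hρdiv T u um ub us β
    hβ.continuous φ φs φc φU
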